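/- Let f = ∇φ : ℝ² → ℝ² be a generic proper gradient map with local flow η, let x be a source of f and y a saddle of f. If there are two distinct trajectories of η connecting x to y, then there is a generic proper gradient map f' proper gradient homotopic to f such that |A_{f'}| < |A_f| and |B_{f'}| < |B_f|, where A denotes the set of sources and sinks and B the set of saddles. -/

import Mathlib

open Set Metric Filter

noncomputable section

/-- Euclidean space `ℝⁿ`. -/
abbrev Euc (n : ℕ) := EuclideanSpace ℝ (Fin n)

/-- A map `f : ℝⁿ → ℝⁿ` is gradient if it is the gradient of a `C¹` function `φ : ℝⁿ → ℝ`. -/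
def IsGradient {n : ℕ} (f : Euc n → Euc n) : Prop :=
  ∃ φ : Euc n → ℝ, ContDiff ℝ 1 φ ∧ ∀ x, gradient φ x = f x

/-- A map is proper if preimages of compact sets are compact (our maps are continuous anyway). -/
def IsProper {n : ℕ} (f : Euc n → Euc n) : Prop :=
  ∀ K : Set (Euc n), IsCompact K → IsCompact (f ⁻¹' K)

/-- `h : [0,1] × ℝⁿ → ℝⁿ` is a gradient homotopy: it is continuous, each `h t` is a
gradient map, and the zero set `h⁻¹(0)` (within `[0,1] × ℝⁿ`) is compact. -/
def IsGradientHomotopy {n : ℕ} (h : ℝ → Euc n → Euc n) : Prop :=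
  ContinuousOn (fun p : ℝ × Euc n => h p.1 p.2) (Icc 0 1 ×ˢ univ) ∧
  (∀ t ∈ Icc (0:ℝ) 1, IsGradient (h t)) ∧
  IsCompact {p : ℝ × Euc n | p.1 ∈ Icc (0:ℝ) 1 ∧ h p.1 p.2 = 0}

/-- Two maps are gradient homotopic if some gradient homotopy connects them. -/
def GradientHomotopic {n : ℕ} (f g : Euc n → Euc n) : Prop :=
  ∃ h : ℝ → Euc n → Euc n, IsGradientHomotopy h ∧ h 0 = f ∧ h 1 = g

/-- `h : [0,1] × ℝⁿ → ℝⁿ` is a proper gradient homotopy: it is continuous, each `h t` is a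
gradient map, and `h` is proper as a map on `[0,1] × ℝⁿ`. -/
def IsProperGradientHomotopy {n : ℕ} (h : ℝ → Euc n → Euc n) : Prop :=
  ContinuousOn (fun p : ℝ × Euc n => h p.1 p.2) (Icc 0 1 ×ˢ univ) ∧
  (∀ t ∈ Icc (0:ℝ) 1, IsGradient (h t)) ∧
  (∀ K : Set (Euc n), IsCompact K →
    IsCompact {p : ℝ × Euc n | p.1 ∈ Icc (0:ℝ) 1 ∧ h p.1 p.2 ∈ K})

/-- Two maps are proper gradient homotopic if some proper gradient homotopy connects them. -/
def ProperGradientHomotopic {n : ℕ} (f g : Euc n → Euc n) : Prop :=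
  ∃ h : ℝ → Euc n → Euc n, IsProperGradientHomotopy h ∧ h 0 = f ∧ h 1 = g

open scoped RealInnerProductSpace

/-- `p` is a source of the gradient map `f = ∇φ`: a zero of `f` at which the Hessian of `φ`,
i.e. the derivative of `f`, is positive definite. -/
def IsSourceAt (f : Euc 2 → Euc 2) (p : Euc 2) : Prop :=
  f p = 0 ∧ ∀ v : Euc 2, v ≠ 0 → 0 < ⟪fderiv ℝ f p v, v⟫

/-- `p` is a sink of the gradient map `f = ∇φ`: a zero of `f` at which the Hessian of `φ`
is negative definite. -/
def IsSinkAt (f : Euc 2 → Euc 2) (p : Euc 2) : Prop :=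
  f p = 0 ∧ ∀ v : Euc 2, v ≠ 0 → ⟪fderiv ℝ f p v, v⟫ < 0

/-- `p` is a saddle of `f`: a zero of `f` which is neither a source nor a sink. -/
def IsSaddleAt (f : Euc 2 → Euc 2) (p : Euc 2) : Prop :=
  f p = 0 ∧ ¬ IsSourceAt f p ∧ ¬ IsSinkAt f p

/-- `γ : ℝ → ℝ²` is a (full) trajectory of the local flow of `ẋ = f(x)`. -/
def IsTrajectory (f : Euc 2 → Euc 2) (γ : ℝ → Euc 2) : Prop :=
  ∀ t : ℝ, HasDerivAt γ (f (γ t)) t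

/-- No trajectory of the local flow of `ẋ = f(x)` connects two (distinct) saddle points. -/
def NoSaddleConnection (f : Euc 2 → Euc 2) : Prop :=
  ¬ ∃ (γ : ℝ → Euc 2) (p q : Euc 2), IsTrajectory f γ ∧
      IsSaddleAt f p ∧ IsSaddleAt f q ∧ p ≠ q ∧
      Filter.Tendsto γ Filter.atBot (nhds p) ∧ Filter.Tendsto γ Filter.atTop (nhds q)

/-- `f` is a generic gradient map with potential `φ`: `φ` is `C²` with `∇φ = f`, all critical
points are nondegenerate, distinct critical points have distinct critical values, and no
trajectory of the local flow connects two saddle points. -/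
def IsGenericGradientPair (φ : Euc 2 → ℝ) (f : Euc 2 → Euc 2) : Prop :=
  ContDiff ℝ 2 φ ∧ (∀ x, gradient φ x = f x) ∧
  (∀ p : Euc 2, f p = 0 → Function.Bijective (fderiv ℝ f p)) ∧
  (∀ p q : Euc 2, f p = 0 → f q = 0 → φ p = φ q → p = q) ∧
  NoSaddleConnection f

/-- `f` is a generic gradient map. -/
def IsGenericGradient (f : Euc 2 → Euc 2) : Prop :=
  ∃ φ : Euc 2 → ℝ, IsGenericGradientPair φ f

/-- The set `A_f` of sources and sinks of `f`. -/
def sourceSinkSet (f : Euc 2 → Euc 2) : Set (Euc 2) :=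
  {p | IsSourceAt f p ∨ IsSinkAt f p}

/-- The set `B_f` of saddles of `f`. -/
def saddleSet (f : Euc 2 → Euc 2) : Set (Euc 2) :=
  {p | IsSaddleAt f p}

/-- `z ∈ E_x⁻`: the trajectory through `z` tends to `x` as `t → -∞`. -/
def InBackwardBasin (f : Euc 2 → Euc 2) (x z : Euc 2) : Prop :=
  ∃ γ : ℝ → Euc 2, γ 0 = z ∧ (∀ t ∈ Set.Iic (0:ℝ), HasDerivAt γ (f (γ t)) t) ∧
    Filter.Tendsto γ Filter.atBot (nhds x)

/-- `z ∈ E_y⁺` for a stationary point `y`: the trajectory through `z` tends to `y` in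
forward time.  (A forward trajectory converging to a stationary point exists for all
`t ≥ 0`.) -/
def InForwardBasin (f : Euc 2 → Euc 2) (y z : Euc 2) : Prop :=
  ∃ γ : ℝ → Euc 2, γ 0 = z ∧ (∀ t ∈ Set.Ici (0:ℝ), HasDerivAt γ (f (γ t)) t) ∧
    Filter.Tendsto γ Filter.atTop (nhds y)

/-- `z ∈ E_∞⁺`: the trajectory through `z` escapes to infinity as `t → ω_z`, where
`ω_z ∈ (0, ∞]` is the endpoint of the maximal forward interval of existence. -/
def EscapesToInfinity (f : Euc 2 → Euc 2) (z : Euc 2) : Prop :=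
  ∃ γ : ℝ → Euc 2, γ 0 = z ∧
    (((∀ t ∈ Set.Ici (0:ℝ), HasDerivAt γ (f (γ t)) t) ∧
        Filter.Tendsto (fun t => ‖γ t‖) Filter.atTop Filter.atTop) ∨
      (∃ ω : ℝ, 0 < ω ∧ (∀ t ∈ Set.Ico (0:ℝ) ω, HasDerivAt γ (f (γ t)) t) ∧
        Filter.Tendsto (fun t => ‖γ t‖) (nhdsWithin ω (Set.Iio ω)) Filter.atTop))

/-- The set of asymptotic backward directions `V_x^P ⊆ S¹`: unit vectors
`v_z = lim_{t → -∞} f(η^t z)/|f(η^t z)|` over points `z ∈ E_x⁻` satisfying `P`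
(membership in `E_y⁺` or `E_∞⁺`). -/
def dirSet (f : Euc 2 → Euc 2) (x : Euc 2) (P : Euc 2 → Prop) : Set (Euc 2) :=
  {v | ∃ (z : Euc 2) (γ : ℝ → Euc 2), γ 0 = z ∧
    (∀ t ∈ Set.Iic (0:ℝ), HasDerivAt γ (f (γ t)) t) ∧
    Filter.Tendsto γ Filter.atBot (nhds x) ∧ P z ∧
    Filter.Tendsto (fun t => (‖f (γ t)‖)⁻¹ • f (γ t)) Filter.atBot (nhds v)}

/-- `V_x^y` for a stationary point `y`. -/
def dirSetTo (f : Euc 2 → Euc 2) (x y : Euc 2) : Set (Euc 2) :=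
  dirSet f x (InForwardBasin f y)

/-- `V_x^∞`. -/
def dirSetInf (f : Euc 2 → Euc 2) (x : Euc 2) : Set (Euc 2) :=
  dirSet f x (EscapesToInfinity f)


set_option autoImplicit false
set_option linter.unusedSimpArgs false
open scoped Topology NNReal


/-! ## Part 1 : global flows of bounded Lipschitz fields -/

/-- `Φ` is the global flow of the Lipschitz field `X`. -/
structure GFlow (X : Euc 2 → Euc 2) (K : ℝ≥0) (Φ : Euc 2 → ℝ → Euc 2) : Prop where
  lip : LipschitzWith K X
  zero : ∀ p, Φ p 0 = p
  deriv : ∀ p t, HasDerivAt (Φ p) (X (Φ p t)) t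

theorem gflow_sol_Icc (X : Euc 2 → Euc 2) (K L : ℝ≥0) (hX : LipschitzWith K X)
    (hb : ∀ p, ‖X p‖ ≤ L) (p : Euc 2) (n : ℕ) :
    ∃ α : ℝ → Euc 2, α 0 = p ∧ ∀ t ∈ Ioo (-(n+1:ℝ)) (n+1), HasDerivAt α (X (α t)) t := by
  have h0 : (0:ℝ) ∈ Icc (-(n+1:ℝ)) (n+1) := by constructor <;> linarith [n.cast_nonneg (α := ℝ)]
  have hpl : IsPicardLindelof (fun _ => X) (⟨0, h0⟩ : Icc (-(n+1:ℝ)) (n+1)) p (L * (n+1)) 0 L K := by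
    refine IsPicardLindelof.of_time_independent (fun x _ => hb x) hX.lipschitzOnWith ?_
    simp
  obtain ⟨α, h1, h2⟩ := hpl.exists_eq_forall_mem_Icc_hasDerivWithinAt₀
  refine ⟨α, h1, fun t ht => ?_⟩
  exact (h2 t (Ioo_subset_Icc_self ht)).hasDerivAt (Icc_mem_nhds ht.1 ht.2)

theorem gflow_exists (X : Euc 2 → Euc 2) (K L : ℝ≥0) (hX : LipschitzWith K X)
    (hb : ∀ p, ‖X p‖ ≤ L) : ∃ Φ, GFlow X K Φ := by
  choose α h0 h1 using fun p n => gflow_sol_Icc X K L hX hb p n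
  have heq : ∀ p (m n : ℕ), m ≤ n → ∀ t ∈ Ioo (-(m+1:ℝ)) (m+1), α p m t = α p n t := by
    intro p m n hmn t ht
    have hmn' : (m:ℝ) ≤ n := by exact_mod_cast hmn
    refine ODE_solution_unique_of_mem_Ioo (v := fun _ => X) (s := fun _ => univ) (K := K)
      (fun t _ => hX.lipschitzOnWith) (t₀ := 0) ?_ (fun t ht => ⟨h1 p m t ht, trivial⟩)
      (fun t ht => ⟨h1 p n t ⟨by linarith [ht.1], by linarith [ht.2]⟩, trivial⟩) ?_ ht
    · constructor <;> linarith [m.cast_nonneg (α := ℝ)]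
    · rw [h0, h0]
  refine ⟨fun p t => α p ⌈|t|⌉₊ t, hX, fun p => by simp [h0], fun p t => ?_⟩
  have hN : ∀ s : ℝ, |s| < ⌈|t|⌉₊ + 1 → α p ⌈|s|⌉₊ s = α p (⌈|t|⌉₊ + 1) s := by
    intro s hs
    refine heq p _ _ ?_ s ?_
    · apply Nat.ceil_le.2; push_cast; linarith
    · have := Nat.le_ceil |s|
      have h3 := abs_lt.1 (show |s| < (⌈|s|⌉₊:ℝ) + 1 by linarith)
      exact h3
  have ht : |t| < (⌈|t|⌉₊:ℝ) + 1 := by linarith [Nat.le_ceil |t|]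
  have hev : (fun s => α p ⌈|s|⌉₊ s) =ᶠ[𝓝 t] α p (⌈|t|⌉₊ + 1) := by
    have : ∀ᶠ s in 𝓝 t, |s| < (⌈|t|⌉₊:ℝ) + 1 := continuous_abs.continuousAt.eventually_lt_const ht
    exact this.mono hN
  show HasDerivAt (fun s => α p ⌈|s|⌉₊ s) (X (α p ⌈|t|⌉₊ t)) t
  rw [hN t ht]
  refine HasDerivAt.congr_of_eventuallyEq ?_ hev
  apply h1
  have := abs_lt.1 ht
  push_cast
  constructor <;> linarith [this.1, this.2]

namespace GFlow
variable {X : Euc 2 → Euc 2} {K : ℝ≥0} {Φ : Euc 2 → ℝ → Euc 2}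

theorem cont (h : GFlow X K Φ) (p) : Continuous (Φ p) :=
  continuous_iff_continuousAt.2 fun t => (h.deriv p t).continuousAt

theorem unique (h : GFlow X K Φ) {γ : ℝ → Euc 2} (hγ : ∀ t, HasDerivAt γ (X (γ t)) t) (s t : ℝ) :
    γ (s + t) = Φ (γ s) t := by
  have := ODE_solution_unique_univ (v := fun _ => X) (s := fun _ => univ) (K := K)
      (f := fun t => γ (s + t)) (g := Φ (γ s)) (t₀ := 0)
      (fun t => h.lip.lipschitzOnWith) (fun t => ⟨(hγ (s+t)).comp_const_add s t, trivial⟩)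
      (fun t => ⟨h.deriv _ t, trivial⟩) (by simp [h.zero])
  exact congrFun this t

theorem add (h : GFlow X K Φ) (p) (s t : ℝ) : Φ p (s + t) = Φ (Φ p s) t :=
  h.unique (h.deriv p) s t

theorem neg_cancel (h : GFlow X K Φ) (p) (s : ℝ) : Φ (Φ p s) (-s) = p := by
  rw [← h.add]; simp [h.zero]

theorem inj (h : GFlow X K Φ) {p q} {t : ℝ} (hpq : Φ p t = Φ q t) : p = q := by
  rw [← h.neg_cancel p t, hpq, h.neg_cancel]

/-- uniqueness on a forward interval -/
theorem unique_Icc (h : GFlow X K Φ) {γ : ℝ → Euc 2} {T : ℝ}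
    (hγ : ∀ t ∈ Icc 0 T, HasDerivAt γ (X (γ t)) t) : ∀ t ∈ Icc 0 T, γ t = Φ (γ 0) t := by
  refine ODE_solution_unique_of_mem_Icc_right (v := fun _ => X) (s := fun _ => univ) (K := K)
      (fun t _ => h.lip.lipschitzOnWith) ?_ ?_ (fun _ _ => trivial) ?_ ?_ (fun _ _ => trivial) ?_
  · exact fun t ht => (hγ t ht).continuousAt.continuousWithinAt
  · exact fun t ht => (hγ t (Ico_subset_Icc_self ht)).hasDerivWithinAt
  · exact (h.cont _).continuousOn
  · exact fun t ht => (h.deriv _ t).hasDerivWithinAt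
  · rw [h.zero]

theorem rev (h : GFlow X K Φ) : GFlow (fun p => - X p) K (fun p t => Φ p (-t)) := by
  refine ⟨h.lip.neg, fun p => by simp [h.zero], fun p t => ?_⟩
  have := (h.deriv p (-t)).scomp t (hasDerivAt_neg t)
  simp only [neg_smul, one_smul] at this
  exact this

theorem dist_le_pos (h : GFlow X K Φ) (p q) {t : ℝ} (ht : 0 ≤ t) :
    dist (Φ p t) (Φ q t) ≤ dist p q * Real.exp (K * t) := by
  have := dist_le_of_trajectories_ODE (v := fun _ => X) (K := K) (f := Φ p) (g := Φ q) (a := 0)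
    (b := t) (δ := dist p q) (fun _ => h.lip) (h.cont p).continuousOn
    (fun t _ => (h.deriv p t).hasDerivWithinAt)
    (h.cont q).continuousOn (fun t _ => (h.deriv q t).hasDerivWithinAt) (by simp [h.zero]) t ⟨ht, le_rfl⟩
  simpa using this

theorem dist_le (h : GFlow X K Φ) (p q) (t : ℝ) :
    dist (Φ p t) (Φ q t) ≤ dist p q * Real.exp (K * |t|) := by
  rcases le_total 0 t with ht | ht
  · rw [abs_of_nonneg ht]; exact h.dist_le_pos p q ht
  · rw [abs_of_nonpos ht]
    simpa using h.rev.dist_le_pos p q (t := -t) (by linarith)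

theorem cont2 (h : GFlow X K Φ) : Continuous (fun z : Euc 2 × ℝ => Φ z.1 z.2) := by
  rw [continuous_iff_continuousAt]
  rintro ⟨p, t⟩
  have h1 : Tendsto (fun z : Euc 2 × ℝ => dist z.1 p * Real.exp (K * |z.2|) + dist (Φ p z.2) (Φ p t))
      (𝓝 (p, t)) (𝓝 0) := by
    have hc := h.cont p
    have : Continuous (fun z : Euc 2 × ℝ => dist z.1 p * Real.exp (K * |z.2|) + dist (Φ p z.2) (Φ p t)) := by
      fun_prop
    have h2 := this.tendsto (p, t)
    simpa using h2
  refine tendsto_iff_dist_tendsto_zero.2 (squeeze_zero (fun _ => dist_nonneg) (fun z => ?_) h1)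
  refine (dist_triangle _ (Φ p z.2) _).trans ?_
  gcongr
  exact h.dist_le _ _ _

theorem cont1 (h : GFlow X K Φ) (t : ℝ) : Continuous (fun p => Φ p t) :=
  h.cont2.comp (by fun_prop : Continuous fun p : Euc 2 => (p, t))

theorem fixed (h : GFlow X K Φ) {p} (hp : X p = 0) (t : ℝ) : Φ p t = p := by
  have := h.unique (γ := fun _ => p) (fun t => by simpa [hp] using hasDerivAt_const t p) 0 t
  simpa using this.symm

/-- an orbit which converges, converges to a zero of the field -/
theorem lim_zero (h : GFlow X K Φ) {p q} (hq : Tendsto (Φ p) atTop (𝓝 q)) : X q = 0 := by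
  have h1 : ∀ s, Φ q s = q := by
    intro s
    have a1 : Tendsto (fun t => Φ (Φ p t) s) atTop (𝓝 (Φ q s)) :=
      ((h.cont1 s).tendsto q).comp hq
    have a2 : Tendsto (fun t => Φ p (t + s)) atTop (𝓝 q) := hq.comp (tendsto_atTop_add_const_right _ _ tendsto_id)
    have : (fun t => Φ (Φ p t) s) = fun t => Φ p (t + s) := by ext1 t; rw [h.add]
    rw [this] at a1
    exact tendsto_nhds_unique a1 a2
  have h2 := h.deriv q 0
  rw [h.zero] at h2
  have h3 : Φ q = fun _ => q := funext h1
  rw [h3] at h2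
  exact h2.unique (hasDerivAt_const _ _)

end GFlow


/-! ## Part 2 : mollification -/

section mollify
open MeasureTheory

theorem avg_ge (ρ : ContDiffBump (0 : Euc 2)) (F : Euc 2 → ℝ) (hF : Continuous F) (a : ℝ)
    (h : ∀ x ∈ ball (0 : Euc 2) ρ.rOut, a ≤ F x) : a ≤ ∫ x, ρ.normed volume x * F x := by
  have h1 : a = ∫ x, ρ.normed volume x * a := by
    rw [integral_mul_const, ρ.integral_normed, one_mul]
  rw [h1]
  have hi : ∀ G : Euc 2 → ℝ, Continuous G → Integrable (fun x => ρ.normed volume x * G x) := by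
    intro G hG
    exact (ρ.continuous_normed.mul hG).integrable_of_hasCompactSupport
      (ρ.hasCompactSupport_normed.mul_right)
  refine integral_mono (hi _ continuous_const) (hi _ hF) fun x => ?_
  by_cases hx : x ∈ ball (0 : Euc 2) ρ.rOut
  · exact mul_le_mul_of_nonneg_left (h x hx) (ρ.nonneg_normed x)
  · have : ρ.normed volume x = 0 := by
      rw [← ρ.support_normed_eq (μ := volume)] at hx
      simpa using hx
    simp [this]

theorem avg_int (ρ : ContDiffBump (0 : Euc 2)) (F : Euc 2 → ℝ) (hF : Continuous F) :
    Integrable (fun x => ρ.normed volume x * F x) :=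
  (ρ.continuous_normed.mul hF).integrable_of_hasCompactSupport
      (ρ.hasCompactSupport_normed.mul_right)

theorem avg_abs_le (ρ : ContDiffBump (0 : Euc 2)) (F : Euc 2 → ℝ) (hF : Continuous F) (a : ℝ)
    (h : ∀ x ∈ ball (0 : Euc 2) ρ.rOut, |F x| ≤ a) : |∫ x, ρ.normed volume x * F x| ≤ a := by
  rw [abs_le]
  constructor
  · exact avg_ge ρ F hF _ fun x hx => (abs_le.1 (h x hx)).1
  · have := avg_ge ρ (fun x => - F x) hF.neg (-a) fun x hx => by
      have := (abs_le.1 (h x hx)).2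
      linarith
    simp only [mul_neg, integral_neg] at this
    linarith

/-- mollified function -/
def moll (ρ : ContDiffBump (0 : Euc 2)) (F : Euc 2 → ℝ) (q : Euc 2) : ℝ :=
  ∫ x, ρ.normed volume x * F (q - x)

theorem moll_contDiff (ρ : ContDiffBump (0 : Euc 2)) (F : Euc 2 → ℝ) (hF : Continuous F) :
    ContDiff ℝ 2 (moll ρ F) := by
  have := (ρ.hasCompactSupport_normed (μ := volume)).contDiff_convolution_left (μ := volume) (n := 2)
    (ContinuousLinearMap.mul ℝ ℝ) (ρ.contDiff_normed (μ := volume)) (hF.locallyIntegrable (μ := volume))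
  exact this

theorem mollify_lemma (φ φ' : Euc 2 → ℝ) (hφ : ContDiff ℝ 2 φ) (hφ' : Continuous φ')
    (N U : Set (Euc 2)) (hN : IsCompact N) (hU : IsOpen U) (hNU : N ⊆ U)
    (heq : ∀ p ∉ N, φ' p = φ p) (hf : ∀ p ∈ U, p ∉ N → fderiv ℝ φ p ≠ 0)
    (hdir : ∀ p ∈ N, ∃ V : Euc 2, ∃ c > 0, ∃ r > 0, ∀ q ∈ ball p r, ∀ t ∈ Icc (0:ℝ) r,
      φ' q + c * t ≤ φ' (q + t • V)) :
    ∃ (φ'' : Euc 2 → ℝ) (N2 : Set (Euc 2)), ContDiff ℝ 2 φ'' ∧ IsCompact N2 ∧ N2 ⊆ U ∧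
      (∀ p ∉ N2, φ'' p = φ p) ∧ ∀ p ∈ U, fderiv ℝ φ'' p ≠ 0 := by
  choose! V c hc r hr hV using hdir
  obtain ⟨δ₁, hδ₁, hδ₁'⟩ := lebesgue_number_lemma_of_metric (s := N)
    (c := fun i : N => ball (i : Euc 2) (r i)) hN (fun i => isOpen_ball)
    (fun p hp => mem_iUnion.2 ⟨⟨p, hp⟩, mem_ball_self (hr p hp)⟩)
  obtain ⟨δ₂, hδ₂, hδ₂'⟩ := hN.exists_cthickening_subset_open hU hNU
  set δ := min δ₁ δ₂ with hδdef
  have hδ : 0 < δ := lt_min hδ₁ hδ₂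
  set N2 := cthickening (δ/2) N with hN2
  have hN2c : IsCompact N2 := hN.cthickening
  have hN2U : N2 ⊆ U := (cthickening_mono (by linarith [min_le_right δ₁ δ₂]) N).trans hδ₂'
  -- the cutoff function
  obtain ⟨χ, hχ, hχr, hχ1, hχ0⟩ : ∃ χ : Euc 2 → ℝ, ContDiff ℝ 2 χ ∧ (∀ p, |χ p| ≤ 1) ∧
      (∀ p ∈ thickening (δ/4) N, χ p = 1) ∧ (∀ p ∉ N2, χ p = 0) := by
    obtain ⟨χ, h1, h2, h3, h4⟩ := exists_contMDiff_support_eq_eq_one_iff (modelWithCornersSelf ℝ (Euc 2))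
      (n := 2) (s := thickening (δ/2) N) (t := cthickening (δ/4) N) isOpen_thickening
      isClosed_cthickening (cthickening_subset_thickening' (by linarith) (by linarith) N)
    refine ⟨χ, h1.contDiff, fun p => ?_, fun p hp => (h4 p).1 (thickening_subset_cthickening _ _ hp), fun p hp => ?_⟩
    · have := h2 (mem_range_self p)
      rw [abs_of_nonneg this.1]; exact this.2
    · by_contra h
      have : p ∈ Function.support χ := h
      rw [h3] at this
      exact hp (thickening_subset_cthickening _ _ this)
  set S := N2 \ thickening (δ/4) N with hS
  have hSc : IsCompact S := hN2c.diff isOpen_thickening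
  have hNth : N ⊆ thickening (δ/4) N := self_subset_thickening (by linarith) N
  have hDφ : Continuous (fderiv ℝ φ) := hφ.continuous_fderiv (by norm_num)
  have hDχ : Continuous (fderiv ℝ χ) := hχ.continuous_fderiv (by norm_num)
  obtain ⟨m, hm, hmS⟩ : ∃ m > 0, ∀ p ∈ S, m ≤ ‖fderiv ℝ φ p‖ := by
    rcases S.eq_empty_or_nonempty with h | h
    · exact ⟨1, one_pos, fun p hp => by simp [h] at hp⟩
    · obtain ⟨p, hp, hmin⟩ := hSc.exists_isMinOn h hDφ.norm.continuousOn
      refine ⟨_, norm_pos_iff.2 (hf p (hN2U hp.1) fun h => hp.2 (hNth h)), fun q hq => hmin hq⟩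
  obtain ⟨C, hC⟩ : ∃ C, ∀ p ∈ S, ‖fderiv ℝ χ p‖ ≤ C := hSc.exists_bound_of_continuousOn hDχ.continuousOn
  obtain ⟨η, hη, hηm⟩ : ∃ η > 0, η + η * |C| < m :=
    ⟨m / (2 * (1 + |C|)), by positivity, by
      have : 0 < 1 + |C| := by positivity
      have h2 : m / (2 * (1 + |C|)) + m / (2 * (1 + |C|)) * |C| = m / 2 := by field_simp
      rw [h2]; linarith⟩
  set B := cthickening δ N with hB
  have hBc : IsCompact B := hN.cthickening
  obtain ⟨ε₁, hε₁, h1⟩ := Metric.uniformContinuousOn_iff.1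
    (hBc.uniformContinuousOn_of_continuous hφ.continuous.continuousOn) η hη
  obtain ⟨ε₂, hε₂, h2⟩ := Metric.uniformContinuousOn_iff.1
    (hBc.uniformContinuousOn_of_continuous hDφ.continuousOn) η hη
  set ε := min (min ε₁ ε₂) (δ/8) with hε
  have hε0 : 0 < ε := lt_min (lt_min hε₁ hε₂) (by linarith)
  have hεδ : ε ≤ δ/8 := min_le_right _ _
  have hεε₁ : ε ≤ ε₁ := (min_le_left _ _).trans (min_le_left _ _)
  have hεε₂ : ε ≤ ε₂ := (min_le_left _ _).trans (min_le_right _ _)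
  let ρ : ContDiffBump (0 : Euc 2) := ⟨ε/2, ε, by linarith, by linarith⟩
  have hρ : ρ.rOut = ε := rfl
  set ψ := moll ρ φ' with hψdef
  have hψ : ContDiff ℝ 2 ψ := moll_contDiff ρ φ' hφ'
  have hψd : ∀ q, DifferentiableAt ℝ ψ q := fun q => hψ.differentiable (by norm_num) q
  have hφd : ∀ q, DifferentiableAt ℝ φ q := fun q => hφ.differentiable (by norm_num) q
  have hχd : ∀ q, DifferentiableAt ℝ χ q := fun q => hχ.differentiable (by norm_num) q
  -- nonvanishing near N
  have hin : ∀ q ∈ thickening (δ/4) N, fderiv ℝ ψ q ≠ 0 := by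
    intro q hq h0
    obtain ⟨p, hp, hpq⟩ := mem_thickening_iff.1 hq
    obtain ⟨⟨i, hi⟩, hball⟩ := hδ₁' p hp
    have key : ∀ t ∈ Icc (0:ℝ) (r i), ψ q + c i * t ≤ ψ (q + t • V i) := by
      intro t ht
      have hsub : ψ (q + t • V i) - ψ q = ∫ x, ρ.normed volume x * (φ' (q + t • V i - x) - φ' (q - x)) := by
        simp only [hψdef, moll, mul_sub]
        rw [integral_sub]
        · exact avg_int ρ (fun x => φ' (q + t • V i - x)) (by fun_prop)
        · exact avg_int ρ (fun x => φ' (q - x)) (by fun_prop)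
      have := avg_ge ρ (fun x => (φ' (q + t • V i - x) - φ' (q - x))) (by fun_prop) (c i * t) (by
        intro x hx
        rw [hρ, mem_ball_zero_iff] at hx
        have hb : q - x ∈ ball i (r i) := by
          apply hball
          rw [mem_ball]
          have : dist (q - x) p ≤ dist (q-x) q + dist q p := dist_triangle _ _ _
          have h3 : dist (q - x) q = ‖x‖ := by simp [dist_eq_norm]
          linarith [min_le_left δ₁ δ₂]
        have := hV i hi _ hb t ht
        have e : q + t • V i - x = q - x + t • V i := by abel
        rw [e]; linarith)
      linarith
    have hd : HasDerivAt (fun t : ℝ => ψ (q + t • V i)) 0 0 := by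
      have h4 : HasFDerivAt ψ (fderiv ℝ ψ q) (q + (0:ℝ) • V i) := by
        simpa using (hψd q).hasFDerivAt
      have h5 : HasDerivAt (fun t : ℝ => q + t • V i) (V i) 0 := by
        simpa using ((hasDerivAt_id (0:ℝ)).smul_const (V i)).const_add q
      have := h4.comp_hasDerivAt (0:ℝ) h5
      rw [h0] at this
      exact this
    have hs := hd.tendsto_slope_zero_right
    have : c i ≤ 0 := by
      refine ge_of_tendsto hs ?_
      have : Ioc 0 (r i) ∈ 𝓝[>] (0:ℝ) := Ioc_mem_nhdsGT (hr i hi)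
      filter_upwards [this] with t ht
      have := key t ⟨ht.1.le, ht.2⟩
      simp only [zero_add, zero_smul, add_zero, smul_eq_mul]
      rw [inv_mul_eq_div, le_div_iff₀ ht.1]; linarith
    linarith [hc i hi]
  -- closeness on S
  have hclose : ∀ q ∈ S, |ψ q - φ q| ≤ η ∧ ‖fderiv ℝ ψ q - fderiv ℝ φ q‖ ≤ η := by
    intro q hq
    have hqB : ∀ w ∈ ball q (δ/4), w ∈ B := by
      intro w hw
      have : w ∈ cthickening (δ/4) N2 :=
        thickening_subset_cthickening _ _ (mem_thickening_iff.2 ⟨q, hq.1, mem_ball.1 hw⟩)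
      have := cthickening_cthickening_subset (by linarith) (by linarith) N this
      exact cthickening_mono (by linarith) N this
    have hqN : ∀ w ∈ ball q (δ/4), φ' w = φ w := by
      intro w hw
      apply heq
      intro h
      exact hq.2 (mem_thickening_iff.2 ⟨w, h, by rw [dist_comm]; exact mem_ball.1 hw⟩)
    have hrep : ∀ w ∈ ball q (δ/8), ψ w - φ w = ∫ x, ρ.normed volume x * (φ' (w - x) - φ w) := by
      intro w hw
      simp only [hψdef, moll, mul_sub]
      rw [integral_sub, integral_mul_const, ρ.integral_normed, one_mul]
      · exact avg_int ρ (fun x => φ' (w - x)) (by fun_prop)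
      · exact avg_int ρ (fun x => φ w) (by fun_prop)
    have hsub : ∀ w ∈ ball q (δ/8), ∀ x ∈ ball (0:Euc 2) ε, w - x ∈ ball q (δ/4) := by
      intro w hw x hx
      rw [mem_ball_zero_iff] at hx
      rw [mem_ball] at hw ⊢
      have : dist (w - x) q ≤ dist (w-x) w + dist w q := dist_triangle _ _ _
      have h3 : dist (w - x) w = ‖x‖ := by simp [dist_eq_norm]
      linarith
    have hball8 : ball q (δ/8) ⊆ ball q (δ/4) := ball_subset_ball (by linarith)
    have hqq : q ∈ ball q (δ/8) := mem_ball_self (by linarith)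
    constructor
    · rw [hrep q hqq]
      refine avg_abs_le ρ _ (by fun_prop) _ fun x hx => ?_
      rw [hρ] at hx
      rw [hqN _ (hsub q hqq x hx)]
      refine (h1 _ (hqB _ (hsub q hqq x hx)) _ (hqB _ (hball8 hqq)) ?_).le
      rw [mem_ball_zero_iff] at hx
      simp [dist_eq_norm]; linarith
    · have hg : HasFDerivAt (fun w => ψ w - φ w) (fderiv ℝ ψ q - fderiv ℝ φ q) q :=
        (hψd q).hasFDerivAt.sub (hφd q).hasFDerivAt
      refine hg.le_of_lip' hη.le ?_
      filter_upwards [ball_mem_nhds q (show 0 < δ/8 by linarith)] with w hw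
      rw [hrep w hw, hrep q hqq]
      have e : (∫ x, ρ.normed volume x * (φ' (w - x) - φ w)) - (∫ x, ρ.normed volume x * (φ' (q - x) - φ q))
          = ∫ x, ρ.normed volume x * ((φ' (w - x) - φ w) - (φ' (q - x) - φ q)) := by
        rw [← integral_sub]
        · congr 1; ext x; ring
        · exact avg_int ρ (fun x => φ' (w - x) - φ w) (by fun_prop)
        · exact avg_int ρ (fun x => φ' (q - x) - φ q) (by fun_prop)
      rw [e]
      refine avg_abs_le ρ _ (by fun_prop) _ fun x hx => ?_
      rw [hρ] at hx
      rw [hqN _ (hsub q hqq x hx), hqN _ (hsub w hw x hx)]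
      have hmv := (convex_ball q (δ/8)).norm_image_sub_le_of_norm_hasFDerivWithin_le
        (f := fun w => φ (w - x) - φ w) (f' := fun w => fderiv ℝ φ (w - x) - fderiv ℝ φ w) (C := η)
        (fun w hw => by
          have h5 : HasFDerivAt (fun w => φ (w - x)) (fderiv ℝ φ (w - x)) w := by
            have := (hφd (w - x)).hasFDerivAt.comp w ((hasFDerivAt_id w).sub_const x)
            exact this
          exact (h5.sub (hφd w).hasFDerivAt).hasFDerivWithinAt)
        (fun w hw => by
          rw [← dist_eq_norm]
          refine (h2 _ (hqB _ (hsub w hw x hx)) _ (hqB _ (hball8 hw)) ?_).le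
          rw [mem_ball_zero_iff] at hx
          simp [dist_eq_norm]; linarith) hqq hw
      exact hmv
  refine ⟨fun q => φ q + χ q * (ψ q - φ q), N2, by fun_prop, hN2c, hN2U, fun p hp => by simp [hχ0 p hp], ?_⟩
  intro q hqU
  by_cases hq1 : q ∈ thickening (δ/4) N
  · have : (fun q => φ q + χ q * (ψ q - φ q)) =ᶠ[𝓝 q] ψ := by
      filter_upwards [isOpen_thickening.mem_nhds hq1] with w hw
      rw [hχ1 w hw]; ring
    rw [this.fderiv_eq]
    exact hin q hq1
  by_cases hq2 : q ∈ N2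
  · have hqS : q ∈ S := ⟨hq2, hq1⟩
    have hd : HasFDerivAt (fun q => φ q + χ q * (ψ q - φ q))
        (fderiv ℝ φ q + (χ q • (fderiv ℝ ψ q - fderiv ℝ φ q) + (ψ q - φ q) • fderiv ℝ χ q)) q :=
      (hφd q).hasFDerivAt.add ((hχd q).hasFDerivAt.mul ((hψd q).hasFDerivAt.sub (hφd q).hasFDerivAt))
    rw [hd.fderiv]
    intro h0
    obtain ⟨c1, c2⟩ := hclose q hqS
    have h6 : fderiv ℝ φ q = -(χ q • (fderiv ℝ ψ q - fderiv ℝ φ q) + (ψ q - φ q) • fderiv ℝ χ q) :=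
      eq_neg_of_add_eq_zero_left h0
    have h7 : ‖fderiv ℝ φ q‖ ≤ η + η * |C| := by
      rw [h6, norm_neg]
      refine (norm_add_le _ _).trans ?_
      rw [norm_smul, norm_smul]
      have a1 : ‖χ q‖ * ‖fderiv ℝ ψ q - fderiv ℝ φ q‖ ≤ 1 * η :=
        mul_le_mul (hχr q) c2 (norm_nonneg _) zero_le_one
      have a2 : ‖ψ q - φ q‖ * ‖fderiv ℝ χ q‖ ≤ η * |C| :=
        mul_le_mul c1 ((hC q hqS).trans (le_abs_self C)) (norm_nonneg _) hη.le
      linarith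
    linarith [hmS q hqS]
  · have : (fun q => φ q + χ q * (ψ q - φ q)) =ᶠ[𝓝 q] φ := by
      filter_upwards [(isClosed_cthickening.isOpen_compl).mem_nhds hq2] with w hw
      rw [hχ0 w hw]; ring
    rw [this.fderiv_eq]
    exact hf q hqU fun h => hq1 (hNth h)

end mollify


/-! ## Part 3 : winding numbers -/

section winding
open Complex MeasureTheory

/-- `∫_a^b g'/(g-w)` written with clamped integrand. -/
def windJ (g g' : ℝ → ℂ) (a b : ℝ) (w : ℂ) : ℂ :=
  ∫ t in a..b, g' (max a (min b t)) / (g (max a (min b t)) - w)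

theorem clamp_mem {a b : ℝ} (hab : a ≤ b) (t : ℝ) : max a (min b t) ∈ Icc a b :=
  ⟨le_max_left _ _, max_le hab (min_le_left _ _)⟩

theorem clamp_eq {a b t : ℝ} (ht : t ∈ Icc a b) : max a (min b t) = t := by
  rw [min_eq_right ht.2, max_eq_right ht.1]

theorem windJ_continuousOn {g g' : ℝ → ℂ} {a b : ℝ} (hab : a ≤ b) (hg : Continuous g)
    (hg' : Continuous g') : ContinuousOn (windJ g g' a b) (g '' Icc a b)ᶜ := by
  rw [continuousOn_iff_continuous_domRestrict]
  have : Continuous (fun z : ((g '' Icc a b)ᶜ : Set ℂ) × ℝ =>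
      g' (max a (min b z.2)) / (g (max a (min b z.2)) - z.1)) := by
    refine Continuous.div (by fun_prop) (by fun_prop) ?_
    rintro ⟨⟨w, hw⟩, t⟩ h0
    exact hw ⟨_, clamp_mem hab t, by simpa [sub_eq_zero] using h0⟩
  exact intervalIntegral.continuous_parametric_intervalIntegral_of_continuous'
    (f := fun (w : ((g '' Icc a b)ᶜ : Set ℂ)) t => g' (max a (min b t)) / (g (max a (min b t)) - w)) this a b

theorem windJ_exp {g g' : ℝ → ℂ} {a b : ℝ} (hab : a ≤ b) (hg : ∀ t, HasDerivAt g (g' t) t)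
    (hg' : Continuous g') {w : ℂ} (hw : w ∉ g '' Icc a b) :
    exp (windJ g g' a b w) = (g b - w) / (g a - w) := by
  have hgc : Continuous g := continuous_iff_continuousAt.2 fun t => (hg t).continuousAt
  have hne : ∀ t ∈ Icc a b, g t - w ≠ 0 := fun t ht h => hw ⟨t, ht, sub_eq_zero.1 h⟩
  set h : ℝ → ℂ := fun t => g' (max a (min b t)) / (g (max a (min b t)) - w) with hh
  have hc : Continuous h := by
    refine Continuous.div (by fun_prop) (by fun_prop) ?_
    intro t
    exact hne _ (clamp_mem hab t)
  have hI : ∀ t, HasDerivAt (fun t => ∫ s in a..t, h s) (h t) t := fun t =>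
    intervalIntegral.integral_hasDerivAt_right (hc.intervalIntegrable _ _)
      (hc.stronglyMeasurableAtFilter _ _) hc.continuousAt
  have key : ∀ t ∈ Icc a b, (g t - w) * exp (-∫ s in a..t, h s) = (g a - w) * exp (-∫ s in a..a, h s) := by
    have hd : ∀ t, HasDerivAt (fun t => (g t - w) * exp (-∫ s in a..t, h s))
        (g' t * exp (-∫ s in a..t, h s) + (g t - w) * (exp (-∫ s in a..t, h s) * (- h t))) t := by
      intro t
      exact ((hg t).sub_const w).mul ((hI t).neg.cexp)
    refine constant_of_has_deriv_right_zero (fun t _ => (hd t).continuousAt.continuousWithinAt) ?_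
    intro t ht
    have h1 := hd t
    have ht' := Ico_subset_Icc_self ht
    have e : g' t * exp (-∫ s in a..t, h s) + (g t - w) * (exp (-∫ s in a..t, h s) * (- h t)) = 0 := by
      have : h t = g' t / (g t - w) := by simp only [hh, clamp_eq ht']
      rw [this]
      have := hne t ht'
      field_simp
      ring
    rw [e] at h1
    exact h1.hasDerivWithinAt
  have h2 := key b ⟨hab, le_rfl⟩
  rw [intervalIntegral.integral_same, neg_zero, exp_zero, mul_one, exp_neg] at h2
  have h3 := hne a ⟨le_rfl, hab⟩
  show exp (∫ s in a..b, h s) = _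
  rw [eq_div_iff h3, ← h2]
  field_simp [exp_ne_zero]

/-- the contribution of a segment -/
def windS (p q w : ℂ) : ℂ := log ((q - w) / (p - w))

theorem windS_slit {p q w : ℂ} (hw : w ∉ segment ℝ p q) : (q - w) / (p - w) ∈ slitPlane := by
  have hp : p - w ≠ 0 := fun h => hw (by rw [← sub_eq_zero.1 h]; exact left_mem_segment _ _ _)
  rw [mem_slitPlane_iff_not_le_zero]
  intro h
  rw [Complex.le_def] at h
  simp only [zero_re, zero_im] at h
  set x := (q - w) / (p - w) with hx
  have hxr : x = (x.re : ℂ) := by apply Complex.ext <;> simp [h.2]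
  apply hw
  have hq : q - w = x.re * (p - w) := by rw [← hxr, hx]; field_simp
  have h1 : 0 < 1 - x.re := by linarith [h.1]
  refine ⟨(-x.re) / (1 - x.re), 1 / (1 - x.re), div_nonneg (by linarith [h.1]) h1.le, by positivity, ?_, ?_⟩
  · field_simp; ring
  · have hq' : q = w + x.re * (p - w) := by rw [← hq]; ring
    have h1' : (1 : ℂ) - x.re ≠ 0 := by exact_mod_cast h1.ne'
    rw [Complex.real_smul, Complex.real_smul, hq']
    push_cast
    field_simp
    ring

theorem windS_exp {p q w : ℂ} (hw : w ∉ segment ℝ p q) : exp (windS p q w) = (q - w) / (p - w) :=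
  exp_log (slitPlane_ne_zero (windS_slit hw))

theorem windS_continuousOn (p q : ℂ) : ContinuousOn (windS p q) (segment ℝ p q)ᶜ := by
  unfold windS
  refine ContinuousOn.clog ?_ fun w hw => windS_slit hw
  refine ContinuousOn.div (by fun_prop) (by fun_prop) fun w hw h => hw ?_
  rw [← sub_eq_zero.1 h]; exact left_mem_segment _ _ _

theorem arg_pos_smul (r : ℝ) (hr : 0 < r) (z w : ℂ) (h : w = r * z) : arg w = arg z := by
  rw [h, arg_real_mul _ hr]

theorem winding_lemma (g₁ g₁' g₂ g₂' : ℝ → ℂ) (a b : ℝ) (hab : a ≤ b)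
    (hg₁ : ∀ t, HasDerivAt g₁ (g₁' t) t) (hg₁' : Continuous g₁')
    (hg₂ : ∀ t, HasDerivAt g₂ (g₂' t) t) (hg₂' : Continuous g₂')
    (h01 : (0:ℂ) ∉ g₁ '' Icc a b) (h02 : (0:ℂ) ∉ g₂ '' Icc a b)
    (h03 : (0:ℂ) ∉ segment ℝ (g₂ a) (g₁ a))
    (hp : 0 < (g₁ b).re) (hq : (g₂ b).re < 0)
    (hC : ∀ᶠ ε : ℝ in 𝓝[>] (0:ℝ), ∃ C : Set ℂ, IsPreconnected C ∧ I * (ε:ℂ) ∈ C ∧ -(I * (ε:ℂ)) ∈ C ∧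
      ∀ w ∈ C, w ∉ g₁ '' Icc a b ∧ w ∉ g₂ '' Icc a b ∧ w ∉ segment ℝ (g₂ a) (g₁ a) ∧
        w ∉ segment ℝ (g₁ b) 0 ∧ w ∉ segment ℝ 0 (g₂ b)) : False := by
  have hc₁ : Continuous g₁ := continuous_iff_continuousAt.2 fun t => (hg₁ t).continuousAt
  have hc₂ : Continuous g₂ := continuous_iff_continuousAt.2 fun t => (hg₂ t).continuousAt
  set p := g₁ b with hpdef
  set q := g₂ b with hqdef
  set R : ℂ → ℂ := fun w => windJ g₁ g₁' a b w - windJ g₂ g₂' a b w + windS (g₂ a) (g₁ a) w with hR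
  set W : ℂ → ℂ := fun w => R w + (windS p 0 w + windS 0 q w) with hW
  have hRc : ContinuousAt R 0 := by
    have o1 : IsOpen (g₁ '' Icc a b)ᶜ := (isCompact_Icc.image hc₁).isClosed.isOpen_compl
    have o2 : IsOpen (g₂ '' Icc a b)ᶜ := (isCompact_Icc.image hc₂).isClosed.isOpen_compl
    have o3 : IsOpen (segment ℝ (g₂ a) (g₁ a))ᶜ := by
      rw [segment_eq_image_lineMap]
      exact (isCompact_Icc.image (by fun_prop)).isClosed.isOpen_compl
    exact (((windJ_continuousOn hab hc₁ hg₁').continuousAt (o1.mem_nhds h01)).sub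
      ((windJ_continuousOn hab hc₂ hg₂').continuousAt (o2.mem_nhds h02))).add
      ((windS_continuousOn _ _).continuousAt (o3.mem_nhds h03))
  -- values
  have hval : ∀ᶠ ε : ℝ in 𝓝[>] (0:ℝ), (W (I * (ε:ℂ))).im = (W (-(I * (ε:ℂ)))).im := by
    filter_upwards [hC] with ε ⟨C, hCp, hC1, hC2, hCa⟩
    have hWc : ContinuousOn (fun w => (W w).im) C := by
      refine Complex.continuous_im.comp_continuousOn ?_
      refine ContinuousOn.add (((windJ_continuousOn hab hc₁ hg₁').mono fun w hw => (hCa w hw).1).sub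
        ((windJ_continuousOn hab hc₂ hg₂').mono fun w hw => (hCa w hw).2.1) |>.add
        ((windS_continuousOn _ _).mono fun w hw => (hCa w hw).2.2.1)) (ContinuousOn.add
        ((windS_continuousOn _ _).mono fun w hw => (hCa w hw).2.2.2.1)
        ((windS_continuousOn _ _).mono fun w hw => (hCa w hw).2.2.2.2))
    have hexp : ∀ w ∈ C, exp (W w) = 1 := by
      intro w hw
      obtain ⟨c1, c2, c3, c4, c5⟩ := hCa w hw
      simp only [hW, hR, exp_add, exp_sub]
      rw [windJ_exp hab hg₁ hg₁' c1, windJ_exp hab hg₂ hg₂' c2, windS_exp c3, windS_exp c4, windS_exp c5]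
      have n1 : g₁ a - w ≠ 0 := fun h => c1 ⟨a, ⟨le_rfl, hab⟩, sub_eq_zero.1 h⟩
      have n2 : p - w ≠ 0 := fun h => c1 ⟨b, ⟨hab, le_rfl⟩, sub_eq_zero.1 h⟩
      have n3 : g₂ a - w ≠ 0 := fun h => c2 ⟨a, ⟨le_rfl, hab⟩, sub_eq_zero.1 h⟩
      have n4 : q - w ≠ 0 := fun h => c2 ⟨b, ⟨hab, le_rfl⟩, sub_eq_zero.1 h⟩
      have n5 : 0 - w ≠ 0 := fun h => c4 (by rw [← sub_eq_zero.1 h]; exact right_mem_segment _ _ _)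
      rw [← hpdef, ← hqdef]
      field_simp
    have hcase : ∀ w ∈ C, ∃ n : ℤ, (W w).im = n * (2 * Real.pi) := by
      intro w hw
      obtain ⟨n, hn⟩ := Complex.exp_eq_one_iff.1 (hexp w hw)
      refine ⟨n, ?_⟩
      rw [hn]
      simp
    have main : ∀ w₁ ∈ C, ∀ w₂ ∈ C, ¬ (W w₁).im < (W w₂).im := by
      intro w₁ hw₁ w₂ hw₂ hlt
      have := hCp.intermediate_value hw₁ hw₂ hWc
      obtain ⟨n, hn⟩ := hcase w₁ hw₁
      obtain ⟨m, hm⟩ := hcase w₂ hw₂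
      have hpi := Real.pi_pos
      have hnm : n + 1 ≤ m := by
        have : (n:ℝ) < m := by
          rw [hn, hm] at hlt
          exact lt_of_mul_lt_mul_right hlt (by positivity)
        have : n < m := by exact_mod_cast this
        omega
      have hnm' : (n:ℝ) + 1 ≤ m := by exact_mod_cast hnm
      obtain ⟨w, hw, hwv⟩ := this (show ((n:ℝ) + 1/2) * (2*Real.pi) ∈ Icc _ _ by
        show ((n:ℝ) + 1/2) * (2*Real.pi) ∈ Icc (W w₁).im (W w₂).im
        rw [hn, hm]
        constructor
        · gcongr; linarith
        · gcongr; linarith)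
      obtain ⟨k, hk⟩ := hcase w hw
      have hwv' : (W w).im = ((n:ℝ) + 1/2) * (2*Real.pi) := hwv
      rw [hk] at hwv'
      have h3 : (k:ℝ) = n + 1/2 := mul_right_cancel₀ (by positivity) hwv'
      have h4 : (2 * k : ℝ) = 2 * n + 1 := by linarith
      have h5 : 2 * k = 2 * n + 1 := by exact_mod_cast h4
      omega
    exact le_antisymm (not_lt.1 (main _ hC2 _ hC1)) (not_lt.1 (main _ hC1 _ hC2))
  -- the jump
  have ht : Tendsto (fun ε : ℝ => I * (ε:ℂ)) (𝓝[>] 0) (𝓝 0) := by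
    have : Continuous (fun ε : ℝ => I * (ε:ℂ)) := by fun_prop
    have := this.tendsto 0
    simp only [ofReal_zero, mul_zero] at this
    exact this.mono_left nhdsWithin_le_nhds
  have ht' : Tendsto (fun ε : ℝ => -(I * (ε:ℂ))) (𝓝[>] 0) (𝓝 0) := by simpa using ht.neg
  have l1 : Tendsto (fun ε : ℝ => (R (I * ε)).im - (R (-(I*ε))).im) (𝓝[>] 0) (𝓝 0) := by
    have a1 := (Complex.continuous_im.tendsto _).comp (hRc.tendsto.comp ht)
    have a2 := (Complex.continuous_im.tendsto _).comp (hRc.tendsto.comp ht')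
    simpa using a1.sub a2
  have hp0 : p ≠ 0 := fun h => by simp [h] at hp
  have hq0 : q ≠ 0 := fun h => by simp [h] at hq
  have argc : ∀ (s : ℂ) (F : ℂ → ℂ), ContinuousAt F 0 → (F 0).im ≠ 0 → ∀ u : ℝ → ℂ, Tendsto u (𝓝[>] 0) (𝓝 0) →
      Tendsto (fun ε : ℝ => arg (F (u ε))) (𝓝[>] 0) (𝓝 (arg (F 0))) := by
    intro s F hF h0 u hu
    exact (continuousAt_arg (mem_slitPlane_iff.2 (Or.inr h0))).tendsto.comp (hF.tendsto.comp hu)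
  have im1 : (I / p).im = p.re / normSq p := by
    rw [div_im]; simp
  have im2 : (I * q).im = q.re := by simp
  have imp : 0 < (I / p).im := by rw [im1]; exact div_pos hp (normSq_pos.2 hp0)
  have l2 := argc 0 (fun w => I / (w - p)) (ContinuousAt.div (by fun_prop) (by fun_prop) (by simpa using hp0))
    (by simp only [zero_sub, div_neg, neg_im]; linarith) _ ht
  have l3 := argc 0 (fun w => -I / (w - p)) (ContinuousAt.div (by fun_prop) (by fun_prop) (by simpa using hp0))
    (by simp only [zero_sub, div_neg, neg_im, neg_div, neg_neg]; linarith) _ ht'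
  have l4 := argc 0 (fun w => I * (q - w)) (by fun_prop)
    (by simp only [sub_zero]; rw [im2]; linarith) _ ht
  have l5 := argc 0 (fun w => -I * (q - w)) (by fun_prop)
    (by simp only [sub_zero, neg_mul, neg_im]; rw [im2]; linarith) _ ht'
  have lall := (l1.add (l2.sub l3)).add (l4.sub l5)
  have hz : ∀ᶠ ε : ℝ in 𝓝[>] (0:ℝ), (R (I * ε)).im - (R (-(I*ε))).im
      + (arg (I / (I * ε - p)) - arg (-I / (-(I * ε) - p)))
      + (arg (I * (q - I * ε)) - arg (-I * (q - -(I*ε)))) = 0 := by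
    filter_upwards [hval, self_mem_nhdsWithin] with ε hε hε0
    have hε0 : 0 < ε := hε0
    have hεc : (ε:ℂ) ≠ 0 := by exact_mod_cast hε0.ne'
    have e1 : arg (I / (I * ε - p)) = (windS p 0 (I * ε)).im := by
      simp only [windS, log_im]
      symm
      apply arg_pos_smul ε hε0
      rw [← mul_div_assoc, ← neg_div_neg_eq]; congr 1 <;> ring
    have e2 : arg (-I / (-(I * ε) - p)) = (windS p 0 (-(I * ε))).im := by
      simp only [windS, log_im]
      symm
      apply arg_pos_smul ε hε0
      rw [← mul_div_assoc, ← neg_div_neg_eq]; congr 1 <;> ring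
    have e3 : arg (I * (q - I * ε)) = (windS 0 q (I * ε)).im := by
      simp only [windS, log_im]
      apply arg_pos_smul ε hε0
      have : (0 - I * (ε:ℂ)) ≠ 0 := by simp [hεc]
      field_simp
      ring_nf
      simp only [I_sq, I_pow_three]; ring
    have e4 : arg (-I * (q - -(I * ε))) = (windS 0 q (-(I * ε))).im := by
      simp only [windS, log_im]
      apply arg_pos_smul ε hε0
      have : (0 - -(I * (ε:ℂ))) ≠ 0 := by simp [hεc]
      field_simp
      ring_nf
      simp only [I_sq, I_pow_three]; ring
    rw [e1, e2, e3, e4]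
    simp only [hW, add_im] at hε
    linarith
  have hlim := tendsto_nhds_unique (lall.congr' hz) tendsto_const_nhds
  simp only [zero_sub, sub_zero, div_neg, neg_div, neg_neg, zero_add, neg_mul] at hlim
  have s1 : arg (-(I/p)) < 0 := arg_neg_iff.2 (by simp only [neg_im]; linarith)
  have s2 : 0 ≤ arg (I/p) := arg_nonneg_iff.2 imp.le
  have s3 : arg (I*q) < 0 := arg_neg_iff.2 (by rw [im2]; exact hq)
  have s4 : 0 ≤ arg (-(I*q)) := arg_nonneg_iff.2 (by rw [neg_im, im2]; linarith)
  linarith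

end winding


/-! ## Part 4 : the causeway, local analysis -/

section causeway

/-- `s` is active at `p` : it maximizes `2 τ s - ‖c s - p‖²` over `[l, r]`. -/
def Act (c : ℝ → Euc 2) (l r τ : ℝ) (p : Euc 2) (s : ℝ) : Prop :=
  s ∈ Icc l r ∧ ∀ t ∈ Icc l r, 2 * τ * (t - s) ≤ ‖c t - p‖ ^ 2 - ‖c s - p‖ ^ 2

/-- local approximation of the arc by a straight line of velocity `v` with error `ε` on `(α, β)`. -/
def Straight (c : ℝ → Euc 2) (l r α β : ℝ) (v : Euc 2) (ε : ℝ) : Prop :=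
  ∀ t t', t ∈ Icc l r → t' ∈ Icc l r → t ∈ Ioo α β → t' ∈ Ioo α β → t ≤ t' →
    ‖c t' - c t - (t' - t) • v‖ ≤ ε * (t' - t)

theorem le_of_small {A B C h0 : ℝ} (h0p : 0 < h0) (h : ∀ h, 0 < h → h < h0 → A ≤ B + h * C) : A ≤ B := by
  have h1 : Tendsto (fun h : ℝ => B + h * C) (𝓝[>] 0) (𝓝 (B + 0 * C)) :=
    ((continuous_const.add (continuous_id.mul continuous_const)).tendsto 0).mono_left nhdsWithin_le_nhds
  rw [zero_mul, add_zero] at h1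
  refine ge_of_tendsto h1 ?_
  filter_upwards [Ioo_mem_nhdsGT h0p] with x hx using h x hx.1 hx.2

theorem norm_add_sq' (a b : Euc 2) : ‖a + b‖ ^ 2 = ‖a‖ ^ 2 + 2 * ⟪a, b⟫ + ‖b‖ ^ 2 :=
  norm_add_sq_real a b

theorem inner_ge_neg (a b : Euc 2) : -(‖a‖ * ‖b‖) ≤ ⟪a, b⟫ :=
  (abs_le.1 (abs_real_inner_le_norm a b)).1

theorem inner_le' (a b : Euc 2) : ⟪a, b⟫ ≤ ‖a‖ * ‖b‖ := real_inner_le_norm a b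

theorem act_right {c : ℝ → Euc 2} {l r τ α β ε s : ℝ} {v p : Euc 2}
    (hst : Straight c l r α β v ε) (hs : Act c l r τ p s) (hsw : s ∈ Ioo α β) (hsr : s < r) :
    τ - ε * ‖c s - p‖ ≤ ⟪c s - p, v⟫ := by
  have h0 : 0 < min (r - s) (β - s) := lt_min (by linarith) (by linarith [hsw.2])
  have key : 2 * τ ≤ 2 * (⟪c s - p, v⟫ + ε * ‖c s - p‖) := by
    refine le_of_small (C := (‖v‖ + ε) ^ 2) h0 fun h hp hlt => ?_
    have hl1 := lt_of_lt_of_le hlt (min_le_left _ _)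
    have hl2 := lt_of_lt_of_le hlt (min_le_right _ _)
    have ht : s + h ∈ Icc l r := ⟨by linarith [hs.1.1], by linarith⟩
    have h1 := hs.2 _ ht
    have h2 := hst s (s + h) hs.1 ht hsw ⟨by linarith [hsw.1], by linarith⟩ (by linarith)
    rw [add_sub_cancel_left] at h1 h2
    set w := c (s + h) - c s - h • v with hw
    set d := c s - p with hd
    have e1 : c (s + h) - p = d + (h • v + w) := by rw [hw, hd]; abel
    rw [e1, norm_add_sq', inner_add_right, inner_smul_right] at h1
    have h3 : ⟪d, w⟫ ≤ ‖d‖ * (ε * h) := (inner_le' _ _).trans (by gcongr)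
    have h4 : ‖h • v + w‖ ≤ h * (‖v‖ + ε) := by
      refine (norm_add_le _ _).trans ?_
      rw [norm_smul, Real.norm_of_nonneg hp.le]; linarith
    have h5 : ‖h • v + w‖ ^ 2 ≤ (h * (‖v‖ + ε)) ^ 2 := by gcongr
    have h6 : h * (2 * τ) ≤ h * (2 * (⟪d, v⟫ + ε * ‖d‖) + h * (‖v‖ + ε) ^ 2) := by nlinarith
    exact le_of_mul_le_mul_left h6 hp
  linarith

theorem act_left {c : ℝ → Euc 2} {l r τ α β ε s : ℝ} {v p : Euc 2}
    (hst : Straight c l r α β v ε) (hs : Act c l r τ p s) (hsw : s ∈ Ioo α β) (hsr : l < s) :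
    ⟪c s - p, v⟫ ≤ τ + ε * ‖c s - p‖ := by
  have h0 : 0 < min (s - l) (s - α) := lt_min (by linarith) (by linarith [hsw.1])
  have key : 2 * ⟪c s - p, v⟫ ≤ 2 * (τ + ε * ‖c s - p‖) := by
    refine le_of_small (C := (‖v‖ + ε) ^ 2) h0 fun h hp hlt => ?_
    have hl1 := lt_of_lt_of_le hlt (min_le_left _ _)
    have hl2 := lt_of_lt_of_le hlt (min_le_right _ _)
    have ht : s - h ∈ Icc l r := ⟨by linarith, by linarith [hs.1.2]⟩
    have h1 := hs.2 _ ht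
    have h2 := hst (s - h) s ht hs.1 ⟨by linarith, by linarith [hsw.2]⟩ hsw (by linarith)
    have e0 : s - (s - h) = h := by ring
    have e0' : s - h - s = - h := by ring
    rw [e0'] at h1; rw [e0] at h2
    set w := c s - c (s - h) - h • v with hw
    set d := c s - p with hd
    have e1 : c (s - h) - p = d + - (h • v + w) := by rw [hw, hd]; abel
    rw [e1, norm_add_sq', inner_neg_right, inner_add_right, inner_smul_right, norm_neg] at h1
    have h3 : -(‖d‖ * (ε * h)) ≤ ⟪d, w⟫ := le_trans (neg_le_neg (by gcongr)) (inner_ge_neg _ _)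
    have h4 : ‖h • v + w‖ ≤ h * (‖v‖ + ε) := by
      refine (norm_add_le _ _).trans ?_
      rw [norm_smul, Real.norm_of_nonneg hp.le]; linarith
    have h5 : ‖h • v + w‖ ^ 2 ≤ (h * (‖v‖ + ε)) ^ 2 := by gcongr
    have h6 : h * (2 * ⟪d, v⟫) ≤ h * (2 * (τ + ε * ‖d‖) + h * (‖v‖ + ε) ^ 2) := by nlinarith
    exact le_of_mul_le_mul_left h6 hp
  linarith

set_option maxHeartbeats 1000000 in
theorem act_pair {c : ℝ → Euc 2} {l r τ α β ε s s0 : ℝ} {v p : Euc 2} (hτ : 0 < τ)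
    (hst : Straight c l r α β v ε) (hε : 0 ≤ ε) (hεv : ε ≤ ‖v‖ / 20) (hv : 0 < ‖v‖)
    (h0 : Act c l r τ p s0) (h0w : s0 ∈ Ioo α β) (h0r : s0 < r)
    (hs : Act c l r τ p s) (hsw : s ∈ Ioo α β) (hss : s0 ≤ s) :
    0 < ‖c s0 - p‖ ∧
    - (ε * ‖c s0 - p‖) ≤ ⟪c s - p, v⟫ ∧ ‖c s0 - p‖ ^ 2 / 2 ≤ ⟪c s - p, c s0 - p⟫ ∧
    (∀ μ, τ ≤ μ * ‖c s0 - p‖ → μ ≤ ‖v‖ / 4 → l < s0 →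
      ⟪c s - p, v⟫ ≤ (μ + 2 * ε) * ‖c s0 - p‖) := by
  have hA := act_right hst h0 h0w h0r
  have hdlt := hst s0 s h0.1 hs.1 h0w hsw hss
  have hopt := h0.2 s hs.1
  have hopt2 := hs.2 s0 h0.1
  set h := s - s0 with hh
  have hh0 : 0 ≤ h := by linarith
  set w := c s - c s0 - h • v with hw
  set d := c s0 - p with hd
  have e1 : c s - p = d + (h • v + w) := by rw [hw, hd]; abel
  have hDpos : 0 < ‖d‖ := by
    rcases (norm_nonneg d).eq_or_lt with h' | h'
    · exfalso
      have : d = 0 := norm_eq_zero.1 h'.symm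
      rw [this] at hA
      simp at hA
      linarith
    · exact h'
  have hsq : ‖c s - p‖ ^ 2 = ‖d‖ ^ 2 + 2 * τ * h := by
    have : s0 - s = -h := by rw [hh]; ring
    rw [this] at hopt2
    linarith
  have hwv : -(ε * h * ‖v‖) ≤ ⟪w, v⟫ := le_trans (neg_le_neg (by gcongr)) (inner_ge_neg _ _)
  have hwd : -(ε * h * ‖d‖) ≤ ⟪w, d⟫ := le_trans (neg_le_neg (by gcongr)) (inner_ge_neg _ _)
  have hvv : ⟪v, v⟫ = ‖v‖ ^ 2 := real_inner_self_eq_norm_sq v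
  have hdd : ⟪d, d⟫ = ‖d‖ ^ 2 := real_inner_self_eq_norm_sq d
  -- bound on h
  have hwpos : 0 < ‖v‖ - ε := by linarith
  have hbd : h * (‖v‖ - ε) ^ 2 ≤ 2 * ‖d‖ * (‖v‖ - ε) + 2 * τ := by
    by_contra hcon
    push Not at hcon
    have hhp : 0 < h := by
      rcases hh0.eq_or_lt with h' | h'
      · rw [← h'] at hcon
        have : 0 ≤ 2 * ‖d‖ * (‖v‖ - ε) := by positivity
        linarith
      · exact h'
    have t1 : h * (‖v‖ - ε) - ‖d‖ ≤ ‖c s - p‖ := by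
      rw [e1]
      have a1 : ‖h • v‖ ≤ ‖d + (h • v + w)‖ + ‖d‖ + ‖w‖ := by
        calc ‖h • v‖ = ‖(d + (h • v + w)) - d - w‖ := by congr 1; abel
          _ ≤ _ := (norm_sub_le _ _).trans (by gcongr; exact norm_sub_le _ _)
      rw [norm_smul, Real.norm_of_nonneg hh0] at a1
      linarith
    have t2 : 0 < h * (‖v‖ - ε) - 2 * ‖d‖ := by
      have : 0 < (h * (‖v‖ - ε) - 2 * ‖d‖) * (‖v‖ - ε) := by nlinarith
      exact pos_of_mul_pos_left this hwpos.le
    have t3 : (h * (‖v‖ - ε) - ‖d‖) ^ 2 ≤ ‖c s - p‖ ^ 2 := by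
      apply pow_le_pow_left₀ _ t1; linarith
    rw [hsq] at t3
    have t4 : h * (h * (‖v‖ - ε) ^ 2) ≤ h * (2 * ‖d‖ * (‖v‖ - ε) + 2 * τ) := by nlinarith
    exact absurd (le_of_mul_le_mul_left t4 hhp) (not_le.2 hcon)
  have hw19 : 19 / 20 * ‖v‖ ≤ ‖v‖ - ε := by linarith
  refine ⟨hDpos, ?_, ?_, ?_⟩
  · rw [e1, inner_add_left, inner_add_left, inner_smul_left, hvv]
    simp only [conj_trivial]
    have : 0 ≤ h * ‖v‖ * (‖v‖ - ε) := by positivity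
    nlinarith
  · rw [e1, inner_add_left, inner_add_left, inner_smul_left, hdd]
    simp only [conj_trivial]
    rw [real_inner_comm v d] at hA
    have q1 : h * (τ - ε * ‖d‖) ≤ h * ⟪v, d⟫ := by
      apply mul_le_mul_of_nonneg_left hA hh0
    by_cases hc : 2 * ε * ‖d‖ ≤ τ
    · have : 0 ≤ h * (τ - 2 * ε * ‖d‖) := mul_nonneg hh0 (by linarith)
      nlinarith [sq_nonneg ‖d‖]
    · push Not at hc
      -- h ≤ 3 ‖d‖ / (‖v‖ - ε)
      have q2 : h * (‖v‖ - ε) ≤ 3 * ‖d‖ := by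
        have : (h * (‖v‖ - ε)) * (‖v‖ - ε) ≤ (3 * ‖d‖) * (‖v‖ - ε) := by
          have : 2 * τ ≤ ‖d‖ * (‖v‖ - ε) := by
            have : 4 * ε ≤ ‖v‖ - ε := by linarith
            nlinarith
          nlinarith
        exact le_of_mul_le_mul_right this hwpos
      have q3 : h * ε ≤ ‖d‖ * (3 / 19) := by
        have q6 : 19 * ε ≤ ‖v‖ - ε := by linarith
        have := mul_le_mul_of_nonneg_left q6 hh0
        linarith
      have q4 : 0 ≤ h * τ := by positivity
      have q5 := mul_le_mul_of_nonneg_right q3 hDpos.le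
      have q7 := sq_nonneg ‖d‖
      linarith
  · intro μ hμ hμv hl
    have hL := act_left hst hs hsw (by linarith)
    have hn : ‖c s - p‖ ≤ 2 * ‖d‖ := by
      refine le_of_sq_le_sq ?_ (by positivity)
      rw [hsq]
      have hμ0 : 0 < μ := by
        by_contra hcon; push Not at hcon
        nlinarith
      have r1 : τ ≤ (‖v‖ - ε) * ‖d‖ / 2 := by nlinarith
      have r2 : h * (‖v‖ - ε) ≤ 3 * ‖d‖ := by
        have : (h * (‖v‖ - ε)) * (‖v‖ - ε) ≤ (3 * ‖d‖) * (‖v‖ - ε) := by nlinarith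
        exact le_of_mul_le_mul_right this hwpos
      have r3 : 2 * τ * h ≤ 3 * ‖d‖ ^ 2 := by
        calc 2 * τ * h ≤ 2 * ((‖v‖ - ε) * ‖d‖ / 2) * h := by gcongr
          _ = ‖d‖ * (h * (‖v‖ - ε)) := by ring
          _ ≤ ‖d‖ * (3 * ‖d‖) := by gcongr
          _ = 3 * ‖d‖ ^ 2 := by ring
      have r4 : (2 * ‖d‖) ^ 2 = 4 * ‖d‖ ^ 2 := by ring
      linarith
    have := mul_le_mul_of_nonneg_left hn hε
    linarith

end causeway


section causeway2

/-- the local solvability statement at the parameter `s'` of the arc -/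
def Win (φ : Euc 2 → ℝ) (f : Euc 2 → Euc 2) (c : ℝ → Euc 2) (l r κ0 η s' : ℝ) : Prop :=
  ∃ ρ > 0, ∃ τ0 > 0, ∀ τ, 0 < τ → τ < τ0 → ∀ p ∈ ball (c s') ρ,
    (∀ s, Act c l r τ p s → |s - s'| < ρ) →
    (∀ s, Act c l r τ p s → φ p ≤ κ0 + η * s - η / (2 * τ) * ‖c s - p‖ ^ 2) →
    ∃ V : Euc 2, (∀ s, Act c l r τ p s → 0 < ⟪V, c s - p⟫) ∧
      ((∃ s, Act c l r τ p s ∧ φ p = κ0 + η * s - η / (2 * τ) * ‖c s - p‖ ^ 2) → 0 < ⟪V, f p⟫)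

theorem act_exists {c : ℝ → Euc 2} (hc : Continuous c) {l r : ℝ} (hlr : l ≤ r) (τ : ℝ) (p : Euc 2) :
    ∃ s, Act c l r τ p s := by
  obtain ⟨s, hs, hmax⟩ := isCompact_Icc.exists_isMaxOn (nonempty_Icc.2 hlr)
    (f := fun s => 2 * τ * s - ‖c s - p‖ ^ 2) (by fun_prop)
  refine ⟨s, hs, fun t ht => ?_⟩
  have := hmax ht
  simp only [mem_setOf_eq] at this
  linarith

theorem act_closed {c : ℝ → Euc 2} (hc : Continuous c) (l r τ : ℝ) (p : Euc 2) :
    IsCompact {s | Act c l r τ p s} := by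
  have : {s | Act c l r τ p s} = Icc l r ∩ ⋂ t ∈ Icc l r,
      {s | 2 * τ * (t - s) ≤ ‖c t - p‖ ^ 2 - ‖c s - p‖ ^ 2} := by
    ext s; simp [Act]
  rw [this]
  refine isCompact_Icc.inter_right (isClosed_biInter fun t _ => ?_)
  exact isClosed_le (by fun_prop) (by fun_prop)

theorem act_min {c : ℝ → Euc 2} (hc : Continuous c) {l r : ℝ} (hlr : l ≤ r) (τ : ℝ) (p : Euc 2) :
    ∃ s0, Act c l r τ p s0 ∧ ∀ s, Act c l r τ p s → s0 ≤ s := by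
  obtain ⟨s0, h1, h2⟩ := (act_closed hc l r τ p).exists_isLeast (act_exists hc hlr τ p)
  exact ⟨s0, h1, fun s hs => h2 hs⟩

/-- the value is the same for all active parameters -/
theorem act_val {c : ℝ → Euc 2} {l r τ : ℝ} {p : Euc 2} {s s' : ℝ} (h : Act c l r τ p s)
    (h' : Act c l r τ p s') (hτ : 0 < τ) (κ0 η : ℝ) :
    κ0 + η * s - η / (2 * τ) * ‖c s - p‖ ^ 2 = κ0 + η * s' - η / (2 * τ) * ‖c s' - p‖ ^ 2 := by
  have h1 := h.2 s' h'.1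
  have h2 := h'.2 s h.1
  have h3 : ‖c s' - p‖ ^ 2 = ‖c s - p‖ ^ 2 + 2 * τ * (s' - s) := by linarith
  rw [h3]
  field_simp
  ring

/-- direction `d0/D + λ v` -/
theorem dir_plus {d0 d v fp : Euc 2} {δ ε : ℝ} (hD : 0 < ‖d0‖) (hv : 0 < ‖v‖) (hδ : 0 < δ)
    (hε : 8 * ε ≤ δ * ‖v‖)
    (h1 : - (ε * ‖d0‖) ≤ ⟪d, v⟫) (h2 : ‖d0‖ ^ 2 / 2 ≤ ⟪d, d0⟫) :
    0 < ⟪(1 / ‖d0‖) • d0 + (2 / (δ * ‖v‖)) • v, d⟫ ∧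
    (0 < ‖fp‖ → δ * ‖fp‖ * ‖v‖ ≤ ⟪fp, v⟫ → 0 < ⟪(1 / ‖d0‖) • d0 + (2 / (δ * ‖v‖)) • v, fp⟫) := by
  have hdv : 0 < δ * ‖v‖ := by positivity
  constructor
  · rw [inner_add_left, inner_smul_left, inner_smul_left, real_inner_comm d d0, real_inner_comm d v]
    simp only [conj_trivial]
    have a1 : ‖d0‖ / 2 ≤ 1 / ‖d0‖ * ⟪d, d0⟫ := by
      rw [one_div, inv_mul_eq_div, le_div_iff₀ hD]; linarith
    have a2 : - (‖d0‖ / 4) ≤ 2 / (δ * ‖v‖) * ⟪d, v⟫ := by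
      rw [div_mul_eq_mul_div, le_div_iff₀ hdv]
      nlinarith
    linarith
  · intro hf hfv
    rw [inner_add_left, inner_smul_left, inner_smul_left, real_inner_comm fp v]
    simp only [conj_trivial]
    have a1 : - ‖fp‖ ≤ 1 / ‖d0‖ * ⟪d0, fp⟫ := by
      rw [one_div, inv_mul_eq_div, le_div_iff₀ hD]
      linarith [inner_ge_neg d0 fp]
    have a2 : 2 * ‖fp‖ ≤ 2 / (δ * ‖v‖) * ⟪fp, v⟫ := by
      rw [div_mul_eq_mul_div, le_div_iff₀ hdv]
      nlinarith
    linarith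

theorem dir_minus {d0 d v fp : Euc 2} {δ ε : ℝ} (hD : 0 < ‖d0‖) (hv : 0 < ‖v‖) (hδ : 0 < δ)
    (hε : 8 * ε ≤ δ * ‖v‖)
    (h1 : ⟪d, v⟫ ≤ ε * ‖d0‖) (h2 : ‖d0‖ ^ 2 / 2 ≤ ⟪d, d0⟫) :
    0 < ⟪(1 / ‖d0‖) • d0 + (2 / (δ * ‖-v‖)) • (-v), d⟫ ∧
    (0 < ‖fp‖ → ⟪fp, v⟫ ≤ - (δ * ‖fp‖ * ‖v‖) →
      0 < ⟪(1 / ‖d0‖) • d0 + (2 / (δ * ‖-v‖)) • (-v), fp⟫) := by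
  have := dir_plus (d0 := d0) (d := d) (v := -v) (fp := fp) hD (by rwa [norm_neg]) hδ
    (ε := ε) (by rwa [norm_neg]) (by rw [inner_neg_right]; linarith) h2
  refine ⟨this.1, fun a b => this.2 a ?_⟩
  rw [norm_neg, inner_neg_right]; linarith

theorem tau_le {η τ μ D h1 X : ℝ} (hη : 0 < η) (hτ : 0 < τ) (hμ : 0 < μ) (hD : 0 < D)
    (h : X - η / (2 * τ) * D ^ 2 ≤ X - h1) (hτ0 : τ < 2 * μ ^ 2 * h1 / η) : τ ≤ μ * D := by
  have a1 : h1 ≤ η / (2 * τ) * D ^ 2 := by linarith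
  rw [div_mul_eq_mul_div, le_div_iff₀ (by positivity)] at a1
  rw [lt_div_iff₀ hη] at hτ0
  refine le_of_sq_le_sq ?_ (by positivity)
  have a3 : τ * (τ * η) ≤ τ * (2 * μ ^ 2 * h1) := mul_le_mul_of_nonneg_left hτ0.le hτ.le
  have a2 := mul_le_mul_of_nonneg_left a1 (sq_nonneg μ)
  have : τ ^ 2 * η ≤ (μ * D) ^ 2 * η := by linarith
  exact le_of_mul_le_mul_right this hη

theorem win_end {φ : Euc 2 → ℝ} {f : Euc 2 → Euc 2} {c : ℝ → Euc 2} {l r κ0 η : ℝ}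
    (hφ : Continuous φ) (hc : Continuous c) (hlr : l ≤ r) (hη : 0 < η) (h : κ0 + η * r < φ (c r)) :
    Win φ f c l r κ0 η r := by
  obtain ⟨ρ, hρ, hb⟩ := Metric.eventually_nhds_iff_ball.1
    ((hφ.continuousAt (x := c r)).eventually (lt_mem_nhds h))
  refine ⟨ρ, hρ, 1, one_pos, fun τ hτ _ p hp _ hle => ?_⟩
  exfalso
  obtain ⟨s, hs⟩ := act_exists hc hlr τ p
  have h1 := hle s hs
  have h2 := hb p hp
  have h3 : η * s ≤ η * r := mul_le_mul_of_nonneg_left hs.1.2 hη.le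
  have h4 : 0 ≤ η / (2 * τ) * ‖c s - p‖ ^ 2 := by positivity
  linarith

theorem win_F {φ : Euc 2 → ℝ} {f : Euc 2 → Euc 2} {c : ℝ → Euc 2} {l r κ0 η s' ρ0 δ ε : ℝ} {v : Euc 2}
    (hf : Continuous f) (hc : Continuous c) (hs' : s' ∈ Ioo l r)
    (hρ0 : 0 < ρ0) (hst : Straight c l r (s' - ρ0) (s' + ρ0) v ε) (hv : 0 < ‖v‖) (hε0 : 0 ≤ ε)
    (hε1 : ε ≤ ‖v‖ / 20) (hδ : 0 < δ) (hε2 : 8 * ε ≤ δ * ‖v‖)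
    (hfv : δ * ‖f (c s')‖ * ‖v‖ < ⟪f (c s'), v⟫) : Win φ f c l r κ0 η s' := by
  obtain ⟨ρ, hρ, hb⟩ := Metric.eventually_nhds_iff_ball.1
    (ContinuousAt.eventually_lt (f := fun p => δ * ‖f p‖ * ‖v‖) (g := fun p => ⟪f p, v⟫) (x₀ := c s')
      (by fun_prop) (by fun_prop) hfv)
  refine ⟨min ρ (min ρ0 (r - s')), lt_min hρ (lt_min hρ0 (by linarith [hs'.2])), 1, one_pos,
    fun τ hτ _ p hp hw _ => ?_⟩
  have hfp := hb p (ball_subset_ball (min_le_left _ _) hp)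
  have hfp0 : 0 < ‖f p‖ := by
    by_contra hcon
    have : f p = 0 := by simpa using hcon
    simp [this] at hfp
  have hw' : ∀ s, Act c l r τ p s → s ∈ Ioo (s' - ρ0) (s' + ρ0) ∧ s < r := by
    intro s hs
    have := abs_lt.1 (hw s hs)
    have m1 : min ρ (min ρ0 (r - s')) ≤ ρ0 := (min_le_right _ _).trans (min_le_left _ _)
    have m2 : min ρ (min ρ0 (r - s')) ≤ r - s' := (min_le_right _ _).trans (min_le_right _ _)
    exact ⟨⟨by linarith, by linarith⟩, by linarith⟩
  obtain ⟨s0, hs0, hmin⟩ := act_min hc (hs'.1.trans hs'.2).le τ p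
  have hpair := fun s (hs : Act c l r τ p s) => act_pair hτ hst hε0 hε1 hv hs0 (hw' s0 hs0).1
    (hw' s0 hs0).2 hs (hw' s hs).1 (hmin s hs)
  have hD := (hpair s0 hs0).1
  refine ⟨(1 / ‖c s0 - p‖) • (c s0 - p) + (2 / (δ * ‖v‖)) • v, fun s hs => ?_, fun _ => ?_⟩
  · exact (dir_plus (fp := f p) hD hv hδ hε2 (hpair s hs).2.1 (hpair s hs).2.2.1).1
  · exact (dir_plus (fp := f p) hD hv hδ hε2 (hpair s0 hs0).2.1 (hpair s0 hs0).2.2.1).2 hfp0 hfp.le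

/-- general tool for windows where the causeway is above `φ` -/
theorem win_tool {φ : Euc 2 → ℝ} {f : Euc 2 → Euc 2} {c : ℝ → Euc 2} {l r κ0 η s' ρ0 θ ε : ℝ} {v : Euc 2}
    (hφ : Continuous φ) (hc : Continuous c) (hη : 0 < η) (hl : l ≤ s') (hr : s' < r)
    (hρ0 : 0 < ρ0) (hst : Straight c l r (s' - ρ0) (s' + ρ0) v ε) (hv : 0 < ‖v‖) (hε0 : 0 ≤ ε)
    (hε1 : ε ≤ ‖v‖ / 20) (hθ : 0 < θ) (hθ1 : θ ≤ ‖v‖ / 4)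
    (hφc : φ (c s') < κ0 + η * s')
    (G : ∃ ρ > 0, ∀ p ∈ ball (c s') ρ, ∀ s0 ∈ Icc l r, |s0 - s'| < ρ → 0 < ‖c s0 - p‖ →
      (l < s0 → -(ε * ‖c s0 - p‖) ≤ ⟪c s0 - p, v⟫ ∧ ⟪c s0 - p, v⟫ ≤ (θ + 2 * ε) * ‖c s0 - p‖) →
      0 < ⟪f p, c s0 - p⟫ ∨ ∃ δ > 0, 0 < ‖f p‖ ∧ 8 * (θ + 2 * ε) ≤ δ * ‖v‖ ∧ 
        (δ * ‖f p‖ * ‖v‖ ≤ ⟪f p, v⟫ ∨ (l < s0 ∧ ⟪f p, v⟫ ≤ - (δ * ‖f p‖ * ‖v‖)))) :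
    Win φ f c l r κ0 η s' := by
  obtain ⟨ρ1, hρ1, hG⟩ := G
  set h1 := (κ0 + η * s' - φ (c s')) / 2 with hh1
  have h1pos : 0 < h1 := by rw [hh1]; linarith
  -- neighborhoods
  obtain ⟨ρ2, hρ2, hb⟩ := Metric.eventually_nhds_iff_ball.1
    ((hφ.continuousAt (x := c s')).eventually (gt_mem_nhds (show φ (c s') < φ (c s') + h1 / 2 by linarith)))
  set ρ3 := h1 / (2 * η) with hρ3
  have hρ3p : 0 < ρ3 := by positivity
  set ρ := min (min ρ0 ρ1) (min (min ρ2 ρ3) (r - s')) with hρdef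
  have hρp : 0 < ρ := lt_min (lt_min hρ0 hρ1) (lt_min (lt_min hρ2 hρ3p) (by linarith))
  have m0 : ρ ≤ ρ0 := (min_le_left _ _).trans (min_le_left _ _)
  have m1 : ρ ≤ ρ1 := (min_le_left _ _).trans (min_le_right _ _)
  have m2 : ρ ≤ ρ2 := (min_le_right _ _).trans ((min_le_left _ _).trans (min_le_left _ _))
  have m3 : ρ ≤ ρ3 := (min_le_right _ _).trans ((min_le_left _ _).trans (min_le_right _ _))
  have m4 : ρ ≤ r - s' := (min_le_right _ _).trans (min_le_right _ _)
  refine ⟨ρ, hρp, 2 * θ ^ 2 * h1 / η, by positivity, fun τ hτ hτ0 p hp hw hle => ?_⟩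
  have hw' : ∀ s, Act c l r τ p s → s ∈ Ioo (s' - ρ0) (s' + ρ0) ∧ s < r := by
    intro s hs
    have := abs_lt.1 (hw s hs)
    exact ⟨⟨by linarith, by linarith⟩, by linarith⟩
  obtain ⟨s0, hs0, hmin⟩ := act_min hc (hl.trans hr.le) τ p
  have hpair := fun s (hs : Act c l r τ p s) => act_pair hτ hst hε0 hε1 hv hs0 (hw' s0 hs0).1
    (hw' s0 hs0).2 hs (hw' s hs).1 (hmin s hs)
  have hD := (hpair s0 hs0).1
  by_cases hrim : φ p = κ0 + η * s0 - η / (2 * τ) * ‖c s0 - p‖ ^ 2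
  swap
  · refine ⟨c s0 - p, fun s hs => ?_, ?_⟩
    · rw [real_inner_comm]
      have := (hpair s hs).2.2.1
      have h2 : 0 < ‖c s0 - p‖ ^ 2 := by positivity
      linarith
    · rintro ⟨s, hs, he⟩
      exact absurd (he.trans (act_val hs hs0 hτ κ0 η)) hrim
  have hφp := hb p (ball_subset_ball m2 hp)
  have hs0a := hw s0 hs0
  have hηs : η * s' - h1 / 2 ≤ η * s0 := by
    have h2 := abs_lt.1 hs0a
    have h3 : s' - ρ3 ≤ s0 := by linarith
    have h4 := mul_le_mul_of_nonneg_left h3 hη.le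
    have h5 : η * ρ3 = h1 / 2 := by rw [hρ3]; field_simp
    linarith
  have hτD : τ ≤ θ * ‖c s0 - p‖ := by
    refine tau_le (X := κ0 + η * s0) hη hτ hθ hD ?_ hτ0
    rw [← hrim]
    have : κ0 + η * s' - φ (c s') = 2 * h1 := by rw [hh1]; ring
    linarith
  have hup : l < s0 → ∀ s, Act c l r τ p s → ⟪c s - p, v⟫ ≤ (θ + 2 * ε) * ‖c s0 - p‖ := fun hls s hs =>
    (hpair s hs).2.2.2 θ hτD hθ1 hls
  rcases hG p (ball_subset_ball m1 hp) s0 hs0.1 (hs0a.trans_le m1) hD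
    (fun hls => ⟨(hpair s0 hs0).2.1, hup hls s0 hs0⟩) with hA | ⟨δ, hδ, hfp, hε2, hP | ⟨hls, hM⟩⟩
  · refine ⟨c s0 - p, fun s hs => ?_, fun _ => ?_⟩
    · rw [real_inner_comm]
      have := (hpair s hs).2.2.1
      have h2 : 0 < ‖c s0 - p‖ ^ 2 := by positivity
      linarith
    · rw [real_inner_comm]; exact hA
  · have hε3 : 8 * ε ≤ δ * ‖v‖ := by linarith
    refine ⟨(1 / ‖c s0 - p‖) • (c s0 - p) + (2 / (δ * ‖v‖)) • v, fun s hs => ?_, fun _ => ?_⟩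
    · exact (dir_plus (fp := f p) hD hv hδ hε3 (hpair s hs).2.1 (hpair s hs).2.2.1).1
    · exact (dir_plus (fp := f p) hD hv hδ hε3 (hpair s0 hs0).2.1 (hpair s0 hs0).2.2.1).2 hfp hP
  · refine ⟨(1 / ‖c s0 - p‖) • (c s0 - p) + (2 / (δ * ‖-v‖)) • (-v), fun s hs => ?_, fun _ => ?_⟩
    · exact (dir_minus (fp := f p) hD hv hδ hε2 (hup hls s hs) (hpair s hs).2.2.1).1
    · exact (dir_minus (fp := f p) hD hv hδ hε2 (hup hls s0 hs0) (hpair s0 hs0).2.2.1).2 hfp hM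

theorem win_B {φ : Euc 2 → ℝ} {f : Euc 2 → Euc 2} {c : ℝ → Euc 2} {l r κ0 η s' ρ0 δ ε : ℝ} {v : Euc 2}
    (hφ : Continuous φ) (hf : Continuous f) (hc : Continuous c) (hη : 0 < η) (hs' : s' ∈ Ioo l r)
    (hρ0 : 0 < ρ0) (hst : Straight c l r (s' - ρ0) (s' + ρ0) v ε) (hv : 0 < ‖v‖) (hε0 : 0 ≤ ε)
    (hε1 : ε ≤ ‖v‖ / 20) (hδ : 0 < δ) (hδ1 : δ ≤ 1) (hε2 : 32 * ε ≤ δ * ‖v‖)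
    (hφc : φ (c s') < κ0 + η * s')
    (hfv : ⟪f (c s'), v⟫ < - (δ * ‖f (c s')‖ * ‖v‖)) : Win φ f c l r κ0 η s' := by
  obtain ⟨ρ, hρ, hb⟩ := Metric.eventually_nhds_iff_ball.1
    (ContinuousAt.eventually_lt (f := fun p => ⟪f p, v⟫) (g := fun p => - (δ * ‖f p‖ * ‖v‖)) (x₀ := c s')
      (by fun_prop) (by fun_prop) hfv)
  refine win_tool (θ := δ * ‖v‖ / 16) hφ hc hη hs'.1.le hs'.2 hρ0 hst hv hε0 hε1 (by positivity) ?_ hφc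
    ⟨min ρ (s' - l), lt_min hρ (by linarith [hs'.1]), fun p hp s0 hs0 hs0' hD _ => Or.inr ?_⟩
  · have : δ * ‖v‖ ≤ 1 * ‖v‖ := by gcongr
    linarith
  have hfp := hb p (ball_subset_ball (min_le_left _ _) hp)
  have hfp0 : 0 < ‖f p‖ := by
    by_contra hcon
    have : f p = 0 := by simpa using hcon
    simp [this] at hfp
  refine ⟨δ, hδ, hfp0, by linarith, Or.inr ⟨?_, hfp.le⟩⟩
  have := (abs_lt.1 (hs0'.trans_le (min_le_right _ _))).1
  linarith

end causeway2


section causeway3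

theorem win_z {φ : Euc 2 → ℝ} {f : Euc 2 → Euc 2} {c : ℝ → Euc 2} {l r κ0 η ρ0 ρ1 δ : ℝ} {v z : Euc 2}
    (hφ : Continuous φ) (hc : Continuous c) (hη : 0 < η) (hlr : l < r)
    (hρ0 : 0 < ρ0) (hst : ∀ h, 0 ≤ h → h < ρ0 → c (l + h) = z + h • v) (hv : 0 < ‖v‖)
    (hδ : 0 < δ) (hδ1 : δ ≤ 1)
    (hφc : φ z < κ0 + η * l) (hρ1 : 0 < ρ1)
    (hfz : ∀ p ∈ ball z ρ1, p ≠ z → 0 < ‖f p‖ ∧ δ * ‖f p‖ * ‖z - p‖ ≤ ⟪f p, z - p⟫) :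
    Win φ f c l r κ0 η l := by
  have hcl : c l = z := by simpa using hst 0 le_rfl hρ0
  have hstr : Straight c l r (l - ρ0) (l + ρ0) v 0 := by
    intro t t' ht ht' hw hw' _
    have e1 := hst (t - l) (by linarith [ht.1]) (by linarith [hw.2])
    have e2 := hst (t' - l) (by linarith [ht'.1]) (by linarith [hw'.2])
    rw [add_sub_cancel] at e1 e2
    rw [e1, e2, zero_mul]
    apply le_of_eq
    rw [norm_eq_zero]
    module
  have hδv : δ * ‖v‖ ≤ 1 * ‖v‖ := by gcongr
  refine win_tool (θ := δ * ‖v‖ / 16) (ε := 0) hφ hc hη le_rfl hlr hρ0 hstr hv le_rfl (by positivity)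
    (by positivity) (by linarith) (by rwa [hcl])
    ⟨min ρ1 ρ0, lt_min hρ1 hρ0, fun p hp s0 hs0 hs0' hD hl => ?_⟩
  rw [hcl] at hp
  have hp1 := ball_subset_ball (min_le_left _ _) hp
  rcases hs0.1.eq_or_lt with h | h
  · left
    rw [← h, hcl] at hD ⊢
    have hne : p ≠ z := by rintro rfl; simp at hD
    obtain ⟨h1, h2⟩ := hfz p hp1 hne
    exact lt_of_lt_of_le (by positivity) h2
  · obtain ⟨h1, h2⟩ := hl h
    set t := s0 - l with ht
    have htp : 0 < t := by linarith
    have hd : c s0 - p = (z - p) + t • v := by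
      have := hst t htp.le (by
        have := (abs_lt.1 (hs0'.trans_le (min_le_right _ _))).2
        exact this)
      rw [ht, add_sub_cancel] at this
      rw [this, ht]; abel
    set d := c s0 - p with hdd
    set q := z - p with hq
    have hqd : q = d - t • v := by rw [hd]; abel
    have hq2 : ‖q‖ ^ 2 = ‖d‖ ^ 2 - 2 * (t * ⟪d, v⟫) + t ^ 2 * ‖v‖ ^ 2 := by
      rw [hqd, norm_sub_sq_real, inner_smul_right, norm_smul, Real.norm_of_nonneg htp.le]; ring
    have hql : t * ‖v‖ / 2 < ‖q‖ := by
      refine lt_of_pow_lt_pow_left₀ 2 (norm_nonneg _) ?_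
      rw [hq2]
      have a1 : t * ⟪d, v⟫ ≤ t * (‖v‖ / 16 * ‖d‖) := by
        apply mul_le_mul_of_nonneg_left _ htp.le
        refine h2.trans ?_
        apply mul_le_mul_of_nonneg_right _ hD.le
        linarith
      have a2 : 0 < t * ‖v‖ := by positivity
      nlinarith [sq_nonneg (‖d‖ - t * ‖v‖ / 16)]
    have hqp : 0 < ‖q‖ := lt_trans (by positivity) hql
    have hne : p ≠ z := by rintro rfl; simp [hq] at hqp
    obtain ⟨g1, g2⟩ := hfz p hp1 hne
    by_cases hP : δ / 2 * ‖f p‖ * ‖v‖ ≤ ⟪f p, v⟫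
    · exact Or.inr ⟨δ / 2, by positivity, g1, by linarith, Or.inl hP⟩
    by_cases hM : ⟪f p, v⟫ ≤ - (δ / 2 * ‖f p‖ * ‖v‖)
    · exact Or.inr ⟨δ / 2, by positivity, g1, by linarith, Or.inr ⟨h, hM⟩⟩
    left
    push Not at hM hP
    rw [hd, inner_add_right, inner_smul_right]
    have b1 : t * -(δ / 2 * ‖f p‖ * ‖v‖) < t * ⟪f p, v⟫ := mul_lt_mul_of_pos_left hM htp
    have b2 : δ * ‖f p‖ * (t * ‖v‖ / 2) < δ * ‖f p‖ * ‖q‖ := by gcongr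
    linarith

/-- an orthonormal frame of the plane -/
structure Frame (eu ev : Euc 2) : Prop where
  nu : ‖eu‖ = 1
  nv : ‖ev‖ = 1
  orth : ⟪eu, ev⟫ = 0
  coord : ∀ w : Euc 2, w = ⟪w, eu⟫ • eu + ⟪w, ev⟫ • ev

theorem Frame.inner_eq {eu ev : Euc 2} (F : Frame eu ev) (w w' : Euc 2) :
    ⟪w, w'⟫ = ⟪w, eu⟫ * ⟪w', eu⟫ + ⟪w, ev⟫ * ⟪w', ev⟫ := by
  conv_lhs => rw [F.coord w']
  rw [inner_add_right, inner_smul_right, inner_smul_right]; ring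

theorem Frame.norm_sq {eu ev : Euc 2} (F : Frame eu ev) (w : Euc 2) :
    ‖w‖ ^ 2 = ⟪w, eu⟫ ^ 2 + ⟪w, ev⟫ ^ 2 := by
  rw [← real_inner_self_eq_norm_sq, F.inner_eq]; ring

theorem Frame.abs_u {eu ev : Euc 2} (F : Frame eu ev) (w : Euc 2) : |⟪w, eu⟫| ≤ ‖w‖ := by
  simpa [F.nu] using abs_real_inner_le_norm w eu

theorem Frame.abs_v {eu ev : Euc 2} (F : Frame eu ev) (w : Euc 2) : |⟪w, ev⟫| ≤ ‖w‖ := by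
  simpa [F.nv] using abs_real_inner_le_norm w ev

theorem Frame.norm_le {eu ev : Euc 2} (F : Frame eu ev) (w : Euc 2) : ‖w‖ ≤ |⟪w, eu⟫| + |⟪w, ev⟫| := by
  refine le_of_sq_le_sq ?_ (by positivity)
  rw [F.norm_sq w, ← sq_abs ⟪w, eu⟫, ← sq_abs ⟪w, ev⟫]
  have : 0 ≤ |⟪w, eu⟫| * |⟪w, ev⟫| := by positivity
  nlinarith

/-- smallness constant at the saddle -/
def SmallTheta (a b θ : ℝ) : Prop :=
  0 < θ ∧ θ ≤ 1 / 100 ∧ 100 * θ * (1 + b) * (3 + 8 * a / b) ≤ a ∧ 100 * θ * (1 + a) ≤ b ∧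
    θ * (1 + 4 * a / b) ≤ 1 / 100

set_option maxHeartbeats 4000000 in
theorem win_y {φ : Euc 2 → ℝ} {f : Euc 2 → Euc 2} {c : ℝ → Euc 2} {l r κ0 η ρ0 ρ1 a b θ ν : ℝ}
    {eu ev y : Euc 2} (hF : Frame eu ev) (ha : 0 < a) (hb : 0 < b) (hθ : SmallTheta a b θ) (hν : 0 < ν)
    (hφ : Continuous φ) (hc : Continuous c) (hη : 0 < η) (hl : l < 0) (hr : 0 < r) (hcy : c 0 = y)
    (hρ0 : 0 < ρ0) (hst : Straight c l r (0 - ρ0) (0 + ρ0) (ν • ev) (θ * ν))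
    (hφc : φ y < κ0) (hρ1 : 0 < ρ1)
    (hfu : ∀ p ∈ ball y ρ1, |⟪f p, eu⟫ + a * ⟪p - y, eu⟫| ≤ θ * ‖p - y‖)
    (hfv : ∀ p ∈ ball y ρ1, |⟪f p, ev⟫ - b * ⟪p - y, ev⟫| ≤ θ * ‖p - y‖) :
    Win φ f c l r κ0 η 0 := by
  obtain ⟨hθ0, hθ1, hθ2, hθ3, hθ4⟩ := hθ
  have hnv : ‖ν • ev‖ = ν := by rw [norm_smul, hF.nv, mul_one, Real.norm_of_nonneg hν.le]
  refine win_tool (θ := θ * ν) (ε := θ * ν) hφ hc hη hl.le hr hρ0 hst (by rwa [hnv]) (by positivity)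
    (by rw [hnv]; nlinarith) (by positivity) (by rw [hnv]; nlinarith) (by rw [hcy]; linarith)
    ⟨min ρ1 (min ρ0 (-l)), lt_min hρ1 (lt_min hρ0 (by linarith)), fun p hp s0 hs0 hs0' hD hls => ?_⟩
  rw [hcy] at hp
  have hp1 := ball_subset_ball (min_le_left _ _) hp
  have hsρ0 : |s0 - 0| < ρ0 := hs0'.trans_le ((min_le_right _ _).trans (min_le_left _ _))
  have hsl : |s0 - 0| < -l := hs0'.trans_le ((min_le_right _ _).trans (min_le_right _ _))
  rw [sub_zero] at hsρ0 hsl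
  have hls0 : l < s0 := by linarith [(abs_lt.1 hsl).1]
  obtain ⟨h1, h2⟩ := hls hls0
  -- displacement of c s0
  have hg : ‖c s0 - y - (s0 * ν) • ev‖ ≤ θ * (ν * |s0|) := by
    have m0 : (0:ℝ) ∈ Icc l r := ⟨hl.le, hr.le⟩
    have w0 : (0:ℝ) ∈ Ioo (0 - ρ0) (0 + ρ0) := ⟨by linarith, by linarith⟩
    have w1 : s0 ∈ Ioo (0 - ρ0) (0 + ρ0) := ⟨by linarith [(abs_lt.1 hsρ0).1], by linarith [(abs_lt.1 hsρ0).2]⟩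
    rcases le_total 0 s0 with h | h
    · have := hst 0 s0 m0 hs0 w0 w1 h
      rw [hcy, sub_zero, smul_smul] at this
      rw [abs_of_nonneg h]; linarith
    · have := hst s0 0 hs0 m0 w1 w0 h
      rw [hcy, zero_sub, smul_smul] at this
      rw [abs_of_nonpos h, ← norm_neg]
      have e : -(c s0 - y - (s0 * ν) • ev) = y - c s0 - (-s0 * ν) • ev := by module
      rw [e]; linarith
  have hfu' := hfu p hp1
  have hfv' := hfv p hp1
  set d := c s0 - p with hd
  set g := c s0 - y - (s0 * ν) • ev with hgd
  set P := p - y with hP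
  have hPeq : P = (s0 * ν) • ev - d + g := by rw [hP, hd, hgd]; abel
  have evv : ⟪ev, ev⟫ = 1 := by rw [real_inner_self_eq_norm_sq, hF.nv]; norm_num
  have evu : ⟪ev, eu⟫ = 0 := by rw [real_inner_comm]; exact hF.orth
  have hPu : ⟪P, eu⟫ = - ⟪d, eu⟫ + ⟪g, eu⟫ := by
    rw [hPeq, inner_add_left, inner_sub_left, inner_smul_left, evu]; simp
  have hPv : ⟪P, ev⟫ = s0 * ν - ⟪d, ev⟫ + ⟪g, ev⟫ := by
    rw [hPeq, inner_add_left, inner_sub_left, inner_smul_left, evv]; simp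
  have hgu := (hF.abs_u g).trans hg
  have hgv := (hF.abs_v g).trans hg
  have hPn := hF.norm_le P
  rw [inner_smul_right] at h1 h2
  have hdv : |⟪d, ev⟫| ≤ 3 * θ * ‖d‖ := by
    have k1 : -(θ * ‖d‖) ≤ ⟪d, ev⟫ := by
      have : ν * (-(θ * ‖d‖)) ≤ ν * ⟪d, ev⟫ := by linarith
      exact le_of_mul_le_mul_left this hν
    have k2 : ⟪d, ev⟫ ≤ 3 * θ * ‖d‖ := by
      have : ν * ⟪d, ev⟫ ≤ ν * (3 * θ * ‖d‖) := by linarith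
      exact le_of_mul_le_mul_left this hν
    rw [abs_le]
    have : 0 < θ * ‖d‖ := by positivity
    exact ⟨by linarith, k2⟩
  have hdn := hF.norm_sq d
  have hfd := hF.inner_eq (f p) d
  have hfn := hF.norm_le (f p)
  rw [inner_smul_right, hnv]
  have hduD := hF.abs_u d
  have hfvn := hF.abs_v (f p)
  set D := ‖d‖ with hDdef
  set σ := ν * |s0| with hσ
  have hσ0 : 0 ≤ σ := by positivity
  have hsσ : |s0 * ν| = σ := by rw [abs_mul, abs_of_pos hν]; ring
  have hPuA : |⟪P, eu⟫ + ⟪d, eu⟫| ≤ θ * σ := by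
    rw [hPu]; simpa using hgu
  have hPvA : |⟪P, ev⟫ - s0 * ν| ≤ 3 * θ * D + θ * σ := by
    rw [hPv]
    have : s0 * ν - ⟪d, ev⟫ + ⟪g, ev⟫ - s0 * ν = - ⟪d, ev⟫ + ⟪g, ev⟫ := by ring
    rw [this]
    refine (abs_add_le _ _).trans ?_
    rw [abs_neg]; linarith
  generalize ⟪P, eu⟫ = Pu at *
  generalize ⟪P, ev⟫ = Pv at *
  generalize ⟪d, eu⟫ = du at *
  generalize ⟪d, ev⟫ = dv at *
  generalize ⟪f p, eu⟫ = fu at *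
  generalize ⟪f p, ev⟫ = fv at *
  have hθν := mul_le_mul_of_nonneg_right hθ1 hν.le
  have hθD : θ * D ≤ D / 100 := by
    have := mul_le_mul_of_nonneg_right hθ1 hD.le
    linarith
  have hθσ : θ * σ ≤ σ / 100 := by
    have := mul_le_mul_of_nonneg_right hθ1 hσ0
    linarith
  have hPu2 : |Pu| ≤ D + σ / 100 := by
    have := abs_sub_abs_le_abs_sub Pu (-du)
    rw [abs_neg, sub_neg_eq_add] at this
    linarith
  have hPv2 : |Pv| ≤ D / 10 + 2 * σ := by
    have := abs_sub_abs_le_abs_sub Pv (s0 * ν)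
    linarith
  have hPn2 : ‖P‖ ≤ 2 * D + 3 * σ := by linarith
  have hθP : θ * ‖P‖ ≤ θ * (2 * D + 3 * σ) := by gcongr
  by_cases hcase : b * σ ≤ (4 * a + b) * D
  · left
    rw [hfd]
    have hσD : σ ≤ (1 + 4 * a / b) * D := by
      have : b * σ ≤ b * ((1 + 4 * a / b) * D) := by
        have e : b * ((1 + 4 * a / b) * D) = (4 * a + b) * D := by field_simp; ring
        rw [e]; exact hcase
      exact le_of_mul_le_mul_left this hb
    set C := 1 + 4 * a / b with hC
    have hC1 : 1 ≤ C := by rw [hC]; have : 0 < 4 * a / b := by positivity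
                           linarith
    have e8 : 3 + 8 * a / b = 1 + 2 * C := by rw [hC]; ring
    rw [e8] at hθ2
    -- fu = -a Pu + e1 , Pu = -du + e2
    have q1 : |fu - a * du| ≤ a * (θ * σ) + θ * (2 * D + 3 * σ) := by
      have : fu - a * du = (fu + a * Pu) - a * (Pu + du) := by ring
      rw [this]
      refine (abs_sub _ _).trans ?_
      rw [abs_mul, abs_of_pos ha]
      have := mul_le_mul_of_nonneg_left hPuA ha.le
      linarith
    have q2 : |fv| ≤ b * (D / 10 + 2 * σ) + θ * (2 * D + 3 * σ) := by
      have := abs_sub_abs_le_abs_sub fv (b * Pv)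
      rw [abs_mul, abs_of_pos hb] at this
      have := mul_le_mul_of_nonneg_left hPv2 hb.le
      linarith
    have q3 : -(|fu - a * du| * D) ≤ (fu - a * du) * du := by
      have := neg_abs_le ((fu - a * du) * du)
      rw [abs_mul] at this
      have : |fu - a * du| * |du| ≤ |fu - a * du| * D := by gcongr
      linarith
    have q4 : -(|fv| * (3 * θ * D)) ≤ fv * dv := by
      have := neg_abs_le (fv * dv)
      rw [abs_mul] at this
      have : |fv| * |dv| ≤ |fv| * (3 * θ * D) := by gcongr
      linarith
    have q5 : dv ^ 2 ≤ D ^ 2 / 100 := by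
      have : dv ^ 2 ≤ (3 * θ * D) ^ 2 := by rw [← sq_abs dv]; gcongr
      have : (3 * θ * D) ^ 2 ≤ (D / 10) ^ 2 := by
        apply pow_le_pow_left₀ (by positivity); linarith
      have : (D / 10) ^ 2 = D ^ 2 / 100 := by ring
      linarith
    have q6 : a * (99 / 100 * D ^ 2) ≤ a * du ^ 2 := by
      apply mul_le_mul_of_nonneg_left _ ha.le; linarith
    -- error bounds
    have hθσD : θ * σ ≤ (θ * C) * D := by
      have := mul_le_mul_of_nonneg_left hσD hθ0.le
      linarith
    have r1 : a * (θ * σ) ≤ a * (D / 100) := by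
      apply mul_le_mul_of_nonneg_left _ ha.le
      have : (θ * C) * D ≤ 1 / 100 * D := by gcongr
      linarith
    have r2 : θ * (2 * D + 3 * σ) ≤ a / 25 * D := by
      have : θ * (1 + 2 * C) * 100 ≤ a := by
        have : 0 ≤ 100 * θ * b * (1 + 2 * C) := by positivity
        linarith
      have t1 : θ * (2 * D + 3 * σ) ≤ θ * (2 * D + 3 * (C * D)) := by gcongr
      have t2 : θ * (2 * D + 3 * (C * D)) ≤ 4 * (θ * (1 + 2 * C)) * D := by
        have : 0 ≤ θ * D * (2 + 5 * C) := by positivity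
        linarith
      have t3 : 4 * (θ * (1 + 2 * C)) * D ≤ 4 * (a / 100) * D := by gcongr; linarith
      linarith
    have r3 : (3 * θ) * (b * (D / 10 + 2 * σ)) ≤ a / 25 * D := by
      have : θ * b * (1 + 2 * C) * 100 ≤ a := by
        have : 0 ≤ 100 * θ * 1 * (1 + 2 * C) := by positivity
        linarith
      have t1 : (3 * θ) * (b * (D / 10 + 2 * σ)) ≤ (3 * θ) * (b * (D + 2 * (C * D))) := by
        gcongr; linarith
      have t3 : 3 * (θ * b * (1 + 2 * C)) * D ≤ 3 * (a / 100) * D := by gcongr; linarith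
      have : 0 ≤ a * D := by positivity
      linarith
    have r4 : (3 * θ) * |fv| ≤ a / 25 * D + a / 25 * D := by
      have t1 : (3 * θ) * |fv| ≤ (3 * θ) * (b * (D / 10 + 2 * σ) + θ * (2 * D + 3 * σ)) := by gcongr
      have t2 : (3 * θ) * (θ * (2 * D + 3 * σ)) ≤ 1 * (a / 25 * D) := by
        gcongr; linarith
      linarith
    have s1 : |fu - a * du| * D ≤ (a * (D / 100) + a / 25 * D) * D := by
      gcongr; linarith
    have s2 : |fv| * (3 * θ * D) ≤ (a / 25 * D + a / 25 * D) * D := by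
      have := mul_le_mul_of_nonneg_right r4 hD.le
      linarith
    have s3 : 0 < a * D ^ 2 := by positivity
    have s4 : fu * du = a * du ^ 2 + (fu - a * du) * du := by ring
    linarith
  · right
    push Not at hcase
    have hσp : 0 < σ := by
      by_contra hcon
      have : σ = 0 := le_antisymm (not_lt.1 hcon) hσ0
      rw [this, mul_zero] at hcase
      have : 0 < (4 * a + b) * D := by positivity
      linarith
    have hDσ : D ≤ σ := by
      have h3 : b * D ≤ b * σ := by
        have : 0 < a * D := by positivity
        linarith
      exact le_of_mul_le_mul_left h3 hb
    have haD : a * D ≤ b * σ / 4 := by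
      have : 0 < b * D := by positivity
      linarith
    have t0 : θ * (2 * D + 3 * σ) ≤ b * σ / 20 := by
      have : 100 * θ ≤ b := by
        have : 0 < 100 * θ * a := by positivity
        linarith
      have : θ * (2 * D + 3 * σ) ≤ (b / 100) * (5 * σ) := by gcongr <;> linarith
      linarith
    have t1 : |fu| ≤ b * σ * (2 / 5) := by
      have k1 := abs_sub_abs_le_abs_sub fu (-(a * Pu))
      rw [sub_neg_eq_add, abs_neg, abs_mul, abs_of_pos ha] at k1
      have k2 : a * |Pu| ≤ a * (D + θ * σ) := by
        apply mul_le_mul_of_nonneg_left _ ha.le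
        have := abs_sub_abs_le_abs_sub Pu (-du)
        rw [abs_neg, sub_neg_eq_add] at this
        linarith
      have k3 : a * (θ * σ) ≤ b * σ / 100 := by
        have k4 : 100 * θ * a ≤ b := by
          have : 0 < 100 * θ := by positivity
          linarith
        have := mul_le_mul_of_nonneg_right k4 hσ0
        linarith
      have : 0 < b * σ := by positivity
      linarith
    have t2 : |fv - b * (s0 * ν)| ≤ b * σ * (1 / 10) := by
      have : fv - b * (s0 * ν) = (fv - b * Pv) + b * (Pv - s0 * ν) := by ring
      rw [this]
      refine (abs_add_le _ _).trans ?_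
      rw [abs_mul, abs_of_pos hb]
      have k2 : b * |Pv - s0 * ν| ≤ b * (4 / 100 * σ) := by
        apply mul_le_mul_of_nonneg_left _ hb.le
        linarith
      have : 0 < b * σ := by positivity
      linarith
    have hbσ : 0 < b * σ := by positivity
    have ht2 := abs_le.1 t2
    have hfp_up : ‖f p‖ ≤ |fu| + |fv| := hfn
    rcases le_or_gt 0 s0 with hs | hs
    · have e : b * (s0 * ν) = b * σ := by rw [hσ, abs_of_nonneg hs]; ring
      rw [e] at ht2
      have hfvp : 0 < fv := by linarith [ht2.1]
      rw [abs_of_pos hfvp] at hfp_up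
      refine ⟨1 / 2, by norm_num, ?_, ?_, Or.inl ?_⟩
      · exact lt_of_lt_of_le (abs_pos.2 hfvp.ne') hfvn
      · linarith
      · have : ν * (1 / 2 * ‖f p‖) ≤ ν * fv := by
          apply mul_le_mul_of_nonneg_left _ hν.le
          linarith [ht2.1]
        linarith
    · have e : b * (s0 * ν) = - (b * σ) := by rw [hσ, abs_of_neg hs]; ring
      rw [e] at ht2
      have hfvp : fv < 0 := by linarith [ht2.2]
      rw [abs_of_neg hfvp] at hfp_up
      refine ⟨1 / 2, by norm_num, ?_, ?_, Or.inr ⟨hls0, ?_⟩⟩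
      · exact lt_of_lt_of_le (abs_pos.2 hfvp.ne) hfvn
      · linarith
      · have : ν * fv ≤ ν * (-(1 / 2 * ‖f p‖)) := by
          apply mul_le_mul_of_nonneg_left _ hν.le
          linarith [ht2.2]
        linarith

end causeway3


section causeway4

/-- the causeway function -/
def cwF (c : ℝ → Euc 2) (κ0 η τ : ℝ) (p : Euc 2) (s : ℝ) : ℝ := κ0 + η * s - η / (2 * τ) * ‖c s - p‖ ^ 2

def cwK (c : ℝ → Euc 2) (l r κ0 η τ : ℝ) (p : Euc 2) : ℝ := sSup (cwF c κ0 η τ p '' Icc l r)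

theorem cwF_cont {c : ℝ → Euc 2} (hc : Continuous c) (κ0 η τ : ℝ) :
    Continuous (fun z : Euc 2 × ℝ => cwF c κ0 η τ z.1 z.2) := by
  unfold cwF; fun_prop

theorem cwK_cont {c : ℝ → Euc 2} (hc : Continuous c) (l r κ0 η τ : ℝ) :
    Continuous (cwK c l r κ0 η τ) := by
  unfold cwK
  exact isCompact_Icc.continuous_sSup (cwF_cont hc κ0 η τ)

theorem cwK_ge {c : ℝ → Euc 2} (hc : Continuous c) {l r : ℝ} (κ0 η τ : ℝ) (p : Euc 2) {s : ℝ}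
    (hs : s ∈ Icc l r) : cwF c κ0 η τ p s ≤ cwK c l r κ0 η τ p := by
  have h : Continuous (cwF c κ0 η τ p) := (cwF_cont hc κ0 η τ).comp (Continuous.prodMk_right p)
  exact le_csSup (isCompact_Icc.image h).bddAbove ⟨s, hs, rfl⟩

theorem act_iff {c : ℝ → Euc 2} {l r κ0 η τ : ℝ} (hη : 0 < η) (hτ : 0 < τ) (p : Euc 2) {s t : ℝ} :
    2 * τ * (t - s) ≤ ‖c t - p‖ ^ 2 - ‖c s - p‖ ^ 2 ↔ cwF c κ0 η τ p t ≤ cwF c κ0 η τ p s := by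
  unfold cwF
  have e : (κ0 + η * s - η / (2 * τ) * ‖c s - p‖ ^ 2) - (κ0 + η * t - η / (2 * τ) * ‖c t - p‖ ^ 2)
    = η / (2 * τ) * ((‖c t - p‖ ^ 2 - ‖c s - p‖ ^ 2) - 2 * τ * (t - s)) := by field_simp; ring
  have h : 0 < η / (2 * τ) := by positivity
  constructor
  · intro h'
    have := mul_nonneg h.le (sub_nonneg.2 h')
    linarith
  · intro h'
    have h2 := sub_nonneg.2 h'
    rw [e] at h2
    exact sub_nonneg.1 (nonneg_of_mul_nonneg_right h2 h)

theorem cwK_act {c : ℝ → Euc 2} (hc : Continuous c) {l r κ0 η τ : ℝ} (hη : 0 < η) (hτ : 0 < τ) (p : Euc 2)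
    {s : ℝ} (hs : Act c l r τ p s) : cwK c l r κ0 η τ p = cwF c κ0 η τ p s := by
  refine le_antisymm ?_ (cwK_ge hc κ0 η τ p hs.1)
  refine csSup_le (⟨_, mem_image_of_mem _ hs.1⟩) ?_
  rintro _ ⟨t, ht, rfl⟩
  exact (act_iff (l := l) (r := r) hη hτ p).1 (hs.2 t ht)

/-- growth of the causeway function -/
theorem cwK_growth {c : ℝ → Euc 2} (hc : Continuous c) {l r κ0 η τ : ℝ} (hlr : l ≤ r) (hη : 0 < η) (hτ : 0 < τ)
    (p V : Euc 2) (hV : ∀ s, Act c l r τ p s → 0 < ⟪V, c s - p⟫) :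
    ∃ e > 0, ∃ ρ > 0, ∀ q ∈ ball p ρ, ∀ t ∈ Icc (0:ℝ) ρ,
      cwK c l r κ0 η τ q + e * t ≤ cwK c l r κ0 η τ (q + t • V) := by
  obtain ⟨s1, hs1, hmin⟩ := (act_closed hc l r τ p).exists_isMinOn (act_exists hc hlr τ p)
    (f := fun s => ⟪V, c s - p⟫) (by fun_prop)
  set β := ⟪V, c s1 - p⟫ / 2 with hβ
  have hβp : 0 < β := by rw [hβ]; linarith [hV s1 hs1]
  have hβs : ∀ s, Act c l r τ p s → β < ⟪V, c s - p⟫ := by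
    intro s hs
    have : ⟪V, c s1 - p⟫ ≤ ⟪V, c s - p⟫ := hmin hs
    linarith [hV s1 hs1]
  have husc : ∀ᶠ q in 𝓝 p, ∀ s ∈ Icc l r, Act c l r τ q s → β < ⟪V, c s - q⟫ := by
    refine isCompact_Icc.eventually_forall_of_forall_eventually fun s hs => ?_
    by_cases h : β < ⟪V, c s - p⟫
    · have : ContinuousAt (fun z : Euc 2 × ℝ => ⟪V, c z.2 - z.1⟫) (p, s) := by fun_prop
      filter_upwards [this.eventually (lt_mem_nhds h)] with z hz _ using hz
    · have hna : ¬ Act c l r τ p s := fun h' => h (hβs s h')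
      simp only [Act, hs, true_and, not_forall, not_le] at hna
      obtain ⟨t, ht, hlt⟩ := hna
      have := ContinuousAt.eventually_lt
        (f := fun z : Euc 2 × ℝ => ‖c t - z.1‖ ^ 2 - ‖c z.2 - z.1‖ ^ 2)
        (g := fun z : Euc 2 × ℝ => 2 * τ * (t - z.2)) (x₀ := (p, s)) (by fun_prop) (by fun_prop) hlt
      filter_upwards [this] with z hz hact
      exact absurd (hact.2 t ht) (not_le.2 hz)
  obtain ⟨ρ, hρ, hb⟩ := Metric.eventually_nhds_iff_ball.1 husc
  set K := η / (2 * τ) with hK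
  have hKp : 0 < K := by positivity
  refine ⟨K * β, by positivity, min ρ (β / (‖V‖ ^ 2 + 1)), lt_min hρ (by positivity), fun q hq t ht => ?_⟩
  obtain ⟨s, hs⟩ := act_exists hc hlr τ q
  have hβq := hb q (ball_subset_ball (min_le_left _ _) hq) s hs.1 hs
  rw [cwK_act hc hη hτ q hs]
  refine le_trans ?_ (cwK_ge hc κ0 η τ (q + t • V) hs.1)
  unfold cwF
  rw [← hK]
  have e1 : c s - (q + t • V) = (c s - q) - t • V := by abel
  rw [e1, norm_sub_sq_real (c s - q) (t • V), inner_smul_right, norm_smul, Real.norm_of_nonneg ht.1, real_inner_comm V (c s - q)]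
  have ht2 : t * (‖V‖ ^ 2 + 1) ≤ β := by
    have := ht.2.trans (min_le_right _ _)
    rwa [le_div_iff₀ (by positivity)] at this
  have h1 : t * (t * ‖V‖ ^ 2) ≤ t * β := by
    apply mul_le_mul_of_nonneg_left _ ht.1
    have := ht.1
    linarith
  have h2 : t * β ≤ t * ⟪V, c s - q⟫ := mul_le_mul_of_nonneg_left hβq.le ht.1
  have h3 : 0 ≤ K * (2 * (t * ⟪V, c s - q⟫) - t * (t * ‖V‖ ^ 2) - t * β) := by
    apply mul_nonneg hKp.le; linarith
  linarith

theorem phi_growth {φ : Euc 2 → ℝ} {f : Euc 2 → Euc 2} (hφ : ∀ p, HasGradientAt φ (f p) p)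
    (hf : Continuous f) (p V : Euc 2) (hV : 0 < ⟪V, f p⟫) :
    ∃ e > 0, ∃ ρ > 0, ∀ q ∈ ball p ρ, ∀ t ∈ Icc (0:ℝ) ρ, φ q + e * t ≤ φ (q + t • V) := by
  set e := ⟪V, f p⟫ / 2 with he
  obtain ⟨ρ, hρ, hb⟩ := Metric.eventually_nhds_iff_ball.1
    ((show ContinuousAt (fun q => ⟪V, f q⟫) p by fun_prop).eventually
      (lt_mem_nhds (show e < ⟪V, f p⟫ by linarith)))
  refine ⟨e, by linarith, ρ / (‖V‖ + 2), by positivity, fun q hq t ht => ?_⟩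
  have hd : ∀ s : ℝ, HasDerivAt (fun s : ℝ => φ (q + s • V)) ⟪f (q + s • V), V⟫ s := by
    intro s
    have h1 : HasDerivAt (fun s : ℝ => q + s • V) V s := by
      simpa using ((hasDerivAt_id s).smul_const V).const_add q
    have h2 := (hφ (q + s • V)).hasFDerivAt.comp_hasDerivAt s h1
    simp only [InnerProductSpace.toDual_apply_apply] at h2
    exact h2
  have hin : ∀ s ∈ Icc (0:ℝ) t, e ≤ ⟪f (q + s • V), V⟫ := by
    intro s hs
    rw [real_inner_comm]
    refine (hb _ ?_).le
    rw [mem_ball, dist_eq_norm] at hq ⊢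
    have : q + s • V - p = (q - p) + s • V := by abel
    rw [this]
    refine lt_of_le_of_lt (norm_add_le _ _) ?_
    rw [norm_smul, Real.norm_of_nonneg hs.1]
    have h1 : s * ‖V‖ ≤ ρ / (‖V‖ + 2) * ‖V‖ := by gcongr; exact hs.2.trans ht.2
    have h2 : ρ / (‖V‖ + 2) + ρ / (‖V‖ + 2) * ‖V‖ < ρ := by
      have : ρ / (‖V‖ + 2) + ρ / (‖V‖ + 2) * ‖V‖ = ρ * ((1 + ‖V‖) / (‖V‖ + 2)) := by ring
      rw [this]
      have : (1 + ‖V‖) / (‖V‖ + 2) < 1 := by rw [div_lt_one (by positivity)]; linarith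
      nlinarith
    linarith
  have := (convex_Icc (0:ℝ) t).mul_sub_le_image_sub_of_le_deriv (f := fun s : ℝ => φ (q + s • V))
    (fun s _ => (hd s).continuousAt.continuousWithinAt) (fun s _ => (hd s).differentiableAt.differentiableWithinAt)
    (C := e) (fun s hs => by rw [(hd s).deriv]; exact hin s (interior_subset hs))
    0 ⟨le_rfl, ht.1⟩ t ⟨ht.1, le_rfl⟩ ht.1
  simp only [zero_smul, add_zero, sub_zero] at this
  linarith

theorem win_uniform {φ : Euc 2 → ℝ} {f : Euc 2 → Euc 2} {c : ℝ → Euc 2} (hc : Continuous c)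
    {l r : ℝ} (hinj : InjOn c (Icc l r)) {κ0 η : ℝ}
    (hwin : ∀ s ∈ Icc l r, Win φ f c l r κ0 η s) :
    ∃ δ > 0, ∀ s' ∈ Icc l r, ∀ τ, 0 < τ → τ < δ → ∀ p ∈ ball (c s') δ,
      (∀ s, Act c l r τ p s → dist (c s) p < δ) →
      (∀ s, Act c l r τ p s → φ p ≤ cwF c κ0 η τ p s) →
      ∃ V : Euc 2, (∀ s, Act c l r τ p s → 0 < ⟪V, c s - p⟫) ∧
        ((∃ s, Act c l r τ p s ∧ φ p = cwF c κ0 η τ p s) → 0 < ⟪V, f p⟫) := by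
  refine isCompact_Icc.induction_on (p := fun S => ∃ δ > 0, ∀ s' ∈ S, ∀ τ, 0 < τ → τ < δ → ∀ p ∈ ball (c s') δ,
      (∀ s, Act c l r τ p s → dist (c s) p < δ) →
      (∀ s, Act c l r τ p s → φ p ≤ cwF c κ0 η τ p s) →
      ∃ V : Euc 2, (∀ s, Act c l r τ p s → 0 < ⟪V, c s - p⟫) ∧
        ((∃ s, Act c l r τ p s ∧ φ p = cwF c κ0 η τ p s) → 0 < ⟪V, f p⟫)) ?_ ?_ ?_ ?_
  · exact ⟨1, one_pos, fun s' hs' => absurd hs' (notMem_empty _)⟩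
  · rintro S T hST ⟨δ, hδ, h⟩
    exact ⟨δ, hδ, fun s' hs' => h s' (hST hs')⟩
  · rintro S T ⟨δ, hδ, h⟩ ⟨δ', hδ', h'⟩
    refine ⟨min δ δ', lt_min hδ hδ', fun s' hs' τ hτ hτ2 p hp ha => ?_⟩
    rcases hs' with hs' | hs'
    · exact h s' hs' τ hτ (hτ2.trans_le (min_le_left _ _)) p (ball_subset_ball (min_le_left _ _) hp)
        (fun s hs => (ha s hs).trans_le (min_le_left _ _))
    · exact h' s' hs' τ hτ (hτ2.trans_le (min_le_right _ _)) p (ball_subset_ball (min_le_right _ _) hp)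
        (fun s hs => (ha s hs).trans_le (min_le_right _ _))
  · intro s' hs'
    obtain ⟨ρ, hρ, τ0, hτ0, hW⟩ := hwin s' hs'
    have hcl : IsCompact (c '' (Icc l r ∩ {s | ρ ≤ |s - s'|})) :=
      (isCompact_Icc.inter_right (isClosed_le continuous_const (by fun_prop))).image hc
    have hn : c s' ∉ c '' (Icc l r ∩ {s | ρ ≤ |s - s'|}) := by
      rintro ⟨s, ⟨hs, hs2⟩, he⟩
      have := hinj hs hs' he
      rw [this] at hs2
      simp at hs2
      linarith
    obtain ⟨ε, hε, hb⟩ := Metric.mem_nhds_iff.1 (hcl.isClosed.isOpen_compl.mem_nhds hn)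
    set m := min (min ε ρ) τ0 with hm
    have hm0 : 0 < m := lt_min (lt_min hε hρ) hτ0
    have hmε : m ≤ ε := (min_le_left _ _).trans (min_le_left _ _)
    have hmρ : m ≤ ρ := (min_le_left _ _).trans (min_le_right _ _)
    have hmτ : m ≤ τ0 := min_le_right _ _
    refine ⟨c ⁻¹' ball (c s') (m / 3), mem_nhdsWithin_of_mem_nhds
      (hc.continuousAt.preimage_mem_nhds (ball_mem_nhds _ (by positivity))), m / 3, by positivity,
      fun s'' hs'' τ hτ hτ2 p hp ha hval => ?_⟩
    have hd1 : dist (c s'') (c s') < m / 3 := hs''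
    have hd2 : dist p (c s'') < m / 3 := hp
    have hd3 : dist p (c s') < 2 * m / 3 := by linarith [dist_triangle p (c s'') (c s')]
    refine hW τ hτ (by linarith) p (mem_ball.2 (by linarith)) (fun s hs => ?_) hval
    by_contra hcon
    refine hb (mem_ball.2 ?_) ⟨s, ⟨hs.1, not_lt.1 hcon⟩, rfl⟩
    linarith [dist_triangle (c s) p (c s'), ha s hs]

theorem causeway (φ : Euc 2 → ℝ) (f : Euc 2 → Euc 2) (hφ : ContDiff ℝ 2 φ)
    (hg : ∀ p, HasGradientAt φ (f p) p) (hf : Continuous f) (c : ℝ → Euc 2) (hc : Continuous c)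
    (l r : ℝ) (hlr : l < r) (hinj : InjOn c (Icc l r)) (κ0 η : ℝ) (hη : 0 < η)
    (hwin : ∀ s ∈ Icc l r, Win φ f c l r κ0 η s) (U0 : Set (Euc 2)) (hU0 : IsOpen U0)
    (hU : c '' Icc l r ⊆ U0)
    (hzero : ∀ p ∈ U0, f p = 0 → ∃ s ∈ Icc l r, p = c s ∧ φ p < κ0 + η * s) :
    ∃ φ'' N2, ContDiff ℝ 2 φ'' ∧ IsCompact N2 ∧ N2 ⊆ U0 ∧ (∀ p ∉ N2, φ'' p = φ p) ∧
      ∀ p ∈ U0, fderiv ℝ φ'' p ≠ 0 := by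
  have hφc : Continuous φ := hφ.continuous
  have hfd : ∀ p, f p ≠ 0 → fderiv ℝ φ p ≠ 0 := by
    intro p hp h0
    rw [(hg p).hasFDerivAt.fderiv] at h0
    exact hp (by simpa using h0)
  set A := c '' Icc l r with hA
  have hAc : IsCompact A := isCompact_Icc.image hc
  have hAne : A.Nonempty := (nonempty_Icc.2 hlr.le).image c
  obtain ⟨δ, hδ, hW⟩ := win_uniform hc hinj hwin
  obtain ⟨ρ1, hρ1, hρU⟩ := hAc.exists_cthickening_subset_open hU0 hU
  set ρ := min ρ1 (δ / 4) with hρdef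
  have hρ : 0 < ρ := lt_min hρ1 (by positivity)
  have hρU' : cthickening ρ A ⊆ U0 := (cthickening_mono (min_le_left _ _) A).trans hρU
  have hρδ : ρ ≤ δ / 4 := min_le_right _ _
  have hCc : IsCompact (cthickening ρ A) := hAc.cthickening
  obtain ⟨m, hm⟩ := (hCc.image hφc).bddBelow
  have hm' : ∀ p ∈ cthickening ρ A, m ≤ φ p := fun p hp => hm ⟨p, hp, rfl⟩
  -- choice of the parameter
  obtain ⟨τ, hτ, hτδ, hτ1, hτ2⟩ : ∃ τ > 0, τ < δ ∧ 2 * τ * (r - l) ≤ 3 * ρ ^ 2 ∧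
      κ0 + η * r - m < η / (2 * τ) * (ρ / 2) ^ 2 := by
    have hrl : 0 < r - l := sub_pos.2 hlr
    set M := |κ0 + η * r - m| + 1 with hM
    have hMp : 0 < M := by positivity
    refine ⟨min (δ / 2) (min (ρ ^ 2 / (r - l)) (η * ρ ^ 2 / (16 * M))), by positivity, ?_, ?_, ?_⟩
    · exact lt_of_le_of_lt (min_le_left _ _) (by linarith)
    · have : min (δ / 2) (min (ρ ^ 2 / (r - l)) (η * ρ ^ 2 / (16 * M))) ≤ ρ ^ 2 / (r - l) :=
        (min_le_right _ _).trans (min_le_left _ _)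
      rw [le_div_iff₀ hrl] at this
      have h2 : 0 ≤ ρ ^ 2 := by positivity
      linarith
    · set τ := min (δ / 2) (min (ρ ^ 2 / (r - l)) (η * ρ ^ 2 / (16 * M))) with hτ
      have hτp : 0 < τ := by positivity
      have : τ ≤ η * ρ ^ 2 / (16 * M) := (min_le_right _ _).trans (min_le_right _ _)
      rw [le_div_iff₀ (by positivity)] at this
      have h1 : M ≤ η / (2 * τ) * (ρ / 2) ^ 2 := by
        rw [div_mul_eq_mul_div, le_div_iff₀ (by positivity)]
        have : 0 ≤ M * τ := by positivity
        nlinarith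
      have := le_abs_self (κ0 + η * r - m)
      linarith
  set k := cwK c l r κ0 η τ with hk
  have hkc : Continuous k := cwK_cont hc l r κ0 η τ
  -- low away from the arc
  have hfar : ∀ p ∈ cthickening ρ A, (∀ s ∈ Icc l r, ρ / 2 ≤ dist p (c s)) → k p < φ p := by
    intro p hp hd
    obtain ⟨s, hs⟩ := act_exists hc hlr.le τ p
    rw [hk, cwK_act hc hη hτ p hs]
    unfold cwF
    have h1 := hd s hs.1
    rw [dist_comm, dist_eq_norm] at h1
    have h2 : (ρ / 2) ^ 2 ≤ ‖c s - p‖ ^ 2 := by gcongr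
    have h3 : η / (2 * τ) * (ρ / 2) ^ 2 ≤ η / (2 * τ) * ‖c s - p‖ ^ 2 := by gcongr
    have h4 : η * s ≤ η * r := by have := hs.1.2; gcongr
    linarith [hm' p hp]
  have hnear : ∀ p ∈ cthickening ρ A, φ p ≤ k p → ∃ s ∈ Icc l r, dist p (c s) < ρ / 2 := by
    intro p hp h
    by_contra hcon
    push Not at hcon
    exact absurd (hfar p hp hcon) (not_lt.2 h)
  set U := thickening ρ A with hUd
  have hUo : IsOpen U := isOpen_thickening
  have hUC : U ⊆ cthickening ρ A := thickening_subset_cthickening ρ A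
  set N := cthickening ρ A ∩ {p | φ p ≤ k p} with hN
  have hNc : IsCompact N := hCc.inter_right (isClosed_le hφc hkc)
  have hNU : N ⊆ U := by
    rintro p ⟨hp, hp2⟩
    obtain ⟨s, hs, hd⟩ := hnear p hp hp2
    exact mem_thickening_iff.2 ⟨c s, ⟨s, hs, rfl⟩, by linarith⟩
  classical
  set φ' : Euc 2 → ℝ := fun p => if p ∈ cthickening ρ A then max (φ p) (k p) else φ p with hφ'
  have hφU : ∀ p ∈ U, φ' p = max (φ p) (k p) := fun p hp => if_pos (hUC hp)
  have hφN : ∀ p ∉ N, φ' p = φ p := by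
    intro p hp
    by_cases h : p ∈ cthickening ρ A
    · have : ¬ φ p ≤ k p := fun h' => hp ⟨h, h'⟩
      simp only [hφ', if_pos h]
      exact max_eq_left (not_le.1 this).le
    · simp only [hφ', if_neg h]
  have hφ'c : Continuous φ' := by
    rw [continuous_iff_continuousAt]
    intro p
    by_cases hp : p ∈ N
    · have h1 : φ' =ᶠ[𝓝 p] fun p => max (φ p) (k p) := by
        filter_upwards [hUo.mem_nhds (hNU hp)] with q hq using hφU q hq
      exact ((hφc.max hkc).continuousAt).congr h1.symm
    · have h1 : φ' =ᶠ[𝓝 p] φ := by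
        filter_upwards [hNc.isClosed.isOpen_compl.mem_nhds hp] with q hq using hφN q hq
      exact hφc.continuousAt.congr h1.symm
  -- zeros of f lie in N
  have hzN : ∀ p ∈ U0, f p = 0 → p ∈ N := by
    intro p hp h0
    obtain ⟨s, hs, rfl, hlt⟩ := hzero p hp h0
    refine ⟨self_subset_cthickening A ⟨s, hs, rfl⟩, ?_⟩
    have := cwK_ge hc κ0 η τ (c s) hs
    simp only [cwF, sub_self, norm_zero] at this
    simp only [mem_setOf_eq, hk]
    norm_num at this
    linarith
  have hdir : ∀ p ∈ N, ∃ V : Euc 2, ∃ e > 0, ∃ r > 0, ∀ q ∈ ball p r, ∀ t ∈ Icc (0:ℝ) r,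
      φ' q + e * t ≤ φ' (q + t • V) := by
    rintro p ⟨hpC, hpk⟩
    have hpU : p ∈ U := hNU ⟨hpC, hpk⟩
    obtain ⟨s0, hs0, hd0⟩ := hnear p hpC hpk
    rw [dist_comm, dist_eq_norm] at hd0
    obtain ⟨V, hV1, hV2⟩ := hW s0 hs0 τ hτ hτδ p (by
        rw [mem_ball, dist_comm, dist_eq_norm]; linarith) (by
        intro s hs
        rw [dist_eq_norm]
        have h1 := hs.2 s0 hs0
        have h2 : 2 * τ * (s - s0) ≤ 2 * τ * (r - l) := by
          have := hs.1.2; have := hs0.1; gcongr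
        have h3 : ‖c s0 - p‖ ^ 2 ≤ (ρ / 2) ^ 2 := by gcongr
        have h4 : ‖c s - p‖ ^ 2 ≤ (2 * ρ) ^ 2 := by nlinarith
        have := le_of_sq_le_sq h4 (by positivity)
        linarith) (by
        intro s hs
        rw [← cwK_act hc hη hτ p hs]; exact hpk)
    obtain ⟨e1, he1, r1, hr1, hgr1⟩ := cwK_growth (κ0 := κ0) hc hlr.le hη hτ p V hV1
    -- stay inside U
    obtain ⟨r0, hr0, hbU⟩ := Metric.isOpen_iff.1 hUo p hpU
    have hst : ∀ r' > 0, ∃ r2 > 0, r2 ≤ r' ∧ ∀ q ∈ ball p r2, ∀ t ∈ Icc (0:ℝ) r2, q ∈ ball p r' ∧ q + t • V ∈ ball p r' := by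
      intro r' hr'
      refine ⟨r' / (‖V‖ + 2), by positivity, div_le_self hr'.le (by linarith [norm_nonneg V]), fun q hq t ht => ?_⟩
      rw [mem_ball, dist_eq_norm] at hq
      have h0 : r' / (‖V‖ + 2) * (‖V‖ + 2) = r' := div_mul_cancel₀ _ (by positivity)
      have h00 : 0 < r' / (‖V‖ + 2) := by positivity
      have h1 : t * ‖V‖ ≤ r' / (‖V‖ + 2) * ‖V‖ := by have := ht.2; gcongr
      have h2 : 0 ≤ r' / (‖V‖ + 2) * ‖V‖ := by positivity
      refine ⟨by rw [mem_ball, dist_eq_norm]; linarith, ?_⟩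
      rw [mem_ball, dist_eq_norm, show q + t • V - p = (q - p) + t • V by abel]
      refine lt_of_le_of_lt (norm_add_le _ _) ?_
      rw [norm_smul, Real.norm_of_nonneg ht.1]
      linarith
    rcases eq_or_lt_of_le (show φ p ≤ k p from hpk) with heq | hlt
    · obtain ⟨s1, hs1⟩ := act_exists hc hlr.le τ p
      obtain ⟨e2, he2, r2, hr2, hgr2⟩ := phi_growth hg hf p V
        (hV2 ⟨s1, hs1, by rw [← cwK_act hc hη hτ p hs1]; exact heq⟩)
      obtain ⟨r3, hr3, hr3le, hb3⟩ := hst (min r0 (min r1 r2)) (lt_min hr0 (lt_min hr1 hr2))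
      refine ⟨V, min e1 e2, lt_min he1 he2, r3, hr3, fun q hq t ht => ?_⟩
      obtain ⟨hq1, hq2⟩ := hb3 q hq t ht
      rw [hφU q (hbU (ball_subset_ball (min_le_left _ _) hq1)),
        hφU _ (hbU (ball_subset_ball (min_le_left _ _) hq2))]
      have hq1' := ball_subset_ball (min_le_right _ _) hq1
      have ht3 : t ≤ min r1 r2 := ht.2.trans (hr3le.trans (min_le_right _ _))
      have g1 := hgr1 q (ball_subset_ball (min_le_left _ _) hq1') t ⟨ht.1, ht3.trans (min_le_left _ _)⟩
      have g2 := hgr2 q (ball_subset_ball (min_le_right _ _) hq1') t ⟨ht.1, ht3.trans (min_le_right _ _)⟩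
      have m1 : min e1 e2 * t ≤ e1 * t := mul_le_mul_of_nonneg_right (min_le_left _ _) ht.1
      have m2 : min e1 e2 * t ≤ e2 * t := mul_le_mul_of_nonneg_right (min_le_right _ _) ht.1
      rw [max_add]
      exact max_le ((by linarith : φ q + min e1 e2 * t ≤ φ (q + t • V)).trans (le_max_left _ _))
        ((by linarith : k q + min e1 e2 * t ≤ k (q + t • V)).trans (le_max_right _ _))
    · obtain ⟨r2, hr2, hb2⟩ := Metric.isOpen_iff.1 (isOpen_lt hφc hkc) p hlt
      obtain ⟨r3, hr3, hr3le, hb3⟩ := hst (min r0 (min r1 r2)) (lt_min hr0 (lt_min hr1 hr2))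
      refine ⟨V, e1, he1, r3, hr3, fun q hq t ht => ?_⟩
      obtain ⟨hq1, hq2⟩ := hb3 q hq t ht
      rw [hφU q (hbU (ball_subset_ball (min_le_left _ _) hq1)),
        hφU _ (hbU (ball_subset_ball (min_le_left _ _) hq2))]
      have hq1' := ball_subset_ball (min_le_right _ _) hq1
      have hq2' := ball_subset_ball (min_le_right _ _) hq2
      have ht3 : t ≤ min r1 r2 := ht.2.trans (hr3le.trans (min_le_right _ _))
      have g1 := hgr1 q (ball_subset_ball (min_le_left _ _) hq1') t ⟨ht.1, ht3.trans (min_le_left _ _)⟩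
      have g2 : φ q < k q := hb2 (ball_subset_ball (min_le_right _ _) hq1')
      rw [max_eq_right g2.le]
      exact g1.trans (le_max_right _ _)
  obtain ⟨φ'', N2, h1, h2, h3, h4, h5⟩ := mollify_lemma φ φ' hφ hφ'c N U hNc hUo hNU hφN
    (fun p hp hpN => hfd p (fun h0 => hpN (hzN p (hρU' (hUC hp)) h0))) hdir
  refine ⟨φ'', N2, h1, h2, h3.trans (hUC.trans hρU'), h4, fun p hp => ?_⟩
  by_cases hpU : p ∈ U
  · exact h5 p hpU
  · have hpN2 : p ∉ N2 := fun h => hpU (h3 h)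
    have he : φ'' =ᶠ[𝓝 p] φ := by
      filter_upwards [h2.isClosed.isOpen_compl.mem_nhds hpN2] with q hq using h4 q hq
    rw [he.fderiv_eq]
    exact hfd p (fun h0 => hpU (hNU (hzN p hp h0)))

end causeway4


/-! ## Part 8 : basic facts about the gradient map -/

/-- Basic facts about a proper generic gradient map. -/
structure Base (φ : Euc 2 → ℝ) (f : Euc 2 → Euc 2) : Prop where
  c2 : ContDiff ℝ 2 φ
  grad : ∀ p, HasGradientAt φ (f p) p
  c1 : ContDiff ℝ 1 f
  symm : ∀ p v w, ⟪fderiv ℝ f p v, w⟫ = ⟪v, fderiv ℝ f p w⟫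
  nondeg : ∀ p, f p = 0 → Function.Injective (fderiv ℝ f p)
  fin : {p | f p = 0}.Finite
  big : ∃ R0 : ℝ, ∀ p, R0 ≤ ‖p‖ → 1 ≤ ‖f p‖

theorem grad_c1 {φ : Euc 2 → ℝ} {f : Euc 2 → Euc 2} (hφ : ContDiff ℝ 2 φ) (hg : ∀ x, gradient φ x = f x) :
    (∀ p, HasGradientAt φ (f p) p) ∧ ContDiff ℝ 1 f ∧ (∀ p v w, ⟪fderiv ℝ f p v, w⟫ = ⟪v, fderiv ℝ f p w⟫) := by
  have hd : Differentiable ℝ φ := hφ.differentiable (by norm_num)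
  have h1 : ∀ p, HasGradientAt φ (f p) p := fun p => by
    rw [← hg p]; exact (hd p).hasGradientAt
  have h2 : ContDiff ℝ 1 (fderiv ℝ φ) := hφ.fderiv_right (by norm_num)
  have he : f = fun p => (InnerProductSpace.toDual ℝ (Euc 2)).symm (fderiv ℝ φ p) := by
    funext p; rw [← hg p]; rfl
  have h3 : ContDiff ℝ 1 f := by
    rw [he]
    exact (InnerProductSpace.toDual ℝ (Euc 2)).symm.contDiff.comp h2
  refine ⟨h1, h3, fun p v w => ?_⟩
  have hs : IsSymmSndFDerivAt ℝ φ p := (hφ.contDiffAt).isSymmSndFDerivAt (by simp)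
  have key : ∀ v w, ⟪fderiv ℝ f p v, w⟫ = fderiv ℝ (fderiv ℝ φ) p v w := by
    intro v w
    have hf : HasFDerivAt f (fderiv ℝ f p) p := (h3.differentiable (by norm_num) p).hasFDerivAt
    have e1 : HasFDerivAt (fun q => ⟪f q, w⟫) ((fderivInnerCLM ℝ (f p, w)).comp ((fderiv ℝ f p).prod (0 : Euc 2 →L[ℝ] Euc 2))) p :=
      hf.inner ℝ (hasFDerivAt_const w p)
    have e2 : HasFDerivAt (fun q => fderiv ℝ φ q w) ((fderiv ℝ (fderiv ℝ φ) p).flip w) p := by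
      have := ((h2.differentiable (by norm_num) p).hasFDerivAt).clm_apply (hasFDerivAt_const w p)
      simpa using this
    have e3 : (fun q => ⟪f q, w⟫) = fun q => fderiv ℝ φ q w := by
      funext q
      rw [(h1 q).hasFDerivAt.fderiv]
      simp
    rw [e3] at e1
    have e4 := congrArg (fun L => L v) (e1.unique e2)
    simpa [fderivInnerCLM_apply] using e4
  rw [key, hs.eq, ← key, real_inner_comm]

theorem base_of {φ : Euc 2 → ℝ} {f : Euc 2 → Euc 2} (hgen : IsGenericGradientPair φ f) (hprop : IsProper f) :
    Base φ f := by
  obtain ⟨hφ, hg, hnd, -, -⟩ := hgen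
  obtain ⟨h1, h3, hs⟩ := grad_c1 hφ hg
  have hfd : ∀ p, HasFDerivAt f (fderiv ℝ f p) p := fun p => (h3.differentiable (by norm_num) p).hasFDerivAt
  refine ⟨hφ, h1, h3, hs, fun p hp => (hnd p hp).1, ?_, ?_⟩
  · have hc : IsCompact {p | f p = 0} := hprop {0} isCompact_singleton
    have hiso : ∀ p, f p = 0 → ∀ᶠ q in 𝓝 p, f q = 0 → q = p := by
      intro p hp
      have hinj := (hnd p hp).1
      obtain ⟨C, -, hC⟩ := (fderiv ℝ f p : Euc 2 →ₗ[ℝ] Euc 2).exists_antilipschitzWith (LinearMap.ker_eq_bot.2 hinj)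
      have := (hfd p).eventually_ne (c := 0) ⟨C, hC⟩
      rw [eventually_nhdsWithin_iff] at this
      filter_upwards [this] with q hq h0
      by_contra hne
      exact hq hne h0
    obtain ⟨t, ht, hcov⟩ := hc.elim_nhds_subcover (fun p => {q | f q = 0 → q = p}) (fun p hp => hiso p hp)
    refine t.finite_toSet.subset fun q hq => ?_
    obtain ⟨p, hp, hqp⟩ := mem_iUnion₂.1 (hcov hq)
    rw [show q = p from hqp hq]
    exact hp
  · have hb := (hprop (closedBall 0 1) (isCompact_closedBall _ _)).isBounded
    obtain ⟨R, hR⟩ := hb.subset_closedBall 0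
    refine ⟨R + 1, fun p hp => ?_⟩
    by_contra hlt
    push Not at hlt
    have := hR (show p ∈ f ⁻¹' closedBall 0 1 by simpa using hlt.le)
    rw [mem_closedBall_zero_iff] at this
    linarith

namespace Base
variable {φ : Euc 2 → ℝ} {f : Euc 2 → Euc 2}

theorem cont (B : Base φ f) : Continuous f := B.c1.continuous
theorem contφ (B : Base φ f) : Continuous φ := B.c2.continuous
theorem hfd (B : Base φ f) (p) : HasFDerivAt f (fderiv ℝ f p) p := (B.c1.differentiable (by norm_num) p).hasFDerivAt

/-- derivative of the potential along a curve -/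
theorem deriv_along (B : Base φ f) {γ : ℝ → Euc 2} {w : Euc 2} {t : ℝ} (h : HasDerivAt γ w t) :
    HasDerivAt (fun s => φ (γ s)) ⟪f (γ t), w⟫ t := by
  have h2 := (B.grad (γ t)).hasFDerivAt.comp_hasDerivAt t h
  simp only [InnerProductSpace.toDual_apply_apply] at h2
  exact h2

theorem coercive {A : Euc 2 →L[ℝ] Euc 2} (h : ∀ v : Euc 2, v ≠ 0 → 0 < ⟪A v, v⟫) :
    ∃ μ > 0, ∀ v, μ * ‖v‖ ^ 2 ≤ ⟪A v, v⟫ := by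
  obtain ⟨v0, hv0, hmin⟩ := (isCompact_sphere (0 : Euc 2) 1).exists_isMinOn
    (NormedSpace.sphere_nonempty.2 zero_le_one) (f := fun v => ⟪A v, v⟫) (by fun_prop)
  have hv1 : ‖v0‖ = 1 := by simpa using hv0
  refine ⟨⟪A v0, v0⟫, h v0 (by intro h0; simp [h0] at hv1), fun v => ?_⟩
  by_cases hv : v = 0
  · simp [hv]
  have hn : 0 < ‖v‖ := norm_pos_iff.2 hv
  have := hmin (show ‖v‖⁻¹ • v ∈ sphere (0 : Euc 2) 1 by simp [norm_smul, hn.ne'])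
  simp only [mem_setOf_eq, map_smul, inner_smul_left, inner_smul_right] at this
  simp only [map_inv₀, conj_trivial] at this
  rw [← div_eq_inv_mul, ← div_eq_inv_mul, div_div, le_div_iff₀ (by positivity)] at this
  rwa [pow_two]

/-- local picture at a sink -/
theorem sink_local (B : Base φ f) {q : Euc 2} (hq : IsSinkAt f q) :
    ∀ᶠ ε in 𝓝[>] (0:ℝ), ∀ p ∈ closedBall q (6 * ε), p ≠ q →
      0 < ‖f p‖ ∧ ε * ‖f p‖ * ‖q - p‖ ≤ ⟪f p, q - p⟫ := by
  set A := fderiv ℝ f q with hA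
  obtain ⟨μ, hμ, hco⟩ := coercive (A := -A) (fun v hv => by
    have := hq.2 v hv
    simp only [ContinuousLinearMap.neg_apply, inner_neg_left]; linarith)
  have ho := (B.hfd q).isLittleO
  have hev := ho.def (show (0:ℝ) < μ / 2 by positivity)
  obtain ⟨r, hr, hball⟩ := Metric.eventually_nhds_iff_ball.1 hev
  set L := ‖A‖ + μ with hL
  have hLp : 0 < L := by positivity
  filter_upwards [Ioo_mem_nhdsGT (show (0:ℝ) < min (r / 7) (μ / (2 * L)) by positivity)] with ε hε p hp hpq
  have hε1 : ε < r / 7 := hε.2.trans_le (min_le_left _ _)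
  have hε2 : ε * (2 * L) < μ := by
    have := hε.2.trans_le (min_le_right _ _)
    rwa [lt_div_iff₀ (by positivity)] at this
  have hε0 : 0 < ε := hε.1
  have h1 := hball p (mem_ball.2 (by rw [mem_closedBall] at hp; linarith))
  rw [hq.1, sub_zero] at h1
  set w := p - q with hw
  have hwn : 0 < ‖w‖ := norm_pos_iff.2 (sub_ne_zero.2 hpq)
  have hqp : q - p = - w := by rw [hw]; abel
  set e := f p - A w with he
  have h1' : ‖e‖ ≤ μ / 2 * ‖w‖ := h1
  have hfp : f p = A w + e := by rw [he]; abel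
  have h2 : μ / 2 * ‖w‖ ^ 2 ≤ ⟪f p, q - p⟫ := by
    have h3 := hco w
    simp only [ContinuousLinearMap.neg_apply, inner_neg_left] at h3
    have h4 : |⟪e, w⟫| ≤ μ / 2 * ‖w‖ * ‖w‖ := (abs_real_inner_le_norm e w).trans (by gcongr)
    have h5 := le_abs_self ⟪e, w⟫
    rw [hqp, hfp, inner_neg_right, inner_add_left]
    linarith
  have h3 : ‖f p‖ ≤ L * ‖w‖ := by
    rw [hfp]
    have := A.le_opNorm w
    refine (norm_add_le _ _).trans ?_
    rw [hL, add_mul]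
    have : μ / 2 * ‖w‖ ≤ μ * ‖w‖ := by gcongr; linarith
    linarith
  have h4 : 0 < ‖f p‖ := by
    rw [norm_pos_iff]; intro h0
    rw [h0, inner_zero_left] at h2
    have : 0 < μ / 2 * ‖w‖ ^ 2 := by positivity
    linarith
  refine ⟨h4, ?_⟩
  rw [hqp, norm_neg, ← hqp]
  refine le_trans ?_ h2
  have h5 : ε * ‖f p‖ * ‖w‖ ≤ ε * (L * ‖w‖) * ‖w‖ := by gcongr
  have h6 : (ε * (2 * L)) * ‖w‖ ^ 2 ≤ μ * ‖w‖ ^ 2 := by gcongr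
  linarith

/-- a source is a strict local minimum -/
theorem source_local (B : Base φ f) {q : Euc 2} (hq : IsSourceAt f q) :
    ∀ᶠ p in 𝓝 q, p ≠ q → φ q < φ p := by
  set A := fderiv ℝ f q with hA
  obtain ⟨μ, hμ, hco⟩ := coercive (A := A) hq.2
  have ho := (B.hfd q).isLittleO
  obtain ⟨r, hr, hball⟩ := Metric.eventually_nhds_iff_ball.1 (ho.def (show (0:ℝ) < μ / 2 by positivity))
  filter_upwards [ball_mem_nhds q hr] with p hp hpq
  set w := p - q with hw
  have hwn : 0 < ‖w‖ := norm_pos_iff.2 (sub_ne_zero.2 hpq)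
  have hd : ∀ t : ℝ, HasDerivAt (fun t : ℝ => φ (q + t • w)) ⟪f (q + t • w), w⟫ t := fun t =>
    B.deriv_along (γ := fun t : ℝ => q + t • w) (by simpa using ((hasDerivAt_id t).smul_const w).const_add q)
  have hpos : ∀ t ∈ Ioo (0:ℝ) 1, 0 < ⟪f (q + t • w), w⟫ := by
    intro t ht
    have h1 := hball (q + t • w) (by
      rw [mem_ball, dist_eq_norm] at hp ⊢
      rw [add_sub_cancel_left, norm_smul, Real.norm_of_nonneg ht.1.le]
      have : t * ‖w‖ ≤ 1 * ‖w‖ := by gcongr; exact ht.2.le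
      linarith)
    rw [hq.1, sub_zero, add_sub_cancel_left, map_smul, norm_smul, Real.norm_of_nonneg ht.1.le] at h1
    set e := f (q + t • w) - t • A w with he
    have hf : f (q + t • w) = t • A w + e := by rw [he]; abel
    have h4 : |⟪e, w⟫| ≤ μ / 2 * (t * ‖w‖) * ‖w‖ := (abs_real_inner_le_norm e w).trans (by gcongr)
    have h5 := neg_abs_le ⟪e, w⟫
    have h6 := mul_le_mul_of_nonneg_left (hco w) ht.1.le
    rw [hf, inner_add_left, inner_smul_left]
    simp only [conj_trivial]
    have h7 : 0 < t * (μ * ‖w‖ ^ 2) := by have := ht.1; positivity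
    linarith
  have hm : StrictMonoOn (fun t : ℝ => φ (q + t • w)) (Icc 0 1) := by
    refine strictMonoOn_of_deriv_pos (convex_Icc 0 1) (fun t _ => (hd t).continuousAt.continuousWithinAt) fun t ht => ?_
    rw [(hd t).deriv]
    rw [interior_Icc] at ht
    exact hpos t ht
  have := hm (left_mem_Icc.2 zero_le_one) (right_mem_Icc.2 zero_le_one) zero_lt_one
  simpa [hw] using this

/-- the trap lemma -/
theorem trap (B : Base φ f) {R1 M m R' : ℝ} (hR : R1 ≤ R') (hbig : ∀ p, R1 ≤ ‖p‖ → 1 ≤ ‖f p‖)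
    (hm : ∀ p, ‖p‖ ≤ R' → m ≤ φ p) (hmM : m ≤ M) {γ : ℝ → Euc 2} {T : ℝ} {D : ℝ → Euc 2}
    (hγ : ∀ t ∈ Icc 0 T, HasDerivAt γ (D t) t)
    (hD : ∀ t ∈ Icc 0 T, R1 ≤ ‖γ t‖ → ∃ θ ∈ Icc (0:ℝ) 1, D t = θ • f (γ t))
    (h0 : ‖γ 0‖ ≤ R') (hM : ∀ t ∈ Icc 0 T, φ (γ t) ≤ M) : ∀ t ∈ Icc 0 T, ‖γ t‖ ≤ R' + (M - m) := by
  intro t ht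
  by_contra hcon
  push Not at hcon
  have hcont : ContinuousOn γ (Icc 0 t) := fun s hs =>
    (hγ s ⟨hs.1, hs.2.trans ht.2⟩).continuousAt.continuousWithinAt
  have hS : IsCompact (Icc 0 t ∩ γ ⁻¹' closedBall 0 R') :=
    isCompact_Icc.of_isClosed_subset (hcont.preimage_isClosed_of_isClosed isClosed_Icc isClosed_closedBall) inter_subset_left
  obtain ⟨t0, ht0, hmax⟩ := hS.exists_isMaxOn ⟨0, ⟨le_rfl, ht.1⟩, by simpa using h0⟩ continuousOn_id
  have hn0 : ‖γ t0‖ ≤ R' := by simpa using ht0.2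
  set e := ‖γ t‖⁻¹ • γ t with he
  have htp : 0 < ‖γ t‖ := by
    have := norm_nonneg (γ 0)
    linarith
  have hen : ‖e‖ = 1 := by simp [he, norm_smul, htp.ne']
  have hout : ∀ s ∈ Ioc t0 t, R' < ‖γ s‖ := by
    intro s hs
    by_contra h
    have : s ≤ t0 := hmax (show s ∈ Icc 0 t ∩ γ ⁻¹' closedBall 0 R' from
      ⟨⟨ht0.1.1.trans hs.1.le, hs.2⟩, by simpa using h⟩)
    linarith [hs.1]
  have hsub : ∀ s ∈ Icc t0 t, s ∈ Icc 0 T := fun s hs => ⟨ht0.1.1.trans hs.1, hs.2.trans ht.2⟩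
  have hd : ∀ s ∈ Icc t0 t, HasDerivAt (fun s => ⟪γ s, e⟫ - φ (γ s)) (⟪D s, e⟫ - ⟪f (γ s), D s⟫) s := by
    intro s hs
    have h1 : HasDerivAt (fun s => ⟪γ s, e⟫) ⟪D s, e⟫ s := by
      simpa using (hγ s (hsub s hs)).inner ℝ (hasDerivAt_const s e)
    exact h1.sub (B.deriv_along (hγ s (hsub s hs)))
  have hanti : AntitoneOn (fun s => ⟪γ s, e⟫ - φ (γ s)) (Icc t0 t) := by
    refine antitoneOn_of_deriv_nonpos (convex_Icc _ _) (fun s hs => (hd s hs).continuousAt.continuousWithinAt)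
      (fun s hs => (hd s (interior_subset hs)).differentiableAt.differentiableWithinAt) fun s hs => ?_
    have hs' := interior_subset hs
    rw [interior_Icc] at hs
    rw [(hd s hs').deriv]
    have hR1 : R1 ≤ ‖γ s‖ := hR.trans (hout s ⟨hs.1, hs.2.le⟩).le
    obtain ⟨θ, hθ, hDs⟩ := hD s (hsub s hs') hR1
    have h1 := hbig _ hR1
    rw [hDs, inner_smul_left, inner_smul_right (f (γ s)) (f (γ s)) θ, real_inner_self_eq_norm_sq]
    simp only [conj_trivial]
    have h2 : ⟪f (γ s), e⟫ ≤ ‖f (γ s)‖ := by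
      have := real_inner_le_norm (f (γ s)) e
      rwa [hen, mul_one] at this
    have h3 : 0 ≤ θ * (‖f (γ s)‖ ^ 2 - ⟪f (γ s), e⟫) := by
      apply mul_nonneg hθ.1
      have : ‖f (γ s)‖ * 1 ≤ ‖f (γ s)‖ * ‖f (γ s)‖ := by gcongr
      rw [pow_two]; linarith
    linarith
  have h1 := hanti (left_mem_Icc.2 ht0.1.2) (right_mem_Icc.2 ht0.1.2) ht0.1.2
  have h2 : ⟪γ t, e⟫ = ‖γ t‖ := by
    rw [he, inner_smul_right, real_inner_self_eq_norm_sq, pow_two, ← mul_assoc, inv_mul_cancel₀ htp.ne', one_mul]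
  have h3 : ⟪γ t0, e⟫ ≤ ‖γ t0‖ := by
    have := real_inner_le_norm (γ t0) e
    rwa [hen, mul_one] at this
  simp only [h2] at h1
  linarith [hM t ht, hm _ hn0]

end Base


/-! ## Part 9 : the modified field -/

structure Dyn (φ : Euc 2 → ℝ) (f X : Euc 2 → Euc 2) (K : ℝ≥0) (Φ : Euc 2 → ℝ → Euc 2) (r R1 M R R2 : ℝ) : Prop where
  base : Base φ f
  flow : GFlow X K Φ
  Xc : Continuous X
  r_pos : 0 < r
  R1_pos : 0 < R1
  sink6 : ∀ q, IsSinkAt f q → ∀ p ∈ closedBall q (6 * r), p ≠ q →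
    0 < ‖f p‖ ∧ r * ‖f p‖ * ‖q - p‖ ≤ ⟪f p, q - p⟫
  sinkR1 : ∀ q, IsSinkAt f q → closedBall q (6 * r) ⊆ ball 0 R1
  big : ∀ p, R1 ≤ ‖p‖ → 1 ≤ ‖f p‖
  hM : ∀ p, ‖p‖ ≤ R1 → φ p + 1 ≤ M
  trapR : ∃ m, (∀ p, ‖p‖ ≤ R1 → m ≤ φ p) ∧ m ≤ M ∧ R = R1 + (M - m)
  trapR2 : ∃ m, (∀ p, ‖p‖ ≤ R + 1 → m ≤ φ p) ∧ m ≤ M ∧ R2 = R + 1 + (M - m)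
  X_eq : ∀ p, ‖p‖ ≤ R2 → (∀ q, IsSinkAt f q → p ∉ closedBall q (2 * r)) → X p = f p
  X_sink : ∀ q, IsSinkAt f q → ∀ p ∈ closedBall q r, X p = q - p
  X_in : ∀ q, IsSinkAt f q → ∀ p ∈ closedBall q (3 * r), p ≠ q → 0 < ⟪X p, q - p⟫
  X_pos : ∀ p, ‖p‖ ≤ R2 → f p ≠ 0 → 0 < ⟪f p, X p⟫
  X_nonneg : ∀ p, 0 ≤ ⟪f p, X p⟫
  X_out : ∀ p, R1 ≤ ‖p‖ → ∃ θ ∈ Icc (0:ℝ) 1, X p = θ • f p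
  X_zero : ∀ p, f p = 0 → X p = 0

theorem dyn_exists {φ : Euc 2 → ℝ} {f : Euc 2 → Euc 2} (B : Base φ f) (Rγ : ℝ) :
    ∃ X K Φ r R1 M R R2, Rγ ≤ R1 ∧ Dyn φ f X K Φ r R1 M R R2 := by
  have hSf : {q | IsSinkAt f q}.Finite := B.fin.subset fun q hq => hq.1
  obtain ⟨r, hr6, hr⟩ : ∃ r : ℝ, (∀ q ∈ {q | IsSinkAt f q}, ∀ p ∈ closedBall q (6 * r), p ≠ q →
      0 < ‖f p‖ ∧ r * ‖f p‖ * ‖q - p‖ ≤ ⟪f p, q - p⟫) ∧ 0 < r := by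
    have h := (Filter.eventually_all_finite hSf).2 (fun q (hq : IsSinkAt f q) => B.sink_local hq)
    exact (h.and self_mem_nhdsWithin).exists
  -- disjointness
  have hdisj : ∀ q q', IsSinkAt f q → IsSinkAt f q' → q ≠ q' → 6 * r < dist q' q := by
    intro q q' hq hq' hne
    by_contra hcon
    have := (hr6 q hq q' (mem_closedBall.2 (not_lt.1 hcon)) hne.symm).1
    rw [hq'.1, norm_zero] at this
    exact lt_irrefl _ this
  obtain ⟨R0, hR0⟩ := B.big
  obtain ⟨Rs, hRs⟩ : ∃ Rs : ℝ, ∀ q ∈ {q | IsSinkAt f q}, ‖q‖ ≤ Rs := hSf.isBounded.exists_norm_le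
  obtain ⟨R1, hR1⟩ : ∃ R1, max (max Rγ R0) (max (|Rs| + 6 * r + 1) 1) = R1 := ⟨_, rfl⟩
  have a1 : Rγ ≤ R1 := hR1 ▸ (le_max_left _ _).trans (le_max_left _ _)
  have a2 : R0 ≤ R1 := hR1 ▸ (le_max_right _ _).trans (le_max_left _ _)
  have a3 : |Rs| + 6 * r + 1 ≤ R1 := hR1 ▸ (le_max_left _ _).trans (le_max_right _ _)
  have a4 : 1 ≤ R1 := hR1 ▸ (le_max_right _ _).trans (le_max_right _ _)
  have hbd : ∀ ρ, ∃ m M, ∀ p, ‖p‖ ≤ ρ → m ≤ φ p ∧ φ p ≤ M := by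
    intro ρ
    have hc : IsCompact (φ '' closedBall 0 ρ) := (isCompact_closedBall 0 ρ).image B.contφ
    obtain ⟨m, hm⟩ := hc.bddBelow
    obtain ⟨M, hM⟩ := hc.bddAbove
    exact ⟨m, M, fun p hp => ⟨hm ⟨p, by simpa using hp, rfl⟩, hM ⟨p, by simpa using hp, rfl⟩⟩⟩
  obtain ⟨m1, M0, hb1⟩ := hbd R1
  obtain ⟨M, hM⟩ : ∃ M, M = M0 + 1 := ⟨_, rfl⟩
  have hmM : m1 ≤ M := by
    have := hb1 0 (by simp; linarith)
    linarith
  obtain ⟨R, hR⟩ : ∃ R, R = R1 + (M - m1) := ⟨_, rfl⟩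
  obtain ⟨m2, _, hb2⟩ := hbd (R + 1)
  have hmM2 : m2 ≤ M := by
    have := (hb2 0 (by simp; linarith)).1
    have := (hb1 0 (by simp; linarith)).2
    linarith
  obtain ⟨R2, hR2⟩ : ∃ R2, R2 = R + 1 + (M - m2) := ⟨_, rfl⟩
  have hR2p : R1 < R2 := by linarith
  -- bumps
  let ψ : ∀ q : Euc 2, ContDiffBump q := fun q => ⟨r, 2 * r, hr, by linarith⟩
  let χ : ContDiffBump (0 : Euc 2) := ⟨R2, R2 + 1, by linarith, by linarith⟩
  let S := hSf.toFinset
  have hS : ∀ q, q ∈ S ↔ IsSinkAt f q := fun q => by simp [S]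
  let X0 : Euc 2 → Euc 2 := fun p => f p + ∑ q ∈ S, ψ q p • ((q - p) - f p)
  let X : Euc 2 → Euc 2 := fun p => χ p • X0 p
  have hX0C : ContDiff ℝ 1 X0 := by
    refine B.c1.add (ContDiff.sum fun q _ => ?_)
    exact (ψ q).contDiff.smul ((contDiff_const.sub contDiff_id).sub B.c1)
  have hXC : ContDiff ℝ 1 X := χ.contDiff.smul hX0C
  have hXs : HasCompactSupport X := χ.hasCompactSupport.smul_right
  obtain ⟨K, hK⟩ := ContDiff.lipschitzWith_of_hasCompactSupport hXs hXC (by norm_num)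
  obtain ⟨C, hC⟩ := hXs.exists_bound_of_continuous hXC.continuous
  obtain ⟨Φ, hΦ⟩ := gflow_exists X K ⟨|C|, abs_nonneg C⟩ hK (fun p => (hC p).trans (le_abs_self C))
  have hψ0 : ∀ q p, p ∉ ball q (2 * r) → ψ q p = 0 := by
    intro q p hp
    exact (ψ q).zero_of_le_dist (by simpa using hp)
  have hψ1 : ∀ q p, p ∈ closedBall q r → ψ q p = 1 := fun q p hp => (ψ q).one_of_mem_closedBall hp
  have hχ1 : ∀ p, ‖p‖ ≤ R2 → χ p = 1 := fun p hp => χ.one_of_mem_closedBall (by simpa using hp)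
  have hsingle : ∀ q, IsSinkAt f q → ∀ p ∈ closedBall q (3 * r), X0 p = f p + ψ q p • ((q - p) - f p) := by
    intro q hq p hp
    simp only [X0]
    rw [Finset.sum_eq_single q]
    · intro q' hq' hne
      rw [hψ0 q' p, zero_smul]
      intro hp'
      have := hdisj q' q ((hS q').1 hq') hq hne
      rw [mem_ball] at hp'
      rw [mem_closedBall, dist_comm] at hp
      linarith [dist_triangle q p q']
    · intro h; exact absurd ((hS q).2 hq) h
  have hnone : ∀ p, (∀ q, IsSinkAt f q → p ∉ ball q (2 * r)) → X0 p = f p := by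
    intro p hp
    simp only [X0]
    rw [Finset.sum_eq_zero, add_zero]
    intro q hq
    rw [hψ0 q p (hp q ((hS q).1 hq)), zero_smul]
  have hsinkR : ∀ q, IsSinkAt f q → closedBall q (6 * r) ⊆ ball 0 R1 := by
    intro q hq p hp
    have h1 := hRs q hq
    have h2 := le_abs_self Rs
    rw [mem_closedBall, dist_eq_norm] at hp
    rw [mem_ball_zero_iff]
    have : ‖p‖ ≤ ‖p - q‖ + ‖q‖ := by simpa using norm_add_le (p - q) q
    linarith
  have hpos0 : ∀ q, IsSinkAt f q → ∀ p ∈ closedBall q (6 * r), p ≠ q → 0 < ⟪f p, q - p⟫ := by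
    intro q hq p hp hne
    obtain ⟨h1, h2⟩ := hr6 q hq p hp hne
    have : 0 < ‖q - p‖ := norm_pos_iff.2 (sub_ne_zero.2 hne.symm)
    have : 0 < r * ‖f p‖ * ‖q - p‖ := by positivity
    linarith
  have hX0pos : ∀ p, f p ≠ 0 → 0 < ⟪f p, X0 p⟫ := by
    intro p hp
    have hpp : 0 < ⟪f p, f p⟫ := real_inner_self_pos.2 hp
    by_cases h : ∀ q, IsSinkAt f q → p ∉ ball q (2 * r)
    · rw [hnone p h]; exact hpp
    · push Not at h
      obtain ⟨q, hq, hpq⟩ := h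
      rw [mem_ball] at hpq
      rw [hsingle q hq p (mem_closedBall.2 (by linarith)), inner_add_right, inner_smul_right, inner_sub_right]
      have hne : p ≠ q := fun h => hp (h ▸ hq.1)
      have h1 := hpos0 q hq p (mem_closedBall.2 (by linarith)) hne
      have h2 := (ψ q).nonneg (x := p)
      have h3 := (ψ q).le_one (x := p)
      rcases eq_or_lt_of_le h2 with h4 | h4
      · rw [← h4]; linarith
      · have h5 := mul_pos h4 h1
        have h6 := mul_nonneg (sub_nonneg.2 h3) hpp.le
        linarith
  have hRR2 : R1 ≤ R2 := by linarith
  refine ⟨X, K, Φ, r, R1, M, R, R2, a1, B, hΦ, hXC.continuous, hr, by linarith, hr6, hsinkR,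
    fun p hp => hR0 p (a2.trans hp), fun p hp => by linarith [(hb1 p hp).2], ⟨m1, fun p hp => (hb1 p hp).1, hmM, hR⟩,
    ⟨m2, fun p hp => (hb2 p hp).1, hmM2, hR2⟩, ?_, ?_, ?_, ?_, ?_, ?_, ?_⟩
  · intro p hp hq
    simp only [X]
    rw [hχ1 p hp, one_smul, hnone p fun q hq' h => hq q hq' (ball_subset_closedBall h)]
  · intro q hq p hp
    have hn : ‖p‖ < R1 := by simpa using hsinkR q hq (closedBall_subset_closedBall (by linarith) hp)
    simp only [X]
    rw [hχ1 p (by linarith), one_smul, hsingle q hq p (closedBall_subset_closedBall (by linarith) hp), hψ1 q p hp, one_smul]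
    abel
  · intro q hq p hp hne
    have hp6 : p ∈ closedBall q (6 * r) := closedBall_subset_closedBall (by linarith) hp
    have hn : ‖p‖ < R1 := by simpa using hsinkR q hq hp6
    simp only [X]
    rw [hχ1 p (by linarith), one_smul, hsingle q hq p hp, inner_add_left, inner_smul_left, inner_sub_left]
    simp only [conj_trivial]
    have h1 := hpos0 q hq p hp6 hne
    have h2 := (ψ q).nonneg (x := p)
    have h3 := (ψ q).le_one (x := p)
    have hpp : 0 < ⟪q - p, q - p⟫ := real_inner_self_pos.2 (sub_ne_zero.2 hne.symm)
    rcases eq_or_lt_of_le h2 with h4 | h4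
    · rw [← h4]; linarith
    · have h5 := mul_pos h4 hpp
      have h6 := mul_nonneg (sub_nonneg.2 h3) h1.le
      linarith
  · intro p hp h0
    simp only [X]
    rw [hχ1 p hp, one_smul]
    exact hX0pos p h0
  · intro p
    simp only [X]
    rw [inner_smul_right]
    apply mul_nonneg χ.nonneg
    by_cases h : f p = 0
    · rw [h, inner_zero_left]
    · exact (hX0pos p h).le
  · intro p hp
    refine ⟨χ p, ⟨χ.nonneg, χ.le_one⟩, ?_⟩
    simp only [X]
    rw [hnone p]
    intro q hq hpq
    have := hsinkR q hq (closedBall_subset_closedBall (by linarith) (ball_subset_closedBall hpq))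
    rw [mem_ball_zero_iff] at this
    linarith
  · intro p hp
    simp only [X]
    by_cases h : ∀ q, IsSinkAt f q → p ∉ ball q (2 * r)
    · rw [hnone p h, hp, smul_zero]
    · push Not at h
      obtain ⟨q, hq, hpq⟩ := h
      rw [mem_ball] at hpq
      have hpq' : p = q := by
        by_contra hne
        have := (hr6 q hq p (mem_closedBall.2 (by linarith)) hne).1
        rw [hp, norm_zero] at this
        exact lt_irrefl _ this
      rw [hsingle q hq p (mem_closedBall.2 (by linarith)), hp, hpq']
      simp


/-! ## Part 10 : dynamics of the modified field -/

theorem barrier {u u' : ℝ → ℝ} {a b K K' : ℝ} (hK : K < K') (hd : ∀ t ∈ Icc a b, HasDerivAt u (u' t) t)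
    (h : ∀ t ∈ Icc a b, u t < K' → u' t ≤ 0) (ha : u a ≤ K) : ∀ t ∈ Icc a b, u t ≤ K := by
  intro t ht
  by_contra hcon
  push Not at hcon
  obtain ⟨L, hL1, hL2⟩ := exists_between (lt_min hK hcon)
  have hLK : L < K' := hL2.trans_le (min_le_left _ _)
  have hLt : L < u t := hL2.trans_le (min_le_right _ _)
  have hcont : ContinuousOn u (Icc a t) := fun s hs =>
    (hd s ⟨hs.1, hs.2.trans ht.2⟩).continuousAt.continuousWithinAt
  have hS : IsCompact (Icc a t ∩ u ⁻¹' Ici L) :=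
    isCompact_Icc.of_isClosed_subset (hcont.preimage_isClosed_of_isClosed isClosed_Icc isClosed_Ici) inter_subset_left
  obtain ⟨t1, ht1, hmin⟩ := hS.exists_isMinOn ⟨t, right_mem_Icc.2 ht.1, hLt.le⟩ continuousOn_id
  have hlow : ∀ s ∈ Ico a t1, u s < L := by
    intro s hs
    by_contra hc
    have : t1 ≤ s := hmin (show s ∈ Icc a t ∩ u ⁻¹' Ici L from ⟨⟨hs.1, hs.2.le.trans ht1.1.2⟩, not_lt.1 hc⟩)
    linarith [hs.2]
  have hsub : ∀ s ∈ Icc a t1, s ∈ Icc a b := fun s hs => ⟨hs.1, hs.2.trans (ht1.1.2.trans ht.2)⟩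
  have hanti : AntitoneOn u (Icc a t1) := by
    refine antitoneOn_of_deriv_nonpos (convex_Icc _ _) (fun s hs => (hd s (hsub s hs)).continuousAt.continuousWithinAt)
      (fun s hs => (hd s (hsub s (interior_subset hs))).differentiableAt.differentiableWithinAt) fun s hs => ?_
    have hs' := hsub s (interior_subset hs)
    rw [interior_Icc] at hs
    rw [(hd s hs').deriv]
    exact h s hs' ((hlow s ⟨hs.1.le, hs.2⟩).trans hLK)
  have := hanti (left_mem_Icc.2 ht1.1.1) (right_mem_Icc.2 ht1.1.1) ht1.1.1
  have h2 : L ≤ u t1 := ht1.2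
  linarith

/-- a curve moving towards `q` inside `closedBall q ρ'` stays in smaller balls -/
theorem ball_stay {γ D : ℝ → Euc 2} {q : Euc 2} {a b ρ ρ' : ℝ} (hρ0 : 0 ≤ ρ) (hρ : ρ < ρ')
    (hd : ∀ t ∈ Icc a b, HasDerivAt γ (D t) t)
    (h : ∀ t ∈ Icc a b, γ t ∈ closedBall q ρ' → 0 ≤ ⟪D t, q - γ t⟫) (ha : γ a ∈ closedBall q ρ) :
    ∀ t ∈ Icc a b, γ t ∈ closedBall q ρ := by
  intro t ht
  have := barrier (u := fun t => ‖γ t - q‖ ^ 2) (u' := fun t => 2 * ⟪γ t - q, D t⟫) (K := ρ ^ 2) (K' := ρ' ^ 2)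
    (a := a) (b := b) (by gcongr) (fun s hs => ((hd s hs).sub_const q).norm_sq) (fun s hs hlt => ?_) (by
      simp only [mem_closedBall, dist_eq_norm] at ha
      gcongr) t ht
  · rw [mem_closedBall, dist_eq_norm]
    exact le_of_sq_le_sq this hρ0
  · have h1 : ‖γ s - q‖ ≤ ρ' := le_of_sq_le_sq hlt.le (by linarith)
    have h2 := h s hs (by rwa [mem_closedBall, dist_eq_norm])
    have h3 : ⟪γ s - q, D s⟫ = - ⟪D s, q - γ s⟫ := by
      rw [real_inner_comm, ← inner_neg_right, neg_sub]
    simp only [h3]; linarith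

/-- points from which the flow becomes high or gets captured by a sink -/
def basinO (φ : Euc 2 → ℝ) (f : Euc 2 → Euc 2) (Φ : Euc 2 → ℝ → Euc 2) (r M : ℝ) : Set (Euc 2) :=
  {p | (∃ t, 0 ≤ t ∧ M < φ (Φ p t)) ∨ ∃ q, IsSinkAt f q ∧ ∃ t, 0 ≤ t ∧ Φ p t ∈ ball q r}

namespace Dyn
variable {φ : Euc 2 → ℝ} {f X : Euc 2 → Euc 2} {K : ℝ≥0} {Φ : Euc 2 → ℝ → Euc 2} {r R1 M R R2 : ℝ}

theorem R1R (D : Dyn φ f X K Φ r R1 M R R2) : R1 ≤ R := by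
  obtain ⟨m, -, h, h'⟩ := D.trapR; linarith
theorem RR2 (D : Dyn φ f X K Φ r R1 M R R2) : R + 1 ≤ R2 := by
  obtain ⟨m, -, h, h'⟩ := D.trapR2; linarith

theorem derφ (D : Dyn φ f X K Φ r R1 M R R2) (p t) :
    HasDerivAt (fun s => φ (Φ p s)) ⟪f (Φ p t), X (Φ p t)⟫ t := D.base.deriv_along (D.flow.deriv p t)

theorem mono (D : Dyn φ f X K Φ r R1 M R R2) (p) : Monotone (fun s => φ (Φ p s)) :=
  monotone_of_deriv_nonneg (fun t => (D.derφ p t).differentiableAt) fun t => by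
    rw [(D.derφ p t).deriv]; exact D.X_nonneg _

theorem zero_lt (D : Dyn φ f X K Φ r R1 M R R2) {p} (hp : f p = 0) : ‖p‖ < R1 := by
  by_contra h
  have := D.big p (not_lt.1 h)
  rw [hp, norm_zero] at this
  linarith

theorem trapX (D : Dyn φ f X K Φ r R1 M R R2) {p} (hp : ‖p‖ ≤ R1) {t : ℝ} (ht : 0 ≤ t) (hM : φ (Φ p t) ≤ M) :
    ‖Φ p t‖ ≤ R := by
  obtain ⟨m, h1, h2, h3⟩ := D.trapR
  rw [h3]
  exact D.base.trap (T := t) le_rfl D.big h1 h2 (fun s _ => D.flow.deriv p s) (fun s _ hs => D.X_out _ hs)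
    (by rwa [D.flow.zero]) (fun s hs => (D.mono p hs.2).trans hM) t ⟨ht, le_rfl⟩

theorem sink_flow (D : Dyn φ f X K Φ r R1 M R R2) {q p} (hq : IsSinkAt f q) (hp : p ∈ closedBall q r) {t : ℝ}
    (ht : 0 ≤ t) : Φ p t = q + Real.exp (-t) • (p - q) := by
  have hd : ∀ s : ℝ, HasDerivAt (fun s => q + Real.exp (-s) • (p - q)) (- (Real.exp (-s) • (p - q))) s := by
    intro s
    have h1 : HasDerivAt (fun s : ℝ => Real.exp (-s)) (- Real.exp (-s)) s := by
      simpa using (hasDerivAt_neg s).exp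
    have := (h1.smul_const (p - q)).const_add q
    simpa using this
  have := D.flow.unique_Icc (γ := fun s => q + Real.exp (-s) • (p - q)) (T := t) (fun s hs => ?_) t ⟨ht, le_rfl⟩
  · simpa using this.symm
  · rw [D.X_sink q hq]
    · have := hd s
      simpa using this
    · rw [mem_closedBall, dist_eq_norm] at hp ⊢
      rw [add_sub_cancel_left, norm_smul, Real.norm_of_nonneg (Real.exp_pos _).le]
      have h1 : Real.exp (-s) ≤ 1 := Real.exp_le_one_iff.2 (by linarith [hs.1])
      calc Real.exp (-s) * ‖p - q‖ ≤ 1 * ‖p - q‖ := by gcongr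
        _ ≤ r := by linarith

theorem sink_ball (D : Dyn φ f X K Φ r R1 M R R2) {q p} (hq : IsSinkAt f q) (hp : p ∈ ball q r) {t : ℝ}
    (ht : 0 ≤ t) : Φ p t ∈ ball q r := by
  rw [D.sink_flow hq (ball_subset_closedBall hp) ht]
  rw [mem_ball, dist_eq_norm] at hp ⊢
  rw [add_sub_cancel_left, norm_smul, Real.norm_of_nonneg (Real.exp_pos _).le]
  have h1 : Real.exp (-t) ≤ 1 := Real.exp_le_one_iff.2 (by linarith)
  calc Real.exp (-t) * ‖p - q‖ ≤ 1 * ‖p - q‖ := by gcongr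
    _ < r := by linarith

theorem sink_tendsto (D : Dyn φ f X K Φ r R1 M R R2) {q p} (hq : IsSinkAt f q) (hp : p ∈ ball q r) :
    Tendsto (Φ p) atTop (𝓝 q) := by
  have h1 : Tendsto (fun t : ℝ => q + Real.exp (-t) • (p - q)) atTop (𝓝 (q + (0:ℝ) • (p - q))) :=
    ((Real.tendsto_exp_atBot.comp tendsto_neg_atTop_atBot).smul_const (p - q)).const_add q
  rw [zero_smul, add_zero] at h1
  refine h1.congr' ?_
  filter_upwards [eventually_ge_atTop 0] with t ht
  exact (D.sink_flow hq (ball_subset_closedBall hp) ht).symm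

theorem isOpen_basin (D : Dyn φ f X K Φ r R1 M R R2) : IsOpen (basinO φ f Φ r M) := by
  have he : basinO φ f Φ r M = (⋃ t ∈ Ici (0:ℝ), {p | M < φ (Φ p t)}) ∪
      ⋃ q ∈ {q | IsSinkAt f q}, ⋃ t ∈ Ici (0:ℝ), (fun p => Φ p t) ⁻¹' ball q r := by
    ext p; simp [basinO]
  rw [he]
  refine (isOpen_biUnion fun t _ => ?_).union (isOpen_biUnion fun q _ => isOpen_biUnion fun t _ => ?_)
  · exact isOpen_lt continuous_const (D.base.contφ.comp (D.flow.cont1 t))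
  · exact isOpen_ball.preimage (D.flow.cont1 t)

theorem basin_forward (D : Dyn φ f X K Φ r R1 M R R2) {p} (hp : p ∈ basinO φ f Φ r M) {s : ℝ} (hs : 0 ≤ s) :
    Φ p s ∈ basinO φ f Φ r M := by
  rcases hp with ⟨t, ht, h⟩ | ⟨q, hq, t, ht, h⟩
  · refine Or.inl ⟨t, ht, ?_⟩
    rw [← D.flow.add]
    exact h.trans_le (D.mono p (by linarith))
  · refine Or.inr ⟨q, hq, t, ht, ?_⟩
    rw [← D.flow.add, add_comm, D.flow.add]
    exact D.sink_ball hq h hs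

theorem sink_nozero (D : Dyn φ f X K Φ r R1 M R R2) {q p} (hq : IsSinkAt f q) (hp : p ∈ closedBall q (6 * r))
    (h0 : f p = 0) : p = q := by
  by_contra hne
  have := (D.sink6 q hq p hp hne).1
  rw [h0, norm_zero] at this
  exact lt_irrefl _ this

theorem f_in (D : Dyn φ f X K Φ r R1 M R R2) {q p} (hq : IsSinkAt f q) (hp : p ∈ closedBall q (6 * r)) :
    0 ≤ ⟪f p, q - p⟫ := by
  by_cases h : p = q
  · rw [h, sub_self, inner_zero_right]
  · have h1 := (D.sink6 q hq p hp h).2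
    have := D.r_pos
    have : 0 ≤ r * ‖f p‖ * ‖q - p‖ := by positivity
    linarith

/-- A forward trajectory of `f` converging to a non-sink is an orbit of the modified flow. -/
theorem traj_eq (D : Dyn φ f X K Φ r R1 M R R2) {δ : ℝ → Euc 2} {p2 : Euc 2} (h0 : ‖δ 0‖ ≤ R + 1)
    (hd : ∀ t, 0 ≤ t → HasDerivAt δ (f (δ t)) t) (hl : Tendsto δ atTop (𝓝 p2)) (hz : f p2 = 0)
    (hns : ¬ IsSinkAt f p2) : ∀ t, 0 ≤ t → δ t = Φ (δ 0) t ∧ φ (δ t) ≤ M ∧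
      ∀ q, IsSinkAt f q → δ t ∉ closedBall q (2 * r) := by
  have hmono : MonotoneOn (fun t => φ (δ t)) (Ici 0) := by
    refine monotoneOn_of_deriv_nonneg (convex_Ici 0)
      (fun s hs => (D.base.deriv_along (hd s hs)).continuousAt.continuousWithinAt)
      (fun s hs => (D.base.deriv_along (hd s (interior_subset hs))).differentiableAt.differentiableWithinAt) fun s hs => ?_
    rw [(D.base.deriv_along (hd s (interior_subset hs))).deriv]
    exact real_inner_self_nonneg
  have hφl : Tendsto (fun t => φ (δ t)) atTop (𝓝 (φ p2)) := (D.base.contφ.tendsto p2).comp hl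
  have hle : ∀ t, 0 ≤ t → φ (δ t) ≤ M := by
    intro t ht
    have h1 : φ (δ t) ≤ φ p2 := by
      refine ge_of_tendsto hφl ?_
      filter_upwards [eventually_ge_atTop t] with s hs
      exact hmono ht (ht.trans hs) hs
    have := D.hM p2 (D.zero_lt hz).le
    linarith
  have hR2 : ∀ t, 0 ≤ t → ‖δ t‖ ≤ R2 := by
    intro t ht
    obtain ⟨m, h1, h2, h3⟩ := D.trapR2
    rw [h3]
    exact D.base.trap (T := t) (R1 := R1) (by linarith [D.R1R]) D.big h1 h2 (fun s hs => hd s hs.1)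
      (fun s _ hs => ⟨1, ⟨zero_le_one, le_rfl⟩, (one_smul _ _).symm⟩) h0 (fun s hs => hle s hs.1) t ⟨ht, le_rfl⟩
  have hrp := D.r_pos
  have hns : ∀ t, 0 ≤ t → ∀ q, IsSinkAt f q → δ t ∉ closedBall q (2 * r) := by
    intro t ht q hq hin
    have hstay : ∀ s, t ≤ s → δ s ∈ closedBall q (2 * r) := fun s hs =>
      ball_stay (ρ' := 6 * r) (by linarith) (by linarith) (fun s' hs' => hd s' (ht.trans hs'.1))
        (fun s' _ h => D.f_in hq h) hin s ⟨hs, le_rfl⟩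
    have h1 : p2 ∈ closedBall q (2 * r) := isClosed_closedBall.mem_of_tendsto hl
      (by filter_upwards [eventually_ge_atTop t] with s hs using hstay s hs)
    exact hns (D.sink_nozero hq (closedBall_subset_closedBall (by linarith) h1) hz ▸ hq)
  intro t ht
  refine ⟨D.flow.unique_Icc (fun s hs => ?_) t ⟨ht, le_rfl⟩, hle t ht, hns t ht⟩
  rw [D.X_eq _ (hR2 s hs.1) (hns s hs.1)]
  exact hd s hs.1

theorem noconv (D : Dyn φ f X K Φ r R1 M R R2) {δ : ℝ → Euc 2} {p2 : Euc 2} (h0 : ‖δ 0‖ ≤ R + 1)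
    (hO : δ 0 ∈ basinO φ f Φ r M)
    (hd : ∀ t, 0 ≤ t → HasDerivAt δ (f (δ t)) t) (hl : Tendsto δ atTop (𝓝 p2)) (hz : f p2 = 0)
    (hns : ¬ IsSinkAt f p2) : False := by
  have key := D.traj_eq h0 hd hl hz hns
  have := D.r_pos
  rcases hO with ⟨t, ht, h⟩ | ⟨q, hq, t, ht, h⟩
  · obtain ⟨h1, h2, -⟩ := key t ht
    rw [h1] at h2; linarith
  · obtain ⟨h1, -, h2⟩ := key t ht
    rw [h1] at h2
    exact h2 q hq (closedBall_subset_closedBall (by linarith) (ball_subset_closedBall h))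

theorem fne (D : Dyn φ f X K Φ r R1 M R R2) {p} (hp : f p ≠ 0) (t : ℝ) : f (Φ p t) ≠ 0 := by
  intro h
  have h1 := D.flow.fixed (D.X_zero _ h) (-t)
  rw [D.flow.neg_cancel] at h1
  rw [← h1] at h
  exact hp h

theorem gain (D : Dyn φ f X K Φ r R1 M R R2) {q} (hq : ‖q‖ ≤ R2) (h0 : f q ≠ 0) {t : ℝ} (ht : 0 < t) :
    φ q < φ (Φ q t) := by
  have h1 := D.derφ q 0
  rw [D.flow.zero] at h1
  have h2 := D.X_pos q hq h0
  by_contra hcon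
  have hc : ∀ s ∈ Icc 0 t, φ (Φ q s) = φ q := by
    intro s hs
    have a := D.mono q hs.1
    have b := D.mono q hs.2
    simp only [D.flow.zero] at a
    linarith
  have hw : HasDerivWithinAt (fun s => φ (Φ q s)) ⟪f q, X q⟫ (Ici 0) 0 := h1.hasDerivWithinAt
  have hw2 : HasDerivWithinAt (fun s => φ (Φ q s)) 0 (Ici 0) 0 := by
    refine (hasDerivWithinAt_const (0:ℝ) (Ici 0) (φ q)).congr_of_eventuallyEq ?_ (by simp [D.flow.zero])
    filter_upwards [Icc_mem_nhdsGE ht] with s hs using hc s hs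
  have := (uniqueDiffWithinAt_Ici (0:ℝ)).eq_deriv _ hw hw2
  linarith

theorem converge (D : Dyn φ f X K Φ r R1 M R R2) {p} (hb : ∀ t, 0 ≤ t → ‖Φ p t‖ ≤ R2) :
    ∃ q, f q = 0 ∧ Tendsto (Φ p) atTop (𝓝 q) := by
  have hcl : ∀ q, MapClusterPt q atTop (Φ p) → f q = 0 := by
    intro q hq
    by_contra h0
    have hqR : ‖q‖ ≤ R2 := by
      have : q ∈ closedBall (0 : Euc 2) R2 := by
        refine isClosed_closedBall.closure_subset (mem_closure_iff_clusterPt.2 (ClusterPt.mono hq ?_))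
        rw [le_principal_iff, mem_map]
        filter_upwards [eventually_ge_atTop 0] with t ht
        simpa using hb t ht
      simpa using this
    have hg := D.gain hqR h0 one_pos
    set e := (φ (Φ q 1) - φ q) / 2 with he
    have hc : Continuous fun q' => φ (Φ q' 1) - φ q' := (D.base.contφ.comp (D.flow.cont1 1)).sub D.base.contφ
    have hev : ∀ᶠ q' in 𝓝 q, e < φ (Φ q' 1) - φ q' := hc.continuousAt.eventually (lt_mem_nhds (by linarith))
    have hfr := mapClusterPt_iff_frequently.1 hq _ hev
    obtain ⟨C, hC⟩ := ((isCompact_closedBall (0:Euc 2) R2).image D.base.contφ).bddAbove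
    have hbd : BddAbove (range fun t => φ (Φ p t)) := by
      refine ⟨C, ?_⟩
      rintro _ ⟨t, rfl⟩
      refine (D.mono p (le_max_left t 0)).trans (hC ⟨_, ?_, rfl⟩)
      simpa using hb _ (le_max_right t 0)
    have ht := tendsto_atTop_ciSup (D.mono p) hbd
    have ht1 : Tendsto (fun t => φ (Φ p (t + 1)) - φ (Φ p t)) atTop (𝓝 0) := by
      have := (ht.comp (tendsto_atTop_add_const_right atTop (1:ℝ) tendsto_id)).sub ht
      simpa using this
    have hev2 := ht1.eventually (gt_mem_nhds (show (0:ℝ) < e by linarith))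
    obtain ⟨t, ha, hb'⟩ := (hfr.and_eventually hev2).exists
    rw [D.flow.add] at hb'
    simp only [mem_setOf_eq] at ha
    linarith
  have hmem : ∀ᶠ t in atTop, Φ p t ∈ closedBall (0 : Euc 2) R2 := by
    filter_upwards [eventually_ge_atTop 0] with t ht
    simpa using hb t ht
  obtain ⟨q, -, hq⟩ := (isCompact_closedBall (0 : Euc 2) R2).exists_mapClusterPt_of_frequently hmem.frequently
  refine ⟨q, hcl q hq, ?_⟩
  have hiso : ({p | f p = 0} \ {q})ᶜ ∈ 𝓝 q :=
    (D.base.fin.subset diff_subset).isClosed.isOpen_compl.mem_nhds (by simp)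
  obtain ⟨ε0, hε0, hball⟩ := Metric.nhds_basis_closedBall.mem_iff.1 hiso
  rw [Metric.tendsto_nhds]
  intro ε hε
  by_contra hne
  rw [not_eventually] at hne
  set e := min ε ε0 with he
  have hep : 0 < e := lt_min hε hε0
  have hfr : ∃ᶠ t in atTop, Φ p t ∈ sphere q e := by
    rw [frequently_atTop]
    intro N
    have h1 := mapClusterPt_iff_frequently.1 hq (ball q e) (ball_mem_nhds _ hep)
    obtain ⟨t1, ht1, hb1⟩ := frequently_atTop.1 h1 N
    obtain ⟨t2, ht2, hb2⟩ := frequently_atTop.1 hne t1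
    have hcd : Continuous fun t => dist (Φ p t) q := (D.flow.cont p).dist continuous_const
    have := intermediate_value_Icc ht2 hcd.continuousOn
    obtain ⟨t, ht, hte⟩ := this (show e ∈ Icc _ _ from ⟨(mem_ball.1 hb1).le, (min_le_left _ _).trans (not_lt.1 hb2)⟩)
    exact ⟨t, ht1.trans ht.1, hte⟩
  obtain ⟨q', hq', hc'⟩ := (isCompact_sphere q e).exists_mapClusterPt_of_frequently hfr
  have h0 := hcl q' hc'
  have hd : dist q' q = e := hq'
  refine hball (mem_closedBall.2 (hd.le.trans (min_le_right _ _))) ⟨h0, ?_⟩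
  intro h
  rw [mem_singleton_iff] at h
  rw [h, dist_self] at hd
  linarith

/-- the unstable branches end high or at a sink -/
theorem unstable_end (D : Dyn φ f X K Φ r R1 M R R2) (hns : NoSaddleConnection f) {y b : Euc 2} (hy : IsSaddleAt f y)
    (hb : f b ≠ 0) (hbR : ‖b‖ ≤ R1) (hback : ∀ t, t ≤ 0 → X (Φ b t) = f (Φ b t))
    (hlim : Tendsto (Φ b) atBot (𝓝 y)) (hφ : φ y < φ b) : b ∈ basinO φ f Φ r M := by
  by_contra hO
  simp only [basinO, mem_setOf_eq, not_or, not_exists, not_and, not_lt] at hO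
  obtain ⟨hlow, hsk⟩ := hO
  have hR : ∀ t, 0 ≤ t → ‖Φ b t‖ ≤ R := fun t ht => D.trapX hbR ht (hlow t ht)
  have hRR := D.RR2
  have hrp := D.r_pos
  obtain ⟨q, hq, hqt⟩ := D.converge (p := b) (fun t ht => (hR t ht).trans (by linarith))
  have hφt : Tendsto (fun t => φ (Φ b t)) atTop (𝓝 (φ q)) := (D.base.contφ.tendsto q).comp hqt
  have hle : ∀ t, φ (Φ b t) ≤ φ q := fun t => (D.mono b).ge_of_tendsto hφt t
  have hnsink : ¬ IsSinkAt f q := by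
    intro h
    obtain ⟨t, h1, h2⟩ := ((hqt.eventually (ball_mem_nhds q hrp)).and (eventually_ge_atTop 0)).exists
    exact hsk q h t h2 h1
  have hnsource : ¬ IsSourceAt f q := by
    intro h
    obtain ⟨t, h1⟩ := (hqt.eventually (D.base.source_local h)).exists
    have h2 := h1 (fun he => D.fne hb t (he ▸ hq))
    linarith [hle t]
  refine hns ⟨Φ b, y, q, fun t => ?_, hy, ⟨hq, hnsource, hnsink⟩, ?_, hlim, hqt⟩
  · have hd := D.flow.deriv b t
    rcases le_total t 0 with ht | ht
    · rwa [hback t ht] at hd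
    · rw [D.X_eq _ ((hR t ht).trans (by linarith))] at hd
      · exact hd
      · intro q' hq' hin
        have hstay : ∀ s, t ≤ s → Φ b s ∈ closedBall q' (2 * r) := fun s hs =>
          ball_stay (ρ' := 3 * r) (by linarith) (by linarith) (fun s' _ => D.flow.deriv b s')
            (fun s' _ h => by
              by_cases he : Φ b s' = q'
              · rw [he, sub_self, inner_zero_right]
              · exact (D.X_in q' hq' _ h he).le) hin s ⟨hs, le_rfl⟩
        have h1 : q ∈ closedBall q' (2 * r) := isClosed_closedBall.mem_of_tendsto hqt
          (by filter_upwards [eventually_ge_atTop t] with s hs using hstay s hs)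
        exact hnsink (D.sink_nozero hq' (closedBall_subset_closedBall (by linarith) h1) hq ▸ hq')
  · intro he
    have h1 := hle 0
    rw [D.flow.zero, ← he] at h1
    linarith

end Dyn


/-! ## Part 11 : local analysis at a saddle -/

/-- quantitative local saddle -/
structure LocSaddle (X : Euc 2 → Euc 2) (y eu ev : Euc 2) (a b κ m θ r : ℝ) : Prop where
  fr : Frame eu ev
  ha : 0 < a
  hb : 0 < b
  hκ : 0 < κ
  hκ1 : κ ≤ 1 / 2
  hm : 0 < m
  hma : m ≤ κ ^ 2 * a
  hmb : m ≤ κ ^ 2 * b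
  hθ0 : 0 ≤ θ
  hθ : θ ≤ m / 4
  hκa : κ ^ 2 * a ≤ b / 4
  hκb : κ ^ 2 * b ≤ a / 4
  hr : 0 < r
  X0 : X y = 0
  hu : ∀ p ∈ closedBall y r, ∀ p' ∈ closedBall y r, |⟪X p - X p', eu⟫ + a * ⟪p - p', eu⟫| ≤ θ * ‖p - p'‖
  hv : ∀ p ∈ closedBall y r, ∀ p' ∈ closedBall y r, |⟪X p - X p', ev⟫ - b * ⟪p - p', ev⟫| ≤ θ * ‖p - p'‖

/-- local unstable set -/
def Wset (Φ : Euc 2 → ℝ → Euc 2) (y : Euc 2) (r : ℝ) : Set (Euc 2) := {q | ∀ t, t ≤ 0 → Φ q t ∈ closedBall y r}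

theorem Frame.swap {eu ev : Euc 2} (F : Frame eu ev) : Frame ev eu :=
  ⟨F.nv, F.nu, by rw [real_inner_comm]; exact F.orth, fun w => by rw [add_comm]; exact F.coord w⟩

theorem Frame.neg_v {eu ev : Euc 2} (F : Frame eu ev) : Frame eu (-ev) :=
  ⟨F.nu, by rw [norm_neg, F.nv], by rw [inner_neg_right, F.orth, neg_zero],
    fun w => by rw [inner_neg_right, smul_neg, neg_smul, neg_neg]; exact F.coord w⟩

theorem first_hit {u : ℝ → ℝ} (hu : Continuous u) {r : ℝ} (h0 : u 0 < r) {t : ℝ} (ht : 0 ≤ t) (h1 : r ≤ u t) :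
    ∃ T, 0 < T ∧ T ≤ t ∧ u T = r ∧ ∀ s, 0 ≤ s → s < T → u s < r := by
  have hc : IsCompact (Icc 0 t ∩ u ⁻¹' (Ici r)) := isCompact_Icc.inter_right (isClosed_Ici.preimage hu)
  obtain ⟨T, hT, hleast⟩ := hc.exists_isLeast ⟨t, ⟨ht, le_rfl⟩, h1⟩
  have hlt : ∀ s, 0 ≤ s → s < T → u s < r := by
    intro s hs hsT
    by_contra hcon
    exact absurd (hleast ⟨⟨hs, hsT.le.trans hT.1.2⟩, not_lt.1 hcon⟩) (not_le.2 hsT)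
  have hT0 : 0 < T := by
    rcases hT.1.1.eq_or_lt with h | h
    · exfalso
      have := hT.2
      rw [← h] at this
      exact absurd this (not_le.2 h0)
    · exact h
  refine ⟨T, hT0, hT.1.2, le_antisymm ?_ hT.2, hlt⟩
  have : Tendsto u (𝓝[<] T) (𝓝 (u T)) := hu.continuousAt.mono_left nhdsWithin_le_nhds
  refine le_of_tendsto this ?_
  filter_upwards [Ioo_mem_nhdsLT hT0] with s hs
  exact (hlt s hs.1.le hs.2).le

namespace LocSaddle
variable {X : Euc 2 → Euc 2} {y eu ev : Euc 2} {a b κ m θ r : ℝ} {K : ℝ≥0} {Φ : Euc 2 → ℝ → Euc 2}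

theorem neg_v (L : LocSaddle X y eu ev a b κ m θ r) : LocSaddle X y eu (-ev) a b κ m θ r :=
  { L with
    fr := L.fr.neg_v
    hv := fun p hp p' hp' => by
      have := L.hv p hp p' hp'
      rw [inner_neg_right, inner_neg_right, mul_neg, ← neg_sub', abs_neg]
      exact this }

theorem rev (L : LocSaddle X y eu ev a b κ m θ r) : LocSaddle (fun p => - X p) y ev eu b a κ m θ r :=
  { L with
    fr := L.fr.swap
    ha := L.hb
    hb := L.ha
    hma := L.hmb
    hmb := L.hma
    hκa := L.hκb
    hκb := L.hκa
    X0 := by rw [L.X0, neg_zero]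
    hu := fun p hp p' hp' => by
      have := L.hv p hp p' hp'
      rw [← neg_sub', inner_neg_left, ← abs_neg, neg_add, neg_neg, ← sub_eq_add_neg]
      exact this
    hv := fun p hp p' hp' => by
      have := L.hu p hp p' hp'
      rw [← neg_sub', inner_neg_left, ← abs_neg, neg_sub', neg_neg, sub_neg_eq_add]
      exact this }

theorem mono_r (L : LocSaddle X y eu ev a b κ m θ r) {r' : ℝ} (h0 : 0 < r') (h : r' ≤ r) :
    LocSaddle X y eu ev a b κ m θ r' :=
  { L with
    hr := h0
    hu := fun p hp p' hp' => L.hu p (closedBall_subset_closedBall h hp) p' (closedBall_subset_closedBall h hp')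
    hv := fun p hp p' hp' => L.hv p (closedBall_subset_closedBall h hp) p' (closedBall_subset_closedBall h hp') }

theorem y_mem (L : LocSaddle X y eu ev a b κ m θ r) : y ∈ closedBall y r := mem_closedBall_self L.hr.le

theorem cone (L : LocSaddle X y eu ev a b κ m θ r) {p p' : Euc 2} (hp : p ∈ closedBall y r) (hp' : p' ∈ closedBall y r) :
    m * ‖p - p'‖ ^ 2 ≤ κ ^ 2 * (2 * ⟪p - p', ev⟫ * ⟪X p - X p', ev⟫) - 2 * ⟪p - p', eu⟫ * ⟪X p - X p', eu⟫ := by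
  have h1 := abs_le.1 (L.hu p hp p' hp')
  have h2 := abs_le.1 (L.hv p hp p' hp')
  have h3 := L.fr.abs_u (p - p')
  have h4 := L.fr.abs_v (p - p')
  have h5 := L.fr.norm_sq (p - p')
  have hθ := L.hθ
  have hθ0 := L.hθ0
  have hma := L.hma
  have hmb := L.hmb
  have hκ := L.hκ
  have hκ1 := L.hκ1
  have ha := L.ha
  have hm := L.hm
  generalize ⟪p - p', eu⟫ = du at *
  generalize ⟪p - p', ev⟫ = dv at *
  generalize ⟪X p - X p', eu⟫ = xu at *
  generalize ⟪X p - X p', ev⟫ = xv at *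
  generalize ‖p - p'‖ = N at *
  have hN : 0 ≤ N := (abs_nonneg _).trans h3
  have h1' : |du * (xu + a * du)| ≤ θ * N ^ 2 := by
    rw [abs_mul]
    calc |du| * |xu + a * du| ≤ N * (θ * N) :=
          mul_le_mul h3 (abs_le.2 h1) (abs_nonneg _) hN
      _ = _ := by ring
  have h2' : |dv * (xv - b * dv)| ≤ θ * N ^ 2 := by
    rw [abs_mul]
    calc |dv| * |xv - b * dv| ≤ N * (θ * N) :=
          mul_le_mul h4 (abs_le.2 h2) (abs_nonneg _) hN
      _ = _ := by ring
  have e1 := (abs_le.1 h1').2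
  have e2 := (abs_le.1 h2').1
  have k1 : κ ^ 2 ≤ 1 := by nlinarith
  have e3 : κ ^ 2 * (-(θ * N ^ 2)) ≤ κ ^ 2 * (dv * (xv - b * dv)) := mul_le_mul_of_nonneg_left e2 (sq_nonneg κ)
  have e4 : κ ^ 2 * (θ * N ^ 2) ≤ 1 * (θ * N ^ 2) := mul_le_mul_of_nonneg_right k1 (by positivity)
  have e5 : m * dv ^ 2 ≤ κ ^ 2 * b * dv ^ 2 := mul_le_mul_of_nonneg_right hmb (sq_nonneg _)
  have e6 : κ ^ 2 * a ≤ 1 * a := mul_le_mul_of_nonneg_right k1 ha.le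
  have e7 : m * du ^ 2 ≤ a * du ^ 2 := mul_le_mul_of_nonneg_right (by linarith) (sq_nonneg _)
  have e8 : θ * N ^ 2 ≤ m / 4 * N ^ 2 := mul_le_mul_of_nonneg_right hθ (sq_nonneg _)
  have e9 : m * N ^ 2 = m * du ^ 2 + m * dv ^ 2 := by rw [h5]; ring
  have g1 : κ ^ 2 * (2 * dv * xv) - 2 * du * xu =
    2 * (κ ^ 2 * (dv * (xv - b * dv))) + 2 * (κ ^ 2 * b * dv ^ 2) - 2 * (du * (xu + a * du)) + 2 * (a * du ^ 2) := by ring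
  rw [g1]
  linarith

theorem hasD (hΦ : GFlow X K Φ) (p p' e : Euc 2) (t : ℝ) :
    HasDerivAt (fun s => ⟪Φ p s - Φ p' s, e⟫) ⟪X (Φ p t) - X (Φ p' t), e⟫ t := by
  have := ((hΦ.deriv p t).sub (hΦ.deriv p' t)).inner ℝ (hasDerivAt_const t e)
  simpa using this

/-- the cone function -/
def gfun (κ : ℝ) (eu ev d : Euc 2) : ℝ := κ ^ 2 * ⟪d, ev⟫ ^ 2 - ⟪d, eu⟫ ^ 2

theorem hasG (hΦ : GFlow X K Φ) (p p' : Euc 2) (t : ℝ) :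
    HasDerivAt (fun s => gfun κ eu ev (Φ p s - Φ p' s))
      (κ ^ 2 * (2 * ⟪Φ p t - Φ p' t, ev⟫ * ⟪X (Φ p t) - X (Φ p' t), ev⟫)
        - 2 * ⟪Φ p t - Φ p' t, eu⟫ * ⟪X (Φ p t) - X (Φ p' t), eu⟫) t := by
  have h1 := (hasD hΦ p p' ev t).pow 2
  have h2 := (hasD hΦ p p' eu t).pow 2
  have := (h1.const_mul (κ ^ 2)).sub h2
  refine this.congr_deriv ?_
  simp

theorem abs_g (L : LocSaddle X y eu ev a b κ m θ r) (d : Euc 2) : |gfun κ eu ev d| ≤ ‖d‖ ^ 2 := by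
  have h := L.fr.norm_sq d
  have k1 : κ ^ 2 ≤ 1 := by nlinarith [L.hκ, L.hκ1]
  have := mul_le_mul_of_nonneg_right k1 (sq_nonneg ⟪d, ev⟫)
  have h2 := mul_nonneg (sq_nonneg κ) (sq_nonneg ⟪d, ev⟫)
  unfold gfun
  rw [abs_le]
  constructor <;> nlinarith [sq_nonneg ⟪d, ev⟫, sq_nonneg ⟪d, eu⟫]

theorem g_nonneg_iff (L : LocSaddle X y eu ev a b κ m θ r) (d : Euc 2) :
    0 ≤ gfun κ eu ev d ↔ |⟪d, eu⟫| ≤ κ * |⟪d, ev⟫| := by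
  unfold gfun
  have hk : |κ * ⟪d, ev⟫| = κ * |⟪d, ev⟫| := by rw [abs_mul, abs_of_pos L.hκ]
  rw [← hk, ← sq_le_sq, mul_pow, sub_nonneg]

/-- growth of `g` along pairs -/
theorem g_growth (L : LocSaddle X y eu ev a b κ m θ r) (hΦ : GFlow X K Φ) {p p' : Euc 2} {α β c : ℝ} (hαβ : α ≤ β)
    (hp : ∀ t ∈ Icc α β, Φ p t ∈ closedBall y r) (hp' : ∀ t ∈ Icc α β, Φ p' t ∈ closedBall y r)
    (hc : ∀ t ∈ Icc α β, c ≤ ‖Φ p t - Φ p' t‖ ^ 2) :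
    gfun κ eu ev (Φ p α - Φ p' α) + m * c * (β - α) ≤ gfun κ eu ev (Φ p β - Φ p' β) := by
  have := (convex_Icc α β).mul_sub_le_image_sub_of_le_deriv (f := fun s => gfun κ eu ev (Φ p s - Φ p' s))
    (C := m * c) (fun t _ => (hasG hΦ p p' t).continuousAt.continuousWithinAt)
    (fun t _ => (hasG hΦ p p' t).differentiableAt.differentiableWithinAt)
    (fun t ht => by
      rw [(hasG hΦ p p' t).deriv]
      have ht' := interior_subset ht
      exact (mul_le_mul_of_nonneg_left (hc t ht') L.hm.le).trans (L.cone (hp t ht') (hp' t ht')))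
    α (left_mem_Icc.2 hαβ) β (right_mem_Icc.2 hαβ) hαβ
  linarith

theorem g_mono (L : LocSaddle X y eu ev a b κ m θ r) (hΦ : GFlow X K Φ) {p p' : Euc 2} {α β : ℝ} (hαβ : α ≤ β)
    (hp : ∀ t ∈ Icc α β, Φ p t ∈ closedBall y r) (hp' : ∀ t ∈ Icc α β, Φ p' t ∈ closedBall y r) :
    gfun κ eu ev (Φ p α - Φ p' α) ≤ gfun κ eu ev (Φ p β - Φ p' β) := by
  have := L.g_growth hΦ hαβ hp hp' (c := 0) (fun t _ => sq_nonneg _)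
  linarith

theorem dist_two {p p' : Euc 2} (hp : p ∈ closedBall y r) (hp' : p' ∈ closedBall y r) : ‖p - p'‖ ≤ 2 * r := by
  rw [← dist_eq_norm]
  have := dist_triangle_right p p' y
  linarith [mem_closedBall.1 hp, mem_closedBall.1 hp']

theorem W_back (hΦ : GFlow X K Φ) {p : Euc 2} (hp : p ∈ Wset Φ y r) {t : ℝ} (ht : t ≤ 0) : Φ p t ∈ Wset Φ y r := by
  intro s hs
  rw [← hΦ.add]
  exact hp _ (by linarith)

theorem W_mem (hΦ : GFlow X K Φ) {p : Euc 2} (hp : p ∈ Wset Φ y r) : p ∈ closedBall y r := by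
  have := hp 0 le_rfl
  rwa [hΦ.zero] at this

theorem y_W (L : LocSaddle X y eu ev a b κ m θ r) (hΦ : GFlow X K Φ) : y ∈ Wset Φ y r := by
  intro t _
  rw [hΦ.fixed L.X0]
  exact L.y_mem

/-- pairs in the unstable set are cone-related -/
theorem W_cone (L : LocSaddle X y eu ev a b κ m θ r) (hΦ : GFlow X K Φ) {p p' : Euc 2}
    (hp : p ∈ Wset Φ y r) (hp' : p' ∈ Wset Φ y r) : |⟪p - p', eu⟫| ≤ κ * |⟪p - p', ev⟫| := by
  rw [← L.g_nonneg_iff]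
  by_contra hneg
  push Not at hneg
  have hs : ∀ t, t ≤ 0 → gfun κ eu ev (Φ p t - Φ p' t) ≤ gfun κ eu ev (p - p') := by
    intro t ht
    have := L.g_mono hΦ ht (fun s hs => hp s hs.2) (fun s hs => hp' s hs.2)
    rwa [hΦ.zero, hΦ.zero] at this
  set c := - gfun κ eu ev (p - p') with hc
  have hc0 : 0 < c := by linarith
  obtain ⟨T, hT⟩ : ∃ T : ℝ, T = (4 * r ^ 2 + 1) / (m * c) := ⟨_, rfl⟩
  have hmc : 0 < m * c := mul_pos L.hm hc0
  have hT0 : 0 ≤ T := by rw [hT]; positivity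
  have h1 := L.g_growth hΦ (p := p) (p' := p') (α := -T) (β := 0) (c := c) (by linarith) (fun s hs => hp s hs.2)
    (fun s hs => hp' s hs.2) (fun t ht => by
      have := (abs_le.1 (L.abs_g (Φ p t - Φ p' t))).1
      linarith [hs t ht.2])
  have h2 := (abs_le.1 (L.abs_g (Φ p (-T) - Φ p' (-T)))).1
  have h3 := dist_two (hp (-T) (by linarith)) (hp' (-T) (by linarith))
  have h4 : ‖Φ p (-T) - Φ p' (-T)‖ ^ 2 ≤ (2 * r) ^ 2 := pow_le_pow_left₀ (norm_nonneg _) h3 2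
  rw [hΦ.zero, hΦ.zero] at h1
  have h5 : m * c * (0 - -T) = 4 * r ^ 2 + 1 := by rw [hT, sub_neg_eq_add, zero_add]; exact mul_div_cancel₀ _ hmc.ne'
  rw [h5] at h1
  nlinarith

theorem W_inj (L : LocSaddle X y eu ev a b κ m θ r) (hΦ : GFlow X K Φ) {p p' : Euc 2}
    (hp : p ∈ Wset Φ y r) (hp' : p' ∈ Wset Φ y r) (h : ⟪p - y, ev⟫ = ⟪p' - y, ev⟫) : p = p' := by
  have h1 := L.W_cone hΦ hp hp'
  have h2 : ⟪p - p', ev⟫ = 0 := by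
    have : p - p' = (p - y) - (p' - y) := by abel
    rw [this, inner_sub_left, h, sub_self]
  rw [h2, abs_zero, mul_zero] at h1
  have h3 : ⟪p - p', eu⟫ = 0 := abs_eq_zero.1 (le_antisymm h1 (abs_nonneg _))
  have := L.fr.coord (p - p')
  rw [h2, h3, zero_smul, zero_smul, add_zero] at this
  exact sub_eq_zero.1 this

/-- norm control in the cone -/
theorem cone_norm (L : LocSaddle X y eu ev a b κ m θ r) {d : Euc 2} (h : |⟪d, eu⟫| ≤ κ * |⟪d, ev⟫|) :
    ‖d‖ ≤ (1 + κ) * |⟪d, ev⟫| := by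
  have := L.fr.norm_le d
  linarith

theorem vv_growth (L : LocSaddle X y eu ev a b κ m θ r) {p : Euc 2} (hp : p ∈ closedBall y r)
    (h : |⟪p - y, eu⟫| ≤ κ * |⟪p - y, ev⟫|) : b * ⟪p - y, ev⟫ ^ 2 ≤ 2 * ⟪p - y, ev⟫ * ⟪X p, ev⟫ := by
  have h1 := L.hv p hp y L.y_mem
  rw [L.X0, sub_zero] at h1
  have h2 := L.cone_norm h
  have hθ := L.hθ
  have hmb := L.hmb
  have hκ := L.hκ
  have hκ1 := L.hκ1
  have hb := L.hb
  have hθ0 := L.hθ0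
  generalize ⟪p - y, ev⟫ = v at *
  generalize ⟪X p, ev⟫ = xv at *
  generalize ‖p - y‖ = N at *
  have h3 : |v * (xv - b * v)| ≤ θ * (2 * |v| * |v|) := by
    rw [abs_mul]
    have e1 : N ≤ 2 * |v| := h2.trans (mul_le_mul_of_nonneg_right (by linarith) (abs_nonneg _))
    calc |v| * |xv - b * v| ≤ |v| * (θ * (2 * |v|)) := mul_le_mul_of_nonneg_left
          (h1.trans (mul_le_mul_of_nonneg_left e1 hθ0)) (abs_nonneg _)
      _ = _ := by ring
  have h4 : 2 * |v| * |v| = 2 * v ^ 2 := by rw [mul_assoc, ← sq, sq_abs]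
  rw [h4] at h3
  have k1 : κ ^ 2 ≤ 1 := by nlinarith
  have h5 : θ ≤ b / 4 := by nlinarith
  have h6 : θ * (2 * v ^ 2) ≤ b / 4 * (2 * v ^ 2) := mul_le_mul_of_nonneg_right h5 (by positivity)
  have h7 := (abs_le.1 h3).1
  have : 2 * v * xv = 2 * (v * (xv - b * v)) + 2 * b * v ^ 2 := by ring
  rw [this]
  linarith

theorem hasV (hΦ : GFlow X K Φ) (p e : Euc 2) (t : ℝ) :
    HasDerivAt (fun s => ⟪Φ p s - y, e⟫) ⟪X (Φ p t), e⟫ t := by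
  have := ((hΦ.deriv p t).sub_const y).inner ℝ (hasDerivAt_const t e)
  simpa using this

theorem W_decay (L : LocSaddle X y eu ev a b κ m θ r) (hΦ : GFlow X K Φ) {p : Euc 2}
    (hp : p ∈ Wset Φ y r) {t : ℝ} (ht : t ≤ 0) :
    ⟪Φ p t - y, ev⟫ ^ 2 ≤ ⟪p - y, ev⟫ ^ 2 * Real.exp (b * t) := by
  have hD : ∀ s, HasDerivAt (fun s => ⟪Φ p s - y, ev⟫ ^ 2 * Real.exp (-(b * s)))
      ((2 * ⟪Φ p s - y, ev⟫ * ⟪X (Φ p s), ev⟫ - b * ⟪Φ p s - y, ev⟫ ^ 2) * Real.exp (-(b * s))) s := by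
    intro s
    have h1 := (hasV (y := y) hΦ p ev s).pow 2
    have h2 := (((hasDerivAt_id s).const_mul b).neg).exp
    refine (h1.mul h2).congr_deriv ?_
    simp
    ring
  have hm : MonotoneOn (fun s => ⟪Φ p s - y, ev⟫ ^ 2 * Real.exp (-(b * s))) (Iic 0) := by
    refine monotoneOn_of_deriv_nonneg (convex_Iic 0) (fun s _ => (hD s).continuousAt.continuousWithinAt)
      (fun s _ => (hD s).differentiableAt.differentiableWithinAt) (fun s hs => ?_)
    rw [(hD s).deriv]
    have hs' : s ≤ 0 := mem_Iic.1 (interior_subset hs)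
    refine mul_nonneg ?_ (Real.exp_pos _).le
    have := L.vv_growth (hp s hs') (L.W_cone hΦ (W_back hΦ hp hs') (L.y_W hΦ))
    linarith
  have := hm (mem_Iic.2 ht) (mem_Iic.2 le_rfl) ht
  simp only [mul_zero, neg_zero, Real.exp_zero, mul_one, hΦ.zero] at this
  rw [Real.exp_neg] at this
  have he := Real.exp_pos (b * t)
  rwa [← div_eq_mul_inv, div_le_iff₀ he] at this

theorem W_tendsto (L : LocSaddle X y eu ev a b κ m θ r) (hΦ : GFlow X K Φ) {p : Euc 2}
    (hp : p ∈ Wset Φ y r) : Tendsto (Φ p) atBot (𝓝 y) := by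
  have h1 : Tendsto (fun t : ℝ => ⟪p - y, ev⟫ ^ 2 * Real.exp (b * t)) atBot (𝓝 0) := by
    have : Tendsto (fun t : ℝ => Real.exp (b * t)) atBot (𝓝 0) :=
      Real.tendsto_exp_atBot.comp (tendsto_id.const_mul_atBot L.hb)
    simpa using this.const_mul (⟪p - y, ev⟫ ^ 2)
  have h2 : Tendsto (fun t : ℝ => 4 * (⟪p - y, ev⟫ ^ 2 * Real.exp (b * t))) atBot (𝓝 0) := by
    simpa using h1.const_mul 4
  have h3 : Tendsto (fun t => ‖Φ p t - y‖ ^ 2) atBot (𝓝 0) := by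
    refine tendsto_of_tendsto_of_tendsto_of_le_of_le' tendsto_const_nhds h2
      (Eventually.of_forall fun t => sq_nonneg _) ?_
    filter_upwards [eventually_le_atBot 0] with t ht
    have a1 := L.cone_norm (L.W_cone hΦ (W_back hΦ hp ht) (L.y_W hΦ))
    have a2 : ‖Φ p t - y‖ ≤ 2 * |⟪Φ p t - y, ev⟫| :=
      a1.trans (mul_le_mul_of_nonneg_right (by linarith [L.hκ1]) (abs_nonneg _))
    have a3 := pow_le_pow_left₀ (norm_nonneg _) a2 2
    rw [mul_pow, sq_abs] at a3
    linarith [L.W_decay hΦ hp ht]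
  rw [tendsto_iff_norm_sub_tendsto_zero]
  have h4 := h3.sqrt
  simpa [Real.sqrt_sq (norm_nonneg _)] using h4

/-- nonzero vertical coordinate on `W \ {y}` -/
theorem W_vne (L : LocSaddle X y eu ev a b κ m θ r) (hΦ : GFlow X K Φ) {p : Euc 2}
    (hp : p ∈ Wset Φ y r) (hne : p ≠ y) : ⟪p - y, ev⟫ ≠ 0 := by
  intro h
  exact hne (L.W_inj hΦ hp (L.y_W hΦ) (by rw [h, sub_self, inner_zero_left]))

theorem ne_of_ne (L : LocSaddle X y eu ev a b κ m θ r) (hΦ : GFlow X K Φ) {p : Euc 2} (hne : p ≠ y) (t : ℝ) :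
    Φ p t ≠ y := by
  intro h
  refine hne (hΦ.inj (t := t) ?_)
  rw [h, hΦ.fixed L.X0]

theorem W_pos (L : LocSaddle X y eu ev a b κ m θ r) (hΦ : GFlow X K Φ) {p : Euc 2}
    (hp : p ∈ Wset Φ y r) (h : 0 < ⟪p - y, ev⟫) {t : ℝ} (ht : t ≤ 0) : 0 < ⟪Φ p t - y, ev⟫ := by
  by_contra hcon
  push Not at hcon
  have hc : Continuous (fun s => ⟪Φ p s - y, ev⟫) :=
    continuous_iff_continuousAt.2 fun s => (hasV hΦ p ev s).continuousAt
  obtain ⟨s, hs, hs0⟩ := intermediate_value_Icc ht hc.continuousOn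
    (show (0:ℝ) ∈ Icc ⟪Φ p t - y, ev⟫ ⟪Φ p 0 - y, ev⟫ from ⟨hcon, by rw [hΦ.zero]; exact h.le⟩)
  have hne : p ≠ y := by
    rintro rfl
    simp at h
  exact L.W_vne hΦ (W_back hΦ hp hs.2) (L.ne_of_ne hΦ hne s) hs0

/-- all heights are attained -/
theorem W_height (L : LocSaddle X y eu ev a b κ m θ r) (hΦ : GFlow X K Φ) {p : Euc 2}
    (hp : p ∈ Wset Φ y r) {ℓ : ℝ} (hℓ : 0 < ℓ) (hℓ' : ℓ ≤ ⟪p - y, ev⟫) :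
    ∃ t, t ≤ 0 ∧ ⟪Φ p t - y, ev⟫ = ℓ := by
  have hc : Continuous (fun s => ⟪Φ p s - y, ev⟫) :=
    continuous_iff_continuousAt.2 fun s => (hasV hΦ p ev s).continuousAt
  have hl : Tendsto (fun s => ⟪Φ p s - y, ev⟫) atBot (𝓝 0) := by
    have := ((L.W_tendsto hΦ hp).sub_const y).inner (𝕜 := ℝ) (tendsto_const_nhds (x := ev))
    simpa using this
  obtain ⟨t, h1, h2⟩ := ((hl.eventually (gt_mem_nhds hℓ)).and (eventually_le_atBot 0)).exists
  obtain ⟨s, hs, hs0⟩ := intermediate_value_Icc h2 hc.continuousOn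
    (show ℓ ∈ Icc ⟪Φ p t - y, ev⟫ ⟪Φ p 0 - y, ev⟫ from ⟨h1.le, by rw [hΦ.zero]; exact hℓ'⟩)
  exact ⟨s, hs.2, hs0⟩

/-- two points of `W` on the same side are on the same orbit -/
theorem W_unique (L : LocSaddle X y eu ev a b κ m θ r) (hΦ : GFlow X K Φ) {p p' : Euc 2}
    (hp : p ∈ Wset Φ y r) (hp' : p' ∈ Wset Φ y r) (h : 0 < ⟪p - y, ev⟫) (h' : 0 < ⟪p' - y, ev⟫) :
    ∃ t, Φ p t = p' := by
  rcases le_total ⟪p' - y, ev⟫ ⟪p - y, ev⟫ with hle | hle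
  · obtain ⟨t, ht, ht'⟩ := L.W_height hΦ hp h' hle
    exact ⟨t, L.W_inj hΦ (W_back hΦ hp ht) hp' ht'⟩
  · obtain ⟨t, ht, ht'⟩ := L.W_height hΦ hp' h hle
    have := L.W_inj hΦ (W_back hΦ hp' ht) hp ht'
    exact ⟨-t, by rw [← this, hΦ.neg_cancel]⟩

/-- limits of long orbit segments belong to the unstable set -/
theorem sphere_limit (L : LocSaddle X y eu ev a b κ m θ r) (hΦ : GFlow X K Φ) {S : Set (Euc 2)} (hS : IsCompact S)
    (hyS : y ∉ S) (h : ∀ ρ > 0, ∃ p ∈ ball y ρ, ∃ T, 0 ≤ T ∧ (∀ s, 0 ≤ s → s ≤ T → Φ p s ∈ closedBall y r) ∧ Φ p T ∈ S) :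
    ∃ q ∈ S, q ∈ Wset Φ y r := by
  choose p hp T hT0 hT hTS using fun n : ℕ => h (1 / ((n:ℝ) + 1)) Nat.one_div_pos_of_nat
  obtain ⟨q, hq, σ, hσ, hlim⟩ := hS.tendsto_subseq hTS
  refine ⟨q, hq, fun t ht => ?_⟩
  have h1 : Tendsto (fun n => Φ (Φ (p (σ n)) (T (σ n))) t) atTop (𝓝 (Φ q t)) :=
    ((hΦ.cont1 t).tendsto q).comp hlim
  refine isClosed_closedBall.mem_of_tendsto h1 ?_
  obtain ⟨s, hs, hsS⟩ : ∃ s > 0, ∀ z ∈ S, s ≤ dist z y := by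
    have : Sᶜ ∈ 𝓝 y := hS.isClosed.isOpen_compl.mem_nhds hyS
    obtain ⟨s, hs, hsub⟩ := Metric.mem_nhds_iff.1 this
    exact ⟨s, hs, fun z hz => by
      by_contra hcon
      exact hsub (mem_ball.2 (not_le.1 hcon)) hz⟩
  have h2 : Tendsto (fun n : ℕ => 1 / ((σ n:ℝ) + 1) * Real.exp (K * |t|)) atTop (𝓝 0) := by
    have := (tendsto_one_div_add_atTop_nhds_zero_nat (𝕜 := ℝ)).comp hσ.tendsto_atTop
    simpa using this.mul_const (Real.exp (K * |t|))
  filter_upwards [h2.eventually (gt_mem_nhds hs)] with n hn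
  rw [← hΦ.add]
  have hTn : -t ≤ T (σ n) := by
    by_contra hcon
    push Not at hcon
    have a1 := hΦ.dist_le (p (σ n)) y (T (σ n))
    rw [hΦ.fixed L.X0] at a1
    have a2 := hsS _ (hTS (σ n))
    have a3 : Real.exp (K * |T (σ n)|) ≤ Real.exp (K * |t|) := by
      apply Real.exp_le_exp.2
      apply mul_le_mul_of_nonneg_left _ K.2
      rw [abs_of_nonneg (hT0 _), abs_of_nonpos ht]
      exact hcon.le
    have a4 : dist (p (σ n)) y * Real.exp (K * |T (σ n)|) ≤ 1 / ((σ n:ℝ) + 1) * Real.exp (K * |t|) :=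
      mul_le_mul (mem_ball.1 (hp (σ n))).le a3 (Real.exp_pos _).le (by positivity)
    linarith
  exact hT _ _ (by linarith) (by linarith)

/-- exit lemma -/
theorem exit_open (L : LocSaddle X y eu ev a b κ m θ r) (hΦ : GFlow X K Φ) {O : Set (Euc 2)} (hO : IsOpen O)
    (hW : ∀ q ∈ Wset Φ y r, q ≠ y → q ∈ O) :
    ∃ ρ > 0, ∀ p ∈ ball y ρ, (∀ t, 0 ≤ t → Φ p t ∈ closedBall y r) ∨ ∃ T, 0 ≤ T ∧ Φ p T ∈ O := by
  by_contra hcon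
  push Not at hcon
  have hyS : y ∉ sphere y r ∩ Oᶜ := by
    intro h
    have := mem_sphere.1 h.1
    rw [dist_self] at this
    linarith [L.hr]
  obtain ⟨q, hq, hqW⟩ := L.sphere_limit hΦ (S := sphere y r ∩ Oᶜ)
    ((isCompact_sphere y r).inter_right hO.isClosed_compl) hyS (fun ρ hρ => by
      obtain ⟨p, hp, ⟨t, ht, hex⟩, hno⟩ := hcon (min ρ r) (lt_min hρ L.hr)
      have hp' : dist p y < min ρ r := hp
      have hc : Continuous (fun s => dist (Φ p s) y) := (hΦ.cont p).dist continuous_const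
      obtain ⟨T, hT, -, hTr, hlt⟩ := first_hit hc (r := r) (by rw [hΦ.zero]; exact hp'.trans_le (min_le_right _ _)) ht
        (not_le.1 (fun h => hex (mem_closedBall.2 h))).le
      refine ⟨p, mem_ball.2 (hp'.trans_le (min_le_left _ _)), T, hT.le, fun s hs hsT => ?_, mem_sphere.2 hTr, hno T hT.le⟩
      rcases hsT.eq_or_lt with h | h
      · rw [h]; exact mem_closedBall.2 hTr.le
      · exact mem_closedBall.2 (hlt s hs h).le)
  refine hq.2 (hW q hqW ?_)
  rintro rfl
  exact hyS hq

/-- existence of the positive half of the unstable set -/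
theorem W_exists (L : LocSaddle X y eu ev a b κ m θ r) (hΦ : GFlow X K Φ) :
    ∃ q ∈ Wset Φ y r, 0 < ⟪q - y, ev⟫ := by
  have hcu : Continuous (fun q : Euc 2 => ⟪q - y, eu⟫) := by fun_prop
  have hcv : Continuous (fun q : Euc 2 => ⟪q - y, ev⟫) := by fun_prop
  have hSc : IsCompact (sphere y r ∩ {q | 0 ≤ ⟪q - y, ev⟫}) :=
    (isCompact_sphere y r).inter_right (isClosed_le continuous_const hcv)
  have hyS : y ∉ sphere y r ∩ {q | 0 ≤ ⟪q - y, ev⟫} := by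
    intro h
    have := mem_sphere.1 h.1
    rw [dist_self] at this
    linarith [L.hr]
  obtain ⟨q, hq, hqW⟩ := L.sphere_limit hΦ hSc hyS (fun ρ hρ => by
    obtain ⟨ε, hε0, hε⟩ := exists_between (lt_min hρ L.hr)
    have hd : dist (y + ε • ev) y = ε := by
      rw [dist_eq_norm, add_sub_cancel_left, norm_smul, L.fr.nv, mul_one, Real.norm_of_nonneg hε0.le]
    obtain ⟨p, hpe⟩ : ∃ p, p = y + ε • ev := ⟨_, rfl⟩
    rw [← hpe] at hd
    have hpv : ⟪p - y, ev⟫ = ε := by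
      rw [hpe, add_sub_cancel_left, inner_smul_left, real_inner_self_eq_norm_sq, L.fr.nv]; simp
    have hpu : ⟪p - y, eu⟫ = 0 := by
      rw [hpe, add_sub_cancel_left, inner_smul_left, real_inner_comm, L.fr.orth]; simp
    have hg0 : gfun κ eu ev (p - y) = κ ^ 2 * ε ^ 2 := by
      unfold gfun; rw [hpv, hpu]; ring
    have hgp : 0 < κ ^ 2 * ε ^ 2 := by have := L.hκ; positivity
    have hgg : ∀ t, 0 ≤ t → (∀ s, 0 ≤ s → s ≤ t → Φ p s ∈ closedBall y r) →
        κ ^ 2 * ε ^ 2 ≤ gfun κ eu ev (Φ p t - y) := by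
      intro t ht hst
      have := L.g_mono hΦ (p := p) (p' := y) ht (fun s hs => hst s hs.1 hs.2)
        (fun s _ => by rw [hΦ.fixed L.X0]; exact L.y_mem)
      rwa [hΦ.fixed L.X0, hΦ.fixed L.X0, hΦ.zero, hg0] at this
    have hexit : ∃ t, 0 ≤ t ∧ r ≤ dist (Φ p t) y := by
      by_contra hno
      push Not at hno
      have hin : ∀ s, 0 ≤ s → Φ p s ∈ closedBall y r := fun s hs => mem_closedBall.2 (hno s hs).le
      obtain ⟨T, hT⟩ : ∃ T : ℝ, T = (r ^ 2 + 1) / (m * (κ ^ 2 * ε ^ 2)) := ⟨_, rfl⟩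
      have hmc : 0 < m * (κ ^ 2 * ε ^ 2) := mul_pos L.hm hgp
      have hT0 : 0 ≤ T := by rw [hT]; positivity
      have h1 := L.g_growth hΦ (p := p) (p' := y) (c := κ ^ 2 * ε ^ 2) hT0 (fun s hs => hin s hs.1)
        (fun s _ => by rw [hΦ.fixed L.X0]; exact L.y_mem) (fun t ht => by
          rw [hΦ.fixed L.X0]
          exact (hgg t ht.1 (fun s hs _ => hin s hs)).trans ((le_abs_self _).trans (L.abs_g _)))
      rw [hΦ.fixed L.X0, hΦ.fixed L.X0, hΦ.zero, hg0] at h1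
      have h5 : m * (κ ^ 2 * ε ^ 2) * (T - 0) = r ^ 2 + 1 := by rw [hT, sub_zero]; exact mul_div_cancel₀ _ hmc.ne'
      rw [h5] at h1
      have h2 := (le_abs_self _).trans (L.abs_g (Φ p T - y))
      have h3 : ‖Φ p T - y‖ ^ 2 ≤ r ^ 2 := pow_le_pow_left₀ (norm_nonneg _)
        (by rw [← dist_eq_norm]; exact (hno T hT0).le) 2
      linarith
    obtain ⟨t, ht, htr⟩ := hexit
    have hc : Continuous (fun s => dist (Φ p s) y) := (hΦ.cont p).dist continuous_const
    obtain ⟨T, hT, -, hTr, hlt⟩ := first_hit hc (r := r)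
      (by rw [hΦ.zero, hd]; exact hε.trans_le (min_le_right _ _)) ht htr
    have hin : ∀ s, 0 ≤ s → s ≤ T → Φ p s ∈ closedBall y r := by
      intro s hs hsT
      rcases hsT.eq_or_lt with h | h
      · rw [h]; exact mem_closedBall.2 hTr.le
      · exact mem_closedBall.2 (hlt s hs h).le
    refine ⟨p, mem_ball.2 (by rw [hd]; exact hε.trans_le (min_le_left _ _)), T, hT.le, hin, mem_sphere.2 hTr, ?_⟩
    by_contra hneg
    have hneg' : ⟪Φ p T - y, ev⟫ < 0 := not_le.1 hneg
    have hcv' : Continuous (fun s => ⟪Φ p s - y, ev⟫) :=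
      continuous_iff_continuousAt.2 fun s => (hasV hΦ p ev s).continuousAt
    obtain ⟨s, hs, hs0⟩ := intermediate_value_Icc' hT.le hcv'.continuousOn
      (show (0:ℝ) ∈ Icc ⟪Φ p T - y, ev⟫ ⟪Φ p 0 - y, ev⟫ from ⟨hneg'.le, by rw [hΦ.zero, hpv]; exact hε0.le⟩)
    have h1 := hgg s hs.1 (fun s' h h' => hin s' h (h'.trans hs.2))
    simp only at hs0
    unfold gfun at h1
    rw [hs0] at h1
    nlinarith [sq_nonneg ⟪Φ p s - y, eu⟫])
  refine ⟨q, hqW, lt_of_le_of_ne hq.2 (Ne.symm (L.W_vne hΦ hqW ?_))⟩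
  rintro rfl
  exact hyS hq

/-- radial derivative in the unstable cone -/
theorem radial (L : LocSaddle X y eu ev a b κ m θ r) {p : Euc 2} (hp : p ∈ closedBall y r)
    (h : |⟪p - y, eu⟫| ≤ κ * |⟪p - y, ev⟫|) : b / 4 * ⟪p - y, ev⟫ ^ 2 ≤ ⟪X p, p - y⟫ := by
  have h1 := L.hu p hp y L.y_mem
  have h2 := L.hv p hp y L.y_mem
  rw [L.X0, sub_zero] at h1 h2
  have h3 := L.cone_norm h
  rw [L.fr.inner_eq (X p) (p - y)]
  have hθ := L.hθ
  have hθ0 := L.hθ0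
  have hmb := L.hmb
  have hκ := L.hκ
  have hκ1 := L.hκ1
  have hκa := L.hκa
  have hb := L.hb
  have ha := L.ha
  have hN := norm_nonneg (p - y)
  generalize ⟪p - y, eu⟫ = u at *
  generalize ⟪p - y, ev⟫ = v at *
  generalize ⟪X p, eu⟫ = xu at *
  generalize ⟪X p, ev⟫ = xv at *
  generalize ‖p - y‖ = N at *
  have hv0 := abs_nonneg v
  have k0 : κ ^ 2 ≤ 1 / 4 := by
    have := pow_le_pow_left₀ hκ.le hκ1 2
    linarith
  have h5 : θ ≤ b / 16 := by
    have := mul_le_mul_of_nonneg_right k0 hb.le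
    linarith
  have e1 : N ≤ 3 / 2 * |v| := h3.trans (mul_le_mul_of_nonneg_right (by linarith) (abs_nonneg _))
  have e2 : |u| ≤ 1 / 2 * |v| := h.trans (mul_le_mul_of_nonneg_right hκ1 hv0)
  have hB : θ * N ≤ b / 16 * (3 / 2 * |v|) := mul_le_mul h5 e1 hN (by linarith)
  have hvv : |v| * |v| = v ^ 2 := by rw [← sq, sq_abs]
  have f1 : |u * (xu + a * u)| ≤ (1 / 2 * |v|) * (b / 16 * (3 / 2 * |v|)) := by
    rw [abs_mul]
    exact mul_le_mul e2 (h1.trans hB) (abs_nonneg _) (by linarith)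
  have f2 : |v * (xv - b * v)| ≤ |v| * (b / 16 * (3 / 2 * |v|)) := by
    rw [abs_mul]
    exact mul_le_mul_of_nonneg_left (h2.trans hB) hv0
  have f3 : u ^ 2 ≤ κ ^ 2 * v ^ 2 := by
    have := pow_le_pow_left₀ (abs_nonneg _) h 2
    rwa [mul_pow, sq_abs, sq_abs] at this
  have f4 := mul_le_mul_of_nonneg_left f3 ha.le
  have f5 := mul_le_mul_of_nonneg_right hκa (sq_nonneg v)
  have g1 := (abs_le.1 f1).1
  have g2 := (abs_le.1 f2).1
  have : xu * u + xv * v = u * (xu + a * u) - a * u ^ 2 + v * (xv - b * v) + b * v ^ 2 := by ring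
  rw [this]
  have r1 : (1 / 2 * |v|) * (b / 16 * (3 / 2 * |v|)) = 3 / 64 * (b * v ^ 2) := by rw [← hvv]; ring
  have r2 : |v| * (b / 16 * (3 / 2 * |v|)) = 3 / 32 * (b * v ^ 2) := by rw [← hvv]; ring
  rw [r1] at g1
  rw [r2] at g2
  have : 0 ≤ b * v ^ 2 := by positivity
  linarith

theorem cone_smul {d : Euc 2} (h : |⟪d, eu⟫| ≤ κ * |⟪d, ev⟫|) (s : ℝ) :
    |⟪s • d, eu⟫| ≤ κ * |⟪s • d, ev⟫| := by
  rw [real_inner_smul_left, real_inner_smul_left, abs_mul, abs_mul]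
  have := mul_le_mul_of_nonneg_left h (abs_nonneg s)
  linarith

theorem ball_smul {d : Euc 2} {s : ℝ} (h : y + d ∈ closedBall y r) (hs : s ∈ Icc (0:ℝ) 1) : y + s • d ∈ closedBall y r := by
  rw [mem_closedBall, dist_eq_norm, add_sub_cancel_left] at *
  rw [norm_smul, Real.norm_of_nonneg hs.1]
  exact (mul_le_of_le_one_left (norm_nonneg _) hs.2).trans h

/-- the potential increases along rays in the unstable cone -/
theorem phi_ray (L : LocSaddle X y eu ev a b κ m θ r) {φ : Euc 2 → ℝ} {f : Euc 2 → Euc 2} (B : Base φ f)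
    (hX : ∀ p ∈ closedBall y r, X p = f p) {d : Euc 2} (hd : y + d ∈ closedBall y r) (hne : d ≠ 0)
    (h : |⟪d, eu⟫| ≤ κ * |⟪d, ev⟫|) : StrictMonoOn (fun s : ℝ => φ (y + s • d)) (Icc 0 1) := by
  have hD : ∀ s : ℝ, HasDerivAt (fun s : ℝ => φ (y + s • d)) ⟪f (y + s • d), d⟫ s := by
    intro s
    have : HasDerivAt (fun s : ℝ => y + s • d) d s := by
      simpa using ((hasDerivAt_id s).smul_const d).const_add y
    exact B.deriv_along this
  refine strictMonoOn_of_deriv_pos (convex_Icc 0 1) (fun s _ => (hD s).continuousAt.continuousWithinAt) (fun s hs => ?_)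
  rw [interior_Icc] at hs
  rw [(hD s).deriv]
  have hin := ball_smul hd (s := s) ⟨hs.1.le, hs.2.le⟩
  have h1 := L.radial hin (by rw [add_sub_cancel_left]; exact cone_smul h s)
  rw [add_sub_cancel_left, hX _ hin, real_inner_smul_right, real_inner_smul_left] at h1
  have hv : ⟪d, ev⟫ ≠ 0 := by
    intro h0
    have := L.cone_norm h
    rw [h0, abs_zero, mul_zero] at this
    exact hne (norm_le_zero_iff.1 this)
  have hb := L.hb
  have h2 : 0 < b / 4 * (s * ⟪d, ev⟫) ^ 2 := by
    have := hs.1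
    positivity
  by_contra hcon
  have := mul_nonpos_of_nonneg_of_nonpos hs.1.le (not_lt.1 hcon)
  linarith

theorem phi_gt (L : LocSaddle X y eu ev a b κ m θ r) {φ : Euc 2 → ℝ} {f : Euc 2 → Euc 2} (B : Base φ f)
    (hX : ∀ p ∈ closedBall y r, X p = f p) {p : Euc 2} (hd : p ∈ closedBall y r) (hne : p ≠ y)
    (h : |⟪p - y, eu⟫| ≤ κ * |⟪p - y, ev⟫|) : φ y < φ p := by
  have := L.phi_ray B hX (d := p - y) (by rwa [add_sub_cancel]) (sub_ne_zero.2 hne) h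
    (left_mem_Icc.2 zero_le_one) (right_mem_Icc.2 zero_le_one) zero_lt_one
  simpa using this
end LocSaddle


theorem basis_frame (e : OrthonormalBasis (Fin 2) ℝ (Euc 2)) : Frame (e 0) (e 1) := by
  refine ⟨e.norm_eq_one 0, e.norm_eq_one 1, e.inner_eq_zero (by decide), fun w => ?_⟩
  have := e.sum_repr' w
  rw [Fin.sum_univ_two] at this
  rw [real_inner_comm, real_inner_comm (e 1) w]
  exact this.symm

theorem saddle_frame {φ : Euc 2 → ℝ} {f : Euc 2 → Euc 2} (B : Base φ f) {y : Euc 2} (hy : IsSaddleAt f y) :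
    ∃ (eu ev : Euc 2) (a b : ℝ), Frame eu ev ∧ 0 < a ∧ 0 < b ∧ fderiv ℝ f y eu = (-a) • eu ∧ fderiv ℝ f y ev = b • ev := by
  have hT : ((fderiv ℝ f y : Euc 2 →L[ℝ] Euc 2) : Euc 2 →ₗ[ℝ] Euc 2).IsSymmetric := fun v w => B.symm y v w
  have hn : Module.finrank ℝ (Euc 2) = 2 := finrank_euclideanSpace_fin
  obtain ⟨e, he⟩ : ∃ e, e = hT.eigenvectorBasis hn := ⟨_, rfl⟩
  obtain ⟨lam, hlam⟩ : ∃ lam, lam = hT.eigenvalues hn := ⟨_, rfl⟩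
  have hA : ∀ i, fderiv ℝ f y (e i) = lam i • e i := by
    intro i
    have := hT.apply_eigenvectorBasis hn i
    rw [he, hlam]
    exact this
  have hne : ∀ i, lam i ≠ 0 := by
    intro i h0
    have h1 := hA i
    rw [h0, zero_smul] at h1
    have h2 := B.nondeg y hy.1 (h1.trans (map_zero (fderiv ℝ f y)).symm)
    have := e.norm_eq_one i
    rw [h2, norm_zero] at this
    exact zero_ne_one this
  have F := basis_frame e
  have hq : ∀ v, ⟪fderiv ℝ f y v, v⟫ = lam 0 * ⟪v, e 0⟫ ^ 2 + lam 1 * ⟪v, e 1⟫ ^ 2 := by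
    intro v
    rw [F.inner_eq, B.symm, B.symm, hA, hA, real_inner_smul_right, real_inner_smul_right]
    ring
  have hpos : ∀ v : Euc 2, v ≠ 0 → ⟪v, e 0⟫ ≠ 0 ∨ ⟪v, e 1⟫ ≠ 0 := by
    intro v hv
    by_contra hcon
    push Not at hcon
    apply hv
    rw [F.coord v, hcon.1, hcon.2]
    simp
  rcases lt_or_gt_of_ne (hne 0) with h0 | h0 <;> rcases lt_or_gt_of_ne (hne 1) with h1 | h1
  · exfalso
    refine hy.2.2 ⟨hy.1, fun v hv => ?_⟩
    rw [hq]
    rcases hpos v hv with h | h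
    · nlinarith [mul_pos (neg_pos.2 h0) (sq_pos_of_ne_zero h), mul_nonneg (neg_pos.2 h1).le (sq_nonneg ⟪v, e 1⟫)]
    · nlinarith [mul_pos (neg_pos.2 h1) (sq_pos_of_ne_zero h), mul_nonneg (neg_pos.2 h0).le (sq_nonneg ⟪v, e 0⟫)]
  · exact ⟨e 0, e 1, -lam 0, lam 1, F, by linarith, h1, by rw [neg_neg, hA], hA 1⟩
  · exact ⟨e 1, e 0, -lam 1, lam 0, F.swap, by linarith, h0, by rw [neg_neg, hA], hA 0⟩
  · exfalso
    refine hy.2.1 ⟨hy.1, fun v hv => ?_⟩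
    rw [hq]
    rcases hpos v hv with h | h
    · nlinarith [mul_pos h0 (sq_pos_of_ne_zero h), mul_nonneg h1.le (sq_nonneg ⟪v, e 1⟫)]
    · nlinarith [mul_pos h1 (sq_pos_of_ne_zero h), mul_nonneg h0.le (sq_nonneg ⟪v, e 0⟫)]

/-- strict differentiability estimate -/
theorem saddle_strict {φ : Euc 2 → ℝ} {f : Euc 2 → Euc 2} (B : Base φ f) {y eu ev : Euc 2} {a b θ : ℝ}
    (F : Frame eu ev) (hu : fderiv ℝ f y eu = (-a) • eu) (hv : fderiv ℝ f y ev = b • ev) (hθ : 0 < θ) :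
    ∃ r0 > 0, ∀ p ∈ closedBall y r0, ∀ p' ∈ closedBall y r0,
      |⟪f p - f p', eu⟫ + a * ⟪p - p', eu⟫| ≤ θ * ‖p - p'‖ ∧ |⟪f p - f p', ev⟫ - b * ⟪p - p', ev⟫| ≤ θ * ‖p - p'‖ := by
  have hs : HasStrictFDerivAt f (fderiv ℝ f y) y := B.c1.contDiffAt.hasStrictFDerivAt (by norm_num)
  have h1 := hs.isLittleO.def hθ
  rw [nhds_prod_eq] at h1
  obtain ⟨s, hs1, hs2⟩ := Filter.eventually_prod_self_iff'.1 h1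
  obtain ⟨r0, hr0, hsub⟩ := Metric.nhds_basis_closedBall.mem_iff.1 hs1
  refine ⟨r0, hr0, fun p hp p' hp' => ?_⟩
  have h2 : ‖f p - f p' - fderiv ℝ f y (p - p')‖ ≤ θ * ‖p - p'‖ := hs2 p (hsub hp) p' (hsub hp')
  constructor
  · have h3 := (F.abs_u _).trans h2
    rw [inner_sub_left, B.symm, hu, real_inner_smul_right] at h3
    have : ⟪f p - f p', eu⟫ + a * ⟪p - p', eu⟫ = ⟪f p - f p', eu⟫ - -a * ⟪p - p', eu⟫ := by ring
    rw [this]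
    exact h3
  · have h3 := (F.abs_v _).trans h2
    rwa [inner_sub_left, B.symm, hv, real_inner_smul_right] at h3

/-- choice of the constants -/
theorem saddle_consts {a b : ℝ} (ha : 0 < a) (hb : 0 < b) :
    ∃ κ m θ θw, 0 < κ ∧ κ ≤ 1 / 2 ∧ 0 < m ∧ m ≤ κ ^ 2 * a ∧ m ≤ κ ^ 2 * b ∧ 0 < θ ∧ θ ≤ m / 4 ∧ κ ^ 2 * a ≤ b / 4 ∧
      κ ^ 2 * b ≤ a / 4 ∧ SmallTheta a b θw ∧ κ ≤ θw ∧ θ ≤ θw ∧ (a + b) * κ ≤ b / 10000 ∧ θ ≤ b / 10000 := by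
  have hsm : ∀ᶠ w : ℝ in 𝓝[>] 0, SmallTheta a b w := by
    have t1 : Tendsto (fun w : ℝ => w) (𝓝[>] 0) (𝓝 0) := tendsto_id.mono_left nhdsWithin_le_nhds
    have t2 : Tendsto (fun w : ℝ => 100 * w * (1 + b) * (3 + 8 * a / b)) (𝓝[>] 0) (𝓝 0) := by
      have : Continuous (fun w : ℝ => 100 * w * (1 + b) * (3 + 8 * a / b)) := by fun_prop
      have := (this.tendsto 0).mono_left (nhdsWithin_le_nhds (s := Ioi 0))
      simpa using this
    have t3 : Tendsto (fun w : ℝ => 100 * w * (1 + a)) (𝓝[>] 0) (𝓝 0) := by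
      have : Continuous (fun w : ℝ => 100 * w * (1 + a)) := by fun_prop
      have := (this.tendsto 0).mono_left (nhdsWithin_le_nhds (s := Ioi 0))
      simpa using this
    have t4 : Tendsto (fun w : ℝ => w * (1 + 4 * a / b)) (𝓝[>] 0) (𝓝 0) := by
      have : Continuous (fun w : ℝ => w * (1 + 4 * a / b)) := by fun_prop
      have := (this.tendsto 0).mono_left (nhdsWithin_le_nhds (s := Ioi 0))
      simpa using this
    filter_upwards [self_mem_nhdsWithin, t1.eventually (gt_mem_nhds (show (0:ℝ) < 1 / 100 by norm_num)),
      t2.eventually (gt_mem_nhds ha), t3.eventually (gt_mem_nhds hb),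
      t4.eventually (gt_mem_nhds (show (0:ℝ) < 1 / 100 by norm_num))] with w h1 h2 h3 h4 h5
    exact ⟨h1, h2.le, h3.le, h4.le, h5.le⟩
  obtain ⟨θw, hw⟩ := hsm.exists
  have hκ : ∀ᶠ k : ℝ in 𝓝[>] 0, 0 < k ∧ k ≤ 1 / 2 ∧ k ^ 2 * a ≤ b / 4 ∧ k ^ 2 * b ≤ a / 4 ∧ k ≤ θw ∧ (a + b) * k ≤ b / 10000 := by
    have t1 : Tendsto (fun w : ℝ => w) (𝓝[>] 0) (𝓝 0) := tendsto_id.mono_left nhdsWithin_le_nhds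
    have t2 : ∀ c : ℝ, Tendsto (fun w : ℝ => w ^ 2 * c) (𝓝[>] 0) (𝓝 0) := by
      intro c
      have : Continuous (fun w : ℝ => w ^ 2 * c) := by fun_prop
      have := (this.tendsto 0).mono_left (nhdsWithin_le_nhds (s := Ioi 0))
      simpa using this
    have t3 : Tendsto (fun w : ℝ => (a + b) * w) (𝓝[>] 0) (𝓝 0) := by simpa using t1.const_mul (a + b)
    filter_upwards [self_mem_nhdsWithin, t1.eventually (gt_mem_nhds (show (0:ℝ) < 1 / 2 by norm_num)),
      (t2 a).eventually (gt_mem_nhds (show (0:ℝ) < b / 4 by positivity)),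
      (t2 b).eventually (gt_mem_nhds (show (0:ℝ) < a / 4 by positivity)),
      t1.eventually (gt_mem_nhds hw.1),
      t3.eventually (gt_mem_nhds (show (0:ℝ) < b / 10000 by positivity))] with w h1 h2 h3 h4 h5 h6
    exact ⟨h1, h2.le, h3.le, h4.le, h5.le, h6.le⟩
  obtain ⟨κ, hκ0, hκ1, hκa, hκb, hκw, hκab⟩ := hκ.exists
  obtain ⟨m, hm⟩ : ∃ m, m = min (κ ^ 2 * a) (κ ^ 2 * b) := ⟨_, rfl⟩
  have hm0 : 0 < m := by rw [hm]; exact lt_min (by positivity) (by positivity)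
  have hw0 := hw.1
  refine ⟨κ, m, min (m / 4) (min θw (b / 10000)), θw, hκ0, hκ1, hm0, hm ▸ min_le_left _ _, hm ▸ min_le_right _ _, ?_,
    min_le_left _ _, hκa, hκb, hw, hκw, (min_le_right _ _).trans (min_le_left _ _), hκab,
    (min_le_right _ _).trans (min_le_right _ _)⟩
  exact lt_min (by positivity) (lt_min hw0 (by positivity))


theorem Base.neg {φ : Euc 2 → ℝ} {f : Euc 2 → Euc 2} (B : Base φ f) : Base (fun p => - φ p) (fun p => - f p) := by
  have hfd : ∀ p, fderiv ℝ (fun p => - f p) p = - fderiv ℝ f p := fun p => fderiv_fun_neg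
  refine ⟨B.c2.neg, fun p => ?_, B.c1.neg, fun p v w => ?_, fun p hp => ?_, ?_, ?_⟩
  · have h : HasFDerivAt φ (InnerProductSpace.toDual ℝ (Euc 2) (f p)) p := (B.grad p)
    have h2 := h.neg
    rw [← map_neg] at h2
    exact h2
  · rw [hfd]
    simp only [ContinuousLinearMap.neg_apply, inner_neg_left, inner_neg_right, B.symm]
  · rw [hfd]
    intro v w hvw
    simp only [ContinuousLinearMap.neg_apply, neg_inj] at hvw
    exact B.nondeg p (neg_eq_zero.1 hp) hvw
  · simpa using B.fin
  · simpa using B.big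

/-- saddle together with the global dynamics -/
structure SD (φ : Euc 2 → ℝ) (f X : Euc 2 → Euc 2) (K : ℝ≥0) (Φ : Euc 2 → ℝ → Euc 2) (r R1 M R R2 : ℝ)
    (y eu ev : Euc 2) (a b κ m θ r0 : ℝ) : Prop where
  D : Dyn φ f X K Φ r R1 M R R2
  L : LocSaddle X y eu ev a b κ m θ r0
  hX : ∀ p ∈ closedBall y r0, X p = f p
  hR : closedBall y r0 ⊆ ball 0 R1
  hns : NoSaddleConnection f
  hy : IsSaddleAt f y
  hsk : ∀ p ∈ closedBall y r0, ∀ q, IsSinkAt f q → p ∉ closedBall q (2 * r)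

theorem sd_exists {φ : Euc 2 → ℝ} {f X : Euc 2 → Euc 2} {K : ℝ≥0} {Φ : Euc 2 → ℝ → Euc 2} {r R1 M R R2 : ℝ}
    {y eu ev : Euc 2} {a b κ m θ : ℝ} (D : Dyn φ f X K Φ r R1 M R R2) (hns : NoSaddleConnection f) (hy : IsSaddleAt f y)
    (F : Frame eu ev) (ha : 0 < a) (hb : 0 < b) (hu : fderiv ℝ f y eu = (-a) • eu) (hv : fderiv ℝ f y ev = b • ev)
    (hκ : 0 < κ) (hκ1 : κ ≤ 1 / 2) (hm : 0 < m) (hma : m ≤ κ ^ 2 * a) (hmb : m ≤ κ ^ 2 * b) (hθ0 : 0 < θ)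
    (hθ : θ ≤ m / 4) (hκa : κ ^ 2 * a ≤ b / 4) (hκb : κ ^ 2 * b ≤ a / 4) :
    ∃ r0, SD φ f X K Φ r R1 M R R2 y eu ev a b κ m θ r0 := by
  obtain ⟨r1, hr1, hst⟩ := saddle_strict D.base F hu hv hθ0
  have hyR : ‖y‖ < R1 := D.zero_lt hy.1
  obtain ⟨r0, hr0, hr0'⟩ := exists_between (lt_min hr1 (lt_min D.r_pos (sub_pos.2 hyR)))
  have h1 : r0 ≤ r1 := hr0'.le.trans (min_le_left _ _)
  have h2 : r0 ≤ r := hr0'.le.trans ((min_le_right _ _).trans (min_le_left _ _))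
  have h3 : r0 < R1 - ‖y‖ := hr0'.trans_le ((min_le_right _ _).trans (min_le_right _ _))
  have hrp := D.r_pos
  have hsk : ∀ p ∈ closedBall y r0, ∀ q, IsSinkAt f q → p ∉ closedBall q (2 * r) := by
    intro p hp q hq hpq
    have hyq : y = q := by
      refine D.sink_nozero hq ?_ hy.1
      have := dist_triangle_left y q p
      rw [mem_closedBall] at *
      linarith
    exact hy.2.2 (hyq ▸ hq)
  have hR : closedBall y r0 ⊆ ball 0 R1 := by
    intro p hp
    rw [mem_ball_zero_iff]
    have := norm_le_norm_add_norm_sub' p y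
    rw [mem_closedBall, dist_eq_norm] at hp
    linarith
  have hX : ∀ p ∈ closedBall y r0, X p = f p := by
    intro p hp
    refine D.X_eq p ?_ (hsk p hp)
    have := hR hp
    rw [mem_ball_zero_iff] at this
    linarith [D.R1R, D.RR2]
  refine ⟨r0, D, ⟨F, ha, hb, hκ, hκ1, hm, hma, hmb, hθ0.le, hθ, hκa, hκb, hr0, D.X_zero y hy.1, ?_, ?_⟩, hX, hR, hns, hy, hsk⟩
  · intro p hp p' hp'
    rw [hX p hp, hX p' hp']
    exact (hst p (closedBall_subset_closedBall h1 hp) p' (closedBall_subset_closedBall h1 hp')).1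
  · intro p hp p' hp'
    rw [hX p hp, hX p' hp']
    exact (hst p (closedBall_subset_closedBall h1 hp) p' (closedBall_subset_closedBall h1 hp')).2

theorem Dyn.basin_back {φ : Euc 2 → ℝ} {f X : Euc 2 → Euc 2} {K : ℝ≥0} {Φ : Euc 2 → ℝ → Euc 2} {r R1 M R R2 : ℝ}
    (D : Dyn φ f X K Φ r R1 M R R2) {p : Euc 2} {T : ℝ} (hT : 0 ≤ T) (h : Φ p T ∈ basinO φ f Φ r M) :
    p ∈ basinO φ f Φ r M := by
  rcases h with ⟨t, ht, h⟩ | ⟨q, hq, t, ht, h⟩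
  · exact Or.inl ⟨T + t, by linarith, by rwa [D.flow.add]⟩
  · exact Or.inr ⟨q, hq, T + t, by linarith, by rwa [D.flow.add]⟩

namespace SD
variable {φ : Euc 2 → ℝ} {f X : Euc 2 → Euc 2} {K : ℝ≥0} {Φ : Euc 2 → ℝ → Euc 2} {r R1 M R R2 : ℝ}
    {y eu ev : Euc 2} {a b κ m θ r0 : ℝ}

theorem neg_v (S : SD φ f X K Φ r R1 M R R2 y eu ev a b κ m θ r0) : SD φ f X K Φ r R1 M R R2 y eu (-ev) a b κ m θ r0 :=
  { S with L := S.L.neg_v }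

theorem W_phi (S : SD φ f X K Φ r R1 M R R2 y eu ev a b κ m θ r0) {p : Euc 2} (hp : p ∈ Wset Φ y r0) (hne : p ≠ y) :
    φ y < φ p :=
  S.L.phi_gt S.D.base S.hX (LocSaddle.W_mem S.D.flow hp) hne (S.L.W_cone S.D.flow hp (S.L.y_W S.D.flow))

theorem W_fne (S : SD φ f X K Φ r R1 M R R2 y eu ev a b κ m θ r0) {p : Euc 2} (hp : p ∈ Wset Φ y r0) (hne : p ≠ y) :
    f p ≠ 0 := by
  intro h0
  have h1 := S.L.W_tendsto S.D.flow hp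
  have h2 : Φ p = fun _ => p := funext fun t => S.D.flow.fixed (S.D.X_zero p h0) t
  rw [h2] at h1
  exact hne (tendsto_nhds_unique tendsto_const_nhds h1)

theorem W_basin (S : SD φ f X K Φ r R1 M R R2 y eu ev a b κ m θ r0) {p : Euc 2} (hp : p ∈ Wset Φ y r0) (hne : p ≠ y) :
    p ∈ basinO φ f Φ r M := by
  refine S.D.unstable_end S.hns S.hy (S.W_fne hp hne) ?_ (fun t ht => S.hX _ (hp t ht)) (S.L.W_tendsto S.D.flow hp)
    (S.W_phi hp hne)
  have := S.hR (LocSaddle.W_mem S.D.flow hp)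
  rw [mem_ball_zero_iff] at this
  exact this.le

theorem exit (S : SD φ f X K Φ r R1 M R R2 y eu ev a b κ m θ r0) :
    ∃ ρ > 0, ρ ≤ r0 ∧ ∀ p ∈ ball y ρ, (∀ t, 0 ≤ t → Φ p t ∈ closedBall y r0) ∨ p ∈ basinO φ f Φ r M := by
  obtain ⟨ρ, hρ, h⟩ := S.L.exit_open S.D.flow S.D.isOpen_basin (fun q hq hne => S.W_basin hq hne)
  refine ⟨min ρ r0, lt_min hρ S.L.hr, min_le_right _ _, fun p hp => ?_⟩
  rcases h p (ball_subset_ball (min_le_left _ _) hp) with h1 | ⟨T, hT, h1⟩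
  · exact Or.inl h1
  · exact Or.inr (S.D.basin_back hT h1)

theorem conn (S : SD φ f X K Φ r R1 M R R2 y eu ev a b κ m θ r0) {γ : ℝ → Euc 2} {x : Euc 2} (hx : IsSourceAt f x)
    (hγ : IsTrajectory f γ) (hR : ∀ t, ‖γ t‖ ≤ R1) (hbot : Tendsto γ atBot (𝓝 x)) (htop : Tendsto γ atTop (𝓝 y)) :
    (∀ s t, γ (s + t) = Φ (γ s) t) ∧ (∀ t, φ (γ t) < φ y) ∧ φ x < φ y := by
  have D := S.D
  have hsh : ∀ s, ∀ t, 0 ≤ t → γ (s + t) = Φ (γ (s + 0)) t ∧ φ (γ (s + t)) ≤ M ∧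
      ∀ q, IsSinkAt f q → γ (s + t) ∉ closedBall q (2 * r) := by
    intro s
    refine D.traj_eq (δ := fun t => γ (s + t)) ?_ (fun t _ => (hγ (s + t)).comp_const_add s t)
      (htop.comp (tendsto_atTop_add_const_left _ s tendsto_id)) S.hy.1 S.hy.2.2
    linarith [hR (s + 0), D.R1R]
  have hXf : ∀ t, X (γ t) = f (γ t) := by
    intro t
    refine D.X_eq _ (by linarith [hR t, D.R1R, D.RR2]) ?_
    have := (hsh t 0 le_rfl).2.2
    rwa [add_zero] at this
  have hun : ∀ s t, γ (s + t) = Φ (γ s) t := D.flow.unique (fun t => by rw [hXf]; exact hγ t)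
  have hne : ∀ t, f (γ t) ≠ 0 := by
    intro t h0
    have h1 : γ = fun _ => γ t := by
      funext s
      have := hun t (s - t)
      rwa [add_sub_cancel, D.flow.fixed (D.X_zero _ h0)] at this
    rw [h1] at hbot htop
    have e1 := tendsto_nhds_unique hbot tendsto_const_nhds
    have e2 := tendsto_nhds_unique htop tendsto_const_nhds
    exact S.hy.2.1 (by rw [e2, ← e1]; exact hx)
  have hD : ∀ t, HasDerivAt (fun s => φ (γ s)) ⟪f (γ t), f (γ t)⟫ t := fun t => D.base.deriv_along (hγ t)
  have hmono : StrictMono (fun s => φ (γ s)) := by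
    refine strictMono_of_deriv_pos fun t => ?_
    rw [(hD t).deriv]
    exact real_inner_self_pos.2 (hne t)
  have hφc := D.base.contφ
  have hlt : Tendsto (fun s => φ (γ s)) atTop (𝓝 (φ y)) := (hφc.tendsto y).comp htop
  have hlb : Tendsto (fun s => φ (γ s)) atBot (𝓝 (φ x)) := (hφc.tendsto x).comp hbot
  have h1 : ∀ t, φ (γ t) < φ y := fun t =>
    (hmono (show t < t + 1 by linarith)).trans_le (hmono.monotone.ge_of_tendsto hlt (t + 1))
  exact ⟨hun, h1, (hmono.monotone.le_of_tendsto hlb 0).trans_lt (h1 0)⟩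

theorem low_cone (S : SD φ f X K Φ r R1 M R R2 y eu ev a b κ m θ r0) {p : Euc 2} (hd : p ∈ closedBall y r0) (hne : p ≠ y)
    (h : |⟪p - y, ev⟫| ≤ κ * |⟪p - y, eu⟫|) : φ p < φ y := by
  have := S.L.rev.phi_gt S.D.base.neg (fun p hp => by rw [S.hX p hp]) hd hne h
  linarith

theorem stable_side (S : SD φ f X K Φ r R1 M R R2 y eu ev a b κ m θ r0) {γ : ℝ → Euc 2}
    (hun : ∀ s t, γ (s + t) = Φ (γ s) t) {T : ℝ} (hin : ∀ t, T ≤ t → γ t ∈ closedBall y r0) :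
    γ T ∈ Wset (fun p t => Φ p (-t)) y r0 := by
  intro t ht
  show Φ (γ T) (-t) ∈ _
  rw [← hun]
  exact hin _ (by linarith)

theorem range_eq (S : SD φ f X K Φ r R1 M R R2 y eu ev a b κ m θ r0) {γ₁ γ₂ : ℝ → Euc 2}
    (h1 : ∀ s t, γ₁ (s + t) = Φ (γ₁ s) t) (h2 : ∀ s t, γ₂ (s + t) = Φ (γ₂ s) t) {T t : ℝ} (h : Φ (γ₁ T) t = γ₂ T) :
    range γ₁ = range γ₂ := by
  have key : ∀ s, γ₂ s = γ₁ (s + t) := by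
    intro s
    have a1 := h2 T (s - T)
    rw [add_sub_cancel] at a1
    rw [a1, ← h, ← S.D.flow.add, ← h1]
    congr 1; ring
  ext z
  constructor
  · rintro ⟨s, rfl⟩
    exact ⟨s - t, by rw [key, sub_add_cancel]⟩
  · rintro ⟨s, rfl⟩
    exact ⟨s + t, (key s).symm⟩
end SD


/-- complex coordinate at `y` -/
def zeta (y eu ev p : Euc 2) : ℂ := ⟨⟪p - y, eu⟫, ⟪p - y, ev⟫⟩
/-- inverse coordinate -/
def psi (y eu ev : Euc 2) (w : ℂ) : Euc 2 := y + (w.re • eu + w.im • ev)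

theorem psi_zeta {y eu ev : Euc 2} (F : Frame eu ev) (p : Euc 2) : psi y eu ev (zeta y eu ev p) = p := by
  unfold psi zeta
  simp only
  rw [← F.coord (p - y)]
  abel

theorem zeta_cont (y eu ev : Euc 2) : Continuous (zeta y eu ev) := by
  have : zeta y eu ev = fun p => Complex.equivRealProdCLM.symm (⟪p - y, eu⟫, ⟪p - y, ev⟫) := by
    funext p; rfl
  rw [this]
  refine Complex.equivRealProdCLM.symm.continuous.comp ?_
  fun_prop

theorem psi_comb (y eu ev : Euc 2) (w w' : ℂ) (α β : ℝ) (h : α + β = 1) :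
    psi y eu ev (α • w + β • w') = α • psi y eu ev w + β • psi y eu ev w' := by
  have hβ : β = 1 - α := by linarith
  subst hβ
  unfold psi
  simp only [Complex.add_re, Complex.add_im, Complex.smul_re, Complex.smul_im, smul_eq_mul]
  module

theorem psi_segment {y eu ev p q : Euc 2} (F : Frame eu ev) {w : ℂ}
    (h : w ∈ segment ℝ (zeta y eu ev p) (zeta y eu ev q)) : psi y eu ev w ∈ segment ℝ p q := by
  obtain ⟨α, β, hα, hβ, hab, rfl⟩ := h
  refine ⟨α, β, hα, hβ, hab, ?_⟩
  rw [psi_comb _ _ _ _ _ _ _ hab, psi_zeta F, psi_zeta F]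

theorem zeta_y (y eu ev : Euc 2) : zeta y eu ev y = 0 := by
  unfold zeta
  simp only [sub_self, inner_zero_left]
  rfl

theorem zeta_hasDeriv (y eu ev : Euc 2) {γ : ℝ → Euc 2} {w : Euc 2} {t : ℝ} (h : HasDerivAt γ w t) :
    HasDerivAt (fun s => zeta y eu ev (γ s)) (⟨⟪w, eu⟫, ⟪w, ev⟫⟩ : ℂ) t := by
  have h1 := (h.sub_const y).inner ℝ (hasDerivAt_const t eu)
  have h2 := (h.sub_const y).inner ℝ (hasDerivAt_const t ev)
  have h3 := h1.prodMk h2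
  have h4 := (Complex.equivRealProdCLM.symm : ℝ × ℝ →L[ℝ] ℂ).hasFDerivAt.comp_hasDerivAt t h3
  refine h4.congr_deriv ?_
  simp only [inner_zero_right, zero_add]
  rfl

theorem seg_smul_mem {y p q : Euc 2} (h : q ∈ segment ℝ p y) : ∃ s ∈ Icc (0:ℝ) 1, q - y = s • (p - y) := by
  obtain ⟨α, β, hα, hβ, hab, rfl⟩ := h
  refine ⟨α, ⟨hα, by linarith⟩, ?_⟩
  have : β = 1 - α := by linarith
  subst this
  module

namespace SD
variable {φ : Euc 2 → ℝ} {f X : Euc 2 → Euc 2} {K : ℝ≥0} {Φ : Euc 2 → ℝ → Euc 2} {r R1 M R R2 : ℝ}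
    {y eu ev : Euc 2} {a b κ m θ r0 : ℝ}

/-- the segment from the axis to a point of the unstable cone stays in the cone -/
theorem seg_axis (S : SD φ f X K Φ r R1 M R R2 y eu ev a b κ m θ r0) {q p : Euc 2} {ε : ℝ} (hε : 0 < ε) (hε' : ε ≤ r0)
    (hq : q ∈ closedBall y r0) (hqc : |⟪q - y, eu⟫| ≤ κ * |⟪q - y, ev⟫|) (hqv : 0 < ⟪q - y, ev⟫)
    (hp : p ∈ segment ℝ (y + ε • ev) q) : φ y < φ p := by
  have hin : p ∈ closedBall y r0 := by
    refine (convex_closedBall y r0).segment_subset ?_ hq hp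
    rw [mem_closedBall, dist_eq_norm, add_sub_cancel_left, norm_smul, S.L.fr.nv, mul_one, Real.norm_of_nonneg hε.le]
    exact hε'
  obtain ⟨α, β, hα, hβ, hab, rfl⟩ := hp
  have e : α • (y + ε • ev) + β • q - y = (α * ε) • ev + β • (q - y) := by
    have : β = 1 - α := by linarith
    subst this
    module
  have hv1 : ⟪ev, ev⟫ = (1:ℝ) := by rw [real_inner_self_eq_norm_sq, S.L.fr.nv]; norm_num
  have hu1 : ⟪ev, eu⟫ = (0:ℝ) := by rw [real_inner_comm]; exact S.L.fr.orth
  have hv : ⟪α • (y + ε • ev) + β • q - y, ev⟫ = α * ε + β * ⟪q - y, ev⟫ := by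
    rw [e, inner_add_left, real_inner_smul_left, real_inner_smul_left, hv1, mul_one]
  have hu : ⟪α • (y + ε • ev) + β • q - y, eu⟫ = β * ⟪q - y, eu⟫ := by
    rw [e, inner_add_left, real_inner_smul_left, real_inner_smul_left, hu1, mul_zero, zero_add]
  have hαε : 0 ≤ α * ε := by positivity
  have hβv : 0 ≤ β * ⟪q - y, ev⟫ := by positivity
  have hpos : 0 < α * ε + β * ⟪q - y, ev⟫ := by
    rcases hα.eq_or_lt with h | h
    · have : β = 1 := by linarith
      rw [← h, this]; linarith
    · have : 0 < α * ε := by positivity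
      linarith
  refine S.L.phi_gt S.D.base S.hX hin ?_ ?_
  · intro h0
    rw [h0, sub_self, inner_zero_left] at hv
    linarith
  · rw [hu, hv, abs_of_pos hpos, abs_mul, abs_of_nonneg hβ]
    rw [abs_of_pos hqv] at hqc
    have := mul_le_mul_of_nonneg_left hqc hβ
    have := mul_nonneg S.L.hκ.le hαε
    linarith

theorem no_join_aux (S : SD φ f X K Φ r R1 M R R2 y eu ev a b κ m θ r0) {γ₁ γ₂ : ℝ → Euc 2} {x : Euc 2}
    (hx : IsSourceAt f x)
    (h₁ : IsTrajectory f γ₁) (hR₁ : ∀ t, ‖γ₁ t‖ ≤ R1) (hb₁ : Tendsto γ₁ atBot (𝓝 x)) (ht₁ : Tendsto γ₁ atTop (𝓝 y))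
    (h₂ : IsTrajectory f γ₂) (hR₂ : ∀ t, ‖γ₂ t‖ ≤ R1) (hb₂ : Tendsto γ₂ atBot (𝓝 x)) (ht₂ : Tendsto γ₂ atTop (𝓝 y))
    {T : ℝ} (hT₁ : ∀ t, T ≤ t → γ₁ t ∈ closedBall y r0) (hT₂ : ∀ t, T ≤ t → γ₂ t ∈ closedBall y r0)
    (hs₁ : 0 < ⟪γ₁ T - y, eu⟫) (hs₂ : ⟪γ₂ T - y, eu⟫ < 0)
    {bp bm : Euc 2} (hbp : bp ∈ Wset Φ y r0) (hbpv : 0 < ⟪bp - y, ev⟫) (hbm : bm ∈ Wset Φ y r0)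
    (hbmv : ⟪bm - y, ev⟫ < 0) {C' : Set (Euc 2)} (hC' : IsPreconnected C') (hpC : bp ∈ C') (hmC : bm ∈ C')
    (hhigh : ∀ p ∈ C', ‖p‖ ≤ R1 → φ y < φ p) : False := by
  obtain ⟨un₁, lo₁, hxy⟩ := S.conn hx h₁ hR₁ hb₁ ht₁
  obtain ⟨un₂, lo₂, -⟩ := S.conn hx h₂ hR₂ hb₂ ht₂
  have F := S.L.fr
  have hφc := S.D.base.contφ
  obtain ⟨ρ, hρ, hρx⟩ := Metric.eventually_nhds_iff_ball.1 ((hφc.tendsto x).eventually (gt_mem_nhds hxy))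
  obtain ⟨A, hA₁, hA₂, hAT⟩ : ∃ A, γ₁ A ∈ ball x ρ ∧ γ₂ A ∈ ball x ρ ∧ A ≤ T :=
    ((hb₁.eventually (ball_mem_nhds x hρ)).and
      ((hb₂.eventually (ball_mem_nhds x hρ)).and (eventually_le_atBot T))).exists
  have hfc := S.D.base.cont
  have hγc₁ : Continuous γ₁ := continuous_iff_continuousAt.2 fun t => (h₁ t).continuousAt
  have hγc₂ : Continuous γ₂ := continuous_iff_continuousAt.2 fun t => (h₂ t).continuousAt
  have hdc : ∀ γ : ℝ → Euc 2, Continuous γ → Continuous (fun t => (⟨⟪f (γ t), eu⟫, ⟪f (γ t), ev⟫⟩ : ℂ)) := by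
    intro γ hγ
    have : (fun t => (⟨⟪f (γ t), eu⟫, ⟪f (γ t), ev⟫⟩ : ℂ)) =
      fun t => Complex.equivRealProdCLM.symm (⟪f (γ t), eu⟫, ⟪f (γ t), ev⟫) := by funext p; rfl
    rw [this]
    exact Complex.equivRealProdCLM.symm.continuous.comp (by fun_prop)
  -- the low set
  have low1 : ∀ p, ‖p‖ ≤ R1 → (φ p < φ y ∨ p = y) → p ∉ C' := by
    intro p hp h hpC
    have := hhigh p hpC hp
    rcases h with h | h
    · linarith
    · rw [h] at this; exact lt_irrefl _ this
  have segx : ∀ p ∈ segment ℝ (γ₂ A) (γ₁ A), ‖p‖ ≤ R1 ∧ φ p < φ y := by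
    intro p hp
    constructor
    · have := (convex_closedBall (0 : Euc 2) R1).segment_subset (mem_closedBall_zero_iff.2 (hR₂ A))
        (mem_closedBall_zero_iff.2 (hR₁ A)) hp
      exact mem_closedBall_zero_iff.1 this
    · exact hρx p ((convex_ball x ρ).segment_subset hA₂ hA₁ hp)
  have segy : ∀ γ : ℝ → Euc 2, (∀ s t, γ (s + t) = Φ (γ s) t) → (∀ t, T ≤ t → γ t ∈ closedBall y r0) →
      ∀ p ∈ segment ℝ (γ T) y, ‖p‖ ≤ R1 ∧ (φ p < φ y ∨ p = y) := by
    intro γ hun hin p hp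
    have hW := S.stable_side hun hin
    have hc := S.L.rev.W_cone S.D.flow.rev hW (S.L.rev.y_W S.D.flow.rev)
    have hpin : p ∈ closedBall y r0 := (convex_closedBall y r0).segment_subset (hin T le_rfl) S.L.y_mem hp
    refine ⟨(mem_ball_zero_iff.1 (S.hR hpin)).le, ?_⟩
    by_cases hpy : p = y
    · exact Or.inr hpy
    · left
      obtain ⟨s, hs, hsp⟩ := seg_smul_mem hp
      refine S.low_cone hpin hpy ?_
      rw [hsp]
      exact LocSaddle.cone_smul hc s
  have hLow : ∀ p, (p ∈ γ₁ '' Icc A T ∨ p ∈ γ₂ '' Icc A T ∨ p ∈ segment ℝ (γ₂ A) (γ₁ A) ∨ p ∈ segment ℝ (γ₁ T) y ∨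
      p ∈ segment ℝ (γ₂ T) y) → ‖p‖ ≤ R1 ∧ (φ p < φ y ∨ p = y) := by
    rintro p (⟨t, -, rfl⟩ | ⟨t, -, rfl⟩ | h | h | h)
    · exact ⟨hR₁ t, Or.inl (lo₁ t)⟩
    · exact ⟨hR₂ t, Or.inl (lo₂ t)⟩
    · exact ⟨(segx p h).1, Or.inl (segx p h).2⟩
    · exact segy γ₁ un₁ hT₁ p h
    · exact segy γ₂ un₂ hT₂ p h
  refine winding_lemma (fun t => zeta y eu ev (γ₁ t)) _ (fun t => zeta y eu ev (γ₂ t)) _ A T hAT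
    (fun t => zeta_hasDeriv y eu ev (h₁ t)) (hdc γ₁ hγc₁) (fun t => zeta_hasDeriv y eu ev (h₂ t)) (hdc γ₂ hγc₂)
    ?_ ?_ ?_ hs₁ hs₂ ?_
  · rintro ⟨t, -, ht⟩
    have := psi_zeta (y := y) F (γ₁ t)
    simp only at ht
    rw [ht, ← zeta_y y eu ev, psi_zeta F] at this
    have := lo₁ t
    rw [← ‹y = γ₁ t›] at this
    exact lt_irrefl _ this
  · rintro ⟨t, -, ht⟩
    have := psi_zeta (y := y) F (γ₂ t)
    simp only at ht
    rw [ht, ← zeta_y y eu ev, psi_zeta F] at this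
    have := lo₂ t
    rw [← ‹y = γ₂ t›] at this
    exact lt_irrefl _ this
  · intro h0
    have := (segx _ (psi_segment F h0)).2
    rw [← zeta_y y eu ev, psi_zeta F] at this
    exact lt_irrefl _ this
  · filter_upwards [Ioo_mem_nhdsGT S.L.hr] with ε hε
    have S' := S.neg_v
    have hcp := S.L.W_cone S.D.flow hbp (S.L.y_W S.D.flow)
    have hcm := S'.L.W_cone S.D.flow hbm (S'.L.y_W S.D.flow)
    have hv1 : ⟪ev, ev⟫ = (1:ℝ) := by rw [real_inner_self_eq_norm_sq, F.nv]; norm_num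
    have hu1 : ⟪ev, eu⟫ = (0:ℝ) := by rw [real_inner_comm]; exact F.orth
    obtain ⟨C, hCe⟩ : ∃ C : Set (Euc 2), C = segment ℝ (y + ε • ev) bp ∪ C' ∪ segment ℝ (y + ε • (-ev)) bm := ⟨_, rfl⟩
    have hCpre : IsPreconnected C := by
      rw [hCe]
      refine IsPreconnected.union bm (Or.inr hmC) (right_mem_segment ℝ _ _) ?_ (convex_segment _ _).isPreconnected
      exact IsPreconnected.union bp (right_mem_segment ℝ _ _) hpC (convex_segment _ _).isPreconnected hC'
    have hCh : ∀ p ∈ C, ‖p‖ ≤ R1 → φ y < φ p := by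
      intro p hp hpR
      rw [hCe] at hp
      rcases hp with (hp | hp) | hp
      · exact S.seg_axis hε.1 hε.2.le (LocSaddle.W_mem S.D.flow hbp) hcp hbpv hp
      · exact hhigh p hp hpR
      · exact S'.seg_axis hε.1 hε.2.le (LocSaddle.W_mem S.D.flow hbm) hcm (by rw [inner_neg_right]; linarith) hp
    have hno : ∀ p ∈ C, ¬ (p ∈ γ₁ '' Icc A T ∨ p ∈ γ₂ '' Icc A T ∨ p ∈ segment ℝ (γ₂ A) (γ₁ A) ∨ p ∈ segment ℝ (γ₁ T) y ∨
        p ∈ segment ℝ (γ₂ T) y) := by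
      intro p hp h
      obtain ⟨g1, g2⟩ := hLow p h
      have g3 := hCh p hp g1
      rcases g2 with g2 | g2
      · linarith
      · rw [g2] at g3; exact lt_irrefl _ g3
    refine ⟨zeta y eu ev '' C, hCpre.image _ (zeta_cont y eu ev).continuousOn, ?_, ?_, ?_⟩
    · refine ⟨y + ε • ev, ?_, ?_⟩
      · rw [hCe]; exact Or.inl (Or.inl (left_mem_segment ℝ _ _))
      · unfold zeta
        rw [add_sub_cancel_left, real_inner_smul_left, real_inner_smul_left, hu1, hv1]
        apply Complex.ext <;> simp
    · refine ⟨y + ε • (-ev), ?_, ?_⟩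
      · rw [hCe]; exact Or.inr (left_mem_segment ℝ _ _)
      · unfold zeta
        rw [add_sub_cancel_left, real_inner_smul_left, real_inner_smul_left, inner_neg_left, inner_neg_left, hu1, hv1]
        apply Complex.ext <;> simp
    · rintro _ ⟨p, hp, rfl⟩
      have hp' := hno p hp
      have hz : psi y eu ev (zeta y eu ev p) = p := psi_zeta F p
      have hinj : ∀ q, zeta y eu ev q = zeta y eu ev p → q = p := by
        intro q hq
        rw [← psi_zeta (y := y) F q, hq, hz]
      refine ⟨?_, ?_, ?_, ?_, ?_⟩
      · rintro ⟨t, ht, h⟩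
        exact hp' (Or.inl ⟨t, ht, hinj _ h⟩)
      · rintro ⟨t, ht, h⟩
        exact hp' (Or.inr (Or.inl ⟨t, ht, hinj _ h⟩))
      · intro h
        have := psi_segment F h
        rw [hz] at this
        exact hp' (Or.inr (Or.inr (Or.inl this)))
      · intro h
        rw [← zeta_y y eu ev] at h
        have := psi_segment F h
        rw [hz] at this
        exact hp' (Or.inr (Or.inr (Or.inr (Or.inl this))))
      · intro h
        rw [← zeta_y y eu ev, segment_symm] at h
        have := psi_segment F h
        rw [hz] at this
        exact hp' (Or.inr (Or.inr (Or.inr (Or.inr this))))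

theorem no_join (S : SD φ f X K Φ r R1 M R R2 y eu ev a b κ m θ r0) {γ₁ γ₂ : ℝ → Euc 2} {x : Euc 2}
    (hx : IsSourceAt f x)
    (h₁ : IsTrajectory f γ₁) (hR₁ : ∀ t, ‖γ₁ t‖ ≤ R1) (hb₁ : Tendsto γ₁ atBot (𝓝 x)) (ht₁ : Tendsto γ₁ atTop (𝓝 y))
    (h₂ : IsTrajectory f γ₂) (hR₂ : ∀ t, ‖γ₂ t‖ ≤ R1) (hb₂ : Tendsto γ₂ atBot (𝓝 x)) (ht₂ : Tendsto γ₂ atTop (𝓝 y))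
    (hdist : range γ₁ ≠ range γ₂)
    {bp bm : Euc 2} (hbp : bp ∈ Wset Φ y r0) (hbpv : 0 < ⟪bp - y, ev⟫) (hbm : bm ∈ Wset Φ y r0)
    (hbmv : ⟪bm - y, ev⟫ < 0) {C' : Set (Euc 2)} (hC' : IsPreconnected C') (hpC : bp ∈ C') (hmC : bm ∈ C')
    (hhigh : ∀ p ∈ C', ‖p‖ ≤ R1 → φ y < φ p) : False := by
  obtain ⟨un₁, lo₁, hxy⟩ := S.conn hx h₁ hR₁ hb₁ ht₁
  obtain ⟨un₂, lo₂, -⟩ := S.conn hx h₂ hR₂ hb₂ ht₂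
  have e1 := ht₁.eventually (closedBall_mem_nhds y S.L.hr)
  have e2 := ht₂.eventually (closedBall_mem_nhds y S.L.hr)
  obtain ⟨T, hT⟩ := Filter.eventually_atTop.1 (e1.and e2)
  have hT₁ : ∀ t, T ≤ t → γ₁ t ∈ closedBall y r0 := fun t ht => (hT t ht).1
  have hT₂ : ∀ t, T ≤ t → γ₂ t ∈ closedBall y r0 := fun t ht => (hT t ht).2
  have W₁ := S.stable_side un₁ hT₁
  have W₂ := S.stable_side un₂ hT₂
  have n₁ : γ₁ T ≠ y := fun h => by have := lo₁ T; rw [h] at this; exact lt_irrefl _ this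
  have n₂ : γ₂ T ≠ y := fun h => by have := lo₂ T; rw [h] at this; exact lt_irrefl _ this
  have LR := S.L.rev
  have FR := S.D.flow.rev
  rcases lt_or_gt_of_ne (LR.W_vne FR W₁ n₁) with s₁ | s₁ <;> rcases lt_or_gt_of_ne (LR.W_vne FR W₂ n₂) with s₂ | s₂
  · obtain ⟨t, ht⟩ := LR.neg_v.W_unique FR W₁ W₂ (by rw [inner_neg_right]; linarith) (by rw [inner_neg_right]; linarith)
    exact hdist (S.range_eq un₁ un₂ ht)
  · exact S.no_join_aux hx h₂ hR₂ hb₂ ht₂ h₁ hR₁ hb₁ ht₁ hT₂ hT₁ s₂ s₁ hbp hbpv hbm hbmv hC' hpC hmC hhigh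
  · exact S.no_join_aux hx h₁ hR₁ hb₁ ht₁ h₂ hR₂ hb₂ ht₂ hT₁ hT₂ s₁ s₂ hbp hbpv hbm hbmv hC' hpC hmC hhigh
  · obtain ⟨t, ht⟩ := LR.W_unique FR W₁ W₂ s₁ s₂
    exact hdist (S.range_eq un₁ un₂ ht)
end SD


theorem outside_preconnected {R : ℝ} (hR : 0 ≤ R) : IsPreconnected {p : Euc 2 | R < ‖p‖} := by
  have h1 : IsPreconnected (sphere (0 : Euc 2) 1 ×ˢ Ioi R) := by
    refine (isPreconnected_sphere ?_ 0 1).prod isPreconnected_Ioi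
    rw [← Module.finrank_eq_rank]
    simp
  have h2 := h1.image (fun z : Euc 2 × ℝ => z.2 • z.1) (by fun_prop)
  convert h2 using 1
  ext p
  simp only [mem_setOf_eq, mem_image, mem_prod, mem_sphere_zero_iff_norm, mem_Ioi, Prod.exists]
  constructor
  · intro h
    have h0 : 0 < ‖p‖ := hR.trans_lt h
    refine ⟨‖p‖⁻¹ • p, ‖p‖, ⟨?_, h⟩, ?_⟩
    · rw [norm_smul, norm_inv, norm_norm, inv_mul_cancel₀ h0.ne']
    · rw [smul_smul, mul_inv_cancel₀ h0.ne', one_smul]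
  · rintro ⟨u, s, ⟨hu, hs⟩, rfl⟩
    rw [norm_smul, hu, mul_one, Real.norm_eq_abs]
    exact hs.trans_le (le_abs_self s)

namespace SD
variable {φ : Euc 2 → ℝ} {f X : Euc 2 → Euc 2} {K : ℝ≥0} {Φ : Euc 2 → ℝ → Euc 2} {r R1 M R R2 : ℝ}
    {y eu ev : Euc 2} {a b κ m θ r0 : ℝ}

theorem orb_high (S : SD φ f X K Φ r R1 M R R2 y eu ev a b κ m θ r0) {p : Euc 2} (hp : p ∈ Wset Φ y r0) (hne : p ≠ y)
    {t : ℝ} (ht : 0 ≤ t) : φ y < φ (Φ p t) := by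
  have h1 := S.W_phi hp hne
  have h2 := S.D.mono p ht
  simp only [S.D.flow.zero] at h2
  linarith

theorem ne_of_pos {p : Euc 2} (h : 0 < ⟪p - y, ev⟫) : p ≠ y := by
  rintro rfl
  simp at h

theorem lim_high (S : SD φ f X K Φ r R1 M R R2 y eu ev a b κ m θ r0) {p q : Euc 2} (hl : Tendsto (Φ p) atTop (𝓝 q)) (t : ℝ) :
    φ (Φ p t) ≤ φ q :=
  (S.D.mono p).ge_of_tendsto ((S.D.base.contφ.tendsto q).comp hl) t

theorem lim_of_sink (S : SD φ f X K Φ r R1 M R R2 y eu ev a b κ m θ r0) {p q : Euc 2} (hq : IsSinkAt f q) {t : ℝ}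
    (h : Φ p t ∈ ball q r) : Tendsto (Φ p) atTop (𝓝 q) := by
  have h1 := S.D.sink_tendsto hq h
  have h2 := h1.comp (tendsto_atTop_add_const_right atTop (-t) tendsto_id)
  refine h2.congr fun s => ?_
  simp only [Function.comp, id]
  rw [← S.D.flow.add]
  congr 1
  ring

/-- the two branches cannot both escape, nor end in the same sink -/
theorem no_join2 (S : SD φ f X K Φ r R1 M R R2 y eu ev a b κ m θ r0) {γ₁ γ₂ : ℝ → Euc 2} {x : Euc 2}
    (hx : IsSourceAt f x)
    (h₁ : IsTrajectory f γ₁) (hR₁ : ∀ t, ‖γ₁ t‖ ≤ R1) (hb₁ : Tendsto γ₁ atBot (𝓝 x)) (ht₁ : Tendsto γ₁ atTop (𝓝 y))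
    (h₂ : IsTrajectory f γ₂) (hR₂ : ∀ t, ‖γ₂ t‖ ≤ R1) (hb₂ : Tendsto γ₂ atBot (𝓝 x)) (ht₂ : Tendsto γ₂ atTop (𝓝 y))
    (hdist : range γ₁ ≠ range γ₂)
    {bp bm : Euc 2} (hbp : bp ∈ Wset Φ y r0) (hbpv : 0 < ⟪bp - y, ev⟫) (hbm : bm ∈ Wset Φ y r0)
    (hbmv : ⟪bm - y, ev⟫ < 0) :
    (∀ t t', 0 ≤ t → 0 ≤ t' → M < φ (Φ bp t) → M < φ (Φ bm t') → False) ∧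
    (∀ q, IsSinkAt f q → ∀ t t', 0 ≤ t → 0 ≤ t' → Φ bp t ∈ ball q r → Φ bm t' ∈ ball q r → False) := by
  have np : bp ≠ y := ne_of_pos hbpv
  have nm : bm ≠ y := ne_of_pos (ev := -ev) (by rw [inner_neg_right]; linarith)
  have pre : ∀ p : Euc 2, IsPreconnected (Φ p '' Ici 0) := fun p =>
    isPreconnected_Ici.image _ (S.D.flow.cont p).continuousOn
  have mem0 : ∀ p : Euc 2, p ∈ Φ p '' Ici 0 := fun p => ⟨0, self_mem_Ici, S.D.flow.zero p⟩
  refine ⟨?_, ?_⟩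
  · intro t t' ht ht' hM hM'
    have out : ∀ p, M < φ p → R1 < ‖p‖ := by
      intro p hp
      by_contra h
      push Not at h
      have := S.D.hM p h
      linarith
    refine S.no_join hx h₁ hR₁ hb₁ ht₁ h₂ hR₂ hb₂ ht₂ hdist hbp hbpv hbm hbmv
      (C' := (Φ bp '' Ici 0 ∪ {p : Euc 2 | R1 < ‖p‖}) ∪ Φ bm '' Ici 0) ?_ ?_ ?_ ?_
    · refine IsPreconnected.union (Φ bm t') ?_ ?_ (IsPreconnected.union (Φ bp t) ?_ ?_ (pre bp) (outside_preconnected S.D.R1_pos.le)) (pre bm)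
      · exact Or.inr (out _ hM')
      · exact ⟨t', ht', rfl⟩
      · exact ⟨t, ht, rfl⟩
      · exact out _ hM
    · exact Or.inl (Or.inl (mem0 bp))
    · exact Or.inr (mem0 bm)
    · rintro p ((⟨s, hs, rfl⟩ | h) | ⟨s, hs, rfl⟩) hn
      · exact S.orb_high hbp np hs
      · exact absurd hn (not_le.2 h)
      · exact S.orb_high hbm nm hs
  · intro q hq t t' ht ht' hM hM'
    have l1 := S.lim_of_sink hq hM
    have l2 := S.lim_of_sink hq hM'
    have pre2 : ∀ p : Euc 2, Tendsto (Φ p) atTop (𝓝 q) → IsPreconnected (insert q (Φ p '' Ici 0)) := by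
      intro p hl
      refine (pre p).subset_closure (subset_insert _ _) (insert_subset ?_ subset_closure)
      refine mem_closure_of_tendsto hl ?_
      filter_upwards [eventually_ge_atTop (0:ℝ)] with s hs using ⟨s, hs, rfl⟩
    refine S.no_join hx h₁ hR₁ hb₁ ht₁ h₂ hR₂ hb₂ ht₂ hdist hbp hbpv hbm hbmv
      (C' := insert q (Φ bp '' Ici 0) ∪ insert q (Φ bm '' Ici 0)) ?_ ?_ ?_ ?_
    · exact IsPreconnected.union q (mem_insert _ _) (mem_insert _ _) (pre2 bp l1) (pre2 bm l2)
    · exact Or.inl (Or.inr (mem0 bp))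
    · exact Or.inr (Or.inr (mem0 bm))
    · have hq' : φ y < φ q := (S.orb_high hbp np le_rfl).trans_le (S.lim_high l1 0)
      rintro p ((rfl | ⟨s, hs, rfl⟩) | (rfl | ⟨s, hs, rfl⟩)) hn
      · exact hq'
      · exact S.orb_high hbp np hs
      · exact hq'
      · exact S.orb_high hbm nm hs

/-- data of the two unstable branches, the `b1` branch ending at the lower sink `z` -/
structure Ends (φ : Euc 2 → ℝ) (f : Euc 2 → Euc 2) (Φ : Euc 2 → ℝ → Euc 2) (r M : ℝ) (y ev : Euc 2) (r0 : ℝ)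
    (b1 b2 z : Euc 2) (T1 T2 : ℝ) : Prop where
  w1 : b1 ∈ Wset Φ y r0
  v1 : ⟪b1 - y, ev⟫ < 0
  w2 : b2 ∈ Wset Φ y r0
  v2 : 0 < ⟪b2 - y, ev⟫
  hz : IsSinkAt f z
  hT1 : 0 ≤ T1
  h1 : Φ b1 T1 ∈ ball z r
  h2 : ∀ t, 0 ≤ t → Φ b2 t ∉ ball z r
  hT2 : 0 ≤ T2
  lt : φ z < φ (Φ b2 T2)
  le : φ (Φ b2 T2) ≤ M

theorem ends_aux (S : SD φ f X K Φ r R1 M R R2 y eu ev a b κ m θ r0)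
    {bp bm z : Euc 2} (hbp : bp ∈ Wset Φ y r0) (hbpv : 0 < ⟪bp - y, ev⟫) (hbm : bm ∈ Wset Φ y r0)
    (hbmv : ⟪bm - y, ev⟫ < 0) {t1 : ℝ} (ht1 : 0 ≤ t1) (hz : IsSinkAt f z) (h1 : Φ bm t1 ∈ ball z r)
    (hno : ∀ t, 0 ≤ t → Φ bp t ∉ ball z r)
    (h : (∃ t, 0 ≤ t ∧ M < φ (Φ bp t)) ∨ ∃ z2, IsSinkAt f z2 ∧ φ z < φ z2 ∧ ∃ t, 0 ≤ t ∧ Φ bp t ∈ ball z2 r) :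
    ∃ T1 T2, Ends φ f Φ r M y ev r0 bm bp z T1 T2 := by
  have hM0 : ∀ q, f q = 0 → φ q + 1 ≤ M := fun q hq => S.D.hM q (S.D.zero_lt hq).le
  have hcφ : Continuous (fun t => φ (Φ bp t)) := S.D.base.contφ.comp (S.D.flow.cont bp)
  rcases h with ⟨t, ht, hM⟩ | ⟨z2, hz2, hlt, t, ht, hin⟩
  · have hb : φ (Φ bp 0) ≤ M := by
      rw [S.D.flow.zero]
      have h3 : bp ∈ closedBall y r0 := by have := hbp 0 le_rfl; rwa [S.D.flow.zero] at this
      have h4 := S.hR h3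
      rw [mem_ball_zero_iff] at h4
      have := S.D.hM bp h4.le
      linarith
    obtain ⟨T2, hT2, hT2e⟩ := intermediate_value_Icc ht hcφ.continuousOn ⟨hb, hM.le⟩
    refine ⟨t1, T2, hbm, hbmv, hbp, hbpv, hz, ht1, h1, hno, hT2.1, ?_, ?_⟩
    · simp only at hT2e
      rw [hT2e]; linarith [hM0 z hz.1]
    · exact hT2e.le
  · have l2 := S.lim_of_sink hz2 hin
    have e : ∀ᶠ s in atTop, φ z < φ (Φ bp s) :=
      ((S.D.base.contφ.tendsto z2).comp l2).eventually (lt_mem_nhds hlt)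
    obtain ⟨T2, hT2⟩ := (e.and (eventually_ge_atTop (0:ℝ))).exists
    refine ⟨t1, T2, hbm, hbmv, hbp, hbpv, hz, ht1, h1, hno, hT2.2, hT2.1, ?_⟩
    linarith [S.lim_high l2 T2, hM0 z2 hz2.1]

theorem ends_exist (S : SD φ f X K Φ r R1 M R R2 y eu ev a b κ m θ r0) {γ₁ γ₂ : ℝ → Euc 2} {x : Euc 2}
    (hx : IsSourceAt f x)
    (h₁ : IsTrajectory f γ₁) (hR₁ : ∀ t, ‖γ₁ t‖ ≤ R1) (hb₁ : Tendsto γ₁ atBot (𝓝 x)) (ht₁ : Tendsto γ₁ atTop (𝓝 y))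
    (h₂ : IsTrajectory f γ₂) (hR₂ : ∀ t, ‖γ₂ t‖ ≤ R1) (hb₂ : Tendsto γ₂ atBot (𝓝 x)) (ht₂ : Tendsto γ₂ atTop (𝓝 y))
    (hdist : range γ₁ ≠ range γ₂) (hval : ∀ p q : Euc 2, f p = 0 → f q = 0 → φ p = φ q → p = q) :
    ∃ ev' b1 b2 z T1 T2, SD φ f X K Φ r R1 M R R2 y eu ev' a b κ m θ r0 ∧ Ends φ f Φ r M y ev' r0 b1 b2 z T1 T2 := by
  obtain ⟨bp, hbp, hbpv⟩ := S.L.W_exists S.D.flow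
  obtain ⟨bm, hbm, hbmv'⟩ := S.neg_v.L.W_exists S.D.flow
  have hbmv : ⟪bm - y, ev⟫ < 0 := by rw [inner_neg_right] at hbmv'; linarith
  have hbpv' : ⟪bp - y, -ev⟫ < 0 := by rw [inner_neg_right]; linarith
  obtain ⟨nA, nB⟩ := S.no_join2 hx h₁ hR₁ hb₁ ht₁ h₂ hR₂ hb₂ ht₂ hdist hbp hbpv hbm hbmv
  have np : bp ≠ y := ne_of_pos hbpv
  have nm : bm ≠ y := ne_of_pos hbmv'
  rcases S.W_basin hbp np with ⟨t, ht, hM⟩ | ⟨q, hq, t, ht, hin⟩ <;>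
    rcases S.W_basin hbm nm with ⟨t', ht', hM'⟩ | ⟨q', hq', t', ht', hin'⟩
  · exact (nA t t' ht ht' hM hM').elim
  · obtain ⟨T1, T2, E⟩ := S.ends_aux hbp hbpv hbm hbmv ht' hq' hin' (fun s hs h => nB q' hq' s t' hs ht' h hin')
      (Or.inl ⟨t, ht, hM⟩)
    exact ⟨ev, bm, bp, q', T1, T2, S, E⟩
  · obtain ⟨T1, T2, E⟩ := S.neg_v.ends_aux hbm hbmv' hbp hbpv' ht hq hin (fun s hs h => nB q hq t s ht hs hin h)
      (Or.inl ⟨t', ht', hM'⟩)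
    exact ⟨-ev, bp, bm, q, T1, T2, S.neg_v, E⟩
  · have hqq : q ≠ q' := by
      rintro rfl
      exact nB q hq t t' ht ht' hin hin'
    rcases lt_trichotomy (φ q) (φ q') with hlt | heq | hlt
    · obtain ⟨T1, T2, E⟩ := S.neg_v.ends_aux hbm hbmv' hbp hbpv' ht hq hin (fun s hs h => nB q hq t s ht hs hin h)
        (Or.inr ⟨q', hq', hlt, t', ht', hin'⟩)
      exact ⟨-ev, bp, bm, q, T1, T2, S.neg_v, E⟩
    · exact (hqq (hval q q' hq.1 hq'.1 heq)).elim
    · obtain ⟨T1, T2, E⟩ := S.ends_aux hbp hbpv hbm hbmv ht' hq' hin' (fun s hs h => nB q' hq' s t' hs ht' h hin')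
        (Or.inr ⟨q, hq, hlt, t, ht, hin⟩)
      exact ⟨ev, bm, bp, q', T1, T2, S, E⟩

end SD


/-- straightness near `s0` -/
def StrAt (c : ℝ → Euc 2) (s0 : ℝ) (v : Euc 2) (ε : ℝ) : Prop :=
  ∃ ρ > 0, ∀ t ∈ Ioo (s0 - ρ) (s0 + ρ), ∀ t' ∈ Ioo (s0 - ρ) (s0 + ρ), t ≤ t' → ‖c t' - c t - (t' - t) • v‖ ≤ ε * (t' - t)

theorem strAt_smooth {G D : ℝ → Euc 2} {s0 ε : ℝ} {v : Euc 2} (hG : ∀ t, HasDerivAt G (D t) t) (hD : Continuous D)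
    (h : ‖D s0 - v‖ < ε) : StrAt G s0 v ε := by
  have hc : Continuous (fun t => ‖D t - v‖) := by fun_prop
  have h1 : ∀ᶠ t in 𝓝 s0, ‖D t - v‖ < ε := (hc.tendsto s0).eventually (gt_mem_nhds h)
  obtain ⟨ρ, hρ, hb⟩ := Metric.eventually_nhds_iff_ball.1 h1
  rw [Real.ball_eq_Ioo] at hb
  refine ⟨ρ, hρ, fun t ht t' ht' htt => ?_⟩
  have hd : ∀ u ∈ Icc t t', HasDerivWithinAt (fun u => G u - u • v) (D u - (1:ℝ) • v) (Icc t t') u := fun u _ =>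
    ((hG u).sub ((hasDerivAt_id u).smul_const v)).hasDerivWithinAt
  have hb2 : ∀ u ∈ Ico t t', ‖D u - (1:ℝ) • v‖ ≤ ε := fun u hu => by
    rw [one_smul]
    exact (hb u ⟨ht.1.trans_le hu.1, hu.2.trans ht'.2⟩).le
  have := norm_image_sub_le_of_norm_deriv_le_segment' hd hb2 t' (right_mem_Icc.2 htt)
  have e : G t' - G t - (t' - t) • v = (G t' - t' • v) - (G t - t • v) := by module
  rw [e]
  exact this

theorem strAt_glue {c G1 G2 : ℝ → Euc 2} {s0 ε α β : ℝ} {v : Euc 2} (hα : α < s0) (hβ : s0 < β)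
    (h1 : ∀ t ∈ Icc α s0, c t = G1 t) (h2 : ∀ t ∈ Icc s0 β, c t = G2 t)
    (H1 : StrAt G1 s0 v ε) (H2 : StrAt G2 s0 v ε) : StrAt c s0 v ε := by
  obtain ⟨ρ1, hρ1, H1⟩ := H1
  obtain ⟨ρ2, hρ2, H2⟩ := H2
  obtain ⟨ρ, hρ, hρ'⟩ := exists_between (lt_min (lt_min hρ1 hρ2) (lt_min (sub_pos.2 hα) (sub_pos.2 hβ)))
  simp only [lt_min_iff] at hρ'
  obtain ⟨⟨k1, k2⟩, k3, k4⟩ := hρ'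
  have A1 : ∀ t t', s0 - ρ < t → t ≤ t' → t' ≤ s0 → ‖c t' - c t - (t' - t) • v‖ ≤ ε * (t' - t) := by
    intro t t' a1 a2 a3
    rw [h1 t ⟨by linarith, by linarith⟩, h1 t' ⟨by linarith, by linarith⟩]
    exact H1 t ⟨by linarith, by linarith⟩ t' ⟨by linarith, by linarith⟩ a2
  have A2 : ∀ t t', s0 ≤ t → t ≤ t' → t' < s0 + ρ → ‖c t' - c t - (t' - t) • v‖ ≤ ε * (t' - t) := by
    intro t t' a1 a2 a3
    rw [h2 t ⟨by linarith, by linarith⟩, h2 t' ⟨by linarith, by linarith⟩]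
    exact H2 t ⟨by linarith, by linarith⟩ t' ⟨by linarith, by linarith⟩ a2
  refine ⟨ρ, hρ, fun t ht t' ht' htt => ?_⟩
  rcases le_total t' s0 with h | h
  · exact A1 t t' ht.1 htt h
  rcases le_total s0 t with h' | h'
  · exact A2 t t' h' htt ht'.2
  · have e : c t' - c t - (t' - t) • v = (c t' - c s0 - (t' - s0) • v) + (c s0 - c t - (s0 - t) • v) := by module
    rw [e]
    have a1 := A1 t s0 ht.1 h' le_rfl
    have a2 := A2 s0 t' le_rfl h ht'.2
    have a3 := norm_add_le (c t' - c s0 - (t' - s0) • v) (c s0 - c t - (s0 - t) • v)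
    linarith

/-- `c` has velocity `v` at `s0` -/
def VelAt (c : ℝ → Euc 2) (s0 : ℝ) (v : Euc 2) : Prop := ∀ ε > 0, StrAt c s0 v ε

theorem velAt_glue {c G1 G2 D1 D2 : ℝ → Euc 2} {s0 α β : ℝ} {v : Euc 2} (hα : α < s0) (hβ : s0 < β)
    (h1 : ∀ t ∈ Icc α s0, c t = G1 t) (h2 : ∀ t ∈ Icc s0 β, c t = G2 t)
    (g1 : ∀ t, HasDerivAt G1 (D1 t) t) (d1 : Continuous D1) (g2 : ∀ t, HasDerivAt G2 (D2 t) t) (d2 : Continuous D2)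
    (e1 : D1 s0 = v) (e2 : D2 s0 = v) : VelAt c s0 v := fun ε hε =>
  strAt_glue hα hβ h1 h2 (strAt_smooth g1 d1 (by rw [e1, sub_self, norm_zero]; exact hε))
    (strAt_smooth g2 d2 (by rw [e2, sub_self, norm_zero]; exact hε))

theorem velAt_of {c G D : ℝ → Euc 2} {s0 α β : ℝ} {v : Euc 2} (hα : α < s0) (hβ : s0 < β)
    (h : ∀ t ∈ Icc α β, c t = G t) (g : ∀ t, HasDerivAt G (D t) t) (d : Continuous D) (e : D s0 = v) : VelAt c s0 v :=
  velAt_glue hα hβ (fun t ht => h t ⟨ht.1, ht.2.trans hβ.le⟩) (fun t ht => h t ⟨hα.le.trans ht.1, ht.2⟩) g d g d e e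

theorem StrAt.straight {c : ℝ → Euc 2} {s0 ε : ℝ} {v : Euc 2} (h : StrAt c s0 v ε) (l r : ℝ) :
    ∃ ρ > 0, Straight c l r (s0 - ρ) (s0 + ρ) v ε := by
  obtain ⟨ρ, hρ, h⟩ := h
  exact ⟨ρ, hρ, fun t t' _ _ ht ht' htt => h t ht t' ht' htt⟩

theorem winF_vel {φ : Euc 2 → ℝ} {f : Euc 2 → Euc 2} {c : ℝ → Euc 2} {l r κ0 η s' : ℝ} {v : Euc 2}
    (hf : Continuous f) (hc : Continuous c) (hs' : s' ∈ Ioo l r) (hv : VelAt c s' v) (h : 0 < ⟪f (c s'), v⟫) :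
    Win φ f c l r κ0 η s' := by
  have hv0 : 0 < ‖v‖ := norm_pos_iff.2 (by rintro rfl; simp at h)
  have hf0 : 0 < ‖f (c s')‖ := norm_pos_iff.2 (by intro h0; rw [h0] at h; simp at h)
  obtain ⟨δ, hδ, hδ'⟩ := exists_between (div_pos h (mul_pos hf0 hv0))
  obtain ⟨ε, hε, hε'⟩ := exists_between (lt_min (div_pos hv0 (by norm_num : (0:ℝ) < 20)) (div_pos (mul_pos hδ hv0) (by norm_num : (0:ℝ) < 8)))
  rw [lt_min_iff] at hε'
  rw [lt_div_iff₀ (mul_pos hf0 hv0), ← mul_assoc] at hδ'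
  obtain ⟨ρ, hρ, hst⟩ := (hv ε hε).straight l r
  exact win_F hf hc hs' hρ hst hv0 hε.le hε'.1.le hδ (by linarith [hε'.2]) hδ'

theorem winB_vel {φ : Euc 2 → ℝ} {f : Euc 2 → Euc 2} {c : ℝ → Euc 2} {l r κ0 η s' : ℝ} {v : Euc 2}
    (hφ : Continuous φ) (hf : Continuous f) (hc : Continuous c) (hη : 0 < η) (hs' : s' ∈ Ioo l r) (hv : VelAt c s' v)
    (hφc : φ (c s') < κ0 + η * s') (h : ⟪f (c s'), v⟫ < 0) :
    Win φ f c l r κ0 η s' := by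
  have hv0 : 0 < ‖v‖ := norm_pos_iff.2 (by rintro rfl; simp at h)
  have hf0 : 0 < ‖f (c s')‖ := norm_pos_iff.2 (by intro h0; rw [h0] at h; simp at h)
  obtain ⟨δ, hδ, hδ'⟩ := exists_between (lt_min (div_pos (neg_pos.2 h) (mul_pos hf0 hv0)) one_pos)
  obtain ⟨ε, hε, hε'⟩ := exists_between (lt_min (div_pos hv0 (by norm_num : (0:ℝ) < 20)) (div_pos (mul_pos hδ hv0) (by norm_num : (0:ℝ) < 32)))
  rw [lt_min_iff] at hε' hδ'
  obtain ⟨h1, h2⟩ := hδ'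
  rw [lt_div_iff₀ (mul_pos hf0 hv0), ← mul_assoc] at h1
  obtain ⟨ρ, hρ, hst⟩ := (hv ε hε).straight l r
  exact win_B hφ hf hc hη hs' hρ hst hv0 hε.le hε'.1.le hδ h2.le (by linarith [hε'.2]) hφc (by linarith)

theorem near_dir {g v : Euc 2} {e : ℝ} (he : e ≤ ‖v‖ / 1000) (hv : 0 < ‖v‖) (h : ‖g - v‖ ≤ e) :
    1 / 2 * ‖g‖ * ‖v‖ < ⟪g, v⟫ := by
  have e1 : ⟪g, v⟫ = ⟪g - v, v⟫ + ‖v‖ ^ 2 := by rw [inner_sub_left, real_inner_self_eq_norm_sq]; ring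
  have e2 := (abs_le.1 (abs_real_inner_le_norm (g - v) v)).1
  have e3 : ‖g‖ ≤ ‖g - v‖ + ‖v‖ := by have := norm_add_le (g - v) v; rwa [sub_add_cancel] at this
  have e4 : ‖g - v‖ * ‖v‖ ≤ ‖v‖ / 1000 * ‖v‖ := mul_le_mul_of_nonneg_right (h.trans he) hv.le
  have e5 : ‖g‖ * ‖v‖ ≤ (‖v‖ / 1000 + ‖v‖) * ‖v‖ := mul_le_mul_of_nonneg_right (by linarith) hv.le
  nlinarith

/-- windows at a small corner where the velocity jumps from `d1` to `d2` -/
theorem winF_corner {φ : Euc 2 → ℝ} {f : Euc 2 → Euc 2} {c : ℝ → Euc 2} {l r κ0 η s' : ℝ} {v : Euc 2}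
    (hf : Continuous f) (hc : Continuous c) (hs' : s' ∈ Ioo l r) (hv0 : 0 < ‖v‖) (hst : StrAt c s' v (‖v‖ / 1000))
    (h : ‖f (c s') - v‖ ≤ ‖v‖ / 1000) : Win φ f c l r κ0 η s' := by
  obtain ⟨ρ, hρ, hst⟩ := hst.straight l r
  exact win_F hf hc hs' hρ hst hv0 (by positivity) (by linarith) (δ := 1 / 2) (by norm_num) (by linarith) (near_dir le_rfl hv0 h)

theorem winB_corner {φ : Euc 2 → ℝ} {f : Euc 2 → Euc 2} {c : ℝ → Euc 2} {l r κ0 η s' : ℝ} {v : Euc 2}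
    (hφ : Continuous φ) (hf : Continuous f) (hc : Continuous c) (hη : 0 < η) (hs' : s' ∈ Ioo l r) (hv0 : 0 < ‖v‖)
    (hst : StrAt c s' (-v) (‖v‖ / 1000)) (hφc : φ (c s') < κ0 + η * s')
    (h : ‖f (c s') - v‖ ≤ ‖v‖ / 1000) : Win φ f c l r κ0 η s' := by
  obtain ⟨ρ, hρ, hst⟩ := hst.straight l r
  have hnd := near_dir le_rfl hv0 h
  refine win_B hφ hf hc hη hs' hρ hst (by rwa [norm_neg]) (by positivity) (by rw [norm_neg]; linarith) (δ := 1 / 2) (by norm_num)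
    (by norm_num) (by rw [norm_neg]; linarith) hφc ?_
  rw [norm_neg, inner_neg_right]
  linarith


namespace SD
variable {φ : Euc 2 → ℝ} {f X : Euc 2 → Euc 2} {K : ℝ≥0} {Φ : Euc 2 → ℝ → Euc 2} {r R1 M R R2 : ℝ}
    {y eu ev : Euc 2} {a b κ m θ r0 : ℝ}

theorem back_sep (S : SD φ f X K Φ r R1 M R R2 y eu ev a b κ m θ r0) {p0 w : Euc 2} (hp : p0 ∈ Wset Φ y r0)
    (hv : 0 < ⟪p0 - y, ev⟫) {τ : ℝ} (hw : ⟪w - y, ev⟫ ≤ 0) (hφ : φ w < φ p0) {t : ℝ}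
    (h : Φ (Φ p0 τ) t = w) : False := by
  rw [← S.D.flow.add] at h
  rcases le_total (τ + t) 0 with h0 | h0
  · have := S.L.W_pos S.D.flow hp hv h0
    rw [h] at this
    linarith
  · have := S.D.mono p0 h0
    simp only [S.D.flow.zero, h] at this
    linarith

theorem cone_y (S : SD φ f X K Φ r R1 M R R2 y eu ev a b κ m θ r0) {p : Euc 2} (hp : p ∈ Wset Φ y r0) :
    |⟪p - y, eu⟫| ≤ κ * |⟪p - y, ev⟫| := S.L.W_cone S.D.flow hp (S.L.y_W S.D.flow)

theorem ray_mono (S : SD φ f X K Φ r R1 M R R2 y eu ev a b κ m θ r0) {p : Euc 2} (hp : p ∈ Wset Φ y r0) (hne : p ≠ y) :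
    StrictMonoOn (fun s : ℝ => φ (y + s • (p - y))) (Icc 0 1) :=
  S.L.phi_ray S.D.base S.hX (by rw [add_sub_cancel]; exact LocSaddle.W_mem S.D.flow hp) (sub_ne_zero.2 hne) (S.cone_y hp)

theorem ray_le (S : SD φ f X K Φ r R1 M R R2 y eu ev a b κ m θ r0) {p : Euc 2} (hp : p ∈ Wset Φ y r0) (hne : p ≠ y)
    {s : ℝ} (hs : s ∈ Icc (0:ℝ) 1) : φ (y + s • (p - y)) ≤ φ p := by
  have := (S.ray_mono hp hne).monotoneOn hs (right_mem_Icc.2 zero_le_one) hs.2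
  simpa using this

theorem ray_mem (S : SD φ f X K Φ r R1 M R R2 y eu ev a b κ m θ r0) {p : Euc 2} (hp : p ∈ Wset Φ y r0)
    {s : ℝ} (hs : s ∈ Icc (0:ℝ) 1) : y + s • (p - y) ∈ closedBall y r0 :=
  LocSaddle.ball_smul (by rw [add_sub_cancel]; exact LocSaddle.W_mem S.D.flow hp) hs

structure ArcD (φ : Euc 2 → ℝ) (f : Euc 2 → Euc 2) (Φ : Euc 2 → ℝ → Euc 2) (r M : ℝ) (y ev : Euc 2) (r0 : ℝ)
    (b1 b2 z : Euc 2) (T1 T2 ℓ ρ : ℝ) : Prop where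
  E : Ends φ f Φ r M y ev r0 b1 b2 z T1 T2
  T1p : 0 < T1
  T2p : 0 < T2
  ℓp : 0 < ℓ
  e1 : ⟪b1 - y, ev⟫ = -ℓ
  e2 : ⟪b2 - y, ev⟫ = ℓ
  n1 : b1 ∈ ball y ρ
  n2 : b2 ∈ ball y ρ
  d1 : ∀ t, ∀ s ∈ Icc (0:ℝ) 1, Φ b2 t ≠ y + s • (b1 - y)
  d2 : ∀ t, ∀ s ∈ Icc (0:ℝ) 1, Φ b1 t ≠ y + s • (b2 - y)

theorem arc_data (S : SD φ f X K Φ r R1 M R R2 y eu ev a b κ m θ r0) {b1 b2 z : Euc 2} {T1 T2 ρ : ℝ} (hρ : 0 < ρ)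
    (E : Ends φ f Φ r M y ev r0 b1 b2 z T1 T2) :
    ∃ b1' b2' T1' T2' ℓ, ArcD φ f Φ r M y ev r0 b1' b2' z T1' T2' ℓ ρ := by
  have F := S.D.flow
  have v1' : 0 < ⟪b1 - y, -ev⟫ := by rw [inner_neg_right]; linarith [E.v1]
  have n1 : b1 ≠ y := ne_of_pos v1'
  have n2 : b2 ≠ y := ne_of_pos E.v2
  have hc := S.D.base.contφ.tendsto y
  have ev1 := hc.eventually (gt_mem_nhds (lt_min (S.W_phi E.w1 n1) (S.W_phi E.w2 n2)))
  obtain ⟨ρ', hρ', hb⟩ := Metric.eventually_nhds_iff_ball.1 ev1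
  obtain ⟨ℓ, hℓ, hℓ'⟩ := exists_between (lt_min (lt_min (half_pos hρ) (half_pos hρ')) (lt_min v1' E.v2))
  simp only [lt_min_iff] at hℓ'
  obtain ⟨⟨k1, k2⟩, k3, k4⟩ := hℓ'
  obtain ⟨t1, ht1, e1⟩ := S.neg_v.L.W_height F E.w1 hℓ k3.le
  obtain ⟨t2, ht2, e2⟩ := S.L.W_height F E.w2 hℓ k4.le
  have w1 := LocSaddle.W_back F E.w1 ht1
  have w2 := LocSaddle.W_back F E.w2 ht2
  have t1n : t1 < 0 := by
    rcases ht1.lt_or_eq with h | h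
    · exact h
    · rw [h, F.zero] at e1; linarith
  have t2n : t2 < 0 := by
    rcases ht2.lt_or_eq with h | h
    · exact h
    · rw [h, F.zero] at e2; linarith
  rw [inner_neg_right] at e1
  have e1' : ⟪Φ b1 t1 - y, ev⟫ = -ℓ := by linarith
  have nrm : ∀ p ∈ Wset Φ y r0, |⟪p - y, ev⟫| = ℓ → ‖p - y‖ < ρ ∧ ‖p - y‖ < ρ' := by
    intro p hp hpe
    have h1 := S.L.cone_norm (S.cone_y hp)
    have h2 : (1 + κ) * |⟪p - y, ev⟫| ≤ 2 * ℓ := by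
      rw [hpe]; exact mul_le_mul_of_nonneg_right (by linarith [S.L.hκ1]) hℓ.le
    constructor <;> linarith
  have N1 := nrm _ w1 (by rw [e1', abs_neg, abs_of_pos hℓ])
  have N2 := nrm _ w2 (by rw [e2, abs_of_pos hℓ])
  have P1 := hb (Φ b1 t1) (by rw [mem_ball, dist_eq_norm]; exact N1.2)
  have P2 := hb (Φ b2 t2) (by rw [mem_ball, dist_eq_norm]; exact N2.2)
  rw [lt_min_iff] at P1 P2
  have n1' : Φ b1 t1 ≠ y := ne_of_pos (ev := -ev) (by rw [inner_neg_right]; linarith)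
  have n2' : Φ b2 t2 ≠ y := ne_of_pos (ev := ev) (by linarith)
  have hv : ∀ (s : ℝ) (p : Euc 2), ⟪y + s • (p - y) - y, ev⟫ = s * ⟪p - y, ev⟫ := by
    intro s p
    rw [add_sub_cancel_left, real_inner_smul_left]
  refine ⟨Φ b1 t1, Φ b2 t2, T1 - t1, T2 - t2, ℓ, ⟨w1, by linarith, w2, by linarith, E.hz, by linarith [E.hT1], ?_, ?_, by linarith [E.hT2], ?_, ?_⟩,
    by linarith [E.hT1], by linarith [E.hT2], hℓ, e1', e2, ?_, ?_, ?_, ?_⟩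
  · rw [← F.add, add_sub_cancel]; exact E.h1
  · intro t ht h
    rw [← F.add] at h
    rcases le_total 0 (t2 + t) with h0 | h0
    · exact E.h2 _ h0 h
    · have h3 := S.hsk _ (E.w2 _ h0) z E.hz
      refine h3 (ball_subset_closedBall (ball_subset_ball ?_ h))
      linarith [S.D.r_pos]
  · rw [← F.add, add_sub_cancel]; exact E.lt
  · rw [← F.add, add_sub_cancel]; exact E.le
  · rw [mem_ball, dist_eq_norm]; exact N1.1
  · rw [mem_ball, dist_eq_norm]; exact N2.1
  · intro t s hs h
    refine S.back_sep E.w2 E.v2 ?_ ?_ h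
    · rw [hv, e1']
      have := mul_nonneg hs.1 hℓ.le
      linarith
    · exact (S.ray_le w1 n1' hs).trans_lt P1.2
  · intro t s hs h
    refine S.neg_v.back_sep E.w1 v1' ?_ ?_ h
    · rw [inner_neg_right, hv, e2]
      have := mul_nonneg hs.1 hℓ.le
      linarith
    · exact (S.ray_le w2 n2' hs).trans_lt P2.1

end SD


theorem strAt_le {G D : ℝ → Euc 2} {s0 ε : ℝ} {v : Euc 2} (hG : ∀ t, HasDerivAt G (D t) t)
    (h : ∀ t, ‖D t - v‖ ≤ ε) : StrAt G s0 v ε := by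
  refine ⟨1, one_pos, fun t ht t' ht' htt => ?_⟩
  have hd : ∀ u ∈ Icc t t', HasDerivWithinAt (fun u => G u - u • v) (D u - (1:ℝ) • v) (Icc t t') u := fun u _ =>
    ((hG u).sub ((hasDerivAt_id u).smul_const v)).hasDerivWithinAt
  have hb2 : ∀ u ∈ Ico t t', ‖D u - (1:ℝ) • v‖ ≤ ε := fun u hu => by
    rw [one_smul]
    exact h u
  have := norm_image_sub_le_of_norm_deriv_le_segment' hd hb2 t' (right_mem_Icc.2 htt)
  have e : G t' - G t - (t' - t) • v = (G t' - t' • v) - (G t - t • v) := by module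
  rw [e]
  exact this

theorem pw5 {G0 G1 G2 G3 G4 : ℝ → Euc 2} {s0 s1 s2 s3 : ℝ} (h01 : s0 ≤ s1) (h12 : s1 ≤ s2) (h23 : s2 ≤ s3)
    (g0 : Continuous G0) (g1 : Continuous G1) (g2 : Continuous G2) (g3 : Continuous G3) (g4 : Continuous G4)
    (m0 : G0 s0 = G1 s0) (m1 : G1 s1 = G2 s1) (m2 : G2 s2 = G3 s2) (m3 : G3 s3 = G4 s3) :
    ∃ c : ℝ → Euc 2, Continuous c ∧ (∀ s ∈ Iic s0, c s = G0 s) ∧ (∀ s ∈ Icc s0 s1, c s = G1 s) ∧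
      (∀ s ∈ Icc s1 s2, c s = G2 s) ∧ (∀ s ∈ Icc s2 s3, c s = G3 s) ∧ (∀ s ∈ Ici s3, c s = G4 s) := by
  have step : ∀ {A B : ℝ → Euc 2} {u : ℝ}, Continuous A → Continuous B → A u = B u →
      ∃ c : ℝ → Euc 2, Continuous c ∧ (∀ s ≤ u, c s = A s) ∧ (∀ s, u ≤ s → c s = B s) := by
    intro A B u hA hB hu
    refine ⟨fun s => if s ≤ u then A s else B s, hA.if_le hB continuous_id continuous_const (by rintro s rfl; exact hu), ?_, ?_⟩
    · intro s hs
      simp only [hs, if_true]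
    · intro s hs
      rcases hs.eq_or_lt with h | h
      · subst h; simp [hu]
      · simp [not_le.2 h]
  obtain ⟨c1, k1, l1, r1⟩ := step g0 g1 m0
  obtain ⟨c2, k2, l2, r2⟩ := step k1 g2 (u := s1) (by rw [r1 s1 h01, m1])
  obtain ⟨c3, k3, l3, r3⟩ := step k2 g3 (u := s2) (by rw [r2 s2 h12, m2])
  obtain ⟨c4, k4, l4, r4⟩ := step k3 g4 (u := s3) (by rw [r3 s3 h23, m3])
  refine ⟨c4, k4, fun s hs => ?_, fun s hs => ?_, fun s hs => ?_, fun s hs => ?_, fun s hs => r4 s hs⟩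
  · have := mem_Iic.1 hs
    rw [l4 s (by linarith), l3 s (by linarith), l2 s (by linarith), l1 s hs]
  · rw [l4 s (by linarith [hs.2]), l3 s (by linarith [hs.2]), l2 s hs.2, r1 s hs.1]
  · rw [l4 s (by linarith [hs.2]), l3 s hs.2, r2 s hs.1]
  · rw [l4 s hs.2, r3 s hs.1]

/-- the arc -/
structure ArcC (Φ : Euc 2 → ℝ → Euc 2) (y b1 b2 z : Euc 2) (b τ T1 : ℝ) (c : ℝ → Euc 2) : Prop where
  cont : Continuous c
  c0 : ∀ s ∈ Iic (-(τ + T1)), c s = Φ b1 T1 + (-(τ + T1) - s) • (z - Φ b1 T1)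
  c1 : ∀ s ∈ Icc (-(τ + T1)) (-τ), c s = Φ b1 (-s - τ)
  c2 : ∀ s ∈ Icc (-τ) 0, c s = y + (-(b * s)) • (b1 - y)
  c3 : ∀ s ∈ Icc 0 τ, c s = y + (b * s) • (b2 - y)
  c4 : ∀ s ∈ Ici τ, c s = Φ b2 (s - τ)

theorem arcC_exists {X : Euc 2 → Euc 2} {K : ℝ≥0} {Φ : Euc 2 → ℝ → Euc 2} (F : GFlow X K Φ) (y b1 b2 z : Euc 2) {b τ T1 : ℝ}
    (hτ : 0 < τ) (hb : b * τ = 1) (hT1 : 0 < T1) : ∃ c, ArcC Φ y b1 b2 z b τ T1 c := by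
  have k1 := F.cont b1
  have k2 := F.cont b2
  obtain ⟨c, h, h0, h1, h2, h3, h4⟩ := pw5 (s0 := -(τ + T1)) (s1 := -τ) (s2 := 0) (s3 := τ)
    (G0 := fun s => Φ b1 T1 + (-(τ + T1) - s) • (z - Φ b1 T1)) (G1 := fun s => Φ b1 (-s - τ))
    (G2 := fun s => y + (-(b * s)) • (b1 - y)) (G3 := fun s => y + (b * s) • (b2 - y)) (G4 := fun s => Φ b2 (s - τ))
    (by linarith) (by linarith) hτ.le (by fun_prop) (by fun_prop) (by fun_prop) (by fun_prop) (by fun_prop)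
    (by simp) (by simp [hb, F.zero]) (by simp) (by simp [hb, F.zero])
  exact ⟨c, h, h0, h1, h2, h3, h4⟩

namespace SD
variable {φ : Euc 2 → ℝ} {f X : Euc 2 → Euc 2} {K : ℝ≥0} {Φ : Euc 2 → ℝ → Euc 2} {r R1 M R R2 : ℝ}
    {y eu ev : Euc 2} {a b κ m θ r0 : ℝ}

theorem in_line (S : SD φ f X K Φ r R1 M R R2 y eu ev a b κ m θ r0) {z p : Euc 2} (hz : IsSinkAt f z)
    (hp : p ∈ ball z r) (hne : p ≠ z) {σ : ℝ} (hσ : σ ∈ Ico (0:ℝ) 1) :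
    p + σ • (z - p) ∈ ball z r ∧ 0 < ⟪f (p + σ • (z - p)), z - p⟫ := by
  have h1 : z - (p + σ • (z - p)) = (1 - σ) • (z - p) := by module
  have hp' := hp
  rw [mem_ball, dist_comm, dist_eq_norm] at hp
  have h2 : p + σ • (z - p) ∈ ball z r := by
    rw [mem_ball, dist_comm, dist_eq_norm, h1, norm_smul, Real.norm_of_nonneg (by linarith [hσ.2])]
    exact (mul_le_of_le_one_left (norm_nonneg _) (by linarith [hσ.1])).trans_lt hp
  refine ⟨h2, ?_⟩
  have hn : 0 < ‖z - (p + σ • (z - p))‖ := by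
    rw [h1, norm_smul, Real.norm_of_nonneg (by linarith [hσ.2])]
    exact mul_pos (by linarith [hσ.2]) (norm_pos_iff.2 (sub_ne_zero.2 hne.symm))
  have h3 := S.D.sink6 z hz (p + σ • (z - p))
    (ball_subset_closedBall (ball_subset_ball (by linarith [S.D.r_pos]) h2)) (by
      intro h; rw [h, sub_self, norm_zero] at hn; exact lt_irrefl _ hn)
  have h4 := (mul_pos (mul_pos S.D.r_pos h3.1) hn).trans_le h3.2
  rw [h1, real_inner_smul_right] at h4
  exact pos_of_mul_pos_right h4 (by linarith [hσ.2])

theorem in_orb (S : SD φ f X K Φ r R1 M R R2 y eu ev a b κ m θ r0) {p : Euc 2} (hp : p ∈ Wset Φ y r0) (hne : p ≠ y)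
    {t : ℝ} (ht : 0 ≤ t) (hM : φ (Φ p t) ≤ M) : ‖Φ p t‖ ≤ R ∧ 0 < ⟪f (Φ p t), X (Φ p t)⟫ := by
  have h1 := S.hR (LocSaddle.W_mem S.D.flow hp)
  rw [mem_ball_zero_iff] at h1
  have h2 := S.D.trapX h1.le ht hM
  exact ⟨h2, S.D.X_pos _ (by linarith [S.D.RR2]) (S.D.fne (S.W_fne hp hne) t)⟩

theorem in_ray (S : SD φ f X K Φ r R1 M R R2 y eu ev a b κ m θ r0) {p : Euc 2} (hp : p ∈ Wset Φ y r0) (hne : p ≠ y)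
    {s : ℝ} (hs : s ∈ Ioc (0:ℝ) 1) : 0 < ⟪f (y + s • (p - y)), p - y⟫ := by
  have h1 := S.ray_mem hp ⟨hs.1.le, hs.2⟩
  have e : y + s • (p - y) - y = s • (p - y) := by module
  have h2 := S.L.radial h1 (by rw [e]; exact LocSaddle.cone_smul (S.cone_y hp) s)
  rw [S.hX _ h1, e, real_inner_smul_right, real_inner_smul_left] at h2
  have h3 := S.L.W_vne S.D.flow hp hne
  have h4 : 0 < b / 4 * (s * ⟪p - y, ev⟫) ^ 2 := by
    have := S.L.hb
    have := hs.1
    positivity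
  exact pos_of_mul_pos_right (h4.trans_le h2) hs.1.le

theorem corner_est (S : SD φ f X K Φ r R1 M R R2 y eu ev a b κ m θ r0) {p : Euc 2} (hp : p ∈ Wset Φ y r0) (hne : p ≠ y)
    (q1 : (a + b) * κ ≤ b / 10000) (q2 : θ ≤ b / 10000) :
    0 < ‖b • (p - y)‖ ∧ ‖f p - b • (p - y)‖ < ‖b • (p - y)‖ / 1000 := by
  have hpm := LocSaddle.W_mem S.D.flow hp
  have h1 := S.L.hu p hpm y S.L.y_mem
  have h2 := S.L.hv p hpm y S.L.y_mem
  rw [S.L.X0, sub_zero, S.hX p hpm] at h1 h2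
  have h3 := S.L.cone_norm (S.cone_y hp)
  have h4 := S.cone_y hp
  have hb := S.L.hb
  have hn := norm_pos_iff.2 (sub_ne_zero.2 hne)
  have h5 := S.L.fr.abs_v (p - y)
  have h6 := S.L.fr.norm_le (f p - b • (p - y))
  have hv0 : 0 < |⟪p - y, ev⟫| := abs_pos.2 (S.L.W_vne S.D.flow hp hne)
  rw [norm_smul, Real.norm_of_nonneg hb.le]
  refine ⟨mul_pos hb hn, ?_⟩
  rw [inner_sub_left, inner_sub_left, real_inner_smul_left, real_inner_smul_left] at h6
  have h7 : |⟪f p, eu⟫ - b * ⟪p - y, eu⟫| ≤ θ * ‖p - y‖ + (a + b) * |⟪p - y, eu⟫| := by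
    have e : ⟪f p, eu⟫ - b * ⟪p - y, eu⟫ = (⟪f p, eu⟫ + a * ⟪p - y, eu⟫) - (a + b) * ⟪p - y, eu⟫ := by ring
    rw [e]
    refine (abs_sub _ _).trans ?_
    rw [abs_mul, abs_of_pos (by linarith [S.L.ha] : 0 < a + b)]
    linarith
  have hab : 0 < a + b := by linarith [S.L.ha]
  have h8 : (a + b) * |⟪p - y, eu⟫| ≤ b / 10000 * |⟪p - y, ev⟫| := by
    refine (mul_le_mul_of_nonneg_left h4 hab.le).trans ?_
    rw [← mul_assoc]
    exact mul_le_mul_of_nonneg_right q1 hv0.le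
  have h9 : θ * ‖p - y‖ ≤ b / 10000 * ‖p - y‖ := mul_le_mul_of_nonneg_right q2 hn.le
  have h10 : b / 10000 * |⟪p - y, ev⟫| ≤ b / 10000 * ‖p - y‖ := mul_le_mul_of_nonneg_left h5 (by positivity)
  have h11 := mul_pos hb hn
  linarith

theorem velocity_y (S : SD φ f X K Φ r R1 M R R2 y eu ev a b κ m θ r0) {p : Euc 2} (hp : p ∈ Wset Φ y r0) :
    ‖b • (p - y) - (b * ⟪p - y, ev⟫) • ev‖ ≤ κ * (b * |⟪p - y, ev⟫|) := by
  have h1 := S.L.fr.coord (p - y)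
  have h4 := S.cone_y hp
  have e : b • (p - y) - (b * ⟪p - y, ev⟫) • ev = (b * ⟪p - y, eu⟫) • eu := by
    have : b • (p - y) = b • (⟪p - y, eu⟫ • eu + ⟪p - y, ev⟫ • ev) := by rw [← h1]
    rw [this]; module
  rw [e, norm_smul, S.L.fr.nu, mul_one, Real.norm_eq_abs, abs_mul, abs_of_pos S.L.hb]
  have := mul_le_mul_of_nonneg_left h4 S.L.hb.le
  linarith

end SD


theorem mono_piece {φ : Euc 2 → ℝ} {f : Euc 2 → Euc 2} (B : Base φ f) {c G D : ℝ → Euc 2} {α β : ℝ}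
    (hG : ∀ t, HasDerivAt G (D t) t) (h : ∀ t ∈ Ioo α β, 0 < ⟪f (G t), D t⟫) (he : ∀ t ∈ Icc α β, c t = G t) :
    StrictMonoOn (fun s => φ (c s)) (Icc α β) := by
  have h1 : StrictMonoOn (fun s => φ (G s)) (Icc α β) := by
    refine strictMonoOn_of_deriv_pos (convex_Icc _ _) (fun t _ => (B.deriv_along (hG t)).continuousAt.continuousWithinAt) ?_
    intro t ht
    rw [interior_Icc] at ht
    rw [(B.deriv_along (hG t)).deriv]
    exact h t ht
  exact h1.congr fun t ht => by simp only [he t ht]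

theorem anti_piece {φ : Euc 2 → ℝ} {f : Euc 2 → Euc 2} (B : Base φ f) {c G D : ℝ → Euc 2} {α β : ℝ}
    (hG : ∀ t, HasDerivAt G (D t) t) (h : ∀ t ∈ Ioo α β, ⟪f (G t), D t⟫ < 0) (he : ∀ t ∈ Icc α β, c t = G t) :
    StrictAntiOn (fun s => φ (c s)) (Icc α β) := by
  have h1 : StrictAntiOn (fun s => φ (G s)) (Icc α β) := by
    refine strictAntiOn_of_deriv_neg (convex_Icc _ _) (fun t _ => (B.deriv_along (hG t)).continuousAt.continuousWithinAt) ?_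
    intro t ht
    rw [interior_Icc] at ht
    rw [(B.deriv_along (hG t)).deriv]
    exact h t ht
  exact h1.congr fun t ht => by simp only [he t ht]

theorem der_line (p w : Euc 2) (s0 t : ℝ) : HasDerivAt (fun s : ℝ => p + (s0 - s) • w) (-w) t := by
  have := ((hasDerivAt_const t s0).sub (hasDerivAt_id t)).smul_const w
  simpa using this.const_add p

theorem der_ray (p w : Euc 2) (k t : ℝ) : HasDerivAt (fun s : ℝ => p + (k * s) • w) (k • w) t := by
  have := (((hasDerivAt_id t).const_mul k).smul_const w).const_add p
  simpa using this

theorem der_ray_neg (p w : Euc 2) (k t : ℝ) : HasDerivAt (fun s : ℝ => p + (-(k * s)) • w) (-(k • w)) t := by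
  have := (((hasDerivAt_id t).const_mul k).neg.smul_const w).const_add p
  simpa using this

theorem der_orb {X : Euc 2 → Euc 2} {K : ℝ≥0} {Φ : Euc 2 → ℝ → Euc 2} (F : GFlow X K Φ) (p : Euc 2) (τ t : ℝ) :
    HasDerivAt (fun s : ℝ => Φ p (s - τ)) (X (Φ p (t - τ))) t := by
  have := (F.deriv p (t - τ)).scomp t ((hasDerivAt_id t).sub_const τ)
  simpa [Function.comp_def] using this

theorem der_orb_neg {X : Euc 2 → Euc 2} {K : ℝ≥0} {Φ : Euc 2 → ℝ → Euc 2} (F : GFlow X K Φ) (p : Euc 2) (τ t : ℝ) :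
    HasDerivAt (fun s : ℝ => Φ p (-s - τ)) (-X (Φ p (-t - τ))) t := by
  have := (F.deriv p (-t - τ)).scomp t ((hasDerivAt_id t).neg.sub_const τ)
  simpa [Function.comp_def] using this

namespace SD
variable {φ : Euc 2 → ℝ} {f X : Euc 2 → Euc 2} {K : ℝ≥0} {Φ : Euc 2 → ℝ → Euc 2} {r R1 M R R2 : ℝ}
    {y eu ev : Euc 2} {a b κ m θ r0 : ℝ} {b1 b2 z : Euc 2} {T1 T2 ℓ ρ τ : ℝ} {c : ℝ → Euc 2}

theorem arc_ne (A : ArcD φ f Φ r M y ev r0 b1 b2 z T1 T2 ℓ ρ) : b1 ≠ y ∧ b2 ≠ y :=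
  ⟨ne_of_pos (ev := -ev) (by rw [inner_neg_right, A.e1]; linarith [A.ℓp]), ne_of_pos (ev := ev) (by rw [A.e2]; exact A.ℓp)⟩

theorem arc_M1 (S : SD φ f X K Φ r R1 M R R2 y eu ev a b κ m θ r0) (A : ArcD φ f Φ r M y ev r0 b1 b2 z T1 T2 ℓ ρ) (t : ℝ) :
    φ (Φ b1 t) ≤ M := by
  have h1 := S.lim_high (S.lim_of_sink A.E.hz A.E.h1) t
  have h2 := S.D.hM z (S.D.zero_lt A.E.hz.1).le
  linarith

theorem arc_M2 (S : SD φ f X K Φ r R1 M R R2 y eu ev a b κ m θ r0) (A : ArcD φ f Φ r M y ev r0 b1 b2 z T1 T2 ℓ ρ) {t : ℝ}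
    (ht : t ≤ T2) : φ (Φ b2 t) ≤ M := (S.D.mono b2 ht).trans A.E.le

theorem arc_hat (S : SD φ f X K Φ r R1 M R R2 y eu ev a b κ m θ r0) (A : ArcD φ f Φ r M y ev r0 b1 b2 z T1 T2 ℓ ρ) :
    Φ b1 T1 ≠ z := by
  intro h
  have := S.D.fne (S.W_fne A.E.w1 (arc_ne A).1) T1
  rw [h] at this
  exact this A.E.hz.1

/-- sign of the derivative of `φ` along the pieces of the arc -/
theorem sg0 (S : SD φ f X K Φ r R1 M R R2 y eu ev a b κ m θ r0) (A : ArcD φ f Φ r M y ev r0 b1 b2 z T1 T2 ℓ ρ)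
    {s : ℝ} (hs : s ∈ Ioc (-(τ + T1) - 1) (-(τ + T1))) :
    ⟪f (Φ b1 T1 + (-(τ + T1) - s) • (z - Φ b1 T1)), -(z - Φ b1 T1)⟫ < 0 := by
  rw [inner_neg_right, neg_lt_zero]
  exact (S.in_line A.E.hz A.E.h1 (S.arc_hat A) ⟨by linarith [hs.2], by linarith [hs.1]⟩).2

theorem sg1 (S : SD φ f X K Φ r R1 M R R2 y eu ev a b κ m θ r0) (A : ArcD φ f Φ r M y ev r0 b1 b2 z T1 T2 ℓ ρ)
    {s : ℝ} (hs : s ≤ -τ) : ⟪f (Φ b1 (-s - τ)), -X (Φ b1 (-s - τ))⟫ < 0 := by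
  rw [inner_neg_right, neg_lt_zero]
  exact (S.in_orb A.E.w1 (arc_ne A).1 (by linarith) (S.arc_M1 A _)).2

theorem sg2 (S : SD φ f X K Φ r R1 M R R2 y eu ev a b κ m θ r0) (A : ArcD φ f Φ r M y ev r0 b1 b2 z T1 T2 ℓ ρ)
    (hb : b * τ = 1) {s : ℝ} (hs : s ∈ Ico (-τ) 0) : ⟪f (y + (-(b * s)) • (b1 - y)), -(b • (b1 - y))⟫ < 0 := by
  have h0 := S.L.hb
  rw [inner_neg_right, neg_lt_zero, real_inner_smul_right]
  refine mul_pos h0 (S.in_ray A.E.w1 (arc_ne A).1 ⟨?_, ?_⟩)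
  · have := mul_neg_of_pos_of_neg h0 hs.2
    linarith
  · have := mul_le_mul_of_nonneg_left hs.1 h0.le
    linarith

theorem sg3 (S : SD φ f X K Φ r R1 M R R2 y eu ev a b κ m θ r0) (A : ArcD φ f Φ r M y ev r0 b1 b2 z T1 T2 ℓ ρ)
    (hb : b * τ = 1) {s : ℝ} (hs : s ∈ Ioc 0 τ) : 0 < ⟪f (y + (b * s) • (b2 - y)), b • (b2 - y)⟫ := by
  have h0 := S.L.hb
  rw [real_inner_smul_right]
  refine mul_pos h0 (S.in_ray A.E.w2 (arc_ne A).2 ⟨mul_pos h0 hs.1, ?_⟩)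
  have := mul_le_mul_of_nonneg_left hs.2 h0.le
  linarith

theorem sg4 (S : SD φ f X K Φ r R1 M R R2 y eu ev a b κ m θ r0) (A : ArcD φ f Φ r M y ev r0 b1 b2 z T1 T2 ℓ ρ)
    {s : ℝ} (hs : s ∈ Icc τ (τ + T2)) : 0 < ⟪f (Φ b2 (s - τ)), X (Φ b2 (s - τ))⟫ :=
  (S.in_orb A.E.w2 (arc_ne A).2 (by linarith [hs.1]) (S.arc_M2 A (by linarith [hs.2]))).2

theorem arc_anti (S : SD φ f X K Φ r R1 M R R2 y eu ev a b κ m θ r0) (A : ArcD φ f Φ r M y ev r0 b1 b2 z T1 T2 ℓ ρ)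
    (C : ArcC Φ y b1 b2 z b τ T1 c) (hτ : 0 < τ) (hb : b * τ = 1) :
    StrictAntiOn (fun s => φ (c s)) (Icc (-(τ + T1) - 1) 0) := by
  have hT := A.T1p
  have p0 : StrictAntiOn (fun s => φ (c s)) (Icc (-(τ + T1) - 1) (-(τ + T1))) :=
    anti_piece S.D.base (der_line _ _ _) (fun t ht => S.sg0 A ⟨ht.1, ht.2.le⟩) (fun t ht => C.c0 t ht.2)
  have p1 : StrictAntiOn (fun s => φ (c s)) (Icc (-(τ + T1)) (-τ)) :=
    anti_piece S.D.base (der_orb_neg S.D.flow b1 τ) (fun t ht => S.sg1 A ht.2.le) C.c1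
  have p2 : StrictAntiOn (fun s => φ (c s)) (Icc (-τ) 0) :=
    anti_piece S.D.base (der_ray_neg _ _ _) (fun t ht => S.sg2 A hb ⟨ht.1.le, ht.2⟩) C.c2
  have p3 := p0.union p1 (isGreatest_Icc (by linarith)) (isLeast_Icc (by linarith))
  rw [Icc_union_Icc_eq_Icc (by linarith) (by linarith)] at p3
  have p4 := p3.union p2 (isGreatest_Icc (by linarith)) (isLeast_Icc (by linarith))
  rwa [Icc_union_Icc_eq_Icc (by linarith) (by linarith)] at p4

theorem arc_mono (S : SD φ f X K Φ r R1 M R R2 y eu ev a b κ m θ r0) (A : ArcD φ f Φ r M y ev r0 b1 b2 z T1 T2 ℓ ρ)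
    (C : ArcC Φ y b1 b2 z b τ T1 c) (hτ : 0 < τ) (hb : b * τ = 1) :
    StrictMonoOn (fun s => φ (c s)) (Icc 0 (τ + T2)) := by
  have hT := A.T2p
  have p0 : StrictMonoOn (fun s => φ (c s)) (Icc 0 τ) :=
    mono_piece S.D.base (der_ray _ _ _) (fun t ht => S.sg3 A hb ⟨ht.1, ht.2.le⟩) C.c3
  have p1 : StrictMonoOn (fun s => φ (c s)) (Icc τ (τ + T2)) :=
    mono_piece S.D.base (der_orb S.D.flow b2 τ) (fun t ht => S.sg4 A ⟨ht.1.le, ht.2.le⟩) (fun t ht => C.c4 t ht.1)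
  have p3 := p0.union p1 (isGreatest_Icc (by linarith)) (isLeast_Icc (by linarith))
  rwa [Icc_union_Icc_eq_Icc (by linarith) (by linarith)] at p3

/-- where the points of the two halves are -/
theorem half1 (S : SD φ f X K Φ r R1 M R R2 y eu ev a b κ m θ r0) (A : ArcD φ f Φ r M y ev r0 b1 b2 z T1 T2 ℓ ρ)
    (C : ArcC Φ y b1 b2 z b τ T1 c) (hb : b * τ = 1) {s : ℝ} (hs : s ∈ Icc (-(τ + T1) - 1) 0) :
    c s ∈ ball z r ∨ (∃ t, 0 ≤ t ∧ c s = Φ b1 t) ∨ ∃ σ ∈ Icc (0:ℝ) 1, (s < 0 → 0 < σ) ∧ c s = y + σ • (b1 - y) := by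
  rcases le_total s (-(τ + T1)) with h | h
  · left
    rw [C.c0 s h]
    rcases hs.1.lt_or_eq with h' | h'
    · exact (S.in_line A.E.hz A.E.h1 (S.arc_hat A) ⟨by linarith, by linarith⟩).1
    · rw [← h']
      have : Φ b1 T1 + (-(τ + T1) - (-(τ + T1) - 1)) • (z - Φ b1 T1) = z := by module
      rw [this]
      exact mem_ball_self S.D.r_pos
  rcases le_total s (-τ) with h' | h'
  · exact Or.inr (Or.inl ⟨_, by linarith, C.c1 s ⟨h, h'⟩⟩)
  · refine Or.inr (Or.inr ⟨_, ⟨?_, ?_⟩, ?_, C.c2 s ⟨h', hs.2⟩⟩)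
    · have := mul_nonneg S.L.hb.le (neg_nonneg.2 hs.2)
      linarith
    · have := mul_le_mul_of_nonneg_left h' S.L.hb.le
      linarith
    · intro h0
      have := mul_pos S.L.hb (neg_pos.2 h0)
      linarith

theorem half2 (S : SD φ f X K Φ r R1 M R R2 y eu ev a b κ m θ r0)
    (C : ArcC Φ y b1 b2 z b τ T1 c) (hb : b * τ = 1) {s : ℝ} (hs : s ∈ Icc 0 (τ + T2)) :
    (∃ t, 0 ≤ t ∧ t ≤ T2 ∧ c s = Φ b2 t) ∨ ∃ σ ∈ Icc (0:ℝ) 1, (0 < s → 0 < σ) ∧ c s = y + σ • (b2 - y) := by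
  rcases le_total s τ with h | h
  · refine Or.inr ⟨_, ⟨?_, ?_⟩, ?_, C.c3 s ⟨hs.1, h⟩⟩
    · exact mul_nonneg S.L.hb.le hs.1
    · have := mul_le_mul_of_nonneg_left h S.L.hb.le
      linarith
    · intro h0
      exact mul_pos S.L.hb h0
  · exact Or.inl ⟨_, by linarith, by linarith [hs.2], C.c4 s h⟩

theorem arc_disj (S : SD φ f X K Φ r R1 M R R2 y eu ev a b κ m θ r0) (A : ArcD φ f Φ r M y ev r0 b1 b2 z T1 T2 ℓ ρ)
    (C : ArcC Φ y b1 b2 z b τ T1 c) (hb : b * τ = 1) {s s' : ℝ} (hs : s ∈ Ico (-(τ + T1) - 1) 0)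
    (hs' : s' ∈ Ioc 0 (τ + T2)) : c s ≠ c s' := by
  intro he
  have F := S.D.flow
  rcases S.half1 A C hb ⟨hs.1, hs.2.le⟩ with h | ⟨t, ht, h⟩ | ⟨σ, hσ, hσ0, h⟩ <;>
    rcases S.half2 C hb ⟨hs'.1.le, hs'.2⟩ with ⟨t', ht', htt', h'⟩ | ⟨σ', hσ', hσ0', h'⟩
  · rw [he, h'] at h
    exact A.E.h2 t' ht' h
  · rw [he, h'] at h
    exact S.hsk _ (S.ray_mem A.E.w2 hσ') z A.E.hz (ball_subset_closedBall (ball_subset_ball (by linarith [S.D.r_pos]) h))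
  · rw [h, h'] at he
    rcases le_total t' t with h0 | h0
    · have e : b2 = Φ b1 (t - t') := by
        have h1 := congrArg (fun p => Φ p (-t')) he
        simp only [F.neg_cancel] at h1
        rw [← h1, ← F.add]
        rfl
      have e' : b1 = Φ b2 (-(t - t')) := by rw [e, F.neg_cancel]
      have := S.L.W_pos F A.E.w2 A.E.v2 (t := -(t - t')) (by linarith)
      rw [← e', A.e1] at this
      linarith [A.ℓp]
    · have e : b1 = Φ b2 (t' - t) := by
        have h1 := congrArg (fun p => Φ p (-t)) he
        simp only [F.neg_cancel] at h1
        rw [h1, ← F.add]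
        rfl
      have e' : b2 = Φ b1 (-(t' - t)) := by rw [e, F.neg_cancel]
      have := S.neg_v.L.W_pos F A.E.w1 (by rw [inner_neg_right, A.e1]; linarith [A.ℓp]) (t := -(t' - t)) (by linarith)
      rw [← e', inner_neg_right, A.e2] at this
      linarith [A.ℓp]
  · rw [h, h'] at he
    exact A.d2 t σ' hσ' he
  · rw [h, h'] at he
    exact A.d1 t' σ hσ he.symm
  · rw [h, h'] at he
    have h1 := congrArg (fun p => ⟪p - y, ev⟫) he
    simp only [add_sub_cancel_left, real_inner_smul_left, A.e1, A.e2] at h1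
    have := mul_pos (hσ0 hs.2) A.ℓp
    have := mul_pos (hσ0' hs'.1) A.ℓp
    linarith

theorem arc_inj (S : SD φ f X K Φ r R1 M R R2 y eu ev a b κ m θ r0) (A : ArcD φ f Φ r M y ev r0 b1 b2 z T1 T2 ℓ ρ)
    (C : ArcC Φ y b1 b2 z b τ T1 c) (hτ : 0 < τ) (hb : b * τ = 1) : InjOn c (Icc (-(τ + T1) - 1) (τ + T2)) := by
  have i1 := (S.arc_anti A C hτ hb).injOn
  have i2 := (S.arc_mono A C hτ hb).injOn
  intro s hs s' hs' he
  rcases lt_or_ge 0 s with h | h <;> rcases lt_or_ge 0 s' with h' | h'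
  · exact i2 ⟨h.le, hs.2⟩ ⟨h'.le, hs'.2⟩ (by simp only [he])
  · rcases h'.lt_or_eq with h0 | h0
    · exact (S.arc_disj A C hb ⟨hs'.1, h0⟩ ⟨h, hs.2⟩ he.symm).elim
    · exact i2 ⟨h.le, hs.2⟩ ⟨h0.ge, hs'.2⟩ (by simp only [he])
  · rcases h.lt_or_eq with h0 | h0
    · exact (S.arc_disj A C hb ⟨hs.1, h0⟩ ⟨h', hs'.2⟩ he).elim
    · exact i2 ⟨h0.ge, hs.2⟩ ⟨h'.le, hs'.2⟩ (by simp only [he])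
  · exact i1 ⟨hs.1, h⟩ ⟨hs'.1, h'⟩ (by simp only [he])

end SD


namespace SD
variable {φ : Euc 2 → ℝ} {f X : Euc 2 → Euc 2} {K : ℝ≥0} {Φ : Euc 2 → ℝ → Euc 2} {r R1 M R R2 : ℝ}
    {y eu ev : Euc 2} {a b κ m θ r0 : ℝ} {b1 b2 z : Euc 2} {T1 T2 ℓ ρ τ : ℝ} {c : ℝ → Euc 2}

theorem arc_z (C : ArcC Φ y b1 b2 z b τ T1 c) : c (-(τ + T1) - 1) = z := by
  rw [C.c0 _ (by simp only [mem_Iic]; linarith)]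
  module

theorem arc_y (C : ArcC Φ y b1 b2 z b τ T1 c) (hτ : 0 < τ) : c 0 = y := by
  rw [C.c3 _ ⟨le_rfl, hτ.le⟩]
  simp

theorem cont_orb (S : SD φ f X K Φ r R1 M R R2 y eu ev a b κ m θ r0) (p : Euc 2) : Continuous (fun t => X (Φ p t)) :=
  S.D.Xc.comp (S.D.flow.cont p)

theorem win_arc_z (S : SD φ f X K Φ r R1 M R R2 y eu ev a b κ m θ r0) (A : ArcD φ f Φ r M y ev r0 b1 b2 z T1 T2 ℓ ρ)
    (C : ArcC Φ y b1 b2 z b τ T1 c) (hτ : 0 < τ) {κ0 η : ℝ} (hη : 0 < η)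
    (h1 : φ z < κ0 + η * (-(τ + T1) - 1)) : Win φ f c (-(τ + T1) - 1) (τ + T2) κ0 η (-(τ + T1) - 1) := by
  have hT1 := A.T1p
  have hT2 := A.T2p
  refine win_z (z := z) (v := Φ b1 T1 - z) (δ := min r 1) (ρ1 := r) S.D.base.contφ C.cont hη (by linarith) one_pos ?_
    (norm_pos_iff.2 (sub_ne_zero.2 (S.arc_hat A))) (lt_min S.D.r_pos one_pos) (min_le_right _ _) h1 S.D.r_pos ?_
  · intro h h0 h1
    rw [C.c0 _ (by simp only [mem_Iic]; linarith)]
    module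
  · intro p hp hne
    obtain ⟨k1, k2⟩ := S.D.sink6 z A.E.hz p (ball_subset_closedBall (ball_subset_ball (by linarith [S.D.r_pos]) hp)) hne
    refine ⟨k1, le_trans ?_ k2⟩
    gcongr
    exact min_le_left _ _

theorem win_arc_y (S : SD φ f X K Φ r R1 M R R2 y eu ev a b κ m θ r0) (A : ArcD φ f Φ r M y ev r0 b1 b2 z T1 T2 ℓ ρ)
    (C : ArcC Φ y b1 b2 z b τ T1 c) (hτ : 0 < τ) {θw : ℝ} (hθ : SmallTheta a b θw) (hκ : κ ≤ θw) (hθ' : θ ≤ θw)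
    {κ0 η : ℝ} (hη : 0 < η)
    (h1 : φ y < κ0) : Win φ f c (-(τ + T1) - 1) (τ + T2) κ0 η 0 := by
  have hT1 := A.T1p
  have hT2 := A.T2p
  have hν := mul_pos S.L.hb A.ℓp
  have st : StrAt c 0 ((b * ℓ) • ev) (θw * (b * ℓ)) := by
    refine strAt_glue (α := -τ) (β := τ) (by linarith) hτ C.c2 C.c3 ?_ ?_
    · refine strAt_le (der_ray_neg _ _ _) fun t => ?_
      have := S.velocity_y A.E.w1
      rw [A.e1, abs_neg, abs_of_pos A.ℓp] at this
      have e : -(b • (b1 - y)) - (b * ℓ) • ev = -(b • (b1 - y) - (b * -ℓ) • ev) := by module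
      rw [e, norm_neg]
      exact this.trans (mul_le_mul_of_nonneg_right hκ hν.le)
    · refine strAt_le (der_ray _ _ _) fun t => ?_
      have := S.velocity_y A.E.w2
      rw [A.e2, abs_of_pos A.ℓp] at this
      exact this.trans (mul_le_mul_of_nonneg_right hκ hν.le)
  obtain ⟨ρ0, hρ0, hst⟩ := st.straight (-(τ + T1) - 1) (τ + T2)
  refine win_y S.L.fr S.L.ha S.L.hb hθ hν S.D.base.contφ C.cont hη (by linarith) (by linarith) (arc_y C hτ) hρ0 hst h1
    S.L.hr ?_ ?_
  · intro p hp
    have hp' := ball_subset_closedBall hp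
    have := S.L.hu p hp' y S.L.y_mem
    rw [S.L.X0, sub_zero, S.hX p hp'] at this
    exact this.trans (mul_le_mul_of_nonneg_right hθ' (norm_nonneg _))
  · intro p hp
    have hp' := ball_subset_closedBall hp
    have := S.L.hv p hp' y S.L.y_mem
    rw [S.L.X0, sub_zero, S.hX p hp'] at this
    exact this.trans (mul_le_mul_of_nonneg_right hθ' (norm_nonneg _))

theorem win_arc_neg (S : SD φ f X K Φ r R1 M R R2 y eu ev a b κ m θ r0) (A : ArcD φ f Φ r M y ev r0 b1 b2 z T1 T2 ℓ ρ)
    (C : ArcC Φ y b1 b2 z b τ T1 c) (hτ : 0 < τ) (hb : b * τ = 1) (q1 : (a + b) * κ ≤ b / 10000) (q2 : θ ≤ b / 10000)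
    {κ0 η : ℝ} (hη : 0 < η) {s : ℝ} (hs : s ∈ Ioo (-(τ + T1) - 1) 0) (hφc : φ (c s) < κ0 + η * s) :
    Win φ f c (-(τ + T1) - 1) (τ + T2) κ0 η s ∧ f (c s) ≠ 0 := by
  have hT1 := A.T1p
  have hT2 := A.T2p
  have hsI : s ∈ Ioo (-(τ + T1) - 1) (τ + T2) := ⟨hs.1, by linarith [hs.2]⟩
  have cX := S.cont_orb b1
  have key : ∀ v, VelAt c s v → ⟪f (c s), v⟫ < 0 → Win φ f c (-(τ + T1) - 1) (τ + T2) κ0 η s ∧ f (c s) ≠ 0 := by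
    intro v hv h
    refine ⟨winB_vel S.D.base.contφ S.D.base.cont C.cont hη hsI hv hφc h, fun h0 => ?_⟩
    rw [h0, inner_zero_left] at h
    exact lt_irrefl _ h
  rcases lt_trichotomy s (-(τ + T1)) with h | h | h
  · refine key (-(z - Φ b1 T1)) (velAt_of hs.1 h (fun t ht => C.c0 t ht.2) (der_line _ _ _) continuous_const rfl) ?_
    rw [C.c0 s h.le]
    exact S.sg0 A ⟨hs.1, h.le⟩
  · refine key (-(z - Φ b1 T1)) (velAt_glue (G1 := fun s => Φ b1 T1 + (-(τ + T1) - s) • (z - Φ b1 T1)) (G2 := fun s => Φ b1 (-s - τ)) (β := -τ) hs.1 (by linarith)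
      (fun t ht => C.c0 t (ht.2.trans h.le)) (fun t ht => C.c1 t ⟨h.ge.trans ht.1, ht.2⟩) (der_line _ _ _) continuous_const
      (der_orb_neg S.D.flow b1 τ) (cX.comp (continuous_neg.sub continuous_const)).neg rfl ?_) ?_
    · have e : -s - τ = T1 := by rw [h]; ring
      rw [e, S.D.X_sink z A.E.hz _ (ball_subset_closedBall A.E.h1)]
    · rw [C.c0 s h.le]
      exact S.sg0 A ⟨hs.1, h.le⟩
  rcases lt_trichotomy s (-τ) with h' | h' | h'
  · refine key _ (velAt_of h h' C.c1 (der_orb_neg S.D.flow b1 τ) (cX.comp (continuous_neg.sub continuous_const)).neg rfl) ?_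
    rw [C.c1 s ⟨h.le, h'.le⟩]
    exact S.sg1 A h'.le
  · obtain ⟨k1, k2⟩ := S.corner_est A.E.w1 (arc_ne A).1 q1 q2
    have ec : c s = b1 := by
      rw [C.c1 s ⟨h.le, h'.le⟩, h', neg_neg, sub_self, S.D.flow.zero]
    have hXb := S.hX b1 (LocSaddle.W_mem S.D.flow A.E.w1)
    refine ⟨winB_corner (v := b • (b1 - y)) S.D.base.contφ S.D.base.cont C.cont hη hsI k1 ?_ hφc (by rw [ec]; exact k2.le), ?_⟩
    · refine strAt_glue h hs.2 (fun t ht => C.c1 t ⟨ht.1, ht.2.trans h'.le⟩) (fun t ht => C.c2 t ⟨h'.ge.trans ht.1, ht.2⟩) ?_ ?_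
      · refine strAt_smooth (der_orb_neg S.D.flow b1 τ) (cX.comp (continuous_neg.sub continuous_const)).neg ?_
        rw [h', neg_neg, sub_self, S.D.flow.zero, hXb, ← neg_sub_neg, neg_neg, neg_neg, norm_sub_rev]
        exact k2
      · refine strAt_smooth (der_ray_neg _ _ _) continuous_const ?_
        rw [sub_self, norm_zero]
        linarith
    · rw [ec]; exact S.W_fne A.E.w1 (arc_ne A).1
  · refine key _ (velAt_of h' hs.2 C.c2 (der_ray_neg _ _ _) continuous_const rfl) ?_
    rw [C.c2 s ⟨h'.le, hs.2.le⟩]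
    exact S.sg2 A hb ⟨h'.le, hs.2⟩

theorem win_arc_pos (S : SD φ f X K Φ r R1 M R R2 y eu ev a b κ m θ r0) (A : ArcD φ f Φ r M y ev r0 b1 b2 z T1 T2 ℓ ρ)
    (C : ArcC Φ y b1 b2 z b τ T1 c) (hτ : 0 < τ) (hb : b * τ = 1) (q1 : (a + b) * κ ≤ b / 10000) (q2 : θ ≤ b / 10000)
    {κ0 η : ℝ} {s : ℝ} (hs : s ∈ Ioo 0 (τ + T2)) :
    Win φ f c (-(τ + T1) - 1) (τ + T2) κ0 η s := by
  have hT1 := A.T1p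
  have hT2 := A.T2p
  have hsI : s ∈ Ioo (-(τ + T1) - 1) (τ + T2) := ⟨by linarith [hs.1], hs.2⟩
  have cX := S.cont_orb b2
  rcases lt_trichotomy s τ with h' | h' | h'
  · refine winF_vel S.D.base.cont C.cont hsI (velAt_of hs.1 h' C.c3 (der_ray _ _ _) continuous_const rfl) ?_
    rw [C.c3 s ⟨hs.1.le, h'.le⟩]
    exact S.sg3 A hb ⟨hs.1, h'.le⟩
  · obtain ⟨k1, k2⟩ := S.corner_est A.E.w2 (arc_ne A).2 q1 q2
    have ec : c s = b2 := by
      rw [C.c4 s h'.ge, h', sub_self, S.D.flow.zero]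
    have hXb := S.hX b2 (LocSaddle.W_mem S.D.flow A.E.w2)
    refine winF_corner (v := b • (b2 - y)) S.D.base.cont C.cont hsI k1 ?_ (by rw [ec]; exact k2.le)
    refine strAt_glue hs.1 hs.2 (fun t ht => C.c3 t ⟨ht.1, ht.2.trans h'.le⟩) (fun t ht => C.c4 t (h'.ge.trans ht.1)) ?_ ?_
    · refine strAt_smooth (der_ray _ _ _) continuous_const ?_
      rw [sub_self, norm_zero]
      linarith
    · refine strAt_smooth (der_orb S.D.flow b2 τ) (cX.comp (continuous_id.sub continuous_const)) ?_
      rw [h', sub_self, S.D.flow.zero, hXb]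
      exact k2
  · refine winF_vel S.D.base.cont C.cont hsI
      (velAt_of h' hs.2 (fun t ht => C.c4 t ht.1) (der_orb S.D.flow b2 τ) (cX.comp (continuous_id.sub continuous_const)) rfl) ?_
    rw [C.c4 s h'.le]
    exact S.sg4 A ⟨h'.le, hs.2.le⟩

theorem fne_pos (S : SD φ f X K Φ r R1 M R R2 y eu ev a b κ m θ r0) (A : ArcD φ f Φ r M y ev r0 b1 b2 z T1 T2 ℓ ρ)
    (C : ArcC Φ y b1 b2 z b τ T1 c) (hb : b * τ = 1) {s : ℝ} (hs : s ∈ Ioc 0 (τ + T2)) : f (c s) ≠ 0 := by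
  intro h0
  rcases le_total s τ with h | h
  · have := S.sg3 A hb ⟨hs.1, h⟩
    rw [← C.c3 s ⟨hs.1.le, h⟩, h0, inner_zero_left] at this
    exact lt_irrefl _ this
  · have := S.sg4 A ⟨h, hs.2⟩
    rw [← C.c4 s h, h0, inner_zero_left] at this
    exact lt_irrefl _ this

theorem arc_loc (S : SD φ f X K Φ r R1 M R R2 y eu ev a b κ m θ r0) (A : ArcD φ f Φ r M y ev r0 b1 b2 z T1 T2 ℓ ρ)
    (C : ArcC Φ y b1 b2 z b τ T1 c) (hb : b * τ = 1) {s : ℝ} (hs : s ∈ Icc (-(τ + T1) - 1) (τ + T2)) :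
    (c s ∈ ball y ρ ∨ c s ∈ basinO φ f Φ r M) ∧ ‖c s‖ ≤ R := by
  have hR1 := S.D.R1R
  have ray : ∀ p ∈ Wset Φ y r0, p ∈ ball y ρ → ∀ σ ∈ Icc (0:ℝ) 1, (y + σ • (p - y) ∈ ball y ρ) ∧ ‖y + σ • (p - y)‖ ≤ R := by
    intro p hp hpρ σ hσ
    constructor
    · rw [mem_ball, dist_eq_norm] at *
      rw [add_sub_cancel_left, norm_smul, Real.norm_of_nonneg hσ.1]
      exact (mul_le_of_le_one_left (norm_nonneg _) hσ.2).trans_lt hpρ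
    · have := S.hR (S.ray_mem hp hσ)
      rw [mem_ball_zero_iff] at this
      linarith
  rcases le_total s 0 with h0 | h0
  · rcases S.half1 A C hb ⟨hs.1, h0⟩ with h | ⟨t, ht, h⟩ | ⟨σ, hσ, -, h⟩
    · refine ⟨Or.inr (Or.inr ⟨z, A.E.hz, 0, le_rfl, by rwa [S.D.flow.zero]⟩), ?_⟩
      have h1 := S.D.sinkR1 z A.E.hz (ball_subset_closedBall (ball_subset_ball (by linarith [S.D.r_pos] : r ≤ 6 * r) h))
      rw [mem_ball_zero_iff] at h1
      linarith
    · rw [h]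
      exact ⟨Or.inr (S.D.basin_forward (S.W_basin A.E.w1 (arc_ne A).1) ht), (S.in_orb A.E.w1 (arc_ne A).1 ht (S.arc_M1 A t)).1⟩
    · rw [h]
      have := ray b1 A.E.w1 A.n1 σ hσ
      exact ⟨Or.inl this.1, this.2⟩
  · rcases S.half2 C hb ⟨h0, hs.2⟩ with ⟨t, ht, ht2, h⟩ | ⟨σ, hσ, -, h⟩
    · rw [h]
      exact ⟨Or.inr (S.D.basin_forward (S.W_basin A.E.w2 (arc_ne A).2) ht), (S.in_orb A.E.w2 (arc_ne A).2 ht (S.arc_M2 A ht2)).1⟩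
    · rw [h]
      have := ray b2 A.E.w2 A.n2 σ hσ
      exact ⟨Or.inl this.1, this.2⟩

/-- existence of the arc with all windows -/
theorem arc_exists (S : SD φ f X K Φ r R1 M R R2 y eu ev a b κ m θ r0) (A : ArcD φ f Φ r M y ev r0 b1 b2 z T1 T2 ℓ ρ)
    {θw : ℝ} (hθ : SmallTheta a b θw) (hκ : κ ≤ θw) (hθ' : θ ≤ θw)
    (q1 : (a + b) * κ ≤ b / 10000) (q2 : θ ≤ b / 10000) :
    ∃ (c : ℝ → Euc 2) (l rr κ0 η : ℝ), Continuous c ∧ l < 0 ∧ 0 < rr ∧ InjOn c (Icc l rr) ∧ 0 < η ∧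
      (∀ s ∈ Icc l rr, Win φ f c l rr κ0 η s) ∧
      (∀ s ∈ Icc l rr, (c s ∈ ball y ρ ∨ c s ∈ basinO φ f Φ r M) ∧ ‖c s‖ ≤ R) ∧ c l = z ∧ c 0 = y ∧
      (∀ s ∈ Icc l rr, f (c s) = 0 → s = l ∨ s = 0) ∧ φ z < κ0 + η * l ∧ φ y < κ0 := by
  have hb0 := S.L.hb
  obtain ⟨τ, hτe⟩ : ∃ τ, τ = 1 / b := ⟨_, rfl⟩
  have hτ : 0 < τ := by rw [hτe]; positivity
  have hb : b * τ = 1 := by rw [hτe]; field_simp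
  have hT1 := A.T1p
  have hT2 := A.T2p
  obtain ⟨c, C⟩ := arcC_exists S.D.flow y b1 b2 z hτ hb hT1
  have hlt := A.E.lt
  obtain ⟨η, hη, hη'⟩ := exists_between (div_pos (half_pos (sub_pos.2 hlt)) (by linarith : 0 < (τ + T1 + 1) + (τ + T2)))
  rw [lt_div_iff₀ (by linarith)] at hη'
  have hp1 : 0 < η * (τ + T1 + 1) := mul_pos hη (by linarith)
  have hp2 : 0 < η * (τ + T2) := mul_pos hη (by linarith)
  obtain ⟨κ0, hκ0⟩ : ∃ κ0, κ0 = (φ z + φ (Φ b2 T2)) / 2 := ⟨_, rfl⟩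
  have hz1 : φ z < κ0 + η * (-(τ + T1) - 1) := by
    have e : η * (-(τ + T1) - 1) = - (η * (τ + T1 + 1)) := by ring
    rw [e]; linarith
  have hP : κ0 + η * (τ + T2) < φ (c (τ + T2)) := by
    rw [C.c4 _ (by simp only [mem_Ici]; linarith), add_sub_cancel_left]; linarith
  have anti := (S.arc_anti A C hτ hb).antitoneOn
  have hle : ∀ s ∈ Icc (-(τ + T1) - 1) 0, φ (c s) ≤ φ z := by
    intro s hs
    have := anti (left_mem_Icc.2 (by linarith)) hs hs.1
    simpa only [arc_z C] using this
  have hyz : φ y < κ0 := by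
    have := hle 0 (right_mem_Icc.2 (by linarith))
    rw [arc_y C hτ] at this
    linarith
  have hneg : ∀ s ∈ Ioo (-(τ + T1) - 1) 0, Win φ f c (-(τ + T1) - 1) (τ + T2) κ0 η s ∧ f (c s) ≠ 0 := by
    intro s hs
    refine S.win_arc_neg A C hτ hb q1 q2 hη hs ?_
    have h1 := hle s ⟨hs.1.le, hs.2.le⟩
    have h2 := mul_lt_mul_of_pos_left hs.1 hη
    linarith
  refine ⟨c, -(τ + T1) - 1, τ + T2, κ0, η, C.cont, by linarith, by linarith, S.arc_inj A C hτ hb, hη, ?_, fun s hs => S.arc_loc A C hb hs,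
    arc_z C, arc_y C hτ, ?_, hz1, hyz⟩
  · intro s hs
    rcases hs.1.eq_or_lt with h | h
    · rw [← h]; exact S.win_arc_z A C hτ hη hz1
    rcases hs.2.eq_or_lt with h' | h'
    · rw [h']; exact win_end S.D.base.contφ C.cont (by linarith) hη hP
    rcases lt_trichotomy s 0 with h0 | h0 | h0
    · exact (hneg s ⟨h, h0⟩).1
    · rw [h0]; exact S.win_arc_y A C hτ hθ hκ hθ' hη hyz
    · exact S.win_arc_pos A C hτ hb q1 q2 ⟨h0, h'⟩
  · intro s hs hf0
    rcases hs.1.eq_or_lt with h | h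
    · exact Or.inl h.symm
    rcases lt_trichotomy s 0 with h0 | h0 | h0
    · exact ((hneg s ⟨h, h0⟩).2 hf0).elim
    · exact Or.inr h0
    · exact (S.fne_pos A C hb ⟨h0, hs.2⟩ hf0).elim

end SD


/-! ### Final assembly -/

theorem bdd_of_limits {γ : ℝ → Euc 2} (hγ : Continuous γ) {p q : Euc 2} (hp : Tendsto γ atBot (𝓝 p))
    (hq : Tendsto γ atTop (𝓝 q)) : ∃ C : ℝ, ∀ t, ‖γ t‖ ≤ C := by
  have e1 : ∀ᶠ t in atBot, ‖γ t‖ < ‖p‖ + 1 := hp.norm.eventually (gt_mem_nhds (by linarith))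
  have e2 : ∀ᶠ t in atTop, ‖γ t‖ < ‖q‖ + 1 := hq.norm.eventually (gt_mem_nhds (by linarith))
  obtain ⟨a, ha⟩ := eventually_atBot.1 e1
  obtain ⟨b, hb⟩ := eventually_atTop.1 e2
  obtain ⟨C, hC⟩ := (isCompact_Icc (a := a) (b := b)).exists_bound_of_continuousOn hγ.continuousOn
  refine ⟨max C (max (‖p‖ + 1) (‖q‖ + 1)), fun t => ?_⟩
  rcases le_total t a with h | h
  · exact (ha t h).le.trans ((le_max_left _ _).trans (le_max_right _ _))
  · rcases le_total t b with h' | h'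
    · exact (hC t ⟨h, h'⟩).trans (le_max_left _ _)
    · exact (hb t h').le.trans ((le_max_right _ _).trans (le_max_right _ _))

theorem SD.zero_unique {φ : Euc 2 → ℝ} {f X : Euc 2 → Euc 2} {K : ℝ≥0} {Φ : Euc 2 → ℝ → Euc 2} {r R1 M R R2 : ℝ}
    {y eu ev : Euc 2} {a b κ m θ r0 : ℝ} (S : SD φ f X K Φ r R1 M R R2 y eu ev a b κ m θ r0) {p : Euc 2}
    (hp : p ∈ closedBall y r0) (h0 : f p = 0) : p = y := by
  by_contra hne
  have hX : X p = 0 := S.D.X_zero p h0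
  refine S.W_fne (p := p) (fun t _ => ?_) hne h0
  rw [S.D.flow.fixed hX]
  exact hp

/-- A forward trajectory starting in the modified region cannot converge to a saddle other than `y`. -/
theorem SD.no_forward {φ : Euc 2 → ℝ} {f X : Euc 2 → Euc 2} {K : ℝ≥0} {Φ : Euc 2 → ℝ → Euc 2} {r R1 M R R2 : ℝ}
    {y eu ev : Euc 2} {a b κ m θ r0 ρ : ℝ} (S : SD φ f X K Φ r R1 M R R2 y eu ev a b κ m θ r0)
    (hexit : ∀ p ∈ ball y ρ, (∀ t, 0 ≤ t → Φ p t ∈ closedBall y r0) ∨ p ∈ basinO φ f Φ r M)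
    {δ : ℝ → Euc 2} {p2 : Euc 2} (h0 : ‖δ 0‖ ≤ R + 1) (hin : δ 0 ∈ ball y ρ ∨ δ 0 ∈ basinO φ f Φ r M)
    (hd : ∀ t, 0 ≤ t → HasDerivAt δ (f (δ t)) t) (hl : Tendsto δ atTop (𝓝 p2)) (hz : f p2 = 0)
    (hns : ¬ IsSinkAt f p2) (hne : p2 ≠ y) : False := by
  have hcase : (∀ t, 0 ≤ t → Φ (δ 0) t ∈ closedBall y r0) ∨ δ 0 ∈ basinO φ f Φ r M := by
    rcases hin with h | h
    · exact hexit _ h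
    · exact Or.inr h
  rcases hcase with h | h
  · refine hne (S.zero_unique ?_ hz)
    refine isClosed_closedBall.mem_of_tendsto hl ?_
    filter_upwards [eventually_ge_atTop 0] with t ht
    rw [(S.D.traj_eq h0 hd hl hz hns t ht).1]
    exact h t ht
  · exact S.D.noconv h0 h hd hl hz hns

/-- the conclusion, from the surgery data -/
theorem finish {φ φ'' : Euc 2 → ℝ} {f : Euc 2 → Euc 2} {N U : Set (Euc 2)} {y z : Euc 2}
    (hgen : IsGenericGradientPair φ f) (hprop : IsProper f) (hfin : {p | f p = 0}.Finite)
    (h2 : ContDiff ℝ 2 φ'') (hN : IsCompact N) (hNU : N ⊆ U) (heq : ∀ p ∉ N, φ'' p = φ p)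
    (hne : ∀ p ∈ U, fderiv ℝ φ'' p ≠ 0) (hyU : y ∈ U) (hzU : z ∈ U)
    (hy : IsSaddleAt f y) (hz : IsSinkAt f z)
    (hfwd : ∀ (δ : ℝ → Euc 2) (p2 : Euc 2), δ 0 ∈ N → (∀ t, 0 ≤ t → HasDerivAt δ (f (δ t)) t) →
      Tendsto δ atTop (𝓝 p2) → f p2 = 0 → ¬ IsSinkAt f p2 → p2 ≠ y → False) :
    ∃ f' : Euc 2 → Euc 2, IsGenericGradient f' ∧ IsProper f' ∧
      ProperGradientHomotopic f f' ∧
      (sourceSinkSet f').ncard < (sourceSinkSet f).ncard ∧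
      (saddleSet f').ncard < (saddleSet f).ncard := by
  obtain ⟨hφ, hg, hnd, hval, hns⟩ := hgen
  obtain ⟨f', hf'⟩ : ∃ f' : Euc 2 → Euc 2, ∀ p, gradient φ'' p = f' p := ⟨gradient φ'', fun _ => rfl⟩
  obtain ⟨G, C, -⟩ := grad_c1 hφ hg
  obtain ⟨G', C', -⟩ := grad_c1 h2 hf'
  have hNc : IsClosed N := hN.isClosed
  have loc : ∀ p ∉ N, f' =ᶠ[𝓝 p] f := by
    intro p hp
    have h1 : ∀ᶠ q in 𝓝 p, q ∉ N := hNc.isOpen_compl.mem_nhds hp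
    filter_upwards [h1.eventually_nhds] with q hq
    have : φ'' =ᶠ[𝓝 q] φ := hq.mono heq
    rw [← hf', ← hg]
    exact this.gradient_eq
  have eqf : ∀ p ∉ N, f' p = f p := fun p hp => (loc p hp).eq_of_nhds
  have eqd : ∀ p ∉ N, fderiv ℝ f' p = fderiv ℝ f p := fun p hp => (loc p hp).fderiv_eq
  have zU : ∀ p, f' p = 0 → p ∉ U := by
    intro p hp hU
    refine hne p hU ?_
    rw [(G' p).hasFDerivAt.fderiv, hp]
    simp
  have zN : ∀ p, f' p = 0 → p ∉ N := fun p hp h => zU p hp (hNU h)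
  have zf : ∀ p, f' p = 0 → f p = 0 := fun p hp => by rw [← eqf p (zN p hp)]; exact hp
  have so : ∀ p, IsSourceAt f' p → IsSourceAt f p := fun p hp => by
    refine ⟨zf p hp.1, ?_⟩
    rw [← eqd p (zN p hp.1)]; exact hp.2
  have si : ∀ p, IsSinkAt f' p → IsSinkAt f p := fun p hp => by
    refine ⟨zf p hp.1, ?_⟩
    rw [← eqd p (zN p hp.1)]; exact hp.2
  have sa : ∀ p, IsSaddleAt f' p → IsSaddleAt f p := fun p hp => by
    refine ⟨zf p hp.1, fun h => hp.2.1 ⟨hp.1, ?_⟩, fun h => hp.2.2 ⟨hp.1, ?_⟩⟩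
    · rw [eqd p (zN p hp.1)]; exact h.2
    · rw [eqd p (zN p hp.1)]; exact h.2
  have hproper : ∀ K : Set (Euc 2), IsCompact K → IsCompact (N ∪ f ⁻¹' K) := fun K hK => hN.union (hprop K hK)
  refine ⟨f', ⟨φ'', h2, hf', ?_, ?_, ?_⟩, ?_, ?_, ?_, ?_⟩
  · intro p hp
    rw [eqd p (zN p hp)]
    exact hnd p (zf p hp)
  · intro p q hp hq h
    rw [heq p (zN p hp), heq q (zN q hq)] at h
    exact hval p q (zf p hp) (zf q hq) h
  · rintro ⟨γ, p, q, ht, hp, hq, hpq, hbot, htop⟩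
    have hγc : Continuous γ := continuous_iff_continuousAt.2 fun t => (ht t).continuousAt
    by_cases hav : ∀ t, γ t ∉ N
    · exact hns ⟨γ, p, q, fun t => by rw [← eqf _ (hav t)]; exact ht t, sa p hp, sa q hq, hpq, hbot, htop⟩
    push Not at hav
    obtain ⟨t0, ht0⟩ := hav
    have hT : IsClosed {t | γ t ∈ N} := hNc.preimage hγc
    obtain ⟨b, hb⟩ := eventually_atTop.1 (htop.eventually (hNc.isOpen_compl.mem_nhds (zN q hq.1)))
    have hbd : BddAbove {t | γ t ∈ N} := ⟨b, fun t h => by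
      by_contra hlt
      exact hb t (not_le.1 hlt).le h⟩
    have hmem := hT.csSup_mem ⟨t0, ht0⟩ hbd
    obtain ⟨s, hs⟩ : ∃ s, s = sSup {t | γ t ∈ N} := ⟨_, rfl⟩
    rw [← hs] at hmem
    have haft : ∀ t, s < t → γ t ∉ N := fun t hlt h => by
      have := le_csSup hbd h
      rw [← hs] at this
      linarith
    have hfs : f' (γ s) = f (γ s) := by
      have t1 : Tendsto (fun t => f' (γ t)) (𝓝[>] s) (𝓝 (f' (γ s))) :=
        ((C'.continuous.comp hγc).tendsto s).mono_left nhdsWithin_le_nhds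
      have t2 : Tendsto (fun t => f (γ t)) (𝓝[>] s) (𝓝 (f (γ s))) :=
        ((C.continuous.comp hγc).tendsto s).mono_left nhdsWithin_le_nhds
      refine tendsto_nhds_unique (t1.congr' ?_) t2
      filter_upwards [self_mem_nhdsWithin] with t hlt
      exact eqf _ (haft t hlt)
    have hfs' : ∀ t, s ≤ t → f' (γ t) = f (γ t) := by
      intro t hst
      rcases hst.eq_or_lt with h | h
      · rw [← h]; exact hfs
      · exact eqf _ (haft t h)
    have hsq := sa q hq
    refine hfwd (fun t => γ (t + s)) q ?_ (fun t h0 => ?_) ?_ hsq.1 hsq.2.2 (fun h => zU q hq.1 (h ▸ hyU))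
    · simpa using hmem
    · have := (ht (t + s)).comp_add_const t s
      rwa [hfs' (t + s) (by linarith)] at this
    · exact htop.comp (tendsto_atTop_add_const_right _ _ tendsto_id)
  · intro K hK
    refine (hproper K hK).of_isClosed_subset (hK.isClosed.preimage C'.continuous) fun p hp => ?_
    by_cases h : p ∈ N
    · exact Or.inl h
    · refine Or.inr ?_
      have h3 : f' p ∈ K := hp
      rw [eqf p h] at h3
      exact h3
  · have hcont : Continuous (fun p : ℝ × Euc 2 => (1 - p.1) • f p.2 + p.1 • f' p.2) := by
      have := C.continuous
      have := C'.continuous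
      fun_prop
    refine ⟨fun t p => (1 - t) • f p + t • f' p, ⟨hcont.continuousOn, ?_, ?_⟩, ?_, ?_⟩
    · intro t _
      refine ⟨fun p => (1 - t) * φ p + t * φ'' p, ?_, fun p => ?_⟩
      · exact (contDiff_const.mul (hφ.of_le (by norm_num))).add (contDiff_const.mul (h2.of_le (by norm_num)))
      · have h3 := ((G p).hasFDerivAt.const_mul (1 - t)).add ((G' p).hasFDerivAt.const_mul t)
        have h4 : HasGradientAt (fun p => (1 - t) * φ p + t * φ'' p) ((1 - t) • f p + t • f' p) p := by
          rw [hasGradientAt_iff_hasFDerivAt]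
          refine HasFDerivAt.congr_fderiv h3 ?_
          ext v
          simp [inner_add_left, inner_smul_left]
        exact h4.gradient
    · intro K hK
      have hcl : IsClosed {p : ℝ × Euc 2 | p.1 ∈ Icc (0:ℝ) 1 ∧ (1 - p.1) • f p.2 + p.1 • f' p.2 ∈ K} :=
        (isClosed_Icc.preimage continuous_fst).inter (hK.isClosed.preimage hcont)
      refine ((isCompact_Icc (a := (0:ℝ)) (b := 1)).prod (hproper K hK)).of_isClosed_subset hcl ?_
      rintro ⟨t, p⟩ ⟨h3, h4⟩
      refine ⟨h3, ?_⟩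
      by_cases h : p ∈ N
      · exact Or.inl h
      · refine Or.inr ?_
        have h5 : (1 - t) • f p + t • f' p ∈ K := h4
        rw [eqf p h, ← add_smul] at h5
        simpa using h5
    · funext p; simp
    · funext p; simp
  · refine ncard_lt_ncard ⟨fun p hp => hp.imp (so p) (si p), fun h => ?_⟩ (hfin.subset fun p hp => hp.elim (·.1) (·.1))
    rcases h (Or.inr hz : z ∈ sourceSinkSet f) with h3 | h3
    · exact zU z h3.1 hzU
    · exact zU z h3.1 hzU
  · refine ncard_lt_ncard ⟨fun p hp => sa p hp, fun h => ?_⟩ (hfin.subset fun p hp => hp.1)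
    exact zU y (h hy : IsSaddleAt f' y).1 hyU

/-- let `f = ∇φ` be a generic proper gradient map, `x` a source and `y` a
saddle.  If two distinct trajectories of the local flow connect `x` to `y`, then there is a
generic proper gradient map `f'` proper gradient homotopic to `f` with `|A_{f'}| < |A_f|`
and `|B_{f'}| < |B_f|`. -/
theorem two_connecting_orbits_cancel (φ : Euc 2 → ℝ) (f : Euc 2 → Euc 2)
    (hgen : IsGenericGradientPair φ f) (hprop : IsProper f)
    (x y : Euc 2) (hx : IsSourceAt f x) (hy : IsSaddleAt f y)
    (γ₁ γ₂ : ℝ → Euc 2)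
    (h₁ : IsTrajectory f γ₁) (h₂ : IsTrajectory f γ₂)
    (h₁x : Filter.Tendsto γ₁ Filter.atBot (nhds x))
    (h₁y : Filter.Tendsto γ₁ Filter.atTop (nhds y))
    (h₂x : Filter.Tendsto γ₂ Filter.atBot (nhds x))
    (h₂y : Filter.Tendsto γ₂ Filter.atTop (nhds y))
    (hdist : Set.range γ₁ ≠ Set.range γ₂) :
    ∃ f' : Euc 2 → Euc 2, IsGenericGradient f' ∧ IsProper f' ∧
      ProperGradientHomotopic f f' ∧
      (sourceSinkSet f').ncard < (sourceSinkSet f).ncard ∧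
      (saddleSet f').ncard < (saddleSet f).ncard := by
  have B := base_of hgen hprop
  obtain ⟨hφ, hg, hnd, hval, hns⟩ := id hgen
  obtain ⟨C1, hC1⟩ := bdd_of_limits (continuous_iff_continuousAt.2 fun t => (h₁ t).continuousAt) h₁x h₁y
  obtain ⟨C2, hC2⟩ := bdd_of_limits (continuous_iff_continuousAt.2 fun t => (h₂ t).continuousAt) h₂x h₂y
  obtain ⟨X, K, Φ, r, R1, M, R, R2, hRR, D⟩ := dyn_exists B (max C1 C2)
  have hR₁ : ∀ t, ‖γ₁ t‖ ≤ R1 := fun t => (hC1 t).trans ((le_max_left _ _).trans hRR)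
  have hR₂ : ∀ t, ‖γ₂ t‖ ≤ R1 := fun t => (hC2 t).trans ((le_max_right _ _).trans hRR)
  obtain ⟨eu, ev, a, b, F, ha, hb, hu, hv⟩ := saddle_frame B hy
  obtain ⟨κ, m, θ, θw, k1, k2, k3, k4, k5, k6, k7, k8, k9, k10, k11, k12, k13, k14⟩ := saddle_consts ha hb
  obtain ⟨r0, S0⟩ := sd_exists D hns hy F ha hb hu hv k1 k2 k3 k4 k5 k6 k7 k8 k9
  obtain ⟨ev', b1, b2, z, T1, T2, S, E⟩ := S0.ends_exist hx h₁ hR₁ h₁x h₁y h₂ hR₂ h₂x h₂y hdist hval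
  obtain ⟨ρ, hρ, -, hexit⟩ := S.exit
  obtain ⟨b1', b2', T1', T2', ℓ, A⟩ := S.arc_data hρ E
  obtain ⟨c, l, rr, κ0, η, hc, hl, hrr, hinj, hη, hwin, hloc, hcl, hc0, hcz, hvz, hvy⟩ :=
    S.arc_exists A k10 k11 k12 k13 k14
  have hR1R := D.R1R
  obtain ⟨U0, hU0⟩ : ∃ U0 : Set (Euc 2), U0 = ((ball y ρ ∪ basinO φ f Φ r M) ∩ ball 0 (R + 1)) ∩
      ({p | f p = 0} \ {y, z})ᶜ := ⟨_, rfl⟩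
  have hopen : IsOpen U0 := by
    rw [hU0]
    exact ((isOpen_ball.union D.isOpen_basin).inter isOpen_ball).inter
      (B.fin.subset diff_subset).isClosed.isOpen_compl
  have hlm : l ∈ Icc l rr := ⟨le_rfl, by linarith⟩
  have h0m : (0:ℝ) ∈ Icc l rr := ⟨hl.le, hrr.le⟩
  have harc : c '' Icc l rr ⊆ U0 := by
    rintro p ⟨s, hs, rfl⟩
    rw [hU0]
    refine ⟨⟨(hloc s hs).1, ?_⟩, ?_⟩
    · rw [mem_ball_zero_iff]
      linarith [(hloc s hs).2]
    · rintro ⟨h3, h4⟩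
      rcases hcz s hs h3 with h | h
      · exact h4 (by rw [h, hcl]; simp)
      · exact h4 (by rw [h, hc0]; simp)
  have hzero : ∀ p ∈ U0, f p = 0 → ∃ s ∈ Icc l rr, p = c s ∧ φ p < κ0 + η * s := by
    intro p hp h0
    rw [hU0] at hp
    have h3 : p = y ∨ p = z := by
      by_contra h
      exact hp.2 ⟨h0, by simpa using h⟩
    rcases h3 with rfl | rfl
    · exact ⟨0, h0m, hc0.symm, by simpa using hvy⟩
    · exact ⟨l, hlm, hcl.symm, hvz⟩
  obtain ⟨φ'', N2, g1, g2, g3, g4, g5⟩ := causeway φ f hφ B.grad B.cont c hc l rr (by linarith) hinj κ0 η hη hwin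
    U0 hopen harc hzero
  refine finish hgen hprop B.fin g1 g2 g3 g4 g5 (harc ⟨0, h0m, hc0⟩) (harc ⟨l, hlm, hcl⟩) hy E.hz ?_
  intro δ p2 hδ hd hlim hz2 hns2 hne2
  have hδ' := g3 hδ
  rw [hU0] at hδ'
  refine S.no_forward hexit ?_ hδ'.1.1 hd hlim hz2 hns2 hne2
  have := mem_ball_zero_iff.1 hδ'.1.2
  linarith
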